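/- Let T > √3/(4π), δ > 0, and x = 4/(1 + 16π²(T+δ)²). If p is a prime with p ≥ (55.42/(x·δ))⁴, then (1/x)·(#{λ ∈ 𝔽_p ∖ {0,−1} : A_λ(p) ∈ [−1, −1+x]})/p > T. -/

import Mathlib

open scoped Classical

noncomputable section

/-- The Clausen trace `a_λ^Cl(p) = p + 1 - #E_λ^Cl(𝔽_p)`, where the point count is
`1 + #{(x,y) : y² = (x-1)(x²+λ)}`. -/
def clausenTrace (p : ℕ) [NeZero p] (lam : ZMod p) : ℤ :=
  (p : ℤ) + 1 -
    (1 + ((Finset.univ : Finset (ZMod p × ZMod p)).filter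
      (fun xy => xy.2 ^ 2 = (xy.1 - 1) * (xy.1 ^ 2 + lam))).card)

/-- The quadratic (Legendre) character of `𝔽_p`, real-valued. -/
def legendreChar (p : ℕ) [NeZero p] (u : ZMod p) : ℝ :=
  if u = 0 then 0 else if IsSquare u then 1 else -1

/-- The normalized Frobenius trace `A_λ(p) = φ(λ+1)·(a_{-1/(λ+1)}^Cl(p)² - p)/p` of the
K3 surface `X_λ`. -/
def ALam (p : ℕ) [NeZero p] (lam : ZMod p) : ℝ :=
  legendreChar p (lam + 1) * (((clausenTrace p (-(lam + 1)⁻¹) : ℝ)) ^ 2 - p) / p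

/-- The `O(3)` (Batman) density function. -/
def fBat (t : ℝ) : ℝ :=
  if 1 < |t| ∧ |t| < 3 then Real.sqrt ((3 - |t|) / (1 + |t|))
  else if |t| < 1 then Real.sqrt ((3 - t) / (1 + t)) + Real.sqrt ((3 + t) / (1 - t))
  else 0

section

open Polynomial

section Stepanov

variable {K : Type*} [Field K]

lemma pow_dvd_hasseDeriv_pow (f : K[X]) (N k : ℕ) : f ^ (N - k) ∣ hasseDeriv k (f ^ N) := by
  induction N generalizing k with
  | zero => simp
  | succ N ih =>
    rw [pow_succ, hasseDeriv_mul]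
    refine Finset.dvd_sum fun ij hij => ?_
    rw [Finset.HasAntidiagonal.mem_antidiagonal] at hij
    rcases Nat.eq_zero_or_pos ij.2 with h | h
    · have h1 : ij.1 = k := by omega
      rw [h, h1, hasseDeriv_zero', ]
      calc f ^ (N + 1 - k) ∣ f ^ (N - k + 1) := pow_dvd_pow _ (by omega)
        _ = f ^ (N - k) * f := pow_succ _ _
        _ ∣ _ := mul_dvd_mul (ih k) dvd_rfl
    · exact Dvd.dvd.mul_right ((pow_dvd_pow _ (by omega)).trans (ih ij.1)) _

lemma exists_hasseDeriv_pow (f : K[X]) (hD : f.natDegree ≠ 0) (N : ℕ) :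
    ∃ B : ℕ → K[X], ∀ k ≤ N, hasseDeriv k (f ^ N) = f ^ (N - k) * B k ∧
      (B k).natDegree + k ≤ k * f.natDegree := by
  have hf : f ≠ 0 := fun h => hD (by simp [h])
  have h : ∀ k, ∃ b, hasseDeriv k (f ^ N) = f ^ (N - k) * b ∧
      (k ≤ N → b.natDegree + k ≤ k * f.natDegree ∨ b = 0) := by
    intro k
    obtain ⟨b, hb⟩ := pow_dvd_hasseDeriv_pow f N k
    refine ⟨b, hb, fun hk => ?_⟩
    by_cases hb0 : b = 0
    · exact Or.inr hb0
    left
    have hne : hasseDeriv k (f ^ N) ≠ 0 := by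
      rw [hb]; exact mul_ne_zero (pow_ne_zero _ hf) hb0
    have h1 := natDegree_hasseDeriv_le (f ^ N) k
    have h2 : k ≤ (f ^ N).natDegree := by
      by_contra hlt
      exact hne (hasseDeriv_eq_zero_of_lt_natDegree _ _ (not_le.mp hlt))
    rw [hb, natDegree_mul (pow_ne_zero _ hf) hb0, natDegree_pow, natDegree_pow] at h1
    rw [natDegree_pow] at h2
    have h3 : (N - k) * f.natDegree + k * f.natDegree = N * f.natDegree := by
      rw [← add_mul, Nat.sub_add_cancel hk]
    omega
  choose b hb using h
  refine ⟨b, fun k hk => ⟨(hb k).1, ?_⟩⟩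
  rcases (hb k).2 hk with h | h
  · exact h
  · rw [h, natDegree_zero, zero_add]
    exact Nat.le_mul_of_pos_right _ (Nat.pos_of_ne_zero hD)

/-- The operator `r ↦ E^k (f^N r) / f^(N-k)`, where `E^k` is the Hasse derivative. -/
lemma exists_hasseDeriv_pow_mul (f : K[X]) (hD : f.natDegree ≠ 0) (N : ℕ) :
    ∃ T : ℕ → K[X] →ₗ[K] K[X], ∀ k ≤ N, ∀ r : K[X],
      hasseDeriv k (f ^ N * r) = f ^ (N - k) * T k r ∧
      (T k r).natDegree ≤ r.natDegree + k * f.natDegree := by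
  obtain ⟨B, hB⟩ := exists_hasseDeriv_pow f hD N
  refine ⟨fun k => ∑ ij ∈ Finset.HasAntidiagonal.antidiagonal k,
    LinearMap.mulLeft K (f ^ ij.2 * B ij.1) ∘ₗ hasseDeriv ij.2, fun k hk r => ⟨?_, ?_⟩⟩
  · rw [hasseDeriv_mul, LinearMap.sum_apply, Finset.mul_sum]
    refine Finset.sum_congr rfl fun ij hij => ?_
    rw [Finset.HasAntidiagonal.mem_antidiagonal] at hij
    rw [(hB ij.1 (by omega)).1, LinearMap.comp_apply, LinearMap.mulLeft_apply,
      show N - ij.1 = N - k + ij.2 by omega, pow_add]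
    ring
  · rw [LinearMap.sum_apply]
    refine natDegree_sum_le_of_forall_le _ _ fun ij hij => ?_
    rw [Finset.HasAntidiagonal.mem_antidiagonal] at hij
    have h1 := (hB ij.1 (by omega)).2
    have h2 := natDegree_hasseDeriv_le r ij.2
    rw [LinearMap.comp_apply, LinearMap.mulLeft_apply]
    refine natDegree_mul_le.trans ?_
    have h3 : (f ^ ij.2 * B ij.1).natDegree ≤ ij.2 * f.natDegree + (B ij.1).natDegree :=
      natDegree_mul_le.trans (by rw [natDegree_pow])
    have h4 : k * f.natDegree = ij.1 * f.natDegree + ij.2 * f.natDegree := by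
      rw [← add_mul, hij]
    omega

lemma hasseDeriv_mul_X_pow_card [Fintype K] (k j : ℕ) (hk : k < Fintype.card K) (r : K[X]) :
    hasseDeriv k (r * X ^ (j * Fintype.card K)) =
      hasseDeriv k r * X ^ (j * Fintype.card K) := by
  have hQ : 0 < Fintype.card K := Fintype.card_pos
  have key : ∀ i, 0 < i → i < Fintype.card K →
      hasseDeriv i (X ^ (j * Fintype.card K) : K[X]) = 0 := by
    intro i hi hi'
    rw [← monomial_one_right_eq_X_pow, hasseDeriv_monomial]
    have : ((j * Fintype.card K).choose i : K) = 0 := by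
      rw [← coeff_one_add_X_pow K, mul_comm, pow_mul, ← FiniteField.expand_card, map_add, map_one,
        expand_X, ← map_one (expand K (Fintype.card K)), ← expand_X, ← map_add, ← map_pow,
        coeff_expand hQ, if_neg (Nat.not_dvd_of_pos_of_lt hi hi')]
    simp [this]
  rw [hasseDeriv_mul, Finset.sum_eq_single (k, 0)]
  · simp
  · intro ij hij hne
    rw [Finset.HasAntidiagonal.mem_antidiagonal] at hij
    rw [key ij.2 _ (by omega), mul_zero]
    rcases Nat.eq_zero_or_pos ij.2 with h | h
    · exact absurd (Prod.ext (by simp; omega) h) hne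
    · exact h
  · simp

lemma X_sub_C_pow_dvd_of_hasseDeriv (H : K[X]) (y : K) (M : ℕ)
    (h : ∀ k < M, (hasseDeriv k H).eval y = 0) : (X - C y) ^ M ∣ H := by
  have h1 : X ^ M ∣ taylor y H := by
    rw [X_pow_dvd_iff]
    intro d hd
    rw [taylor_coeff]
    exact h d hd
  obtain ⟨g, hg⟩ := h1
  refine ⟨taylor (-y) g, ?_⟩
  have := congrArg (taylor (-y)) hg
  rw [taylor_taylor] at this
  simpa [taylor_mul, taylor_pow, taylor_X, sub_eq_add_neg] using this

lemma eq_zero_of_sq_mul_eq {f : K[X]} (hsq : Squarefree f) (hD : f.natDegree ≠ 0) {a : K}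
    (ha : a ≠ 0) (n : ℕ) :
    ∀ r s : K[X], r.natDegree ≤ n → r ^ 2 * f = C a * s ^ 2 → r = 0 := by
  have hf0 : f ≠ 0 := fun h => hD (by simp [h])
  induction n using Nat.strong_induction_on with
  | _ n ih =>
    intro r s hr h
    by_contra hr0
    have h1 : f ∣ s ^ 2 := by
      have : f ∣ C a⁻¹ * (C a * s ^ 2) := Dvd.dvd.mul_left (h ▸ dvd_mul_left _ _) _
      rwa [← mul_assoc, ← C_mul, inv_mul_cancel₀ ha, C_1, one_mul] at this
    obtain ⟨t, rfl⟩ := hsq.isRadical 2 s h1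
    have h2 : r ^ 2 = C a * (f * t ^ 2) := by
      apply mul_right_cancel₀ hf0
      rw [h]; ring
    obtain ⟨u, rfl⟩ := hsq.isRadical 2 r (h2 ▸ ⟨C a * t ^ 2, by ring⟩)
    have hu : u ≠ 0 := fun hu => hr0 (by simp [hu])
    have hlt : u.natDegree < n := by
      rw [natDegree_mul hf0 hu] at hr; omega
    refine hu (ih _ hlt u t le_rfl ?_)
    apply mul_left_cancel₀ hf0
    rw [show f * (u ^ 2 * f) = (f * u) ^ 2 by ring, h2]; ring

lemma coeff_zero_sum_eq_zero_of_stepanov [Fintype K] (hodd : Odd (Fintype.card K)) {f : K[X]}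
    (hsq : Squarefree f) (hD : f.natDegree ≠ 0) (hf0 : f.coeff 0 ≠ 0) {R : ℕ}
    (hR : 2 * R + f.natDegree ≤ Fintype.card K) {J : ℕ} (r s : ℕ → K[X])
    (hr : ∀ j, (r j).degree < R) (hs : ∀ j, (s j).degree < R)
    (h : ∑ j ∈ Finset.range J,
      (r j + s j * f ^ (Fintype.card K / 2)) * X ^ (j * Fintype.card K) = 0) :
    ∀ j < J, r j = 0 ∧ s j = 0 := by
  set Q := Fintype.card K with hQ
  have hQ0 : 0 < Q := Fintype.card_pos
  have hfne : f ≠ 0 := fun h => hf0 (by simp [h])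
  induction J generalizing r s with
  | zero => intro j hj; omega
  | succ J ih =>
    rw [Finset.sum_range_succ'] at h
    set tl := ∑ j ∈ Finset.range J, (r (j + 1) + s (j + 1) * f ^ (Q / 2)) * X ^ (j * Q) with htl
    have hsum : ∑ j ∈ Finset.range J, (r (j + 1) + s (j + 1) * f ^ (Q / 2)) * X ^ ((j + 1) * Q)
        = X ^ Q * tl := by
      rw [htl, Finset.mul_sum]
      refine Finset.sum_congr rfl fun j _ => ?_
      rw [add_mul j 1 Q, pow_add]; ring
    rw [hsum, zero_mul, pow_zero, mul_one] at h
    have hdvd : X ^ Q ∣ r 0 + s 0 * f ^ (Q / 2) :=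
      ⟨-tl, by linear_combination h⟩
    have hfQ : X ^ Q ∣ f ^ Q - C (f.coeff 0) := by
      have e : expand K Q f = f ^ Q := FiniteField.expand_card f
      have h1 : X ∣ f - C (f.coeff 0) := by simp [X_dvd_iff]
      have h2 := map_dvd (expand K Q) h1
      rwa [expand_X, map_sub, expand_C, e] at h2
    have h2Q : Q / 2 * 2 + 1 = Q := Nat.div_two_mul_two_add_one_of_odd hodd
    have hmain : X ^ Q ∣ r 0 ^ 2 * f - C (f.coeff 0) * s 0 ^ 2 := by
      have e : r 0 ^ 2 * f - C (f.coeff 0) * s 0 ^ 2 =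
          (r 0 + s 0 * f ^ (Q / 2)) * ((r 0 - s 0 * f ^ (Q / 2)) * f) +
            (f ^ Q - C (f.coeff 0)) * s 0 ^ 2 := by
        have : f ^ Q = (f ^ (Q / 2)) ^ 2 * f := by
          rw [← pow_mul, ← pow_succ, h2Q]
        rw [this]; ring
      rw [e]
      exact dvd_add (hdvd.mul_right _) (hfQ.mul_right _)
    have hdeg : (r 0 ^ 2 * f - C (f.coeff 0) * s 0 ^ 2).degree < (Q : ℕ) := by
      by_cases hR0 : R = 0
      · have h1 : r 0 = 0 := by
          have := hr 0; rw [hR0] at this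
          exact degree_eq_bot.mp (by simpa using this)
        have h2 : s 0 = 0 := by
          have := hs 0; rw [hR0] at this
          exact degree_eq_bot.mp (by simpa using this)
        simp [h1, h2]
      have hn : ∀ u : K[X], u.degree < R → u.natDegree + 1 ≤ R := fun u hu => by
        by_cases hu0 : u = 0
        · simp [hu0]; omega
        · exact (natDegree_lt_iff_degree_lt hu0).mpr hu
      refine lt_of_le_of_lt (degree_le_natDegree) ?_
      norm_cast
      refine lt_of_le_of_lt (natDegree_sub_le _ _) (max_lt ?_ ?_)
      · refine lt_of_le_of_lt natDegree_mul_le ?_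
        rw [natDegree_pow]
        have := hn _ (hr 0); omega
      · refine lt_of_le_of_lt (natDegree_C_mul_le _ _) ?_
        rw [natDegree_pow]
        have := hn _ (hs 0); omega
    have hzero : r 0 ^ 2 * f - C (f.coeff 0) * s 0 ^ 2 = 0 := by
      by_contra hne
      have h1 := degree_le_of_dvd hmain hne
      rw [degree_X_pow] at h1
      exact absurd hdeg (not_lt.mpr h1)
    have hr0 : r 0 = 0 := eq_zero_of_sq_mul_eq hsq hD hf0 _ (r 0) (s 0) le_rfl
      (sub_eq_zero.mp hzero)
    have hs0 : s 0 = 0 := by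
      rw [hr0] at hzero
      have : C (f.coeff 0) * s 0 ^ 2 = 0 := by linear_combination -hzero
      rcases mul_eq_zero.mp this with h | h
      · exact absurd (C_eq_zero.mp h) hf0
      · exact pow_eq_zero_iff (two_ne_zero) |>.mp h
    have htl0 : tl = 0 := by
      rw [hr0, hs0, zero_mul, add_zero, add_zero] at h
      exact (mul_eq_zero.mp h).resolve_left (pow_ne_zero _ X_ne_zero)
    have := ih (fun j => r (j + 1)) (fun j => s (j + 1)) (fun j => hr _) (fun j => hs _) htl0
    intro j hj
    rcases j with _ | j
    · exact ⟨hr0, hs0⟩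
    · exact this j (by omega)

lemma stepanov_bound [Fintype K] (hodd : Odd (Fintype.card K)) {f : K[X]}
    (hsq : Squarefree f) (hD : f.natDegree ≠ 0) (hf0 : f.coeff 0 ≠ 0) {R J M : ℕ}
    (hR : 2 * R + f.natDegree ≤ Fintype.card K) (hM : M ≤ Fintype.card K)
    (hdim : M * (R + M * f.natDegree + J) < 2 * (J * R)) (a : K) :
    (Finset.univ.filter fun y : K => f.eval y ^ (Fintype.card K / 2) = a).card * M ≤
      M * f.natDegree + (R + f.natDegree * (Fintype.card K / 2) + J * Fintype.card K) := by
  set Q := Fintype.card K with hQ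
  set D := f.natDegree with hDdef
  have hfne : f ≠ 0 := fun h => hf0 (by simp [h])
  obtain ⟨T, hT⟩ := exists_hasseDeriv_pow_mul f hD M
  obtain ⟨T', hT'⟩ := exists_hasseDeriv_pow_mul f hD (M + Q / 2)
  set N := R + M * D + J with hN
  let G : ℕ → ((Fin J → degreeLT K R) × (Fin J → degreeLT K R)) →ₗ[K] K[X] := fun k =>
    ∑ j : Fin J, LinearMap.mulRight K (X ^ (j : ℕ)) ∘ₗ
      (T k ∘ₗ (degreeLT K R).subtype ∘ₗ LinearMap.proj j ∘ₗ LinearMap.fst K _ _ +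
        a • T' k ∘ₗ (degreeLT K R).subtype ∘ₗ LinearMap.proj j ∘ₗ LinearMap.snd K _ _)
  have hG : ∀ k v, G k v = ∑ j : Fin J, (T k (v.1 j) + a • T' k (v.2 j)) * X ^ (j : ℕ) := by
    intro k v
    simp [G, LinearMap.sum_apply]
  let Φ : ((Fin J → degreeLT K R) × (Fin J → degreeLT K R)) →ₗ[K] (Fin M → Fin N → K) :=
    LinearMap.pi fun k => LinearMap.pi fun n => lcoeff K n ∘ₗ G k
  have : FiniteDimensional K (degreeLT K R) := (degreeLTEquiv K R).symm.finiteDimensional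
  have hfin : Module.finrank K (Fin M → Fin N → K) <
      Module.finrank K ((Fin J → degreeLT K R) × (Fin J → degreeLT K R)) := by
    have h1 : Module.finrank K (degreeLT K R) = R := by
      rw [(degreeLTEquiv K R).finrank_eq]; simp
    have h2 : Module.finrank K (Fin J → degreeLT K R) = J * R := by
      rw [Module.finrank_pi_fintype]; simp [h1]
    have h3 : Module.finrank K (Fin M → Fin N → K) = M * N := by
      rw [Module.finrank_pi_fintype]; simp
    rw [Module.finrank_prod, h2, h3]
    linarith
  obtain ⟨v, hv, hv0⟩ := (Submodule.ne_bot_iff _).mp (LinearMap.ker_ne_bot_of_finrank_lt (f := Φ) hfin)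
  have hdegr : ∀ u : degreeLT K R, (u : K[X]).degree < R := fun u => mem_degreeLT.mp u.2
  have hnat : ∀ u : degreeLT K R, (u : K[X]).natDegree ≤ R := fun u =>
    natDegree_le_of_degree_le (hdegr u).le
  have hGv : ∀ k < M, G k v = 0 := by
    intro k hk
    ext n
    rw [coeff_zero]
    by_cases hn : n < N
    · have := congrFun (congrFun (LinearMap.mem_ker.mp hv) ⟨k, hk⟩) ⟨n, hn⟩
      simpa [Φ] using this
    · refine coeff_eq_zero_of_natDegree_lt (lt_of_lt_of_le ?_ (not_lt.mp hn))
      rw [hG]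
      have hkM : (k + 1) * D ≤ M * D := Nat.mul_le_mul_right _ hk
      have hD0 : 0 < D := Nat.pos_of_ne_zero hD
      have hb : (∑ j : Fin J, (T k (v.1 j) + a • T' k (v.2 j)) * X ^ (j : ℕ)).natDegree
          ≤ R + k * D + J := by
        refine natDegree_sum_le_of_forall_le _ _ fun j _ => ?_
        refine natDegree_mul_le.trans ?_
        rw [natDegree_X_pow]
        refine add_le_add ((natDegree_add_le _ _).trans (max_le ?_ ?_)) j.2.le
        · exact (hT k hk.le _).2.trans (by gcongr; exact hnat _)
        · exact (natDegree_smul_le _ _).trans ((hT' k (by omega) _).2.trans (by gcongr; exact hnat _))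
      rw [add_mul] at hkM
      omega
  let r : ℕ → K[X] := fun j => if h : j < J then (v.1 ⟨j, h⟩ : K[X]) else 0
  let s : ℕ → K[X] := fun j => if h : j < J then (v.2 ⟨j, h⟩ : K[X]) else 0
  have hbot : ((⊥ : WithBot ℕ)) < (R : WithBot ℕ) := WithBot.bot_lt_coe _
  have hr : ∀ j, (r j).degree < R := fun j => by
    by_cases h : j < J
    · simp only [r, h, dif_pos]; exact hdegr _
    · simp only [r, h, dif_neg, not_false_eq_true, degree_zero]; exact hbot
  have hs : ∀ j, (s j).degree < R := fun j => by
    by_cases h : j < J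
    · simp only [s, h, dif_pos]; exact hdegr _
    · simp only [s, h, dif_neg, not_false_eq_true, degree_zero]; exact hbot
  set h := ∑ j ∈ Finset.range J, (r j + s j * f ^ (Q / 2)) * X ^ (j * Q) with hh
  have hne : h ≠ 0 := by
    intro h0
    have := coeff_zero_sum_eq_zero_of_stepanov hodd hsq hD hf0 hR r s hr hs h0
    apply hv0
    ext j
    · have := (this j j.2).1
      simp only [r, j.2, dif_pos] at this
      simp [this]
    · have := (this j j.2).2
      simp only [s, j.2, dif_pos] at this
      simp [this]
  set H := f ^ M * h with hH
  have hHne : H ≠ 0 := mul_ne_zero (pow_ne_zero _ hfne) hne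
  have hvan : ∀ y : K, f.eval y ^ (Q / 2) = a → (X - C y) ^ M ∣ H := by
    intro y hy
    refine X_sub_C_pow_dvd_of_hasseDeriv H y M fun k hk => ?_
    have hHe : H = ∑ j ∈ Finset.range J,
        (f ^ M * r j + f ^ (M + Q / 2) * s j) * X ^ (j * Q) := by
      rw [hH, hh, Finset.mul_sum]
      refine Finset.sum_congr rfl fun j _ => ?_
      rw [pow_add]; ring
    have hk' : k < Q := lt_of_lt_of_le hk hM
    have h1 : ∀ j ∈ Finset.range J, eval y (hasseDeriv k
        ((f ^ M * r j + f ^ (M + Q / 2) * s j) * X ^ (j * Q))) =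
        (f ^ (M - k)).eval y * ((T k (r j) + a • T' k (s j)) * X ^ j).eval y := by
      intro j _
      rw [hasseDeriv_mul_X_pow_card k j hk', map_add, (hT k hk.le _).1, (hT' k (by omega) _).1,
        show M + Q / 2 - k = M - k + Q / 2 by omega, pow_add]
      simp only [eval_mul, eval_add, eval_pow, eval_X, eval_smul, smul_eq_mul, hy]
      rw [mul_comm j Q, pow_mul, FiniteField.pow_card]
      ring
    rw [hHe, map_sum, eval_finsetSum, Finset.sum_congr rfl h1, ← Finset.mul_sum,
      ← eval_finsetSum]
    have h2 := hGv k hk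
    rw [hG] at h2
    have h3 : ∑ j ∈ Finset.range J, (T k (r j) + a • T' k (s j)) * X ^ j = 0 := by
      rw [← h2, Finset.sum_range]
      refine Finset.sum_congr rfl fun j _ => ?_
      simp only [r, s, j.2, dif_pos]
    rw [h3, eval_zero, mul_zero]
  set S := Finset.univ.filter fun y : K => f.eval y ^ (Q / 2) = a with hS
  have hprod : ∏ y ∈ S, (X - C y) ^ M ∣ H := by
    refine Finset.prod_dvd_of_coprime ?_ fun y hy => hvan y (by simpa [hS] using hy)
    intro y _ z _ hyz
    exact (pairwise_coprime_X_sub_C Function.injective_id hyz).pow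
  have hdeg1 : (∏ y ∈ S, (X - C y) ^ M).natDegree = S.card * M := by
    rw [natDegree_prod _ _ fun y _ => pow_ne_zero _ (X_sub_C_ne_zero y)]
    simp
  have hdeg2 : H.natDegree ≤ M * D + (R + D * (Q / 2) + J * Q) := by
    rw [hH]
    refine natDegree_mul_le.trans ?_
    rw [natDegree_pow]
    gcongr
    refine natDegree_sum_le_of_forall_le _ _ fun j hj => ?_
    refine natDegree_mul_le.trans ?_
    rw [natDegree_X_pow]
    refine add_le_add ((natDegree_add_le _ _).trans (max_le ?_ ?_))
      (Nat.mul_le_mul_right _ (Finset.mem_range.mp hj).le)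
    · exact (natDegree_le_of_degree_le (hr j).le).trans (Nat.le_add_right _ _)
    · refine natDegree_mul_le.trans ?_
      rw [natDegree_pow, mul_comm D]
      gcongr
      exact natDegree_le_of_degree_le (hs j).le
  rw [← hdeg1]
  exact (natDegree_le_of_dvd hprod hHne).trans hdeg2

/-- Stepanov's bound over a field with a square number of elements. -/
theorem stepanov [Fintype K] {N : ℕ} (hcard : Fintype.card K = N ^ 2) (hN : Odd N) {f : K[X]}
    (hsq : Squarefree f) (hD : f.natDegree ≠ 0) (hf0 : f.coeff 0 ≠ 0)
    (hbig : 2 * f.natDegree + 10 ≤ N) (a : K) :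
    2 * (Finset.univ.filter fun y : K => f.eval y ^ (Fintype.card K / 2) = a).card ≤
      N ^ 2 + N * (3 * f.natDegree + 8) := by
  set D := f.natDegree
  have hodd : Odd (Fintype.card K) := by rw [hcard]; exact hN.pow
  obtain ⟨n, hn⟩ := hN
  have hNN : N ≤ N ^ 2 := Nat.le_self_pow two_ne_zero N
  have hND : N * (2 * D + 10) ≤ N ^ 2 := by rw [sq]; exact Nat.mul_le_mul_left _ hbig
  have hdN : D * (2 * D + 10) ≤ D * N := Nat.mul_le_mul_left _ hbig
  obtain ⟨R, hR1, hR2⟩ : ∃ R, 2 * R + D ≤ N ^ 2 ∧ N ^ 2 ≤ 2 * R + D + 1 :=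
    ⟨(N ^ 2 - D) / 2, by omega, by omega⟩
  have hJ : 2 * (n + D + 3) = N + 2 * D + 5 := by omega
  set J := n + D + 3
  have hdim : N * (R + N * D + J) < 2 * (J * R) := by
    have e1 : 2 * (J * R) = (N + 2 * D + 5) * R := by rw [← hJ]; ring
    rw [e1]
    have e2 : 2 * (N * (R + N * D + J)) = 2 * N * R + 2 * N ^ 2 * D + N * (N + 2 * D + 5) := by
      rw [← hJ]; ring
    have e3 : (2 * D + 5) * N ^ 2 ≤ (2 * D + 5) * (2 * R + D + 1) := Nat.mul_le_mul_left _ hR2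
    nlinarith
  have h := stepanov_bound hodd hsq hD hf0 (R := R) (J := J) (M := N) (by rw [hcard]; exact hR1)
    (by rw [hcard]; exact hNN) hdim a
  set c := (Finset.univ.filter fun y : K => f.eval y ^ (Fintype.card K / 2) = a).card
  rw [hcard] at h
  have hhalf : D * (N ^ 2 / 2) * 2 ≤ D * N ^ 2 := by
    rw [mul_assoc]; exact Nat.mul_le_mul_left _ (Nat.div_mul_le_self _ _)
  have hN0 : 0 < N := by omega
  have h2 : 2 * c * N ≤ (N ^ 2 + N * (3 * D + 8)) * N := by
    have e4 : 2 * (J * N ^ 2) = (N + 2 * D + 5) * N ^ 2 := by rw [← hJ]; ring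
    nlinarith
  exact Nat.le_of_mul_le_mul_right h2 hN0

end Stepanov

end

section

open Finset

section Kloosterman

set_option linter.unusedSectionVars false

variable {F : Type*} [Field F] [Fintype F]

/-- The Kloosterman sum `∑_{x ≠ 0} ψ(x + c / x)`. -/
def klooSum (ψ : AddChar F ℂ) (c : F) : ℂ := ∑ x ∈ univ.erase (0 : F), ψ (x + c / x)

lemma card_quadratic_roots (hF : ringChar F ≠ 2) (t n : F) :
    ((univ.filter fun x : F => x ^ 2 - t * x + n = 0).card : ℤ)
      = 1 + quadraticChar F (t ^ 2 - 4 * n) := by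
  have h2 := Ring.two_ne_zero hF
  rw [add_comm, ← quadraticChar_card_sqrts hF]
  norm_cast
  refine card_bij (fun x _ => 2 * x - t) ?_ ?_ ?_
  · intro x hx
    simp only [mem_filter, mem_univ, true_and] at hx
    simp only [Set.mem_toFinset, Set.mem_ofPred_eq]
    linear_combination 4 * hx
  · intro x _ y _ h
    exact mul_left_cancel₀ h2 (sub_left_injective h)
  · intro y hy
    simp only [Set.mem_toFinset, Set.mem_ofPred_eq] at hy
    refine ⟨(y + t) / 2, ?_, by field_simp; ring⟩
    simp only [mem_filter, mem_univ, true_and]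
    field_simp
    linear_combination hy

lemma quadratic_count_eq_sum (hF : ringChar F ≠ 2) (t n : F) :
    (1 + quadraticChar F (t ^ 2 - 4 * n) : ℂ) =
      ∑ x : F, if x ^ 2 - t * x + n = 0 then (1 : ℂ) else 0 := by
  rw [sum_boole]
  have := card_quadratic_roots hF t n
  rw [← Int.cast_natCast (R := ℂ), this]
  push_cast; ring

lemma sum_erase_add_div (hF : ringChar F ≠ 2) {c : F} (hc : c ≠ 0) (g : F → ℂ) :
    ∑ x ∈ univ.erase (0 : F), g (x + c / x) =
      ∑ y : F, (1 + quadraticChar F (y ^ 2 - 4 * c) : ℂ) * g y := by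
  simp_rw [quadratic_count_eq_sum hF, sum_mul]
  rw [sum_comm, ← add_sum_erase univ _ (mem_univ (0 : F))]
  have h0 : ∑ y : F, (if (0 : F) ^ 2 - y * 0 + c = 0 then (1 : ℂ) else 0) * g y = 0 := by
    simp [hc]
  rw [h0, zero_add]
  refine sum_congr rfl fun x hx => ?_
  have hx0 : x ≠ 0 := ne_of_mem_erase hx
  rw [sum_eq_single (x + c / x)]
  · rw [if_pos (by field_simp; ring), one_mul]
  · intro y _ hy
    rw [if_neg, zero_mul]
    intro h
    apply hy
    field_simp
    linear_combination -h
  · simp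

lemma klooSum_sq (hF : ringChar F ≠ 2) (ψ : AddChar F ℂ) (c : F) :
    klooSum ψ c ^ 2 = ∑ t : F, ∑ n ∈ univ.erase (0 : F),
      (1 + quadraticChar F (t ^ 2 - 4 * n) : ℂ) * ψ (t + c * t / n) := by
  have h1 : klooSum ψ c ^ 2 = ∑ x : F, ∑ y : F,
      if x * y ≠ 0 then ψ ((x + y) + c * (x + y) / (x * y)) else 0 := by
    rw [sq, klooSum, sum_mul_sum, ← add_sum_erase univ _ (mem_univ (0 : F))]
    simp only [zero_mul, ne_eq, not_true_eq_false, if_false, sum_const_zero, zero_add]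
    refine sum_congr rfl fun x hx => ?_
    have hx0 : x ≠ 0 := ne_of_mem_erase hx
    rw [← add_sum_erase univ (fun y => ite _ _ _) (mem_univ (0 : F))]
    simp only [mul_zero, not_true_eq_false, if_false, zero_add]
    refine sum_congr rfl fun y hy => ?_
    have hy0 : y ≠ 0 := ne_of_mem_erase hy
    rw [if_pos (mul_ne_zero hx0 hy0), ← AddChar.map_add_eq_mul]
    congr 1
    field_simp
    ring
  have h2 : ∀ t : F, ∑ n ∈ univ.erase (0 : F),
      (1 + quadraticChar F (t ^ 2 - 4 * n) : ℂ) * ψ (t + c * t / n) =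
      ∑ x : F, if x * (t - x) ≠ 0 then ψ (t + c * t / (x * (t - x))) else 0 := by
    intro t
    simp_rw [quadratic_count_eq_sum hF, sum_mul]
    rw [sum_comm]
    refine sum_congr rfl fun x _ => ?_
    by_cases hx : x * (t - x) = 0
    · rw [if_neg (not_not.mpr hx)]
      refine sum_eq_zero fun n hn => ?_
      rw [if_neg, zero_mul]
      intro h
      exact ne_of_mem_erase hn (by linear_combination h + hx)
    · rw [if_pos hx, sum_eq_single_of_mem (x * (t - x)) (mem_erase.mpr ⟨hx, mem_univ _⟩)]
      · rw [if_pos (by ring), one_mul]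
      · intro n _ hn
        rw [if_neg, zero_mul]
        intro h
        exact hn (by linear_combination h)
  rw [h1, sum_congr rfl fun t _ => h2 t, sum_comm (γ := F) (s := univ) (t := univ)
    (f := fun t x => if x * (t - x) ≠ 0 then ψ (t + c * t / (x * (t - x))) else 0)]
  refine sum_congr rfl fun x _ => ?_
  refine Eq.trans ?_ (Equiv.sum_comp (Equiv.addLeft x) _)
  simp

open QuadraticAlgebra in
lemma exists_quadratic_extension (hF : ringChar F ≠ 2) :
    ∃ (ν : F) (_ : ∀ r : F, r ^ 2 ≠ ν + 0 * r), ¬ IsSquare ν := by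
  obtain ⟨ν, hν⟩ := FiniteField.exists_nonsquare hF
  exact ⟨ν, fun r h => hν ⟨r, by linear_combination -h⟩, hν⟩

lemma quadraticAlgebra_trace (ν : F) (z : QuadraticAlgebra F ν 0) :
    Algebra.trace F (QuadraticAlgebra F ν 0) z = 2 * z.re := by
  rw [Algebra.trace_eq_matrix_trace (QuadraticAlgebra.basis ν 0), Matrix.trace_fin_two]
  simp [Algebra.leftMulMatrix_eq_repr_mul, QuadraticAlgebra.basis]
  ring

instance (ν : F) : Fintype (QuadraticAlgebra F ν 0) :=
  Fintype.ofEquiv _ (QuadraticAlgebra.equivProd ν 0).symm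

lemma card_quadraticAlgebra (ν : F) :
    Fintype.card (QuadraticAlgebra F ν 0) = Fintype.card F ^ 2 := by
  rw [Fintype.card_congr (QuadraticAlgebra.equivProd ν 0), Fintype.card_prod, sq]

lemma klooSum_quadraticAlgebra (hF : ringChar F ≠ 2) {ψ : AddChar F ℂ} (hψ : ψ ≠ 1) {c : F}
    (hc : c ≠ 0) (ν : F) [hfact : Fact (∀ r : F, r ^ 2 ≠ ν + 0 * r)] (hν : ¬ IsSquare ν)
    (Ψ : AddChar (QuadraticAlgebra F ν 0) ℂ) (hΨ : ∀ z, Ψ z = ψ (2 * z.re)) :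
    klooSum Ψ (algebraMap F _ c) = 2 * Fintype.card F - klooSum ψ c ^ 2 := by
  have h2 := Ring.two_ne_zero hF
  have h4 : (4 : F) ≠ 0 := by rw [show (4 : F) = 2 * 2 by norm_num]; exact mul_ne_zero h2 h2
  have hν0 : ν ≠ 0 := fun h => hν (h ▸ IsSquare.zero)
  have h1 : klooSum Ψ (algebraMap F _ c) = ∑ a : F, ∑ b : F,
      if a ^ 2 - ν * b ^ 2 ≠ 0 then ψ (2 * a + c * (2 * a) / (a ^ 2 - ν * b ^ 2)) else 0 := by
    rw [← sum_product', univ_product_univ, ← Equiv.sum_comp (QuadraticAlgebra.equivProd ν 0), klooSum,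
      ← add_sum_erase univ (fun i => ite _ _ _) (mem_univ (0 : QuadraticAlgebra F ν 0))]
    rw [if_neg (by simp [QuadraticAlgebra.equivProd]), zero_add]
    refine sum_congr (by ext; simp only [mem_erase]) fun z hz => ?_
    have hz0 : z ≠ 0 := (mem_erase.mp hz).1
    have hn : z.norm ≠ 0 := fun h => hz0 (QuadraticAlgebra.norm_eq_zero_iff_eq_zero.mp h)
    have hn' : z.norm = z.re ^ 2 - ν * z.im ^ 2 := by
      rw [QuadraticAlgebra.norm_def]; ring
    have he : (QuadraticAlgebra.equivProd ν 0) z = (z.re, z.im) := rfl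
    rw [he, if_pos (by rw [← hn']; exact hn), hΨ, ← hn']
    congr 1
    have : (algebraMap F (QuadraticAlgebra F ν 0) c / z).re = c * (z.re / z.norm) := by
      rw [div_eq_mul_inv, ← QuadraticAlgebra.C_eq_algebraMap, QuadraticAlgebra.C_mul_eq_smul]
      simp [QuadraticAlgebra.inv_def]
      field_simp
      exact Or.inl trivial
    rw [QuadraticAlgebra.re_add, this]
    ring
  have h3 : klooSum Ψ (algebraMap F _ c) = ∑ t : F, ∑ n ∈ univ.erase (0 : F),
      (1 - quadraticChar F (t ^ 2 - 4 * n) : ℂ) * ψ (t + c * t / n) := by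
    rw [h1, ← Equiv.sum_comp (Equiv.mulLeft₀ (2 : F)⁻¹ (inv_ne_zero h2))]
    refine sum_congr rfl fun t _ => ?_
    have hcount : ∀ n : F, (1 - quadraticChar F (t ^ 2 - 4 * n) : ℂ) =
        ∑ b : F, if n = (2⁻¹ * t) ^ 2 - ν * b ^ 2 then (1 : ℂ) else 0 := by
      intro n
      rw [sum_boole]
      have hs := quadraticChar_card_sqrts hF (ν⁻¹ * ((2⁻¹ * t) ^ 2 - n))
      have hset : (univ.filter fun b : F => n = (2⁻¹ * t) ^ 2 - ν * b ^ 2) =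
          {x | x ^ 2 = ν⁻¹ * ((2⁻¹ * t) ^ 2 - n)}.toFinset := by
        ext b
        simp only [mem_filter, mem_univ, true_and, Set.mem_toFinset, Set.mem_ofPred_eq]
        constructor
        · intro h; rw [h]; field_simp; ring
        · intro h; rw [h]; field_simp; ring
      have hχ : quadraticChar F (ν⁻¹ * ((2⁻¹ * t) ^ 2 - n)) =
          - quadraticChar F (t ^ 2 - 4 * n) := by
        have e : t ^ 2 - 4 * n = 2 ^ 2 * (ν * (ν⁻¹ * ((2⁻¹ * t) ^ 2 - n))) := by
          field_simp; ring
        have e' := congrArg (quadraticChar F) e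
        rw [map_mul, quadraticChar_sq_one' h2, one_mul, map_mul,
          quadraticChar_neg_one_iff_not_isSquare.mpr hν] at e'
        rw [e']
        ring
      rw [hset, ← Int.cast_natCast (R := ℂ), hs, hχ]
      push_cast; ring
    simp_rw [hcount, sum_mul]
    rw [sum_comm]
    refine sum_congr rfl fun b _ => ?_
    have e2 : (2 : F) * (Equiv.mulLeft₀ (2 : F)⁻¹ (inv_ne_zero h2) t) = t := by
      simp [Equiv.mulLeft₀]; field_simp
    have e3 : (Equiv.mulLeft₀ (2 : F)⁻¹ (inv_ne_zero h2) t) = 2⁻¹ * t := rfl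
    rw [e2, e3]
    by_cases hx : (2⁻¹ * t) ^ 2 - ν * b ^ 2 = 0
    · rw [if_neg (not_not.mpr hx)]
      refine (sum_eq_zero fun n hn => ?_).symm
      rw [if_neg, zero_mul]
      intro h
      exact ne_of_mem_erase hn (h.trans hx)
    · rw [if_pos hx, sum_eq_single_of_mem _ (mem_erase.mpr ⟨hx, mem_univ _⟩)]
      · rw [if_pos rfl, one_mul]
      · intro n _ hn
        rw [if_neg hn, zero_mul]
  have h5 : klooSum Ψ (algebraMap F _ c) + klooSum ψ c ^ 2 =
      2 * ∑ n ∈ univ.erase (0 : F), ∑ t : F, ψ (t * (1 + c / n)) := by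
    rw [h3, klooSum_sq hF, ← sum_add_distrib, sum_comm (s := univ.erase (0 : F)), mul_sum]
    refine sum_congr rfl fun t _ => ?_
    rw [← sum_add_distrib, mul_sum]
    refine sum_congr rfl fun n _ => ?_
    rw [show t * (1 + c / n) = t + c * t / n by ring]
    ring
  have hprim : ψ.IsPrimitive := AddChar.IsPrimitive.of_ne_one hψ
  have h6 : ∑ n ∈ univ.erase (0 : F), ∑ t : F, ψ (t * (1 + c / n)) = Fintype.card F := by
    simp_rw [AddChar.sum_mulShift _ hprim]
    rw [sum_eq_single_of_mem (-c) (mem_erase.mpr ⟨neg_ne_zero.mpr hc, mem_univ _⟩)]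
    · rw [if_pos (by field_simp; ring)]
    · intro n hn hne
      have hn0 : n ≠ 0 := ne_of_mem_erase hn
      rw [if_neg, Nat.cast_zero]
      intro h
      apply hne
      field_simp at h
      linear_combination h
  rw [h6] at h5
  linear_combination h5

end Kloosterman

end

section

open Finset Polynomial

section KloostermanBound

set_option linter.unusedSectionVars false

universe u

variable {F : Type u} [Field F] [Fintype F]

/-- The sequence `u_0 = s`, `u_{k+1} = 2 q^{2^k} - u_k²`. -/
def klooIter (q s : ℝ) : ℕ → ℝ
  | 0 => s
  | k + 1 => 2 * q ^ 2 ^ k - klooIter q s k ^ 2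

lemma klooSum_eq_re (ψ : AddChar F ℂ) (c : F) : klooSum ψ c = ((klooSum ψ c).re : ℂ) := by
  refine (Complex.conj_eq_iff_re.mp ?_).symm
  rw [klooSum, map_sum]
  refine sum_nbij' (fun x => -x) (fun x => -x) ?_ ?_ ?_ ?_ ?_
  · intro x hx; simpa using hx
  · intro x hx; simpa using hx
  · intro x _; simp
  · intro x _; simp
  · intro x _
    rw [← AddChar.map_neg_eq_conj]
    congr 1
    rw [div_neg]; ring

/-- The additive character `ψ ∘ Tr_{K/F}`. -/
def traceChar (K : Type u) [Field K] [Algebra F K] (ψ : AddChar F ℂ) : AddChar K ℂ :=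
  ψ.compAddMonoidHom (Algebra.trace F K).toAddMonoidHom

lemma traceChar_apply (K : Type u) [Field K] [Algebra F K] (ψ : AddChar F ℂ) (z : K) :
    traceChar K ψ z = ψ (Algebra.trace F K z) := rfl

lemma traceChar_ne_one (K : Type u) [Field K] [Finite K] [Algebra F K] {ψ : AddChar F ℂ}
    (hψ : ψ ≠ 1) : traceChar K ψ ≠ 1 := by
  intro h
  apply hψ
  ext a
  obtain ⟨z, rfl⟩ := Algebra.trace_surjective F K a
  rw [← traceChar_apply, h]
  rfl

lemma exists_klooSum_tower (hF : ringChar F ≠ 2) (k : ℕ) :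
    ∃ (K : Type u) (_ : Field K) (_ : Fintype K) (_ : Algebra F K),
      Fintype.card K = Fintype.card F ^ 2 ^ k ∧
      ∀ ψ : AddChar F ℂ, ψ ≠ 1 → ∀ c : F, c ≠ 0 →
        klooSum (traceChar K ψ) (algebraMap F K c)
          = klooIter (Fintype.card F) (klooSum ψ c).re k := by
  induction k with
  | zero =>
    refine ⟨F, inferInstance, inferInstance, inferInstance, by simp, ?_⟩
    intro ψ _ c _
    rw [klooIter, ← klooSum_eq_re]
    have : traceChar F ψ = ψ := by
      ext z; rw [traceChar_apply]; simp
    rw [this]; rfl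
  | succ k ih =>
    obtain ⟨K, _, _, _, hcard, hsum⟩ := ih
    have hK : ringChar K ≠ 2 := by rwa [← Algebra.ringChar_eq F K]
    obtain ⟨ν, hν1, hν⟩ := exists_quadratic_extension hK
    have : Fact (∀ r : K, r ^ 2 ≠ ν + 0 * r) := ⟨hν1⟩
    refine ⟨QuadraticAlgebra K ν 0, inferInstance, inferInstance, inferInstance, ?_, ?_⟩
    · rw [card_quadraticAlgebra, hcard, ← pow_mul, pow_succ]
    intro ψ hψ c hc
    rw [IsScalarTower.algebraMap_apply F K, klooSum_quadraticAlgebra hK (traceChar_ne_one K hψ)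
      (by simpa using hc) ν hν, hsum ψ hψ c hc, hcard, klooIter]
    · push_cast; ring
    · intro z
      rw [traceChar_apply, traceChar_apply, ← quadraticAlgebra_trace, Algebra.trace_trace]

lemma klooIter_succ_le (q s : ℝ) (k : ℕ) : klooIter q s (k + 1) ≤ 2 * q ^ 2 ^ k := by
  rw [klooIter]; nlinarith [sq_nonneg (klooIter q s k)]

section Extension

variable {K : Type u} [Field K] [Fintype K] [Algebra F K]

lemma card_frobenius_fiber_le (a : K) :
    (univ.filter fun y : K => y ^ Fintype.card F - y = a).card ≤ Fintype.card F := by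
  have h1 := Fintype.one_lt_card (α := F)
  have hd : (X ^ Fintype.card F - X - C a : K[X]).natDegree = Fintype.card F := by
    rw [natDegree_sub_C, FiniteField.X_pow_card_sub_X_natDegree_eq K h1]
  have hne : (X ^ Fintype.card F - X - C a : K[X]) ≠ 0 := by
    intro h; rw [h] at hd; simp at hd; omega
  calc _ ≤ (X ^ Fintype.card F - X - C a : K[X]).roots.toFinset.card := by
        refine card_le_card fun y hy => ?_
        simp only [mem_filter, mem_univ, true_and] at hy
        rw [Multiset.mem_toFinset, mem_roots hne]
        simp [hy]
    _ ≤ _ := (Multiset.toFinset_card_le _).trans ((card_roots' _).trans hd.le)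

lemma trace_frobenius_sub (y : K) :
    Algebra.trace F K (y ^ Fintype.card F - y) = 0 := by
  rw [map_sub, sub_eq_zero]
  have := Algebra.trace_eq_of_algEquiv (FiniteField.frobeniusAlgEquivOfAlgebraic F K) y
  simpa using this

lemma card_cast_eq_zero : ((Fintype.card F : ℕ) : K) = 0 := by
  rw [← map_natCast (algebraMap F K), FiniteField.cast_card_eq_zero, map_zero]

/-- `(X^q - X)² - 4c` -/
def artinSchreierDisc (F : Type u) [Fintype F] (K : Type u) [Field K] (c : K) : K[X] :=
  (X ^ Fintype.card F - X) ^ 2 - C (4 * c)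

lemma artinSchreierDisc_natDegree (c : K) :
    (artinSchreierDisc F K c).natDegree = 2 * Fintype.card F := by
  have h1 := Fintype.one_lt_card (α := F)
  rw [artinSchreierDisc, natDegree_sub_C, natDegree_pow,
    FiniteField.X_pow_card_sub_X_natDegree_eq K h1]

lemma artinSchreierDisc_eval (c y : K) :
    (artinSchreierDisc F K c).eval y = (y ^ Fintype.card F - y) ^ 2 - 4 * c := by
  simp [artinSchreierDisc]

lemma artinSchreierDisc_squarefree (hK : ringChar K ≠ 2) {c : K} (hc : c ≠ 0) :
    Squarefree (artinSchreierDisc F K c) := by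
  have h2 : (2 : K) ≠ 0 := Ring.two_ne_zero hK
  have h4 : (4 : K) ≠ 0 := by rw [show (4 : K) = 2 * 2 by norm_num]; exact mul_ne_zero h2 h2
  apply Polynomial.Separable.squarefree
  have hd : derivative (artinSchreierDisc F K c) = - 2 * (X ^ Fintype.card F - X) := by
    rw [artinSchreierDisc, derivative_sub, derivative_C, derivative_pow, derivative_sub,
      derivative_X_pow, derivative_X, card_cast_eq_zero]
    simp only [zero_sub, map_zero, zero_mul, sub_zero]
    push_cast
    rw [map_ofNat (C : K →+* K[X]) 2]
    ring
  refine ⟨C (-(4 * c)⁻¹), C (-(4 * c)⁻¹) * C (2⁻¹) * (X ^ Fintype.card F - X), ?_⟩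
  rw [hd, artinSchreierDisc]
  have e1 : (C (2⁻¹) : K[X]) * 2 = 1 := by
    rw [← map_ofNat (C : K →+* K[X]) 2, ← C_mul, inv_mul_cancel₀ h2, C_1]
  have e2 : (C (-(4 * c)⁻¹) : K[X]) * C (4 * c) = -1 := by
    rw [← C_mul, neg_mul, inv_mul_cancel₀ (mul_ne_zero h4 hc)]; simp
  linear_combination (-C (-(4 * c)⁻¹) * (X ^ Fintype.card F - X) ^ 2) * e1 - e2

lemma sum_quadraticChar_artinSchreierDisc (hK : ringChar K ≠ 2) {N : ℕ}
    (hcard : Fintype.card K = N ^ 2) (hN : 4 * Fintype.card F + 10 ≤ N) {c : K} (hc : c ≠ 0) :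
    -(2 * Fintype.card F + N * (6 * Fintype.card F + 8) : ℤ) ≤
      ∑ y : K, quadraticChar K ((y ^ Fintype.card F - y) ^ 2 - 4 * c) := by
  have h2 : (2 : K) ≠ 0 := Ring.two_ne_zero hK
  have h4 : (4 : K) ≠ 0 := by rw [show (4 : K) = 2 * 2 by norm_num]; exact mul_ne_zero h2 h2
  have h1 := Fintype.one_lt_card (α := F)
  set f := artinSchreierDisc F K c with hf
  have hdeg : f.natDegree = 2 * Fintype.card F := artinSchreierDisc_natDegree c
  have hsq := artinSchreierDisc_squarefree (F := F) hK hc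
  have hNodd : Odd N := by
    have := FiniteField.odd_card_of_char_ne_two hK
    rw [hcard] at this
    have h3 : Odd (N ^ 2) := Nat.odd_iff.mpr this
    exact (Nat.odd_pow_iff (by norm_num)).mp h3
  have hcoeff : f.coeff 0 ≠ 0 := by
    rw [coeff_zero_eq_eval_zero, hf, artinSchreierDisc_eval]
    simp only [zero_pow Fintype.card_ne_zero, sub_zero]
    simp [h4, hc]
  have hst := stepanov hcard hNodd hsq (by rw [hdeg]; omega) hcoeff (by rw [hdeg]; omega) (-1)
  have hz : (univ.filter fun y => f.eval y = 0).card ≤ 2 * Fintype.card F := by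
    rw [← hdeg]
    refine le_trans ?_ (card_roots' f)
    refine le_trans (card_le_card fun y hy => ?_) (Multiset.toFinset_card_le _)
    simp only [mem_filter, mem_univ, true_and] at hy
    rw [Multiset.mem_toFinset, mem_roots hsq.ne_zero]
    exact hy
  have hpt : ∀ y : K, (1 : ℤ) - (if f.eval y = 0 then 1 else 0)
      - 2 * (if f.eval y ^ (Fintype.card K / 2) = -1 then 1 else 0) ≤
      quadraticChar K ((y ^ Fintype.card F - y) ^ 2 - 4 * c) := by
    intro y
    rw [← artinSchreierDisc_eval, ← hf, ← quadraticChar_eq_pow_of_char_ne_two' hK]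
    have hne : (1 : K) ≠ -1 := by
      intro h
      exact h2 (by linear_combination h)
    by_cases h0 : f.eval y = 0
    · simp [h0]
    · rcases quadraticChar_dichotomy h0 with h | h
      · rw [h]; simp [h0, hne]
      · rw [h]; simp [h0]
  have := sum_le_sum fun y (_ : y ∈ univ) => hpt y
  refine le_trans ?_ this
  rw [sum_sub_distrib, sum_sub_distrib, ← mul_sum, sum_boole, sum_boole]
  simp only [sum_const, card_univ, nsmul_eq_mul, mul_one]
  rw [hcard]
  rw [hdeg, hcard] at hst
  zify at hst hz
  push_cast
  nlinarith

lemma sum_klooSum_mulShift_ge (hK : ringChar K ≠ 2) {N : ℕ}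
    (hcard : Fintype.card K = N ^ 2) (hN : 4 * Fintype.card F + 10 ≤ N) {c : F} (hc : c ≠ 0)
    {ψ : AddChar F ℂ} (hψ : ψ ≠ 1) :
    -(2 * Fintype.card F + N * (6 * Fintype.card F + 8) : ℝ) ≤
      ∑ t ∈ univ.erase (0 : F),
        (klooSum (traceChar K (ψ.mulShift t)) (algebraMap F K c)).re := by
  set c' := algebraMap F K c with hc'
  have hc0 : c' ≠ 0 := by simpa [hc'] using hc
  set S := (univ.erase (0 : K)).filter fun x => Algebra.trace F K (x + c' / x) = 0 with hS
  have hprim : ψ.IsPrimitive := AddChar.IsPrimitive.of_ne_one hψ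
  have h1 : ∑ t ∈ univ.erase (0 : F), klooSum (traceChar K (ψ.mulShift t)) c' =
      Fintype.card F * S.card - ((N : ℂ) ^ 2 - 1) := by
    have hx : ∀ x : K, ∑ t ∈ univ.erase (0 : F), traceChar K (ψ.mulShift t) (x + c' / x) =
        Fintype.card F * (if Algebra.trace F K (x + c' / x) = 0 then 1 else 0) - 1 := by
      intro x
      have := AddChar.sum_mulShift (Algebra.trace F K (x + c' / x)) hprim
      rw [← add_sum_erase univ _ (mem_univ (0 : F))] at this
      simp only [zero_mul, AddChar.map_zero_eq_one] at this
      simp only [traceChar_apply, AddChar.mulShift_apply]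
      push_cast at this
      rw [eq_sub_iff_add_eq, add_comm, this]
      split_ifs <;> simp
    simp only [klooSum]
    rw [sum_comm, sum_congr rfl fun x _ => hx x, sum_sub_distrib, ← mul_sum, sum_boole]
    congr 1
    rw [sum_const, card_erase_of_mem (mem_univ _), card_univ, hcard, nsmul_eq_mul, mul_one,
      Nat.cast_sub]
    · push_cast; ring
    · have : 0 < N := by omega
      exact Nat.one_le_pow _ _ this
  have h1' : ∑ t ∈ univ.erase (0 : F), (klooSum (traceChar K (ψ.mulShift t)) c').re =
      Fintype.card F * S.card - ((N : ℝ) ^ 2 - 1) := by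
    rw [← Complex.re_sum, h1]
    norm_cast
  have h2 : ((N : ℤ) ^ 2 + ∑ y : K, quadraticChar K ((y ^ Fintype.card F - y) ^ 2 - 4 * c') : ℤ)
      ≤ Fintype.card F * S.card := by
    have e1 : ((N : ℤ) ^ 2 + ∑ y : K, quadraticChar K ((y ^ Fintype.card F - y) ^ 2 - 4 * c') : ℤ)
        = ∑ y : K, ((univ.filter fun x : K =>
            x ^ 2 - (y ^ Fintype.card F - y) * x + c' = 0).card : ℤ) := by
      simp_rw [card_quadratic_roots hK]
      rw [sum_add_distrib]
      simp [hcard]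
    rw [e1]
    norm_cast
    rw [← card_sigma]
    refine card_le_mul_card_image_of_maps_to (f := fun z => z.2) ?_ _ ?_
    · rintro ⟨y, x⟩ hz
      simp only [mem_sigma, mem_univ, mem_filter, true_and] at hz
      have hx0 : x ≠ 0 := by
        rintro rfl
        apply hc0
        simpa using hz
      simp only [hS, mem_filter, mem_erase, mem_univ, and_true]
      refine ⟨hx0, ?_⟩
      have : x + c' / x = y ^ Fintype.card F - y := by
        field_simp
        linear_combination hz
      rw [this, trace_frobenius_sub]
    · intro x hx
      have hx0 : x ≠ 0 := by
        simp only [hS, mem_filter, mem_erase] at hx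
        exact hx.1.1
      refine le_trans ?_ (card_frobenius_fiber_le (F := F) (x + c' / x))
      refine card_le_card_of_injOn (fun z => z.1) ?_ ?_
      · rintro ⟨y, x'⟩ hz
        simp only [coe_filter, mem_sigma, mem_univ, mem_filter, true_and, Set.mem_ofPred_eq] at hz ⊢
        obtain ⟨hz, rfl⟩ := hz
        field_simp
        linear_combination -hz
      · rintro ⟨y, x'⟩ hz ⟨y', x''⟩ hz' h
        simp only [coe_filter, mem_sigma, mem_univ, mem_filter, true_and, Set.mem_ofPred_eq] at hz hz'
        obtain ⟨_, rfl⟩ := hz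
        obtain ⟨_, rfl⟩ := hz'
        simp only at h
        rw [h]
  have h3 := sum_quadraticChar_artinSchreierDisc (F := F) hK hcard hN hc0
  rw [h1']
  have h4 : ((N : ℤ) ^ 2 - (2 * Fintype.card F + N * (6 * Fintype.card F + 8)) : ℤ)
      ≤ Fintype.card F * S.card := by linarith
  have h5 : ((N : ℝ) ^ 2 - (2 * Fintype.card F + N * (6 * Fintype.card F + 8)) : ℝ)
      ≤ Fintype.card F * S.card := by exact_mod_cast h4
  linarith

end Extension

lemma klooSum_re_ge (hF : ringChar F ≠ 2) {c : F} (hc : c ≠ 0) {ψ : AddChar F ℂ} (hψ : ψ ≠ 1)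
    (k : ℕ) (hk : 4 * Fintype.card F + 10 ≤ Fintype.card F ^ 2 ^ k) :
    -(Fintype.card F ^ 2 ^ k * (10 * Fintype.card F + 8) : ℝ) ≤
      klooIter (Fintype.card F) (klooSum ψ c).re (k + 1) := by
  obtain ⟨K, _, _, _, hcard, hsum⟩ := exists_klooSum_tower hF (k + 1)
  have hK : ringChar K ≠ 2 := by rwa [← Algebra.ringChar_eq F K]
  have hprim : ψ.IsPrimitive := AddChar.IsPrimitive.of_ne_one hψ
  have hcard' : Fintype.card K = (Fintype.card F ^ 2 ^ k) ^ 2 := by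
    rw [hcard, ← pow_mul, pow_succ]
  have h1 := sum_klooSum_mulShift_ge hK hcard' hk hc hψ
  have h1F := Fintype.one_lt_card (α := F)
  have hshift : ∀ t : F, t ≠ 0 → ψ.mulShift t ≠ 1 := fun t ht => hprim ht
  rw [← add_sum_erase _ _ (mem_erase.mpr ⟨one_ne_zero, mem_univ (1 : F)⟩)] at h1
  have h2 : ∑ t ∈ (univ.erase (0 : F)).erase 1,
      (klooSum (traceChar K (ψ.mulShift t)) (algebraMap F K c)).re ≤
      Fintype.card F * (2 * Fintype.card F ^ 2 ^ k : ℝ) := by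
    refine (sum_le_card_nsmul _ _ (2 * Fintype.card F ^ 2 ^ k : ℝ) ?_).trans ?_
    · intro t ht
      have ht0 : t ≠ 0 := (mem_erase.mp (mem_erase.mp ht).2).1
      rw [hsum _ (hshift t ht0) c hc, Complex.ofReal_re]
      exact klooIter_succ_le _ _ _
    · rw [nsmul_eq_mul]
      gcongr
      exact card_le_univ _
  rw [AddChar.mulShift_one, hsum ψ hψ c hc, Complex.ofReal_re] at h1
  push_cast at h1
  have hN : (1 : ℝ) ≤ Fintype.card F ^ 2 ^ k := one_le_pow₀ (by exact_mod_cast h1F.le)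
  have : (2 : ℝ) * Fintype.card F ≤ 2 * Fintype.card F * Fintype.card F ^ 2 ^ k :=
    le_mul_of_one_le_right (by positivity) hN
  nlinarith

/-- The Weil bound for Kloosterman sums over a finite field of odd characteristic. -/
theorem norm_klooSum_le (hF : ringChar F ≠ 2) {c : F} (hc : c ≠ 0) {ψ : AddChar F ℂ}
    (hψ : ψ ≠ 1) : ‖klooSum ψ c‖ ≤ 2 * Real.sqrt (Fintype.card F) := by
  by_contra! hcon
  set q : ℝ := (Fintype.card F : ℝ) with hq
  set s := (klooSum ψ c).re with hs
  have h1F := Fintype.one_lt_card (α := F)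
  have hq1 : (2 : ℝ) ≤ q := by rw [hq]; exact_mod_cast h1F
  rw [klooSum_eq_re, Complex.norm_real, Real.norm_eq_abs, ← hs] at hcon
  have hs2 : 4 * q < s ^ 2 := by
    have h0 : 0 ≤ 2 * Real.sqrt q := by positivity
    have := pow_lt_pow_left₀ hcon h0 two_ne_zero
    rw [mul_pow, Real.sq_sqrt (by linarith), sq_abs] at this
    linarith
  obtain ⟨ε, hε, hε2⟩ : ∃ ε : ℝ, 0 < ε ∧ s ^ 2 = (4 + ε) * q :=
    ⟨s ^ 2 / q - 4, by rw [sub_pos, lt_div_iff₀ (by linarith)]; linarith,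
      by field_simp; ring⟩
  have hgrow : ∀ k, klooIter q s (k + 1) ≤ -(2 + ε * 2 ^ k) * q ^ 2 ^ k := by
    intro k
    induction k with
    | zero => simp only [klooIter]; rw [hε2]; simp; nlinarith
    | succ k ih =>
      have hpos : 0 < q ^ 2 ^ k := by positivity
      have he : 0 < ε * 2 ^ k := by positivity
      have h1 : ((2 + ε * 2 ^ k) * q ^ 2 ^ k) ^ 2 ≤ klooIter q s (k + 1) ^ 2 := by
        rw [← neg_sq (klooIter q s (k + 1))]
        exact pow_le_pow_left₀ (by positivity) (by linarith) 2
      rw [klooIter]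
      have e : q ^ 2 ^ (k + 1) = (q ^ 2 ^ k) ^ 2 := by rw [← pow_mul, pow_succ]
      rw [e]
      have e2 : (2 : ℝ) ^ (k + 1) = 2 * 2 ^ k := by ring
      rw [e2]
      nlinarith [mul_pos he (sq_pos_of_pos hpos), mul_pos (mul_pos he he) (sq_pos_of_pos hpos)]
  obtain ⟨k0, hk0⟩ := pow_unbounded_of_one_lt ((10 * q + 8) / ε) (one_lt_two)
  set k := k0 + 4 * Fintype.card F + 10 with hk
  have hbig : 4 * Fintype.card F + 10 ≤ Fintype.card F ^ 2 ^ k := by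
    calc 4 * Fintype.card F + 10 ≤ k := by omega
      _ ≤ 2 ^ k := Nat.lt_two_pow_self.le
      _ ≤ 2 ^ 2 ^ k := Nat.lt_two_pow_self.le
      _ ≤ _ := Nat.pow_le_pow_left h1F _
  have h3 := klooSum_re_ge hF hc hψ k hbig
  have h4 := hgrow k
  have hpos : 0 < q ^ 2 ^ k := by positivity
  have h5 : (2 + ε * 2 ^ k) * q ^ 2 ^ k ≤ (10 * q + 8) * q ^ 2 ^ k := by
    rw [← hq, ← hs] at h3
    linarith
  have h6 := le_of_mul_le_mul_right h5 hpos
  rw [div_lt_iff₀ hε] at hk0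
  have h7 : (2 : ℝ) ^ k0 ≤ 2 ^ k := pow_le_pow_right₀ (by norm_num) (by omega)
  nlinarith

end KloostermanBound

end

section

open Finset PowerSeries

section ConvergentSeries

set_option linter.unusedSectionVars false

/-- Absolute convergence of a complex power series on the open unit disc. -/
def ConvOnDisc (F : ℂ⟦X⟧) : Prop := ∀ x : ℂ, ‖x‖ < 1 → Summable fun n => ‖coeff n F * x ^ n‖

/-- The sum of a complex power series. -/
def seriesEval (F : ℂ⟦X⟧) (x : ℂ) : ℂ := ∑' n, coeff n F * x ^ n

namespace ConvOnDisc

variable {F G : ℂ⟦X⟧}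

lemma hasSum (hF : ConvOnDisc F) {x : ℂ} (hx : ‖x‖ < 1) :
    HasSum (fun n => coeff n F * x ^ n) (seriesEval F x) := (hF x hx).of_norm.hasSum

lemma add (hF : ConvOnDisc F) (hG : ConvOnDisc G) : ConvOnDisc (F + G) := by
  intro x hx
  refine Summable.of_nonneg_of_le (fun _ => norm_nonneg _) (fun n => ?_) ((hF x hx).add (hG x hx))
  rw [map_add, add_mul]
  exact norm_add_le _ _

lemma coeff_mul_pow (F G : ℂ⟦X⟧) (x : ℂ) (n : ℕ) : coeff n (F * G) * x ^ n =
    ∑ kl ∈ Finset.HasAntidiagonal.antidiagonal n,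
      (coeff kl.1 F * x ^ kl.1) * (coeff kl.2 G * x ^ kl.2) := by
  rw [coeff_mul, sum_mul]
  refine sum_congr rfl fun kl hkl => ?_
  rw [← Finset.HasAntidiagonal.mem_antidiagonal.mp hkl, pow_add]
  ring

lemma mul (hF : ConvOnDisc F) (hG : ConvOnDisc G) : ConvOnDisc (F * G) := by
  intro x hx
  have := summable_norm_sum_mul_antidiagonal_of_summable_norm (hF x hx) (hG x hx)
  simpa only [coeff_mul_pow] using this

lemma C (a : ℂ) : ConvOnDisc (PowerSeries.C a) := by
  intro x _
  refine summable_of_ne_finset_zero (s := {0}) fun n hn => ?_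
  rw [coeff_C, if_neg (by simpa using hn)]; simp

lemma one : ConvOnDisc 1 := by simpa using C 1

lemma neg (hF : ConvOnDisc F) : ConvOnDisc (-F) := by
  intro x hx; simpa using hF x hx

lemma sub (hF : ConvOnDisc F) (hG : ConvOnDisc G) : ConvOnDisc (F - G) := by
  rw [sub_eq_add_neg]; exact hF.add hG.neg

lemma pow (hF : ConvOnDisc F) (k : ℕ) : ConvOnDisc (F ^ k) := by
  induction k with
  | zero => simpa using one
  | succ k ih => rw [pow_succ]; exact ih.mul hF

lemma prod {ι : Type*} (s : Finset ι) {F : ι → ℂ⟦X⟧} (hF : ∀ i ∈ s, ConvOnDisc (F i)) :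
    ConvOnDisc (∏ i ∈ s, F i) :=
  prod_induction F ConvOnDisc (fun _ _ => mul) one hF

lemma sum {ι : Type*} (s : Finset ι) {F : ι → ℂ⟦X⟧} (hF : ∀ i ∈ s, ConvOnDisc (F i)) :
    ConvOnDisc (∑ i ∈ s, F i) :=
  sum_induction F ConvOnDisc (fun _ _ => add) (by simpa using C 0) hF

lemma rescale (hF : ConvOnDisc F) {z : ℂ} (hz : ‖z‖ ≤ 1) :
    ConvOnDisc (PowerSeries.rescale z F) := by
  intro x hx
  have : ‖z * x‖ < 1 := by
    rw [norm_mul]; nlinarith [norm_nonneg x, norm_nonneg z]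
  refine (hF _ this).congr fun n => ?_
  rw [coeff_rescale]; congr 1; ring

lemma hasSum_expand {k : ℕ} (hk : k ≠ 0) {a : ℂ} {x : ℂ}
    (h : HasSum (fun n => coeff n F * (x ^ k) ^ n) a) :
    HasSum (fun n => coeff n (PowerSeries.expand k hk F) * x ^ n) a := by
  have hinj : Function.Injective fun n : ℕ => k * n :=
    fun _ _ h => Nat.eq_of_mul_eq_mul_left (Nat.pos_of_ne_zero hk) h
  refine (hinj.hasSum_iff ?_).mp (h.congr_fun ?_)
  · intro n hn
    rw [coeff_expand_of_not_dvd, zero_mul]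
    rintro ⟨m, rfl⟩
    exact hn ⟨m, rfl⟩
  · intro n
    simp [coeff_expand_mul, pow_mul]

lemma expand (hF : ConvOnDisc F) {k : ℕ} (hk : k ≠ 0) : ConvOnDisc (PowerSeries.expand k hk F) := by
  intro x hx
  have hinj : Function.Injective fun n : ℕ => k * n :=
    fun _ _ h => Nat.eq_of_mul_eq_mul_left (Nat.pos_of_ne_zero hk) h
  have hxk : ‖x ^ k‖ < 1 := by rw [norm_pow]; exact pow_lt_one₀ (norm_nonneg _) hx hk
  refine (hinj.summable_iff ?_).mp ((hF _ hxk).congr ?_)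
  · intro n hn
    rw [coeff_expand_of_not_dvd, zero_mul, norm_zero]
    rintro ⟨m, rfl⟩
    exact hn ⟨m, rfl⟩
  · intro n
    simp [coeff_expand_mul, pow_mul]

variable {x : ℂ}

lemma eval_add (hx : ‖x‖ < 1) (hF : ConvOnDisc F) (hG : ConvOnDisc G) :
    seriesEval (F + G) x = seriesEval F x + seriesEval G x := by
  refine (((hF.hasSum hx).add (hG.hasSum hx)).congr_fun fun n => ?_).tsum_eq
  simp [add_mul]

lemma eval_neg (hx : ‖x‖ < 1) (F : ℂ⟦X⟧) : seriesEval (-F) x = -seriesEval F x := by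
  simp [seriesEval, tsum_neg]

lemma eval_sub (hx : ‖x‖ < 1) (hF : ConvOnDisc F) (hG : ConvOnDisc G) :
    seriesEval (F - G) x = seriesEval F x - seriesEval G x := by
  rw [sub_eq_add_neg, eval_add hx hF hG.neg, eval_neg hx, sub_eq_add_neg]

lemma eval_mul (hx : ‖x‖ < 1) (hF : ConvOnDisc F) (hG : ConvOnDisc G) :
    seriesEval (F * G) x = seriesEval F x * seriesEval G x := by
  simp only [seriesEval, coeff_mul_pow]
  exact (tsum_mul_tsum_eq_tsum_sum_antidiagonal_of_summable_norm (hF x hx) (hG x hx)).symm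

lemma eval_C (hx : ‖x‖ < 1) (a : ℂ) : seriesEval (PowerSeries.C a) x = a := by
  rw [seriesEval, tsum_eq_single 0]
  · simp
  · intro n hn; simp [coeff_C, hn]

lemma eval_one (hx : ‖x‖ < 1) : seriesEval 1 x = 1 := by simpa using eval_C hx 1

lemma eval_pow (hx : ‖x‖ < 1) (hF : ConvOnDisc F) (k : ℕ) :
    seriesEval (F ^ k) x = seriesEval F x ^ k := by
  induction k with
  | zero => simpa using eval_one hx
  | succ k ih => rw [pow_succ, pow_succ, eval_mul hx (hF.pow k) hF, ih]

lemma eval_prod (hx : ‖x‖ < 1) {ι : Type*} (s : Finset ι) {F : ι → ℂ⟦X⟧}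
    (hF : ∀ i ∈ s, ConvOnDisc (F i)) :
    seriesEval (∏ i ∈ s, F i) x = ∏ i ∈ s, seriesEval (F i) x := by
  induction s using Finset.cons_induction with
  | empty => simpa using eval_one hx
  | cons a s ha ih =>
    rw [prod_cons, prod_cons, eval_mul hx (hF a (mem_cons_self _ _))
      (prod s fun i hi => hF i (mem_cons_of_mem hi)), ih fun i hi => hF i (mem_cons_of_mem hi)]

lemma eval_sum (hx : ‖x‖ < 1) {ι : Type*} (s : Finset ι) {F : ι → ℂ⟦X⟧}
    (hF : ∀ i ∈ s, ConvOnDisc (F i)) :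
    seriesEval (∑ i ∈ s, F i) x = ∑ i ∈ s, seriesEval (F i) x := by
  induction s using Finset.cons_induction with
  | empty => simpa using eval_C hx 0
  | cons a s ha ih =>
    rw [sum_cons, sum_cons, eval_add hx (hF a (mem_cons_self _ _))
      (sum s fun i hi => hF i (mem_cons_of_mem hi)), ih fun i hi => hF i (mem_cons_of_mem hi)]

lemma eval_rescale (F : ℂ⟦X⟧) (z x : ℂ) :
    seriesEval (PowerSeries.rescale z F) x = seriesEval F (z * x) := by
  simp only [seriesEval, coeff_rescale]
  congr 1; ext n; ring

lemma eval_expand (hx : ‖x‖ < 1) (hF : ConvOnDisc F) {k : ℕ} (hk : k ≠ 0) :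
    seriesEval (PowerSeries.expand k hk F) x = seriesEval F (x ^ k) := by
  have hxk : ‖x ^ k‖ < 1 := by rw [norm_pow]; exact pow_lt_one₀ (norm_nonneg _) hx hk
  exact (hasSum_expand hk (hF.hasSum hxk)).tsum_eq

end ConvOnDisc

open ConvOnDisc in
lemma hasFPowerSeriesOnBall_seriesEval {F : ℂ⟦X⟧} (hF : ConvOnDisc F) :
    HasFPowerSeriesOnBall (seriesEval F) (.ofScalars ℂ fun n => coeff n F) 0 1 := by
  refine ⟨?_, one_pos, ?_⟩
  · refine ENNReal.le_of_forall_nnreal_lt fun r hr => ?_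
    have hr1 : r < 1 := by exact_mod_cast hr
    refine FormalMultilinearSeries.le_radius_of_summable_norm _ ?_
    have := hF (r : ℂ) (by simpa using hr1)
    refine this.congr fun n => ?_
    simp
  · intro y hy
    have hy1 : ‖y‖ < 1 := by
      have : ‖y‖₊ < 1 := by simpa [Metric.mem_eball, edist_zero_right, enorm_eq_nnnorm] using hy
      exact_mod_cast this
    simpa [mul_comm] using hF.hasSum hy1

lemma differentiableAt_seriesEval {F : ℂ⟦X⟧} (hF : ConvOnDisc F) {x : ℂ} (hx : ‖x‖ < 1) :
    DifferentiableAt ℂ (seriesEval F) x := by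
  refine ((hasFPowerSeriesOnBall_seriesEval hF).analyticAt_of_mem ?_).differentiableAt
  have : ‖x‖₊ < 1 := by exact_mod_cast hx
  simpa [Metric.mem_eball, edist_zero_right, enorm_eq_nnnorm] using this

lemma seriesEval_injective {F G : ℂ⟦X⟧} (hF : ConvOnDisc F) (hG : ConvOnDisc G)
    (h : ∀ x : ℂ, ‖x‖ < 1 → x ≠ 0 → seriesEval F x = seriesEval G x) : F = G := by
  have h1 := (hasFPowerSeriesOnBall_seriesEval hF).hasFPowerSeriesAt
  have h2 := (hasFPowerSeriesOnBall_seriesEval hG).hasFPowerSeriesAt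
  have hev : seriesEval F =ᶠ[nhds 0] seriesEval G := by
    refine (h1.analyticAt.frequently_eq_iff_eventually_eq h2.analyticAt).mp
      (Filter.Eventually.frequently ?_)
    have : ∀ᶠ x : ℂ in nhdsWithin 0 {0}ᶜ, ‖x‖ < 1 :=
      nhdsWithin_le_nhds (by
        filter_upwards [Metric.ball_mem_nhds (0 : ℂ) one_pos] with x hx using by simpa using hx)
    filter_upwards [this, self_mem_nhdsWithin] with x hx hx0 using h x hx hx0
  have h3 := h1.eq_formalMultilinearSeries (h2.congr hev.symm)
  ext n
  simpa using congr_arg (FormalMultilinearSeries.coeff · n) h3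

end ConvergentSeries

end

section

open Finset PowerSeries

section ThetaSeries

/-- The theta series `∑_{n ∈ ℤ} q^{n²}`. -/
def thetaSeries (R : Type*) [CommRing R] : R⟦X⟧ :=
  PowerSeries.mk fun n => if n = 0 then 1 else if IsSquare n then 2 else 0

/-- The alternating theta series `∑_{n ∈ ℤ} (-1)^n q^{n²}`. -/
def thetaAlt (R : Type*) [CommRing R] : R⟦X⟧ := rescale (-1 : R) (thetaSeries R)

lemma map_thetaSeries {R S : Type*} [CommRing R] [CommRing S] (f : R →+* S) :
    PowerSeries.map f (thetaSeries R) = thetaSeries S := by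
  ext n
  simp only [thetaSeries, coeff_map, coeff_mk]
  split_ifs
  · exact map_one f
  · exact map_ofNat f 2
  · exact map_zero f

lemma map_thetaAlt {R S : Type*} [CommRing R] [CommRing S] (f : R →+* S) :
    PowerSeries.map f (thetaAlt R) = thetaAlt S := by
  ext n
  have := congrArg (coeff n) (map_thetaSeries f)
  rw [coeff_map] at this
  simp [thetaAlt, coeff_rescale, ← this]

lemma convOnDisc_thetaSeries : ConvOnDisc (thetaSeries ℂ) := by
  intro x hx
  refine Summable.of_nonneg_of_le (fun _ => norm_nonneg _) (fun n => ?_)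
    ((summable_geometric_of_lt_one (norm_nonneg x) hx).mul_left 2)
  rw [norm_mul, norm_pow]
  gcongr
  simp only [thetaSeries, coeff_mk]
  split_ifs <;> simp

lemma convOnDisc_thetaAlt : ConvOnDisc (thetaAlt ℂ) :=
  convOnDisc_thetaSeries.rescale (by simp)

lemma seriesEval_thetaAlt (x : ℂ) :
    seriesEval (thetaAlt ℂ) x = seriesEval (thetaSeries ℂ) (-x) := by
  rw [thetaAlt, ConvOnDisc.eval_rescale, neg_one_mul]

lemma summable_pow_sq {x : ℂ} (hx : ‖x‖ < 1) : Summable fun n : ℕ => ‖x ^ n ^ 2‖ := by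
  refine Summable.of_nonneg_of_le (fun _ => norm_nonneg _) (fun n => ?_)
    (summable_geometric_of_lt_one (norm_nonneg x) hx)
  rw [norm_pow]
  exact pow_le_pow_of_le_one (norm_nonneg _) hx.le (Nat.le_self_pow two_ne_zero n)

lemma summable_pow_natAbs_sq {x : ℂ} (hx : ‖x‖ < 1) :
    Summable fun n : ℤ => ‖x ^ n.natAbs ^ 2‖ := by
  refine Summable.of_nat_of_neg ?_ ?_ <;> simpa using summable_pow_sq hx

lemma hasSum_theta {x : ℂ} (hx : ‖x‖ < 1) :
    HasSum (fun n : ℤ => x ^ n.natAbs ^ 2) (seriesEval (thetaSeries ℂ) x) := by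
  set S := ∑' n : ℕ, x ^ n ^ 2
  have hS : HasSum (fun n : ℕ => x ^ n ^ 2) S := (summable_pow_sq hx).of_norm.hasSum
  have h1 : HasSum (fun n : ℕ => x ^ (n + 1) ^ 2) (S - 1) := by
    have := (hasSum_nat_add_iff' 1).mpr hS
    simpa using this
  have h2 : HasSum (fun n : ℤ => x ^ n.natAbs ^ 2) (S + (S - 1)) := by
    refine HasSum.of_nat_of_neg_add_one ?_ ?_
    · simpa using hS
    · refine h1.congr_fun fun n => ?_
      congr 2
  have h3 : HasSum (fun n : ℕ => coeff n (thetaSeries ℂ) * x ^ n) (S + (S - 1)) := by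
    have hinj : Function.Injective fun n : ℕ => n ^ 2 := fun a b h => by
      simpa using h
    refine (hinj.hasSum_iff ?_).mp ?_
    · intro n hn
      have h0 : n ≠ 0 := by rintro rfl; exact hn ⟨0, rfl⟩
      have hs : ¬ IsSquare n := by
        rintro ⟨r, rfl⟩; exact hn ⟨r, by simp [sq]⟩
      simp [thetaSeries, h0, hs]
    · have h4 : HasSum (fun n : ℕ => if n = 0 then (1 : ℂ) else 0) 1 := by
        simpa using hasSum_ite_eq (0 : ℕ) (1 : ℂ)
      rw [← add_sub_assoc]
      refine ((hS.add hS).sub h4).congr_fun fun n => ?_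
      rcases eq_or_ne n 0 with rfl | hn
      · simp [thetaSeries]
      · have hsq : IsSquare (n ^ 2) := IsSquare.sq n
        simp [thetaSeries, hn, two_mul, hsq]
  rw [(convOnDisc_thetaSeries.hasSum hx).unique h3]
  exact h2

lemma natAbs_sq_add_sq (a b : ℤ) :
    (a + b).natAbs ^ 2 + (a - b).natAbs ^ 2 = 2 * a.natAbs ^ 2 + 2 * b.natAbs ^ 2 := by
  zify
  simp only [sq_abs]
  ring

lemma pow_natAbs_sq_mul (x : ℂ) (a b : ℤ) :
    x ^ (a + b).natAbs ^ 2 * x ^ (a - b).natAbs ^ 2 =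
      (x ^ 2) ^ a.natAbs ^ 2 * (x ^ 2) ^ b.natAbs ^ 2 := by
  rw [← pow_add, natAbs_sq_add_sq, pow_add, pow_mul, pow_mul]

lemma neg_one_pow_natAbs_sq_of_odd {m n : ℤ} (h : Odd (m + n)) :
    (-1 : ℂ) ^ m.natAbs ^ 2 = -(-1 : ℂ) ^ n.natAbs ^ 2 := by
  rcases Int.even_or_odd m with hm | hm
  · have hn : Odd n := (Int.odd_add'.mp h).mpr hm
    rw [Even.neg_one_pow, Odd.neg_one_pow, neg_neg]
    · exact (Int.natAbs_odd.mpr hn).pow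
    · exact (Int.natAbs_even.mpr hm).pow_of_ne_zero two_ne_zero
  · have hn : Even n := (Int.odd_add.mp h).mp hm
    rw [Odd.neg_one_pow, Even.neg_one_pow]
    · exact (Int.natAbs_even.mpr hn).pow_of_ne_zero two_ne_zero
    · exact (Int.natAbs_odd.mpr hm).pow

/-- The map `(a, b) ↦ (a + b, a - b)`. -/
def sumDiff (z : ℤ × ℤ) : ℤ × ℤ := (z.1 + z.2, z.1 - z.2)

lemma sumDiff_injective : Function.Injective sumDiff := by
  rintro ⟨a, b⟩ ⟨c, d⟩ h
  simp only [sumDiff, Prod.mk.injEq] at h ⊢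
  omega

lemma odd_of_notMem_range_sumDiff {z : ℤ × ℤ} (h : z ∉ Set.range sumDiff) : Odd (z.1 + z.2) := by
  by_contra hodd
  obtain ⟨k, hk⟩ := Int.not_odd_iff_even.mp hodd
  exact h ⟨(k, z.1 - k), by simp only [sumDiff]; ext <;> simp; omega⟩

lemma hasSum_theta_mul {x y : ℂ} (hx : ‖x‖ < 1) (hy : ‖y‖ < 1) :
    HasSum (fun z : ℤ × ℤ => x ^ z.1.natAbs ^ 2 * y ^ z.2.natAbs ^ 2)
      (seriesEval (thetaSeries ℂ) x * seriesEval (thetaSeries ℂ) y) := by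
  have h := summable_mul_of_summable_norm (f := fun n : ℤ => x ^ n.natAbs ^ 2)
    (g := fun n : ℤ => y ^ n.natAbs ^ 2) (summable_pow_natAbs_sq hx) (summable_pow_natAbs_sq hy)
  have h2 := (hasSum_theta hx).mul (hasSum_theta hy) h
  exact h2

lemma theta_sq_add_theta_neg_sq {x : ℂ} (hx : ‖x‖ < 1) :
    seriesEval (thetaSeries ℂ) x ^ 2 + seriesEval (thetaSeries ℂ) (-x) ^ 2 =
      2 * seriesEval (thetaSeries ℂ) (x ^ 2) ^ 2 := by
  have hx2 : ‖x ^ 2‖ < 1 := by rw [norm_pow]; exact pow_lt_one₀ (norm_nonneg _) hx two_ne_zero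
  have hnx : ‖-x‖ < 1 := by rwa [norm_neg]
  have h1 := (hasSum_theta_mul hx hx).add (hasSum_theta_mul hnx hnx)
  have h2 := (hasSum_theta_mul hx2 hx2).mul_left 2
  rw [← sq] at h2
  rw [← sq, ← sq] at h1
  refine h1.unique ((sumDiff_injective.hasSum_iff ?_).mp (h2.congr_fun ?_))
  · intro z hz
    have := neg_one_pow_natAbs_sq_of_odd (odd_of_notMem_range_sumDiff hz)
    rw [neg_pow x, neg_pow x, this]
    rcases neg_one_pow_eq_or ℂ (z.2.natAbs ^ 2) with h | h <;> rw [h] <;> ring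
  · rintro ⟨a, b⟩
    simp only [sumDiff, Function.comp, pow_natAbs_sq_mul, neg_sq]
    ring

lemma theta_mul_theta_neg {x : ℂ} (hx : ‖x‖ < 1) :
    seriesEval (thetaSeries ℂ) x * seriesEval (thetaSeries ℂ) (-x) =
      seriesEval (thetaSeries ℂ) (-x ^ 2) ^ 2 := by
  have hx2 : ‖-x ^ 2‖ < 1 := by
    rw [norm_neg, norm_pow]; exact pow_lt_one₀ (norm_nonneg _) hx two_ne_zero
  have hnx : ‖-x‖ < 1 := by rwa [norm_neg]
  have h1 := (hasSum_theta_mul hx hnx).add (hasSum_theta_mul hnx hx)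
  have h2 := (hasSum_theta_mul hx2 hx2).mul_left 2
  rw [← sq] at h2
  have h3 := h1.unique ((sumDiff_injective.hasSum_iff ?_).mp (h2.congr_fun ?_))
  · linear_combination h3 / 2
  · intro z hz
    have := neg_one_pow_natAbs_sq_of_odd (odd_of_notMem_range_sumDiff hz)
    rw [neg_pow x, neg_pow x, this]
    ring
  · rintro ⟨a, b⟩
    simp only [sumDiff, Function.comp]
    rw [neg_pow x, neg_pow x, neg_pow (x ^ 2), neg_pow (x ^ 2)]
    have e1 := pow_natAbs_sq_mul x a b
    have e2 := pow_natAbs_sq_mul (-1) a b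
    have e3 : (-1 : ℂ) ^ (a - b).natAbs ^ 2 = (-1) ^ a.natAbs ^ 2 * (-1) ^ b.natAbs ^ 2 := by
      have : (-1 : ℂ) ^ (a - b).natAbs ^ 2 = (-1 : ℂ) ^ (a.natAbs ^ 2 + b.natAbs ^ 2) := by
        rw [neg_one_pow_eq_pow_mod_two, neg_one_pow_eq_pow_mod_two (a.natAbs ^ 2 + b.natAbs ^ 2)]
        congr 1
        zify
        simp only [sq_abs]
        rw [show (a - b) ^ 2 = a ^ 2 + b ^ 2 + 2 * (-a * b) by ring, Int.add_mul_emod_self_left]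
      rw [this, pow_add]
    have e4 : (-1 : ℂ) ^ (a + b).natAbs ^ 2 = (-1 : ℂ) ^ (a - b).natAbs ^ 2 := by
      rw [neg_one_sq, one_pow, one_pow, one_mul] at e2
      rcases neg_one_pow_eq_or ℂ ((a - b).natAbs ^ 2) with h | h <;> rw [h] at e2 ⊢
      · linear_combination e2
      · linear_combination -e2
    rw [e4, e3]
    linear_combination (2 : ℂ) * (-1 : ℂ) ^ a.natAbs ^ 2 * (-1) ^ b.natAbs ^ 2 * e1

lemma theta_sq_add_thetaAlt_sq_complex :
    thetaSeries ℂ ^ 2 + thetaAlt ℂ ^ 2 = expand 2 two_ne_zero (thetaSeries ℂ) ^ 2 + expand 2 two_ne_zero (thetaSeries ℂ) ^ 2 := by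
  have c1 := convOnDisc_thetaSeries
  have c2 := convOnDisc_thetaAlt
  have c3 := c1.expand two_ne_zero
  refine seriesEval_injective ((c1.pow 2).add (c2.pow 2)) ((c3.pow 2).add (c3.pow 2))
    fun x hx _ => ?_
  rw [ConvOnDisc.eval_add hx (c1.pow 2) (c2.pow 2), ConvOnDisc.eval_add hx (c3.pow 2) (c3.pow 2),
    ConvOnDisc.eval_pow hx c1, ConvOnDisc.eval_pow hx c2, ConvOnDisc.eval_pow hx c3,
    ConvOnDisc.eval_expand hx c1, seriesEval_thetaAlt, theta_sq_add_theta_neg_sq hx, two_mul]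

lemma theta_mul_thetaAlt_complex :
    thetaSeries ℂ * thetaAlt ℂ = (expand 2 two_ne_zero (thetaAlt ℂ)) ^ 2 := by
  have c1 := convOnDisc_thetaSeries
  have c2 := convOnDisc_thetaAlt
  have c3 := c2.expand two_ne_zero
  refine seriesEval_injective (c1.mul c2) (c3.pow 2) fun x hx _ => ?_
  rw [ConvOnDisc.eval_mul hx c1 c2, ConvOnDisc.eval_pow hx c3,
    ConvOnDisc.eval_expand hx c2, seriesEval_thetaAlt, seriesEval_thetaAlt, theta_mul_theta_neg hx]

lemma powerSeries_map_int_injective :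
    Function.Injective (PowerSeries.map (Int.castRingHom ℂ)) :=
  PowerSeries.map_injective _ Int.cast_injective

lemma theta_sq_add_thetaAlt_sq (R : Type*) [CommRing R] :
    thetaSeries R ^ 2 + thetaAlt R ^ 2 = expand 2 two_ne_zero (thetaSeries R) ^ 2 + expand 2 two_ne_zero (thetaSeries R) ^ 2 := by
  have h : thetaSeries ℤ ^ 2 + thetaAlt ℤ ^ 2 =
      expand 2 two_ne_zero (thetaSeries ℤ) ^ 2 + expand 2 two_ne_zero (thetaSeries ℤ) ^ 2 := by
    apply powerSeries_map_int_injective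
    simpa [map_thetaSeries, map_thetaAlt] using theta_sq_add_thetaAlt_sq_complex
  simpa [map_thetaSeries, map_thetaAlt] using congrArg (PowerSeries.map (Int.castRingHom R)) h

lemma theta_mul_thetaAlt (R : Type*) [CommRing R] :
    thetaSeries R * thetaAlt R = (expand 2 two_ne_zero (thetaAlt R)) ^ 2 := by
  have h : thetaSeries ℤ * thetaAlt ℤ = (expand 2 two_ne_zero (thetaAlt ℤ)) ^ 2 := by
    apply powerSeries_map_int_injective
    simpa [map_thetaSeries, map_thetaAlt] using theta_mul_thetaAlt_complex
  simpa [map_thetaSeries, map_thetaAlt] using congrArg (PowerSeries.map (Int.castRingHom R)) h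

end ThetaSeries

end

section

open Finset PowerSeries

section ThetaModular

open Complex hiding I
open UpperHalfPlane hiding I
open ModularGroup Matrix MatrixGroups Real

/-- The nome `e^{πiz}`. -/
def nome (z : ℂ) : ℂ := cexp (π * Complex.I * z)

lemma norm_nome_lt_one {z : ℂ} (hz : 0 < z.im) : ‖nome z‖ < 1 := by
  rw [nome, Complex.norm_exp]
  simp
  positivity

lemma nome_ne_zero (z : ℂ) : nome z ≠ 0 := Complex.exp_ne_zero _

lemma nome_add (z w : ℂ) : nome (z + w) = nome z * nome w := by
  rw [nome, nome, nome, mul_add, Complex.exp_add]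

lemma nome_one : nome 1 = -1 := by rw [nome, mul_one, Complex.exp_pi_mul_I]

lemma nome_natCast_mul (n : ℕ) (z : ℂ) : nome (n * z) = nome z ^ n := by
  rw [nome, nome, ← Complex.exp_nat_mul]; congr 1; ring

lemma exists_nome_eq {x : ℂ} (hx : ‖x‖ < 1) (hx0 : x ≠ 0) : ∃ z : ℂ, 0 < z.im ∧ nome z = x := by
  refine ⟨Complex.log x / (π * Complex.I), ?_, ?_⟩
  · have : Complex.log x / (π * Complex.I) = Complex.log x * (-Complex.I) / π := by
      have : (π : ℂ) ≠ 0 := by exact_mod_cast Real.pi_ne_zero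
      field_simp
      simp
    rw [this, Complex.div_ofReal_im]
    simp
    apply div_pos _ Real.pi_pos
    have := Real.log_neg (norm_pos_iff.mpr hx0) hx
    rw [Complex.log_re]
    linarith
  · rw [nome, mul_div_cancel₀, Complex.exp_log hx0]
    exact mul_ne_zero (by exact_mod_cast Real.pi_ne_zero) Complex.I_ne_zero

lemma jacobiTheta_eq_seriesEval {z : ℂ} (hz : 0 < z.im) :
    jacobiTheta z = seriesEval (thetaSeries ℂ) (nome z) := by
  rw [← (hasSum_theta (norm_nome_lt_one hz)).tsum_eq, jacobiTheta]
  refine tsum_congr fun n => ?_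
  rw [nome, ← Complex.exp_nat_mul]
  congr 1
  have : ((n.natAbs ^ 2 : ℕ) : ℂ) = (n : ℂ) ^ 2 := by
    have h : ((n.natAbs ^ 2 : ℕ) : ℤ) = n ^ 2 := by push_cast; exact sq_abs n
    have h' := congrArg (Int.cast (R := ℂ)) h
    rwa [Int.cast_natCast, Int.cast_pow] at h'
  rw [this]; ring

lemma jacobiTheta_add_one_eq_seriesEval {z : ℂ} (hz : 0 < z.im) :
    jacobiTheta (z + 1) = seriesEval (thetaSeries ℂ) (-nome z) := by
  rw [jacobiTheta_eq_seriesEval (by simpa using hz), nome_add, nome_one, mul_neg_one]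

lemma jacobiTheta_add_two (z : ℂ) : jacobiTheta (z + 2) = jacobiTheta z := by
  rw [add_comm, jacobiTheta_two_add]

lemma jacobiTheta_sq_add {z : ℂ} (hz : 0 < z.im) :
    jacobiTheta z ^ 2 + jacobiTheta (z + 1) ^ 2 = 2 * jacobiTheta (2 * z) ^ 2 := by
  have h2 : 0 < (2 * z).im := by simpa using hz
  rw [jacobiTheta_eq_seriesEval hz, jacobiTheta_add_one_eq_seriesEval hz,
    jacobiTheta_eq_seriesEval h2, theta_sq_add_theta_neg_sq (norm_nome_lt_one hz),
    ← nome_natCast_mul]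
  norm_num

lemma jacobiTheta_mul_add_one {z : ℂ} (hz : 0 < z.im) :
    jacobiTheta z * jacobiTheta (z + 1) = jacobiTheta (2 * z + 1) ^ 2 := by
  have h2 : 0 < (2 * z).im := by simpa using hz
  rw [jacobiTheta_eq_seriesEval hz, jacobiTheta_add_one_eq_seriesEval hz,
    jacobiTheta_add_one_eq_seriesEval h2, theta_mul_theta_neg (norm_nome_lt_one hz),
    ← nome_natCast_mul]
  norm_num

lemma jacobiTheta_sq_neg_inv {z : ℂ} (hz : 0 < z.im) :
    jacobiTheta (-1 / z) ^ 2 = -Complex.I * z * jacobiTheta z ^ 2 := by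
  have h := jacobiTheta_S_smul ⟨z, hz⟩
  rw [UpperHalfPlane.modular_S_smul] at h
  have e : (-1 / z) = (-z)⁻¹ := by rw [neg_div, one_div, inv_neg]
  rw [e]
  change jacobiTheta ((-z)⁻¹) = (-Complex.I * z) ^ (1 / 2 : ℂ) * jacobiTheta z at h
  rw [h, mul_pow]
  congr 1
  rw [← Complex.cpow_nat_mul]
  norm_num

/-- `θ₃⁴`, as a function on the upper half plane. -/
def thY (z : ℂ) : ℂ := jacobiTheta z ^ 4

/-- `θ₃⁴ - θ₄⁴ = θ₂⁴`, as a function on the upper half plane. -/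
def thX (z : ℂ) : ℂ := jacobiTheta z ^ 4 - jacobiTheta (z + 1) ^ 4

lemma thX_eq_sq {z : ℂ} (hz : 0 < z.im) :
    thX z = (jacobiTheta (z / 2) ^ 2 - jacobiTheta z ^ 2) ^ 2 := by
  have hz2 : 0 < (z / 2).im := by
    rw [show z / 2 = z / (2 : ℝ) by simp, Complex.div_ofReal_im]; positivity
  have h1 := jacobiTheta_sq_add hz2
  have h2 := jacobiTheta_mul_add_one hz2
  rw [mul_div_cancel₀ z two_ne_zero] at h1 h2
  have h3 : jacobiTheta (z + 1) ^ 4 = jacobiTheta (z / 2) ^ 2 * jacobiTheta (z / 2 + 1) ^ 2 := by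
    linear_combination -(jacobiTheta (z / 2) * jacobiTheta (z / 2 + 1) + jacobiTheta (z + 1) ^ 2) * h2
  rw [thX, h3]
  linear_combination -jacobiTheta (z / 2) ^ 2 * h1

lemma thX_add_one (z : ℂ) : thX (z + 1) = -thX z := by
  rw [thX, thX, show z + 1 + 1 = z + 2 by ring, jacobiTheta_add_two]; ring

lemma thY_add_one (z : ℂ) : thY (z + 1) = thY z - thX z := by rw [thX, thY, thY]; ring

lemma thY_neg_inv {z : ℂ} (hz : 0 < z.im) : thY (-1 / z) = -z ^ 2 * thY z := by
  rw [thY, thY, show jacobiTheta (-1 / z) ^ 4 = (jacobiTheta (-1 / z) ^ 2) ^ 2 by ring,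
    jacobiTheta_sq_neg_inv hz]
  linear_combination (z ^ 2 * jacobiTheta z ^ 4) * Complex.I_sq

lemma neg_inv_im_pos {z : ℂ} (hz : 0 < z.im) : 0 < (-1 / z).im := by
  have h0 : z ≠ 0 := by rintro rfl; simp at hz
  have := UpperHalfPlane.im_pos (ModularGroup.S • (⟨z, hz⟩ : ℍ))
  rw [UpperHalfPlane.modular_S_smul] at this
  change 0 < ((-z)⁻¹).im at this
  rwa [show (-1 / z) = (-z)⁻¹ by rw [neg_div, one_div, inv_neg]]

lemma thX_neg_inv {z : ℂ} (hz : 0 < z.im) : thX (-1 / z) = z ^ 2 * (thX z - thY z) := by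
  have hz2 : 0 < (z / 2).im := by
    rw [show z / 2 = z / (2 : ℝ) by simp, Complex.div_ofReal_im]; positivity
  have h0 : z ≠ 0 := by rintro rfl; simp at hz
  have h1 := jacobiTheta_sq_add (neg_inv_im_pos hz)
  have h2 := jacobiTheta_sq_neg_inv hz2
  rw [show 2 * (-1 / z) = -1 / (z / 2) by field_simp, h2, jacobiTheta_sq_neg_inv hz] at h1
  have h3 : jacobiTheta (-1 / z + 1) ^ 4 = -z ^ 2 * thX z := by
    have : jacobiTheta (-1 / z + 1) ^ 2 = -Complex.I * z * (jacobiTheta (z / 2) ^ 2 - jacobiTheta z ^ 2) := by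
      linear_combination h1
    rw [thX_eq_sq hz, show jacobiTheta (-1 / z + 1) ^ 4 = (jacobiTheta (-1 / z + 1) ^ 2) ^ 2 by ring,
      this]
    linear_combination (z ^ 2 * (jacobiTheta (z / 2) ^ 2 - jacobiTheta z ^ 2) ^ 2) * Complex.I_sq
  have h4 := thY_neg_inv hz
  rw [thY] at h4
  rw [thX, h3, h4]
  ring

/-- The representation of `SL₂(ℤ/2)` on the span of `θ₂⁴, θ₃⁴`, as a function of matrices. -/
def thetaRep (g : Matrix (Fin 2) (Fin 2) (ZMod 2)) : Matrix (Fin 2) (Fin 2) ℤ :=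
  if g 1 0 = 0 then (if g 0 1 = 0 then !![1, 0; 0, 1] else !![-1, 0; -1, 1])
  else if g 0 0 = 0 then (if g 1 1 = 0 then !![1, -1; 0, -1] else !![0, -1; 1, -1])
  else if g 1 1 = 0 then !![-1, 1; -1, 0] else !![0, 1; 1, 0]

lemma thetaRep_mul : ∀ g h : SL(2, ZMod 2),
    thetaRep (g * h : SL(2, ZMod 2)).1 = thetaRep g.1 * thetaRep h.1 := by
  decide

/-- The reduction `SL₂(ℤ) → SL₂(ℤ/2)`. -/
def redModTwo : SL(2, ℤ) →* SL(2, ZMod 2) := Matrix.SpecialLinearGroup.map (Int.castRingHom (ZMod 2))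

/-- The vector `(θ₂⁴, θ₃⁴)`. -/
def thVec (z : ℂ) : Fin 2 → ℂ := ![thX z, thY z]

/-- The complex matrix of `thetaRep`. -/
def thetaRepC (γ : SL(2, ℤ)) : Matrix (Fin 2) (Fin 2) ℂ :=
  (thetaRep (redModTwo γ).1).map (Int.cast : ℤ → ℂ)

lemma thetaRepC_mul (γ γ' : SL(2, ℤ)) : thetaRepC (γ * γ') = thetaRepC γ * thetaRepC γ' := by
  rw [thetaRepC, map_mul, thetaRep_mul]
  exact Matrix.map_mul (f := Int.castRingHom ℂ)

lemma thetaRepC_of_eq_one {γ : SL(2, ℤ)} (h : redModTwo γ = 1) : thetaRepC γ = 1 := by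
  have : thetaRep (1 : SL(2, ZMod 2)).1 = 1 := by decide
  rw [thetaRepC, h, this]
  exact Matrix.map_one _ Int.cast_zero Int.cast_one

/-- The automorphy factor `cz + d`. -/
def autFac (γ : SL(2, ℤ)) (z : ℂ) : ℂ := (γ 1 0 : ℂ) * z + γ 1 1

lemma coe_smul_eq (γ : SL(2, ℤ)) (τ : ℍ) :
    ((γ • τ : ℍ) : ℂ) = ((γ 0 0 : ℂ) * τ + γ 0 1) / autFac γ τ := by
  rw [UpperHalfPlane.coe_specialLinearGroup_apply]
  simp [autFac]

lemma autFac_ne_zero (γ : SL(2, ℤ)) (τ : ℍ) : autFac γ τ ≠ 0 := by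
  have := UpperHalfPlane.denom_ne_zero (γ : GL (Fin 2) ℝ) τ
  rwa [ModularGroup.denom_apply] at this

lemma autFac_one (z : ℂ) : autFac 1 z = 1 := by simp [autFac]

lemma autFac_mul (g h : SL(2, ℤ)) (τ : ℍ) :
    autFac (g * h) τ = autFac g ((h • τ : ℍ) : ℂ) * autFac h τ := by
  have h0 := autFac_ne_zero h τ
  rw [coe_smul_eq]
  rw [autFac, autFac, add_mul, mul_assoc, div_mul_cancel₀ _ h0, autFac]
  have e (j : Fin 2) : (g * h) 1 j = g 1 0 * h 0 j + g 1 1 * h 1 j := by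
    simp [Matrix.mul_apply, Fin.sum_univ_two]
  rw [e, e]
  push_cast
  ring

lemma thVec_smul (γ : SL(2, ℤ)) (τ : ℍ) :
    thVec ((γ • τ : ℍ) : ℂ) = autFac γ τ ^ 2 • (thetaRepC γ).mulVec (thVec τ) := by
  have hmem : γ ∈ Subgroup.closure {ModularGroup.S, ModularGroup.T} := by
    simp [SpecialLinearGroup.SL2Z_generators]
  induction hmem using Subgroup.closure_induction generalizing τ with
  | one => 
    rw [thetaRepC_of_eq_one (map_one _), autFac_one]
    simp
  | mem g hg =>
    rcases hg with rfl | rfl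
    · have hr : thetaRep (redModTwo ModularGroup.S).1 = !![1, -1; 0, -1] := by decide
      have hd : autFac ModularGroup.S τ = τ := by simp [autFac, ModularGroup.S]
      rw [thetaRepC, hr, hd, UpperHalfPlane.modular_S_smul]
      have e : (-(τ : ℂ))⁻¹ = -1 / τ := by rw [neg_div, one_div, inv_neg]
      ext i
      fin_cases i
      · change thX ((-(τ : ℂ))⁻¹) = _
        rw [e, thX_neg_inv τ.im_pos]
        simp only [thVec, Pi.smul_apply, smul_eq_mul, Matrix.mulVec, dotProduct, Fin.sum_univ_two]
        simp
        left; ring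
      · change thY ((-(τ : ℂ))⁻¹) = _
        rw [e, thY_neg_inv τ.im_pos]
        simp [thVec]
    · have hr : thetaRep (redModTwo ModularGroup.T).1 = !![-1, 0; -1, 1] := by decide
      have hd : autFac ModularGroup.T τ = 1 := by simp [autFac, ModularGroup.T]
      have e : ((ModularGroup.T • τ : ℍ) : ℂ) = τ + 1 := by
        rw [UpperHalfPlane.modular_T_smul, UpperHalfPlane.coe_vadd]; push_cast; ring
      rw [thetaRepC, hr, hd, e]
      ext i
      fin_cases i
      · change thX (τ + 1) = _
        rw [thX_add_one]
        simp [thVec]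
      · change thY (τ + 1) = _
        rw [thY_add_one]
        simp [thVec]; ring
  | mul g h _ _ hg hh =>
    have e : ((g * h : SL(2, ℤ)) • τ : ℍ) = g • (h • τ) := mul_smul g h τ
    rw [e, hg, hh, autFac_mul, thetaRepC_mul, Matrix.mulVec_smul, smul_smul, ← mul_pow,
      Matrix.mulVec_mulVec]
  | inv g _ hg =>
    have h1 := hg (g⁻¹ • τ)
    rw [smul_inv_smul] at h1
    have hden : autFac g ((g⁻¹ • τ : ℍ) : ℂ) * autFac g⁻¹ τ = 1 := by
      rw [← autFac_mul, mul_inv_cancel, autFac_one]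
    have hmat : thetaRepC g⁻¹ * thetaRepC g = 1 := by
      rw [← thetaRepC_mul, inv_mul_cancel, thetaRepC_of_eq_one (map_one _)]
    rw [h1, Matrix.mulVec_smul, smul_smul, ← mul_pow, mul_comm, hden, Matrix.mulVec_mulVec, hmat]
    simp

end ThetaModular

end

section

open Finset PowerSeries

section LevelOne

open UpperHalfPlane hiding I
open ModularGroup Matrix MatrixGroups Real Manifold ModularForm SlashAction

lemma seriesEval_eq_zero_imp {G : ℂ⟦X⟧} (hG : ConvOnDisc G)
    (h : ∀ τ : ℍ, seriesEval G (nome τ) = 0) : G = 0 := by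
  refine seriesEval_injective hG (by simpa using ConvOnDisc.C 0) fun x hx hx0 => ?_
  obtain ⟨z, hz, rfl⟩ := exists_nome_eq hx hx0
  rw [h ⟨z, hz⟩]
  simpa using (ConvOnDisc.eval_C hx 0).symm

lemma seriesEval_eq_imp {F G : ℂ⟦X⟧} (hF : ConvOnDisc F) (hG : ConvOnDisc G)
    (h : ∀ τ : ℍ, seriesEval F (nome τ) = seriesEval G (nome τ)) : F = G := by
  refine seriesEval_injective hF hG fun x hx hx0 => ?_
  obtain ⟨z, hz, rfl⟩ := exists_nome_eq hx hx0
  exact h ⟨z, hz⟩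

lemma coe_T_smul (τ : ℍ) : ((ModularGroup.T • τ : ℍ) : ℂ) = τ + 1 := by
  rw [UpperHalfPlane.modular_T_smul, UpperHalfPlane.coe_vadd]; push_cast; ring

lemma nome_T_smul (τ : ℍ) : nome (ModularGroup.T • τ : ℍ) = -nome τ := by
  rw [coe_T_smul, nome_add, nome_one, mul_neg_one]

lemma levelOne_eq_zero {f : ℍ → ℂ} {k : ℕ} {c : ℕ → ℂ}
    (hsum : ∀ τ : ℍ, HasSum (fun m : ℕ => c m • Function.Periodic.qParam 1 τ ^ m) (f τ))
    (hSs : f ∣[(k : ℤ)] ModularGroup.S = f) (hTs : f ∣[(k : ℤ)] ModularGroup.T = f)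
    (hhol : MDiff f) (hord : ∀ n < k / 12 + 1, c n = 0) (τ : ℍ) : f τ = 0 := by
  have hinv := SlashInvariantForm.slash_action_generators_SL2Z hSs hTs
  have hbdd : IsBoundedAtImInfty f := isBoundedAtImInfty_of_hasSum_qExpansion one_pos hsum
  let F : ModularForm 𝒮ℒ (k : ℤ) :=
    { toFun := f
      slash_action_eq' := by
        rintro A ⟨A, rfl⟩
        exact hinv A
      holo' := hhol
      bdd_at_cusps' := by
        intro c hc
        rw [Subgroup.IsArithmetic.isCusp_iff_isCusp_SL2Z] at hc
        rw [OnePoint.isBoundedAt_iff_forall_SL2Z hc]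
        intro γ _
        rw [hinv]
        exact hbdd }
  have hF : F = 0 := by
    refine sturm_bound_levelOne_nat ?_
    refine lt_of_lt_of_le (b := ((k / 12 + 1 : ℕ) : ℕ∞)) (by exact_mod_cast Nat.lt_succ_self _) ?_
    refine PowerSeries.nat_le_order _ _ fun i hi => ?_
    rw [← ModularFormClass.qExpansion_coeff_unique (Γ := 𝒮ℒ) (k := k) (f := F) one_pos (by simp) hsum i]
    exact hord _ hi
  exact congrArg (fun F : ModularForm 𝒮ℒ (k : ℤ) => F τ) hF

lemma mdiff_of_eq_seriesEval {f : ℍ → ℂ} {G : ℂ⟦X⟧} (hG : ConvOnDisc G)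
    (hf : ∀ τ : ℍ, f τ = seriesEval G (nome τ)) : MDiff f := by
  rw [UpperHalfPlane.mdifferentiable_iff]
  have hn : ∀ z : ℂ, DifferentiableAt ℂ nome z := by
    intro z; unfold nome; fun_prop
  have hd : ∀ z : ℂ, 0 < z.im → DifferentiableAt ℂ (fun z => seriesEval G (nome z)) z :=
    fun z hz => DifferentiableAt.comp z (differentiableAt_seriesEval hG (norm_nome_lt_one hz)) (hn z)
  have hd' : DifferentiableOn ℂ (fun z => seriesEval G (nome z)) {z | 0 < z.im} :=
    fun z hz => (hd z hz).differentiableWithinAt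
  refine hd'.congr fun w hw => ?_
  change f (ofComplex w) = _
  rw [hf, ofComplex_apply_of_im_pos hw]

theorem eq_zero_of_levelOne {f : ℍ → ℂ} {k : ℕ} {G : ℂ⟦X⟧} (hG : ConvOnDisc G)
    (hf : ∀ τ : ℍ, f τ = seriesEval G (nome τ))
    (hT : ∀ τ : ℍ, f (ModularGroup.T • τ) = f τ)
    (hS : ∀ τ : ℍ, f (ModularGroup.S • τ) = (τ : ℂ) ^ k * f τ)
    (hord : ∀ n < 2 * (k / 12 + 1), coeff n G = 0) (τ : ℍ) : f τ = 0 := by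
  have hneg : rescale (-1 : ℂ) G = G := by
    refine seriesEval_eq_imp (hG.rescale (by simp)) hG fun τ => ?_
    rw [ConvOnDisc.eval_rescale, neg_one_mul, ← nome_T_smul, ← hf, ← hf, hT]
  have hodd : ∀ n, coeff (2 * n + 1) G = 0 := by
    intro n
    have := congrArg (coeff (2 * n + 1)) hneg
    rw [coeff_rescale, Odd.neg_one_pow ⟨n, rfl⟩] at this
    linear_combination (-1 / 2 : ℂ) * this
  have hsum : ∀ τ : ℍ, HasSum (fun m : ℕ => coeff (2 * m) G • Function.Periodic.qParam 1 τ ^ m) (f τ) := by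
    intro τ
    have h1 := hG.hasSum (norm_nome_lt_one τ.im_pos)
    rw [← hf] at h1
    have hinj : Function.Injective fun n : ℕ => 2 * n :=
      fun _ _ h => Nat.eq_of_mul_eq_mul_left two_pos h
    have h2 : HasSum ((fun n => coeff n G * nome τ ^ n) ∘ fun n : ℕ => 2 * n) (f τ) := by
      refine (hinj.hasSum_iff ?_).mpr h1
      intro n hn
      obtain ⟨m, rfl⟩ : Odd n := by
        by_contra h
        obtain ⟨m, rfl⟩ := Nat.not_odd_iff_even.mp h
        exact hn ⟨m, two_mul m⟩
      rw [hodd, zero_mul]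
    have h3 : Function.Periodic.qParam 1 τ = nome τ ^ 2 := by
      rw [Function.Periodic.qParam, nome, ← Complex.exp_nat_mul]
      congr 1
      push_cast
      ring
    have h4 : (fun m : ℕ => coeff (2 * m) G • Function.Periodic.qParam 1 τ ^ m) =
        (fun n => coeff n G * nome τ ^ n) ∘ fun n : ℕ => 2 * n := by
      funext m
      simp only [Function.comp, smul_eq_mul, pow_mul, h3]
    rw [h4]
    exact h2
  have hTs : f ∣[(k : ℤ)] ModularGroup.T = f := by
    ext τ
    rw [SL_slash_apply, ModularGroup.denom_apply, hT]
    simp [ModularGroup.T]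
  have hSs : f ∣[(k : ℤ)] ModularGroup.S = f := by
    ext τ
    rw [SL_slash_apply, ModularGroup.denom_apply, hS]
    have := τ.ne_zero
    simp [ModularGroup.S]
    field_simp
  refine levelOne_eq_zero (c := fun m => coeff (2 * m) G) hsum hSs hTs (mdiff_of_eq_seriesEval hG hf)
    (fun n hn => hord (2 * n) (by omega)) τ

end LevelOne

end

section

open Finset PowerSeries

section Isobaric

open UpperHalfPlane hiding I
open ModularGroup Matrix MatrixGroups Real

/-- The `q`-series of `θ₂⁴`. -/
def XSer (R : Type*) [CommRing R] : R⟦X⟧ := thetaSeries R ^ 4 - thetaAlt R ^ 4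

/-- The `q`-series of `θ₃⁴`. -/
def YSer (R : Type*) [CommRing R] : R⟦X⟧ := thetaSeries R ^ 4

lemma map_XSer {R S : Type*} [CommRing R] [CommRing S] (f : R →+* S) :
    PowerSeries.map f (XSer R) = XSer S := by
  simp [XSer, map_thetaSeries, map_thetaAlt]

lemma map_YSer {R S : Type*} [CommRing R] [CommRing S] (f : R →+* S) :
    PowerSeries.map f (YSer R) = YSer S := by
  simp [YSer, map_thetaSeries]

lemma convOnDisc_XSer : ConvOnDisc (XSer ℂ) :=
  (convOnDisc_thetaSeries.pow 4).sub (convOnDisc_thetaAlt.pow 4)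

lemma convOnDisc_YSer : ConvOnDisc (YSer ℂ) := convOnDisc_thetaSeries.pow 4

lemma seriesEval_YSer {z : ℂ} (hz : 0 < z.im) : seriesEval (YSer ℂ) (nome z) = thY z := by
  rw [YSer, ConvOnDisc.eval_pow (norm_nome_lt_one hz) convOnDisc_thetaSeries, thY,
    jacobiTheta_eq_seriesEval hz]

lemma seriesEval_XSer {z : ℂ} (hz : 0 < z.im) : seriesEval (XSer ℂ) (nome z) = thX z := by
  have hx := norm_nome_lt_one hz
  rw [XSer, ConvOnDisc.eval_sub hx (convOnDisc_thetaSeries.pow 4) (convOnDisc_thetaAlt.pow 4),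
    ConvOnDisc.eval_pow hx convOnDisc_thetaSeries, ConvOnDisc.eval_pow hx convOnDisc_thetaAlt, thX,
    jacobiTheta_eq_seriesEval hz, jacobiTheta_add_one_eq_seriesEval hz, seriesEval_thetaAlt]

lemma constantCoeff_thetaSeries (R : Type*) [CommRing R] :
    constantCoeff (thetaSeries R) = 1 := by
  rw [← coeff_zero_eq_constantCoeff_apply]; simp [thetaSeries]

lemma constantCoeff_thetaAlt (R : Type*) [CommRing R] :
    constantCoeff (thetaAlt R) = 1 := by
  rw [← coeff_zero_eq_constantCoeff_apply]; simp [thetaAlt, thetaSeries, coeff_rescale]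

lemma constantCoeff_YSer (R : Type*) [CommRing R] : constantCoeff (YSer R) = 1 := by
  simp [YSer, constantCoeff_thetaSeries]

lemma exists_XSer_eq (R : Type*) [CommRing R] :
    ∃ W : R⟦X⟧, XSer R = X * W ∧ constantCoeff W = 16 := by
  have hW : ∃ A : R⟦X⟧, thetaSeries R = 1 + X * A ∧ constantCoeff A = 2 := by
    refine ⟨PowerSeries.mk fun n => coeff (n + 1) (thetaSeries R), ?_, ?_⟩
    · ext n
      rcases n with _ | n
      · simp [constantCoeff_thetaSeries]
      · simp [coeff_succ_X_mul, coeff_one]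
    · rw [← coeff_zero_eq_constantCoeff_apply]; simp [thetaSeries]
  have hW' : ∃ A : R⟦X⟧, thetaAlt R = 1 + X * A ∧ constantCoeff A = -2 := by
    refine ⟨PowerSeries.mk fun n => coeff (n + 1) (thetaAlt R), ?_, ?_⟩
    · ext n
      rcases n with _ | n
      · simp [constantCoeff_thetaAlt]
      · simp [coeff_succ_X_mul, coeff_one]
    · rw [← coeff_zero_eq_constantCoeff_apply]; simp [thetaAlt, thetaSeries, coeff_rescale]
  obtain ⟨A, hA, hA0⟩ := hW
  obtain ⟨B, hB, hB0⟩ := hW'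
  refine ⟨(A - B) * ((1 + X * A) ^ 3 + (1 + X * A) ^ 2 * (1 + X * B) +
    (1 + X * A) * (1 + X * B) ^ 2 + (1 + X * B) ^ 3), ?_, ?_⟩
  · rw [XSer, hA, hB]; ring
  · simp [hA0, hB0]; norm_num

/-- The isobaric polynomial `∑ a_k u^k v^{K-k}`. -/
def isobaric {R : Type*} [CommSemiring R] (K : ℕ) (a : ℕ → R) (u v : R) : R :=
  ∑ k ∈ range (K + 1), a k * u ^ k * v ^ (K - k)

lemma isobaric_smul {R : Type*} [CommSemiring R] (K : ℕ) (a : ℕ → R) (t u v : R) :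
    isobaric K a (t * u) (t * v) = t ^ K * isobaric K a u v := by
  rw [isobaric, isobaric, mul_sum]
  refine sum_congr rfl fun k hk => ?_
  have : K = k + (K - k) := by have := mem_range.mp hk; omega
  rw [mul_pow, mul_pow]
  nth_rewrite 3 [this]
  rw [pow_add]
  ring

lemma map_isobaric {R S : Type*} [CommSemiring R] [CommSemiring S] (f : R →+* S) (K : ℕ) (a : ℕ → R)
    (u v : R) : f (isobaric K a u v) = isobaric K (fun k => f (a k)) (f u) (f v) := by
  simp [isobaric, map_sum]

lemma exists_isobaric_coeff {R : Type*} [CommRing R] (h16 : IsUnit (16 : R)) (G : R⟦X⟧) (K : ℕ) :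
    ∃ a : ℕ → R, ∀ n ≤ K, coeff n (G - isobaric K (fun k => C (a k)) (XSer R) (YSer R)) = 0 := by
  obtain ⟨W, hW, hW0⟩ := exists_XSer_eq R
  obtain ⟨u, hu⟩ := h16
  have key : ∀ N ≤ K + 1, ∃ a : ℕ → R, ∀ n < N,
      coeff n (G - ∑ k ∈ range N, C (a k) * XSer R ^ k * YSer R ^ (K - k)) = 0 := by
    intro N
    induction N with
    | zero => intro _; exact ⟨0, fun n hn => absurd hn (Nat.not_lt_zero n)⟩
    | succ N ih =>
      intro hN
      obtain ⟨a, ha⟩ := ih (by omega)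
      set D := G - ∑ k ∈ range N, C (a k) * XSer R ^ k * YSer R ^ (K - k) with hD
      set t := coeff N D * (↑(u⁻¹ ^ N) : R) with ht
      refine ⟨Function.update a N t, fun n hn => ?_⟩
      have hsum : ∑ k ∈ range (N + 1), C (Function.update a N t k) * XSer R ^ k * YSer R ^ (K - k) =
          ∑ k ∈ range N, C (a k) * XSer R ^ k * YSer R ^ (K - k) +
            C t * XSer R ^ N * YSer R ^ (K - N) := by
        rw [sum_range_succ, Function.update_self]
        congr 1
        refine sum_congr rfl fun k hk => ?_
        rw [Function.update_of_ne (mem_range.mp hk).ne]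
      rw [hsum, ← sub_sub, ← hD, map_sub]
      have hx : C t * XSer R ^ N * YSer R ^ (K - N) = X ^ N * (C t * W ^ N * YSer R ^ (K - N)) := by
        rw [hW]; ring
      rw [hx]
      rcases Nat.lt_succ_iff_lt_or_eq.mp hn with h | rfl
      · rw [ha n h, coeff_X_pow_mul', if_neg (by omega), sub_zero]
      · rw [coeff_X_pow_mul', if_pos le_rfl, Nat.sub_self, coeff_zero_eq_constantCoeff_apply]
        simp only [map_mul, map_pow, hW0, constantCoeff_YSer, one_pow, mul_one, constantCoeff_C]
        rw [ht, ← hu, mul_assoc, ← Units.val_pow_eq_pow_val, ← Units.val_mul]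
        simp
  obtain ⟨a, ha⟩ := key (K + 1) le_rfl
  exact ⟨a, fun n hn => ha n (by omega)⟩

lemma isobaric_XSer_YSer_injective {k : Type*} [Field k] (h16 : (16 : k) ≠ 0) {K : ℕ} {a b : ℕ → k}
    (h : isobaric K (fun i => C (a i)) (XSer k) (YSer k) =
      isobaric K (fun i => C (b i)) (XSer k) (YSer k)) : ∀ i ≤ K, a i = b i := by
  obtain ⟨W, hW, hW0⟩ := exists_XSer_eq k
  have hsum : ∑ i ∈ range (K + 1), C (a i - b i) * XSer k ^ i * YSer k ^ (K - i) = 0 := by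
    rw [← sub_eq_zero, isobaric, isobaric, ← sum_sub_distrib] at h
    rw [← h]
    refine sum_congr rfl fun i _ => ?_
    rw [map_sub]; ring
  intro i
  induction i using Nat.strong_induction_on with
  | _ i ih =>
    intro hi
    have h1 := congrArg (coeff i) hsum
    rw [map_sum, map_zero, sum_eq_single i] at h1
    · rw [hW, mul_pow, show C (a i - b i) * (X ^ i * W ^ i) * YSer k ^ (K - i) =
        X ^ i * (C (a i - b i) * W ^ i * YSer k ^ (K - i)) by ring, coeff_X_pow_mul',
        if_pos le_rfl, Nat.sub_self, coeff_zero_eq_constantCoeff_apply] at h1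
      simp only [map_mul, map_pow, hW0, constantCoeff_YSer, one_pow, mul_one, constantCoeff_C] at h1
      rcases mul_eq_zero.mp h1 with h2 | h2
      · exact sub_eq_zero.mp h2
      · exact absurd h2 (pow_ne_zero _ h16)
    · intro j _ hj
      rcases lt_or_gt_of_ne hj with h | h
      · rw [ih j h (by omega), sub_self, map_zero, zero_mul, zero_mul, map_zero]
      · rw [hW, mul_pow, show C (a j - b j) * (X ^ j * W ^ j) * YSer k ^ (K - j) =
          X ^ j * (C (a j - b j) * W ^ j * YSer k ^ (K - j)) by ring, coeff_X_pow_mul',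
          if_neg (by omega)]
    · intro h; exact absurd (mem_range.mpr (by omega)) h

lemma card_SL_two : Fintype.card SL(2, ZMod 2) = 6 := by decide

end Isobaric

end

section

open Finset PowerSeries

section Isobaric

open UpperHalfPlane hiding I
open ModularGroup Matrix MatrixGroups Real

/-- The two linear forms `ρ(g)(u, v)`. -/
def repAct {R : Type*} [CommRing R] (g : SL(2, ZMod 2)) (i : Fin 2) (u v : R) : R :=
  (thetaRep g.1 i 0 : R) * u + (thetaRep g.1 i 1 : R) * v

lemma repAct_mul {R : Type*} [CommRing R] (g h : SL(2, ZMod 2)) (i : Fin 2) (u v : R) :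
    repAct (g * h) i u v = repAct g i (repAct h 0 u v) (repAct h 1 u v) := by
  simp only [repAct]
  rw [thetaRep_mul, Matrix.mul_apply, Matrix.mul_apply, Fin.sum_univ_two, Fin.sum_univ_two]
  push_cast
  ring

lemma repAct_smul {R : Type*} [CommRing R] (g : SL(2, ZMod 2)) (i : Fin 2) (t u v : R) :
    repAct g i (t * u) (t * v) = t * repAct g i u v := by
  simp only [repAct]; ring

lemma thVec_smul_apply (γ : SL(2, ℤ)) (τ : ℍ) (i : Fin 2) :
    thVec ((γ • τ : ℍ) : ℂ) i = autFac γ τ ^ 2 * repAct (redModTwo γ) i (thX τ) (thY τ) := by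
  rw [thVec_smul, Pi.smul_apply, smul_eq_mul]
  simp [thetaRepC, Matrix.mulVec, dotProduct, Fin.sum_univ_two, repAct, thVec]

lemma thX_smul (γ : SL(2, ℤ)) (τ : ℍ) :
    thX ((γ • τ : ℍ) : ℂ) = autFac γ τ ^ 2 * repAct (redModTwo γ) 0 (thX τ) (thY τ) :=
  thVec_smul_apply γ τ 0

lemma thY_smul (γ : SL(2, ℤ)) (τ : ℍ) :
    thY ((γ • τ : ℍ) : ℂ) = autFac γ τ ^ 2 * repAct (redModTwo γ) 1 (thX τ) (thY τ) :=
  thVec_smul_apply γ τ 1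

lemma repAct_one {R : Type*} [CommRing R] (u v : R) :
    repAct 1 0 u v = u ∧ repAct 1 1 u v = v := by
  have h : thetaRep (1 : SL(2, ZMod 2)).1 = !![1, 0; 0, 1] := by decide
  simp only [repAct, h]
  simp

lemma intCast_eq_C (n : ℤ) : ((n : ℤ) : ℂ⟦X⟧) = C (n : ℂ) := (map_intCast (C : ℂ →+* ℂ⟦X⟧) n).symm

lemma convOnDisc_repAct (g : SL(2, ZMod 2)) (i : Fin 2) :
    ConvOnDisc (repAct g i (XSer ℂ) (YSer ℂ)) := by
  rw [repAct, intCast_eq_C, intCast_eq_C]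
  exact ((ConvOnDisc.C _).mul convOnDisc_XSer).add ((ConvOnDisc.C _).mul convOnDisc_YSer)

lemma seriesEval_repAct (g : SL(2, ZMod 2)) (i : Fin 2) (τ : ℍ) :
    seriesEval (repAct g i (XSer ℂ) (YSer ℂ)) (nome τ) = repAct g i (thX τ) (thY τ) := by
  have hx := norm_nome_lt_one τ.im_pos
  rw [repAct, intCast_eq_C, intCast_eq_C,
    ConvOnDisc.eval_add hx ((ConvOnDisc.C _).mul convOnDisc_XSer)
      ((ConvOnDisc.C _).mul convOnDisc_YSer), ConvOnDisc.eval_mul hx (ConvOnDisc.C _) convOnDisc_XSer,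
    ConvOnDisc.eval_mul hx (ConvOnDisc.C _) convOnDisc_YSer, ConvOnDisc.eval_C hx,
    ConvOnDisc.eval_C hx, seriesEval_XSer τ.im_pos, seriesEval_YSer τ.im_pos, repAct]

lemma convOnDisc_isobaric {K : ℕ} {a : ℕ → ℂ} {F G : ℂ⟦X⟧} (hF : ConvOnDisc F)
    (hG : ConvOnDisc G) : ConvOnDisc (isobaric K (fun k => C (a k)) F G) :=
  ConvOnDisc.sum _ fun _ _ => ((ConvOnDisc.C _).mul (hF.pow _)).mul (hG.pow _)

lemma seriesEval_isobaric {K : ℕ} {a : ℕ → ℂ} {F G : ℂ⟦X⟧} (hF : ConvOnDisc F)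
    (hG : ConvOnDisc G) {x : ℂ} (hx : ‖x‖ < 1) :
    seriesEval (isobaric K (fun k => C (a k)) F G) x =
      isobaric K a (seriesEval F x) (seriesEval G x) := by
  rw [isobaric, ConvOnDisc.eval_sum hx _
    fun _ _ => ((ConvOnDisc.C _).mul (hF.pow _)).mul (hG.pow _), isobaric]
  refine sum_congr rfl fun k _ => ?_
  rw [ConvOnDisc.eval_mul hx ((ConvOnDisc.C _).mul (hF.pow _)) (hG.pow _),
    ConvOnDisc.eval_mul hx (ConvOnDisc.C _) (hF.pow _), ConvOnDisc.eval_C hx,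
    ConvOnDisc.eval_pow hx hF, ConvOnDisc.eval_pow hx hG]

theorem eq_isobaric_of_levelOne {f : ℍ → ℂ} {K : ℕ} {G : ℂ⟦X⟧} (hG : ConvOnDisc G)
    (hf : ∀ τ : ℍ, f τ = seriesEval G (nome τ))
    (hT : ∀ τ : ℍ, f (ModularGroup.T • τ) = f τ)
    (hS : ∀ τ : ℍ, f (ModularGroup.S • τ) = (τ : ℂ) ^ (2 * K) * f τ) (a : ℕ → ℂ)
    (hord : ∀ n ≤ K, coeff n (G - isobaric K (fun k => C (a k)) (XSer ℂ) (YSer ℂ)) = 0)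
    (τ : ℍ) : f τ = isobaric K a (thX τ) (thY τ) := by
  set φ : SL(2, ZMod 2) → ℍ → ℂ := fun g τ => f τ -
    isobaric K a (repAct g 0 (thX τ) (thY τ)) (repAct g 1 (thX τ) (thY τ)) with hφ
  set Φ : SL(2, ZMod 2) → ℂ⟦X⟧ := fun g => G - isobaric K (fun k => C (a k))
    (repAct g 0 (XSer ℂ) (YSer ℂ)) (repAct g 1 (XSer ℂ) (YSer ℂ)) with hΦ
  have hconv : ∀ g, ConvOnDisc (Φ g) := fun g =>
    hG.sub (convOnDisc_isobaric (convOnDisc_repAct g 0) (convOnDisc_repAct g 1))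
  have heval : ∀ g (τ : ℍ), φ g τ = seriesEval (Φ g) (nome τ) := by
    intro g τ
    have hx := norm_nome_lt_one τ.im_pos
    rw [hΦ, hφ]
    simp only
    rw [ConvOnDisc.eval_sub hx hG (convOnDisc_isobaric (convOnDisc_repAct g 0)
      (convOnDisc_repAct g 1)), seriesEval_isobaric (convOnDisc_repAct g 0)
      (convOnDisc_repAct g 1) hx, seriesEval_repAct, seriesEval_repAct, hf]
  have haction : ∀ (γ : SL(2, ℤ)) (τ : ℍ), f (γ • τ) = autFac γ τ ^ (2 * K) * f τ → ∀ g,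
      φ g (γ • τ) = autFac γ τ ^ (2 * K) * φ (g * redModTwo γ) τ := by
    intro γ τ h g
    simp only [hφ]
    rw [h, thX_smul, thY_smul, repAct_smul, repAct_smul, isobaric_smul, ← repAct_mul,
      ← repAct_mul, pow_mul]
    ring
  have hφT : ∀ g (τ : ℍ), φ g (ModularGroup.T • τ) = φ (g * redModTwo T) τ := by
    intro g τ
    have h1 : autFac ModularGroup.T τ = 1 := by simp [autFac, ModularGroup.T]
    rw [haction T τ (by rw [h1, one_pow, one_mul, hT]), h1, one_pow, one_mul]
  have hφS : ∀ g (τ : ℍ), φ g (ModularGroup.S • τ) = (τ : ℂ) ^ (2 * K) * φ (g * redModTwo S) τ := by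
    intro g τ
    have h1 : autFac ModularGroup.S τ = τ := by simp [autFac, ModularGroup.S]
    rw [haction S τ (by rw [h1, hS]), h1]
  have hΦ1 : Φ 1 = G - isobaric K (fun k => C (a k)) (XSer ℂ) (YSer ℂ) := by
    simp only [hΦ, repAct_one]
  have hΦT : Φ (redModTwo T) = rescale (-1 : ℂ) (Φ 1) := by
    refine seriesEval_eq_imp (hconv _) ((hconv 1).rescale (by simp)) fun τ => ?_
    rw [ConvOnDisc.eval_rescale, neg_one_mul, ← nome_T_smul, ← heval, ← heval, hφT, one_mul]
  have hdvd1 : X ^ (K + 1) ∣ Φ 1 := by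
    rw [X_pow_dvd_iff]
    intro m hm
    rw [hΦ1]; exact hord m (by omega)
  have hdvdT : X ^ (K + 1) ∣ Φ (redModTwo T) := by
    rw [X_pow_dvd_iff] at hdvd1 ⊢
    intro m hm
    rw [hΦT, coeff_rescale, hdvd1 m hm, mul_zero]
  have hne : redModTwo T ≠ 1 := by decide
  have hdvd : X ^ (2 * (K + 1)) ∣ ∏ g, Φ g := by
    rw [← mul_prod_erase univ Φ (mem_univ 1),
      ← mul_prod_erase (univ.erase 1) Φ (mem_erase.mpr ⟨hne, mem_univ _⟩), ← mul_assoc, two_mul,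
      pow_add]
    exact Dvd.dvd.mul_right (mul_dvd_mul hdvd1 hdvdT) _
  have hprod : ∀ τ : ℍ, ∏ g, φ g τ = 0 := by
    refine eq_zero_of_levelOne (k := 12 * K) (ConvOnDisc.prod univ fun g _ => hconv g) ?_ ?_ ?_ ?_
    · intro τ
      rw [ConvOnDisc.eval_prod (norm_nome_lt_one τ.im_pos) _ fun g _ => hconv g]
      exact prod_congr rfl fun g _ => heval g τ
    · intro τ
      rw [← Equiv.prod_comp (Equiv.mulRight (redModTwo T)) fun g => φ g τ]
      exact prod_congr rfl fun g _ => hφT g τ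
    · intro τ
      rw [← Equiv.prod_comp (Equiv.mulRight (redModTwo S)) fun g => φ g τ, prod_congr rfl
        fun g _ => hφS g τ, prod_mul_distrib, prod_const, card_univ, card_SL_two, ← pow_mul]
      congr 2
      ring
    · intro n hn
      rw [Nat.mul_div_cancel_left _ (by norm_num)] at hn
      exact (X_pow_dvd_iff.mp hdvd) n hn
  have hzero : ∏ g, Φ g = 0 := by
    refine seriesEval_eq_zero_imp (ConvOnDisc.prod univ fun g _ => hconv g) fun τ => ?_
    rw [ConvOnDisc.eval_prod (norm_nome_lt_one τ.im_pos) _ fun g _ => hconv g, ← hprod τ]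
    exact prod_congr rfl fun g _ => (heval g τ).symm
  obtain ⟨g, -, hg⟩ := prod_eq_zero_iff.mp hzero
  have hg0 : ∀ τ, φ g τ = 0 := by
    intro τ
    rw [heval, hg, ← sub_self G, ConvOnDisc.eval_sub (norm_nome_lt_one τ.im_pos) hG hG, sub_self]
  have stepT : ∀ g, (∀ τ, φ g τ = 0) → ∀ τ, φ (g * redModTwo T) τ = 0 := by
    intro g h τ
    rw [← hφT, h]
  have stepS : ∀ g, (∀ τ, φ g τ = 0) → ∀ τ, φ (g * redModTwo S) τ = 0 := by
    intro g h τ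
    have := h (ModularGroup.S • τ)
    rw [hφS] at this
    exact (mul_eq_zero.mp this).resolve_left (pow_ne_zero _ τ.ne_zero)
  have key : ∀ g : SL(2, ZMod 2), g = 1 ∨ g * redModTwo S = 1 ∨ g * redModTwo T = 1 ∨
      g * redModTwo S * redModTwo T = 1 ∨ g * redModTwo T * redModTwo S = 1 ∨
      g * redModTwo S * redModTwo T * redModTwo S = 1 := by decide
  have h1 : ∀ τ, φ 1 τ = 0 := by
    rcases key g with h | h | h | h | h | h <;> rw [← h]
    · exact hg0
    · exact stepS _ hg0
    · exact stepT _ hg0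
    · exact stepT _ (stepS _ hg0)
    · exact stepS _ (stepT _ hg0)
    · exact stepS _ (stepT _ (stepS _ hg0))
  have := h1 τ
  simp only [hφ, repAct_one] at this
  exact sub_eq_zero.mp this

end Isobaric

end

section

open Finset PowerSeries

section Hecke

set_option linter.unusedSectionVars false

open UpperHalfPlane hiding I
open ModularGroup Matrix MatrixGroups Real

lemma thX_add_two (z : ℂ) : thX (z + 2) = thX z := by
  rw [show z + 2 = z + 1 + 1 by ring, thX_add_one, thX_add_one, neg_neg]

lemma thY_add_two (z : ℂ) : thY (z + 2) = thY z := by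
  rw [thY, thY, jacobiTheta_add_two]

lemma thX_add_two_mul_int (z : ℂ) (n : ℤ) : thX (z + 2 * n) = thX z := by
  induction n using Int.induction_on with
  | zero => simp
  | succ n ih => rw [← ih, ← thX_add_two (z + 2 * ((n : ℤ) : ℂ))]; push_cast; ring_nf
  | pred n ih => rw [← ih, ← thX_add_two (z + 2 * ((-n - 1 : ℤ) : ℂ))]; push_cast; ring_nf

lemma thY_add_two_mul_int (z : ℂ) (n : ℤ) : thY (z + 2 * n) = thY z := by
  induction n using Int.induction_on with
  | zero => simp
  | succ n ih => rw [← ih, ← thY_add_two (z + 2 * ((n : ℤ) : ℂ))]; push_cast; ring_nf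
  | pred n ih => rw [← ih, ← thY_add_two (z + 2 * ((-n - 1 : ℤ) : ℂ))]; push_cast; ring_nf

variable (p : ℕ) [hp : Fact p.Prime]

/-- The point `(z + 2n)/p`. -/
def heckePt (z : ℂ) (n : ℤ) : ℂ := (z + 2 * n) / p

lemma heckePt_im {z : ℂ} (n : ℤ) : (heckePt p z n).im = z.im / p := by
  rw [heckePt, show (p : ℂ) = ((p : ℝ) : ℂ) by simp, Complex.div_ofReal_im]
  simp

lemma heckePt_im_pos {z : ℂ} (hz : 0 < z.im) (n : ℤ) : 0 < (heckePt p z n).im := by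
  rw [heckePt_im]
  exact div_pos hz (by exact_mod_cast hp.out.pos)

lemma thX_heckePt_congr (z : ℂ) {m n : ℤ} (h : (m : ZMod p) = n) :
    thX (heckePt p z m) = thX (heckePt p z n) := by
  have hp0 : (p : ℂ) ≠ 0 := by exact_mod_cast hp.out.ne_zero
  obtain ⟨k, hk⟩ := (ZMod.intCast_eq_intCast_iff_dvd_sub m n p).mp h
  rw [← thX_add_two_mul_int (heckePt p z m) k]
  congr 1
  have : (n : ℂ) = m + p * k := by
    have : n = m + p * k := by linarith
    exact_mod_cast this
  rw [heckePt, heckePt, this]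
  field_simp
  ring

lemma thY_heckePt_congr (z : ℂ) {m n : ℤ} (h : (m : ZMod p) = n) :
    thY (heckePt p z m) = thY (heckePt p z n) := by
  have hp0 : (p : ℂ) ≠ 0 := by exact_mod_cast hp.out.ne_zero
  obtain ⟨k, hk⟩ := (ZMod.intCast_eq_intCast_iff_dvd_sub m n p).mp h
  rw [← thY_add_two_mul_int (heckePt p z m) k]
  congr 1
  have : (n : ℂ) = m + p * k := by
    have : n = m + p * k := by linarith
    exact_mod_cast this
  rw [heckePt, heckePt, this]
  field_simp
  ring

/-- The action of `S` on pairs. -/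
lemma repAct_S {R : Type*} [CommRing R] (u v : R) :
    repAct (redModTwo S) 0 u v = u - v ∧ repAct (redModTwo S) 1 u v = -v := by
  have h : thetaRep (redModTwo S).1 = !![1, -1; 0, -1] := by decide
  simp only [repAct, h]
  constructor
  · simp; ring
  · simp

/-- A function of two vectors that is homogeneous of degree two and semi-invariant under the
representation `thetaRep`. -/
structure PairInvariant (E : ℂ → ℂ → ℂ → ℂ → ℂ) : Prop where
  smul : ∀ t u v u₁ v₁, E (t * u) (t * v) (t * u₁) (t * v₁) = t ^ 2 * E u v u₁ v₁
  T_or : (∀ u v u₁ v₁, E (-u) (v - u) (-u₁) (v₁ - u₁) = E u v u₁ v₁) ∨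
    (∀ u v u₁ v₁, E (-u) (v - u) (-u₁) (v₁ - u₁) = -E u v u₁ v₁)
  S_or : (∀ u v u₁ v₁, E (u - v) (-v) (u₁ - v₁) (-v₁) = E u v u₁ v₁) ∨
    (∀ u v u₁ v₁, E (u - v) (-v) (u₁ - v₁) (-v₁) = -E u v u₁ v₁)

/-- The product of the values of `E` over the `p + 1` isogenies of degree `p`. -/
def heckeProd (E : ℂ → ℂ → ℂ → ℂ → ℂ) (z : ℂ) : ℂ :=
  ((p : ℂ) ^ 2)⁻¹ * E (thX z) (thY z) ((p : ℂ) ^ 2 * thX (p * z)) ((p : ℂ) ^ 2 * thY (p * z)) *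
    ∏ j : ZMod p, E (thX z) (thY z) (thX (heckePt p z j.val)) (thY (heckePt p z j.val))

lemma prod_const_mul_zmod (c : ℂ) (f : ZMod p → ℂ) : ∏ j, c * f j = c ^ p * ∏ j, f j := by
  rw [prod_mul_distrib, prod_const, card_univ, ZMod.card]

lemma sign_pow_succ {ε : ℂ} (hε : ε = 1 ∨ ε = -1) (hp2 : p ≠ 2) : ε * ε ^ p = 1 := by
  have hodd : Odd p := hp.out.odd_of_ne_two hp2
  rcases hε with rfl | rfl
  · simp
  · rw [hodd.neg_one_pow]; ring

theorem heckeProd_add_one {E : ℂ → ℂ → ℂ → ℂ → ℂ} (hE : PairInvariant E) (hp2 : p ≠ 2) (z : ℂ) :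
    heckeProd p E (z + 1) = heckeProd p E z := by
  have hodd : Odd p := hp.out.odd_of_ne_two hp2
  have hp0 : (p : ℂ) ≠ 0 := by exact_mod_cast hp.out.ne_zero
  obtain ⟨m, hm⟩ := hodd
  obtain ⟨ε, hε, hT⟩ : ∃ ε : ℂ, (ε = 1 ∨ ε = -1) ∧
      ∀ u v u' v', E (-u) (v - u) (-u') (v' - u') = ε * E u v u' v' := by
    rcases hE.T_or with h | h
    · exact ⟨1, Or.inl rfl, fun u v u' v' => by rw [h, one_mul]⟩
    · exact ⟨-1, Or.inr rfl, fun u v u' v' => by rw [h, neg_one_mul]⟩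
  have e1 : (p : ℂ) * (z + 1) = (p * z + 1) + 2 * ((m : ℤ) : ℂ) := by
    rw [hm]; push_cast; ring
  have e2 : ∀ j : ZMod p, heckePt p (z + 1) j.val = heckePt p z ((j.val : ℤ) - m) + 1 := by
    intro j
    have hmc : (p : ℂ) = 2 * m + 1 := by exact_mod_cast congrArg (Nat.cast (R := ℂ)) hm
    rw [heckePt, heckePt]
    field_simp
    push_cast
    linear_combination -hmc
  have e3 : ∀ j : ZMod p, (((j.val : ℤ) - m : ℤ) : ZMod p) = (((j - m : ZMod p)).val : ℤ) := by
    intro j; simp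
  rw [heckeProd, heckeProd, e1, thX_add_two_mul_int, thY_add_two_mul_int, thX_add_one, thY_add_one,
    thX_add_one, thY_add_one]
  have hprod : ∏ j : ZMod p, E (-thX z) (thY z - thX z) (thX (heckePt p (z + 1) j.val))
      (thY (heckePt p (z + 1) j.val)) = ε ^ p * ∏ j : ZMod p, E (thX z) (thY z)
        (thX (heckePt p z j.val)) (thY (heckePt p z j.val)) := by
    rw [← prod_const_mul_zmod]
    refine Eq.trans ?_ (Equiv.prod_comp (Equiv.subRight (m : ZMod p)) _)
    refine prod_congr rfl fun j _ => ?_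
    rw [e2, thX_add_one, thY_add_one, hT, Equiv.subRight_apply, thX_heckePt_congr p z (e3 j),
      thY_heckePt_congr p z (e3 j)]
  rw [hprod, show (p : ℂ) ^ 2 * -thX (p * z) = -((p : ℂ) ^ 2 * thX (p * z)) by ring, mul_sub, hT]
  linear_combination (((p : ℂ) ^ 2)⁻¹ * E (thX z) (thY z) ((p : ℂ) ^ 2 * thX (p * z))
    ((p : ℂ) ^ 2 * thY (p * z)) * ∏ j : ZMod p, E (thX z) (thY z)
        (thX (heckePt p z j.val)) (thY (heckePt p z j.val))) * sign_pow_succ p hε hp2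

/-- `(-1/z + 2m)/p` is equivalent to `(z + 2n)/p` if `4mn ≡ -1` modulo `p`. -/
lemma thVec_heckePt_neg_inv (hp2 : p ≠ 2) {z : ℂ} (hz : 0 < z.im) {m n : ℤ}
    (h : (4 * m * n : ZMod p) = -1) :
    thX (heckePt p (-1 / z) m) = z ^ 2 * (thX (heckePt p z n) - thY (heckePt p z n)) ∧
    thY (heckePt p (-1 / z) m) = z ^ 2 * -thY (heckePt p z n) := by
  have hp0 : (p : ℂ) ≠ 0 := by exact_mod_cast hp.out.ne_zero
  have hz0 : z ≠ 0 := by rintro rfl; simp at hz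
  obtain ⟨k, hk⟩ : (p : ℤ) ∣ -1 - 4 * m * n := by
    rw [← ZMod.intCast_zmod_eq_zero_iff_dvd]
    push_cast
    rw [h]; ring
  have hk1 : ((k : ℤ) : ZMod 2) = 1 := by
    have hodd : Odd k := by
      have : Odd ((p : ℤ) * k) := by rw [← hk]; exact ⟨-1 - 2 * m * n, by ring⟩
      exact (Int.odd_mul.mp this).2
    obtain ⟨r, rfl⟩ := hodd
    push_cast
    have : (2 : ZMod 2) = 0 := rfl
    rw [this]; ring
  have hp1 : ((p : ℤ) : ZMod 2) = 1 := by
    obtain ⟨r, hr⟩ := hp.out.odd_of_ne_two hp2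
    rw [hr]; push_cast
    have : (2 : ZMod 2) = 0 := rfl
    rw [this]; ring
  let γ : SL(2, ℤ) := ⟨!![2 * m, k; p, -2 * n], by
    rw [Matrix.det_fin_two_of]; linear_combination hk⟩
  have hred : redModTwo γ = redModTwo S := by
    ext i j
    have h2 : (2 : ZMod 2) = 0 := rfl
    fin_cases i <;> fin_cases j
    · change ((2 * m : ℤ) : ZMod 2) = ((0 : ℤ) : ZMod 2)
      push_cast; rw [h2, zero_mul]
    · change ((k : ℤ) : ZMod 2) = ((-1 : ℤ) : ZMod 2)
      rw [hk1]; rfl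
    · change ((p : ℤ) : ZMod 2) = ((1 : ℤ) : ZMod 2)
      rw [hp1]; rfl
    · change ((-2 * n : ℤ) : ZMod 2) = ((0 : ℤ) : ZMod 2)
      push_cast; rw [h2, neg_zero, zero_mul]
  let w : ℍ := ⟨heckePt p z n, heckePt_im_pos p hz n⟩
  have hw : (w : ℂ) = heckePt p z n := rfl
  have haut : autFac γ w = z := by
    rw [hw, autFac, heckePt]
    simp [γ]
    field_simp
    ring
  have hsm : ((γ • w : ℍ) : ℂ) = heckePt p (-1 / z) m := by
    rw [coe_smul_eq, haut, hw, heckePt, heckePt]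
    have hkc : (p : ℂ) * k = -1 - 4 * m * n := by exact_mod_cast hk.symm
    simp [γ]
    field_simp
    linear_combination hkc
  constructor
  · rw [← hsm, thX_smul, haut, hred, (repAct_S _ _).1, hw]
  · rw [← hsm, thY_smul, haut, hred, (repAct_S _ _).2, hw]

theorem heckeProd_neg_inv {E : ℂ → ℂ → ℂ → ℂ → ℂ} (hE : PairInvariant E) (hp2 : p ≠ 2) {z : ℂ}
    (hz : 0 < z.im) : heckeProd p E (-1 / z) = z ^ (2 * (2 * (p + 1))) * heckeProd p E z := by
  have hp0 : (p : ℂ) ≠ 0 := by exact_mod_cast hp.out.ne_zero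
  have hz0 : z ≠ 0 := by rintro rfl; simp at hz
  obtain ⟨ε, hε, hS⟩ : ∃ ε : ℂ, (ε = 1 ∨ ε = -1) ∧
      ∀ u v u' v', E (z ^ 2 * (u - v)) (z ^ 2 * -v) (z ^ 2 * (u' - v')) (z ^ 2 * -v') =
        (z ^ 4 * ε) * E u v u' v' := by
    rcases hE.S_or with h | h
    · exact ⟨1, Or.inl rfl, fun u v u' v' => by rw [hE.smul, h]; ring⟩
    · exact ⟨-1, Or.inr rfl, fun u v u' v' => by rw [hE.smul, h]; ring⟩
  have hX := thX_neg_inv hz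
  have hY : thY (-1 / z) = z ^ 2 * -thY z := by rw [thY_neg_inv hz]; ring
  have hpz : 0 < (p * z).im := by
    have : (0 : ℝ) < p := by exact_mod_cast hp.out.pos
    simp; positivity
  have e0 : heckePt p (-1 / z) 0 = -1 / (p * z) := by
    rw [heckePt]; field_simp; simp
  have e0' : (p : ℂ) * (-1 / z) = -1 / heckePt p z 0 := by
    rw [heckePt, Int.cast_zero, mul_zero, add_zero]; field_simp
  have hz' : 0 < (heckePt p z 0).im := heckePt_im_pos p hz 0
  have hpt0 : (p : ℂ) * heckePt p z 0 = z := by rw [heckePt]; field_simp; simp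
  rw [heckeProd, heckeProd, ← mul_prod_erase univ _ (mem_univ (0 : ZMod p)),
    ← mul_prod_erase univ (fun j : ZMod p => E (thX z) (thY z) _ _) (mem_univ (0 : ZMod p))]
  simp only [ZMod.val_zero, Nat.cast_zero]
  have hrest : ∏ j ∈ univ.erase (0 : ZMod p), E (thX (-1 / z)) (thY (-1 / z))
      (thX (heckePt p (-1 / z) j.val)) (thY (heckePt p (-1 / z) j.val)) =
      (z ^ 4 * ε) ^ (p - 1) * ∏ j ∈ univ.erase (0 : ZMod p), E (thX z) (thY z)
        (thX (heckePt p z j.val)) (thY (heckePt p z j.val)) := by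
    have h2 : (2 : ZMod p) ≠ 0 := by
      intro h
      have : (p : ℕ) ∣ 2 := (ZMod.natCast_eq_zero_iff 2 p).mp (by exact_mod_cast h)
      exact hp2 ((Nat.prime_dvd_prime_iff_eq hp.out Nat.prime_two).mp this)
    have h4 : (4 : ZMod p) ≠ 0 := by
      rw [show (4 : ZMod p) = 2 * 2 by norm_num]; exact mul_ne_zero h2 h2
    have hcard : (univ.erase (0 : ZMod p)).card = p - 1 := by
      rw [card_erase_of_mem (mem_univ _), card_univ, ZMod.card]
    rw [← hcard, ← prod_const, ← prod_mul_distrib]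
    refine prod_nbij' (fun j => -(4 * j)⁻¹) (fun j => -(4 * j)⁻¹) ?_ ?_ ?_ ?_ ?_
    · intro j hj
      have := ne_of_mem_erase hj
      simp [h4, this]
    · intro j hj
      have := ne_of_mem_erase hj
      simp [h4, this]
    · intro j hj
      have := ne_of_mem_erase hj
      field_simp
    · intro j hj
      have := ne_of_mem_erase hj
      field_simp
    · intro j hj
      have hj0 := ne_of_mem_erase hj
      obtain ⟨h1, h2⟩ := thVec_heckePt_neg_inv p hp2 hz (m := (j.val : ℤ))
        (n := ((-(4 * j)⁻¹ : ZMod p).val : ℤ)) (by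
          simp
          field_simp)
      rw [hX, hY, h1, h2, hS]
  rw [hrest, e0, thX_neg_inv hpz, thY_neg_inv hpz, e0', thX_neg_inv hz', thY_neg_inv hz', hX, hY]
  have hz2 : z ^ 2 = (p : ℂ) ^ 2 * heckePt p z 0 ^ 2 := by rw [← mul_pow, hpt0]
  have f1 : E (z ^ 2 * (thX z - thY z)) (z ^ 2 * -thY z)
      ((p : ℂ) ^ 2 * (heckePt p z 0 ^ 2 * (thX (heckePt p z 0) - thY (heckePt p z 0))))
      ((p : ℂ) ^ 2 * (-heckePt p z 0 ^ 2 * thY (heckePt p z 0))) =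
      (z ^ 4 * ε) * E (thX z) (thY z) (thX (heckePt p z 0)) (thY (heckePt p z 0)) := by
    rw [← hS]
    congr 1
    · rw [hz2]; ring
    · rw [hz2]; ring
  have f2 : E (z ^ 2 * (thX z - thY z)) (z ^ 2 * -thY z)
      ((p * z) ^ 2 * (thX (p * z) - thY (p * z))) (-(p * z) ^ 2 * thY (p * z)) =
      (z ^ 4 * ε) * E (thX z) (thY z) ((p : ℂ) ^ 2 * thX (p * z)) ((p : ℂ) ^ 2 * thY (p * z)) := by
    rw [← hS]
    congr 1 <;> ring
  rw [f1, f2]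
  have hpow : (z ^ 4 * ε) * (z ^ 4 * ε) * (z ^ 4 * ε) ^ (p - 1) = z ^ (2 * (2 * (p + 1))) := by
    have : (z ^ 4 * ε) * (z ^ 4 * ε) * (z ^ 4 * ε) ^ (p - 1) = (z ^ 4 * ε) * (z ^ 4 * ε) ^ p := by
      rw [mul_assoc, ← pow_succ', Nat.sub_add_cancel hp.out.one_le]
    rw [this, mul_pow]
    have h := sign_pow_succ p hε hp2
    rw [show 2 * (2 * (p + 1)) = 4 + 4 * p by ring, pow_add, pow_mul]
    linear_combination (z ^ 4 * (z ^ 4) ^ p) * h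
  rw [← hpow]
  ring

end Hecke

end

section

open Finset PowerSeries

section HeckeSeries

open UpperHalfPlane hiding I
open ModularGroup MatrixGroups Real

lemma exists_valuationSubring_above (p : ℕ) [hp : Fact p.Prime] :
    ∃ V : ValuationSubring ℂ, CharP (IsLocalRing.ResidueField V) p := by
  let A : Subring ℂ := (Int.castRingHom ℂ).range
  let a : A := ⟨(p : ℂ), ⟨p, by simp⟩⟩
  have hI : Ideal.span {a} ≠ ⊤ := by
    intro h
    rw [Ideal.span_singleton_eq_top] at h
    obtain ⟨b, hb⟩ := h.exists_right_inv
    obtain ⟨n, hn⟩ := b.2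
    have h1 : (p : ℂ) * n = 1 := by
      have := congrArg Subtype.val hb
      simp only [Subring.coe_mul, Subring.coe_one, ← hn] at this
      exact this
    have h2 : (p : ℤ) * n = 1 := by exact_mod_cast h1
    have h3 : (p : ℤ) ∣ 1 := ⟨n, h2.symm⟩
    have := Int.natCast_dvd_natCast.mp (by exact_mod_cast h3 : ((p : ℕ) : ℤ) ∣ ((1 : ℕ) : ℤ))
    exact hp.out.one_lt.ne' (Nat.dvd_one.mp this)
  obtain ⟨V, -, hV⟩ := Ideal.image_subset_nonunits_valuationSubring (Ideal.span {a}) hI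
  refine ⟨V, ?_⟩
  have hpm : ((p : ℕ) : V) ∈ IsLocalRing.maximalIdeal V := by
    have h1 : (p : ℂ) ∈ V.nonunits := hV ⟨a, Ideal.subset_span rfl, rfl⟩
    rw [ValuationSubring.mem_nonunits_iff_exists_mem_maximalIdeal] at h1
    obtain ⟨h2, h3⟩ := h1
    convert h3
    exact map_natCast V.subtype p
  have h0 : ((p : ℕ) : IsLocalRing.ResidueField V) = 0 := by
    rw [← map_natCast (IsLocalRing.residue V), IsLocalRing.residue_eq_zero_iff]
    exact hpm
  exact (CharP.charP_iff_prime_eq_zero hp.out).mpr h0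

lemma map_frobenius_expand_powerSeries {k : Type*} [CommRing k] (p : ℕ) [hp : Fact p.Prime] [CharP k p]
    (F : k⟦X⟧) : PowerSeries.map (frobenius k p) (expand p hp.out.ne_zero F) = F ^ p :=
  MvPowerSeries.map_frobenius_expand p hp.out.ne_zero

lemma pow_eq_expand {k : Type*} [CommRing k] (p : ℕ) [hp : Fact p.Prime] [CharP k p]
    {F : k⟦X⟧} (hF : PowerSeries.map (frobenius k p) F = F) : F ^ p = expand p hp.out.ne_zero F := by
  rw [← map_frobenius_expand_powerSeries, PowerSeries.map_expand, hF]

lemma expand_injective {R : Type*} [CommRing R] {p : ℕ} (hp : p ≠ 0) :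
    Function.Injective (PowerSeries.expand p hp : R⟦X⟧ → R⟦X⟧) := by
  intro F G h
  ext n
  have := congrArg (coeff (p * n)) h
  simpa using this

lemma convOnDisc_eval₂ {σ A : Type*} [CommRing A] (ι : A →+* ℂ) (E : MvPolynomial σ A)
    {F : σ → ℂ⟦X⟧} (hF : ∀ i, ConvOnDisc (F i)) :
    ConvOnDisc (MvPolynomial.eval₂ ((C : ℂ →+* ℂ⟦X⟧).comp ι) F E) := by
  induction E using MvPolynomial.induction_on with
  | C a => rw [MvPolynomial.eval₂_C]; exact ConvOnDisc.C _
  | add P Q hP hQ => rw [MvPolynomial.eval₂_add]; exact hP.add hQ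
  | mul_X P i hP => rw [MvPolynomial.eval₂_mul, MvPolynomial.eval₂_X]; exact hP.mul (hF i)

lemma seriesEval_eval₂ {σ A : Type*} [CommRing A] (ι : A →+* ℂ) (E : MvPolynomial σ A)
    {F : σ → ℂ⟦X⟧} (hF : ∀ i, ConvOnDisc (F i)) {x : ℂ} (hx : ‖x‖ < 1) :
    seriesEval (MvPolynomial.eval₂ ((C : ℂ →+* ℂ⟦X⟧).comp ι) F E) x =
      MvPolynomial.eval₂ ι (fun i => seriesEval (F i) x) E := by
  induction E using MvPolynomial.induction_on with
  | C a => rw [MvPolynomial.eval₂_C, MvPolynomial.eval₂_C]; exact ConvOnDisc.eval_C hx _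
  | add P Q hP hQ =>
    rw [MvPolynomial.eval₂_add, MvPolynomial.eval₂_add,
      ConvOnDisc.eval_add hx (convOnDisc_eval₂ ι P hF) (convOnDisc_eval₂ ι Q hF), hP, hQ]
  | mul_X P i hP =>
    rw [MvPolynomial.eval₂_mul, MvPolynomial.eval₂_X, MvPolynomial.eval₂_mul, MvPolynomial.eval₂_X,
      ConvOnDisc.eval_mul hx (convOnDisc_eval₂ ι P hF) (hF i), hP]

variable (p : ℕ) [hp : Fact p.Prime]

/-- Evaluation of a polynomial in four variables at power series. -/
def polyAt {R : Type*} [CommRing R] (E : MvPolynomial (Fin 4) R) (u v u' v' : R⟦X⟧) : R⟦X⟧ :=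
  MvPolynomial.eval₂ (C : R →+* R⟦X⟧) ![u, v, u', v'] E

lemma map_polyAt {R S : Type*} [CommRing R] [CommRing S] (f : R →+* S) (E : MvPolynomial (Fin 4) R)
    (u v u' v' : R⟦X⟧) : PowerSeries.map f (polyAt E u v u' v') =
      polyAt (MvPolynomial.map f E) (PowerSeries.map f u) (PowerSeries.map f v)
        (PowerSeries.map f u') (PowerSeries.map f v') := by
  rw [polyAt, polyAt, MvPolynomial.hom_eval₂, MvPolynomial.eval₂_map]
  congr 1
  · ext a; simp
  · funext i; fin_cases i <;> rfl

lemma expand_polyAt {R : Type*} [CommRing R] {n : ℕ} (hn : n ≠ 0) (E : MvPolynomial (Fin 4) R)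
    (u v u' v' : R⟦X⟧) : expand n hn (polyAt E u v u' v') =
      polyAt E (expand n hn u) (expand n hn v) (expand n hn u') (expand n hn v') := by
  have := MvPolynomial.hom_eval₂ E (C : R →+* R⟦X⟧) ((expand n hn : R⟦X⟧ →ₐ[R] R⟦X⟧) : R⟦X⟧ →+* R⟦X⟧)
    ![u, v, u', v']
  rw [polyAt, polyAt]
  refine this.trans ?_
  congr 1
  · ext a : 1; exact expand_C n hn a
  · funext i; fin_cases i <;> rfl

lemma convOnDisc_polyAt {E : MvPolynomial (Fin 4) ℂ} {u v u' v' : ℂ⟦X⟧} (hu : ConvOnDisc u)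
    (hv : ConvOnDisc v) (hu' : ConvOnDisc u') (hv' : ConvOnDisc v') :
    ConvOnDisc (polyAt E u v u' v') := by
  refine convOnDisc_eval₂ (RingHom.id ℂ) E fun i => ?_
  fin_cases i
  exacts [hu, hv, hu', hv']

lemma seriesEval_polyAt {E : MvPolynomial (Fin 4) ℂ} {u v u' v' : ℂ⟦X⟧} (hu : ConvOnDisc u)
    (hv : ConvOnDisc v) (hu' : ConvOnDisc u') (hv' : ConvOnDisc v') {x : ℂ} (hx : ‖x‖ < 1) :
    seriesEval (polyAt E u v u' v') x =
      MvPolynomial.eval ![seriesEval u x, seriesEval v x, seriesEval u' x, seriesEval v' x] E := by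
  have := seriesEval_eval₂ (RingHom.id ℂ) E (F := ![u, v, u', v']) (fun i => by
    fin_cases i
    exacts [hu, hv, hu', hv']) hx
  refine this.trans ?_
  rw [MvPolynomial.eval]
  congr 1
  funext i; fin_cases i <;> rfl

/-- The formal expansion, in powers of `e^{πiτ/p}`, of the Hecke product. -/
def heckeSeries {R : Type*} [CommRing R] (ζ : R) (E Einf : MvPolynomial (Fin 4) R) : R⟦X⟧ :=
  polyAt Einf (expand p hp.out.ne_zero (XSer R)) (expand p hp.out.ne_zero (YSer R))
      (expand p hp.out.ne_zero (expand p hp.out.ne_zero (XSer R)))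
      (expand p hp.out.ne_zero (expand p hp.out.ne_zero (YSer R))) *
    ∏ j : ZMod p, polyAt E (expand p hp.out.ne_zero (XSer R)) (expand p hp.out.ne_zero (YSer R))
      (rescale (ζ ^ j.val) (XSer R)) (rescale (ζ ^ j.val) (YSer R))

lemma map_rescale_series {R S : Type*} [CommRing R] [CommRing S] (f : R →+* S) (a : R) (F : R⟦X⟧) :
    PowerSeries.map f (rescale a F) = rescale (f a) (PowerSeries.map f F) := by
  ext n; simp [coeff_rescale]

lemma map_heckeSeries {R S : Type*} [CommRing R] [CommRing S] (f : R →+* S) (ζ : R)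
    (E Einf : MvPolynomial (Fin 4) R) : PowerSeries.map f (heckeSeries p ζ E Einf) =
      heckeSeries p (f ζ) (MvPolynomial.map f E) (MvPolynomial.map f Einf) := by
  simp only [heckeSeries, map_mul, map_prod, map_polyAt, map_expand, map_XSer, map_YSer,
    map_rescale_series, map_pow]

/-- In characteristic `p` the Hecke product is given by a Kronecker congruence. -/
lemma heckeSeries_charP {k : Type*} [CommRing k] [CharP k p] {E Einf : MvPolynomial (Fin 4) k}
    (hE : MvPolynomial.map (frobenius k p) E = E) :
    heckeSeries p 1 E Einf = expand p hp.out.ne_zero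
      (polyAt Einf (XSer k) (YSer k) (XSer k ^ p) (YSer k ^ p) *
        polyAt E (XSer k ^ p) (YSer k ^ p) (XSer k) (YSer k)) := by
  have hX : XSer k ^ p = expand p hp.out.ne_zero (XSer k) := pow_eq_expand p (map_XSer _)
  have hY : YSer k ^ p = expand p hp.out.ne_zero (YSer k) := pow_eq_expand p (map_YSer _)
  rw [heckeSeries, map_mul, expand_polyAt, hX, hY]
  congr 1
  simp only [one_pow, rescale_one, RingHom.id_apply]
  rw [prod_const, card_univ, ZMod.card]
  refine pow_eq_expand p ?_
  rw [map_polyAt, hE, map_expand, map_expand, map_XSer, map_YSer]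

end HeckeSeries

end

section

open Finset PowerSeries

section HeckeIsobaric

open UpperHalfPlane hiding I
open ModularGroup MatrixGroups Real

variable (p : ℕ) [hp : Fact p.Prime]

lemma nome_two_div_isPrimitiveRoot : IsPrimitiveRoot (nome (2 / p)) p := by
  have h := Complex.isPrimitiveRoot_exp p hp.out.ne_zero
  have : nome (2 / p) = Complex.exp (2 * π * Complex.I / p) := by
    rw [nome]; congr 1; ring
  rwa [this]

lemma norm_nome_two_div : ‖nome (2 / p)‖ = 1 :=
  (nome_two_div_isPrimitiveRoot p).norm'_eq_one hp.out.ne_zero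

lemma convOnDisc_heckeSeries (E Einf : MvPolynomial (Fin 4) ℂ) :
    ConvOnDisc (heckeSeries p (nome (2 / p)) E Einf) := by
  have hX := convOnDisc_XSer.expand hp.out.ne_zero
  have hY := convOnDisc_YSer.expand hp.out.ne_zero
  refine (convOnDisc_polyAt hX hY (hX.expand _) (hY.expand _)).mul
    (ConvOnDisc.prod univ fun j _ => ?_)
  have hj : ‖nome (2 / p) ^ j.val‖ ≤ 1 := by rw [norm_pow, norm_nome_two_div, one_pow]
  exact convOnDisc_polyAt hX hY (convOnDisc_XSer.rescale hj) (convOnDisc_YSer.rescale hj)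

lemma seriesEval_heckeSeries {E Einf : MvPolynomial (Fin 4) ℂ}
    (hinf : ∀ u v u' v', MvPolynomial.eval ![u, v, u', v'] Einf = ((p : ℂ) ^ 2)⁻¹ *
      MvPolynomial.eval ![u, v, (p : ℂ) ^ 2 * u', (p : ℂ) ^ 2 * v'] E) {z : ℂ} (hz : 0 < z.im) :
    seriesEval (heckeSeries p (nome (2 / p)) E Einf) (nome (z / p)) =
      heckeProd p (fun u v u' v' => MvPolynomial.eval ![u, v, u', v'] E) z := by
  have hp0 : (p : ℂ) ≠ 0 := by exact_mod_cast hp.out.ne_zero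
  have hzp : 0 < (z / p).im := by
    have := heckePt_im_pos p hz 0
    simpa [heckePt] using this
  have hpz : 0 < (p * z).im := by
    have : (0 : ℝ) < p := by exact_mod_cast hp.out.pos
    simp; positivity
  have hx := norm_nome_lt_one hzp
  have hX := convOnDisc_XSer.expand hp.out.ne_zero
  have hY := convOnDisc_YSer.expand hp.out.ne_zero
  have hxp : nome (z / p) ^ p = nome z := by
    rw [← nome_natCast_mul, mul_div_cancel₀ _ hp0]
  have hxp' : ‖nome (z / p) ^ p‖ < 1 := by rw [hxp]; exact norm_nome_lt_one hz
  have eX : seriesEval (expand p hp.out.ne_zero (XSer ℂ)) (nome (z / p)) = thX z := by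
    rw [ConvOnDisc.eval_expand hx convOnDisc_XSer, hxp, seriesEval_XSer hz]
  have eY : seriesEval (expand p hp.out.ne_zero (YSer ℂ)) (nome (z / p)) = thY z := by
    rw [ConvOnDisc.eval_expand hx convOnDisc_YSer, hxp, seriesEval_YSer hz]
  have eX2 : seriesEval (expand p hp.out.ne_zero (expand p hp.out.ne_zero (XSer ℂ)))
      (nome (z / p)) = thX (p * z) := by
    rw [ConvOnDisc.eval_expand hx hX, ConvOnDisc.eval_expand hxp' convOnDisc_XSer, hxp,
      ← nome_natCast_mul, seriesEval_XSer hpz]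
  have eY2 : seriesEval (expand p hp.out.ne_zero (expand p hp.out.ne_zero (YSer ℂ)))
      (nome (z / p)) = thY (p * z) := by
    rw [ConvOnDisc.eval_expand hx hY, ConvOnDisc.eval_expand hxp' convOnDisc_YSer, hxp,
      ← nome_natCast_mul, seriesEval_YSer hpz]
  have hj : ∀ j : ZMod p, ‖nome (2 / p) ^ j.val‖ ≤ 1 := fun j => by
    rw [norm_pow, norm_nome_two_div, one_pow]
  have hpt : ∀ j : ZMod p, nome (2 / p) ^ j.val * nome (z / p) = nome (heckePt p z j.val) := by
    intro j
    rw [← nome_natCast_mul, ← nome_add, heckePt]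
    congr 1
    field_simp
    push_cast; ring
  have hconv : ∀ j ∈ (univ : Finset (ZMod p)), ConvOnDisc (polyAt E (expand p hp.out.ne_zero (XSer ℂ))
      (expand p hp.out.ne_zero (YSer ℂ)) (rescale (nome (2 / p) ^ j.val) (XSer ℂ))
      (rescale (nome (2 / p) ^ j.val) (YSer ℂ))) := fun j _ =>
    convOnDisc_polyAt hX hY (convOnDisc_XSer.rescale (hj j)) (convOnDisc_YSer.rescale (hj j))
  rw [heckeSeries, ConvOnDisc.eval_mul hx (convOnDisc_polyAt hX hY (hX.expand _) (hY.expand _))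
    (ConvOnDisc.prod univ hconv), ConvOnDisc.eval_prod hx univ hconv,
    seriesEval_polyAt hX hY (hX.expand _) (hY.expand _) hx, eX, eY, eX2, eY2, hinf, heckeProd]
  congr 1
  refine prod_congr rfl fun j _ => ?_
  rw [seriesEval_polyAt hX hY (convOnDisc_XSer.rescale (hj j)) (convOnDisc_YSer.rescale (hj j)) hx,
    eX, eY, ConvOnDisc.eval_rescale, ConvOnDisc.eval_rescale, hpt,
    seriesEval_XSer (heckePt_im_pos p hz _), seriesEval_YSer (heckePt_im_pos p hz _)]

lemma convOnDisc_of_expand {F : ℂ⟦X⟧} {n : ℕ} (hn : n ≠ 0)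
    (h : ConvOnDisc (expand n hn F)) : ConvOnDisc F := by
  intro x hx
  obtain ⟨y, rfl⟩ := IsAlgClosed.exists_pow_nat_eq x (Nat.pos_of_ne_zero hn)
  have hy : ‖y‖ < 1 := by
    rw [norm_pow] at hx
    by_contra! hcon
    exact absurd hx (not_lt.mpr (one_le_pow₀ hcon))
  have hinj : Function.Injective fun m : ℕ => n * m :=
    fun _ _ h => Nat.eq_of_mul_eq_mul_left (Nat.pos_of_ne_zero hn) h
  have h1 := (h y hy).comp_injective hinj
  have h2 : ((fun m => ‖coeff m (expand n hn F) * y ^ m‖) ∘ fun m : ℕ => n * m) =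
      fun m => ‖coeff m F * (y ^ n) ^ m‖ := by
    funext m
    simp [coeff_expand_mul, pow_mul]
  rwa [h2] at h1

lemma exists_eq_expand_of_rescale {R : Type*} [CommRing R] {ι : R →+* ℂ}
    (hι : Function.Injective ι) {S : R⟦X⟧}
    (h : rescale (nome (2 / p)) (PowerSeries.map ι S) = PowerSeries.map ι S) :
    ∃ G : R⟦X⟧, S = expand p hp.out.ne_zero G := by
  refine ⟨PowerSeries.mk fun n => coeff (p * n) S, ?_⟩
  ext n
  rw [coeff_expand]
  split_ifs with hn
  · obtain ⟨m, rfl⟩ := hn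
    rw [Nat.mul_div_cancel_left _ hp.out.pos, coeff_mk]
  · have h1 := congrArg (coeff n) h
    rw [coeff_rescale, coeff_map] at h1
    have h2 : nome (2 / p) ^ n ≠ 1 := fun h =>
      hn ((nome_two_div_isPrimitiveRoot p).pow_eq_one_iff_dvd n |>.mp h)
    have h3 : (nome (2 / p) ^ n - 1) * ι (coeff n S) = 0 := by linear_combination h1
    rcases mul_eq_zero.mp h3 with h4 | h4
    · exact absurd (sub_eq_zero.mp h4) h2
    · exact hι (by rw [h4, map_zero])

variable {V : ValuationSubring ℂ} [CharP (IsLocalRing.ResidueField V) p]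

lemma exists_rootOfUnity : ∃ ζ : V, (ζ : ℂ) = nome (2 / p) ∧ IsLocalRing.residue V ζ = 1 := by
  have hpow : nome (2 / p) ^ p = 1 := (nome_two_div_isPrimitiveRoot p).pow_eq_one
  have hne : nome (2 / p) ≠ 0 := nome_ne_zero _
  have hmem : nome (2 / p) ∈ V := by
    rcases V.mem_or_inv_mem (nome (2 / p)) with h | h
    · exact h
    · have h1 := pow_mem h (p - 1)
      have h2 : (nome (2 / p))⁻¹ ^ (p - 1) = nome (2 / p) := by
        rw [inv_pow]
        apply inv_eq_of_mul_eq_one_left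
        rw [← pow_succ', Nat.sub_add_cancel hp.out.one_le, hpow]
      rwa [h2] at h1
  refine ⟨⟨_, hmem⟩, rfl, ?_⟩
  have h1 : (IsLocalRing.residue V ⟨_, hmem⟩) ^ p = 1 := by
    rw [← map_pow, ← map_one (IsLocalRing.residue V)]
    congr 1
    exact Subtype.ext hpow
  have h2 : (IsLocalRing.residue V ⟨_, hmem⟩ - 1) ^ p = 0 := by
    rw [sub_pow_char, h1, one_pow, sub_self]
  exact sub_eq_zero.mp (pow_eq_zero_iff hp.out.ne_zero |>.mp h2)

lemma isUnit_sixteen (hp2 : p ≠ 2) : IsUnit (16 : V) := by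
  have hne : IsLocalRing.residue V (16 : V) ≠ 0 := by
    rw [map_ofNat]
    intro h
    have h1 : ((16 : ℕ) : IsLocalRing.ResidueField V) = 0 := by exact_mod_cast h
    have h2 := (CharP.cast_eq_zero_iff (IsLocalRing.ResidueField V) p 16).mp h1
    have h3 : p ∣ 2 ^ 4 := by norm_num; exact h2
    exact hp2 ((Nat.prime_dvd_prime_iff_eq hp.out Nat.prime_two).mp (hp.out.dvd_of_dvd_pow h3))
  by_contra hcon
  exact hne ((IsLocalRing.residue_eq_zero_iff _).mpr ((IsLocalRing.mem_maximalIdeal _).mpr hcon))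

theorem exists_hecke_isobaric (hp2 : p ≠ 2) (E Einf : MvPolynomial (Fin 4) V)
    (hPI : PairInvariant fun u v u' v' =>
      MvPolynomial.eval ![u, v, u', v'] (MvPolynomial.map V.subtype E))
    (hinf : ∀ u v u' v', MvPolynomial.eval ![u, v, u', v'] (MvPolynomial.map V.subtype Einf) =
      ((p : ℂ) ^ 2)⁻¹ * MvPolynomial.eval ![u, v, (p : ℂ) ^ 2 * u', (p : ℂ) ^ 2 * v']
        (MvPolynomial.map V.subtype E))
    (hfrob : MvPolynomial.map (frobenius (IsLocalRing.ResidueField V) p)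
      (MvPolynomial.map (IsLocalRing.residue V) E) = MvPolynomial.map (IsLocalRing.residue V) E) :
    ∃ (ζ : V) (a : ℕ → V), (∀ τ : ℍ, heckeProd p (fun u v u' v' =>
        MvPolynomial.eval ![u, v, u', v'] (MvPolynomial.map V.subtype E)) τ =
        isobaric (2 * (p + 1)) (fun k => (a k : ℂ)) (thX τ) (thY τ)) ∧
      heckeSeries p ζ E Einf = expand p hp.out.ne_zero
        (isobaric (2 * (p + 1)) (fun k => C (a k)) (XSer V) (YSer V)) ∧
      isobaric (2 * (p + 1)) (fun k => C (IsLocalRing.residue V (a k)))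
          (XSer (IsLocalRing.ResidueField V)) (YSer (IsLocalRing.ResidueField V)) =
        polyAt (MvPolynomial.map (IsLocalRing.residue V) Einf) (XSer _) (YSer _) (XSer _ ^ p)
          (YSer _ ^ p) *
        polyAt (MvPolynomial.map (IsLocalRing.residue V) E) (XSer _ ^ p) (YSer _ ^ p) (XSer _)
          (YSer _) := by
  have hp0 : (p : ℂ) ≠ 0 := by exact_mod_cast hp.out.ne_zero
  set Ec : ℂ → ℂ → ℂ → ℂ → ℂ := fun u v u' v' =>
    MvPolynomial.eval ![u, v, u', v'] (MvPolynomial.map V.subtype E) with hEc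
  obtain ⟨ζ, hζ, hζ1⟩ := exists_rootOfUnity p (V := V)
  set S := heckeSeries p ζ E Einf with hS
  have hSC : PowerSeries.map V.subtype S = heckeSeries p (nome (2 / p))
      (MvPolynomial.map V.subtype E) (MvPolynomial.map V.subtype Einf) := by
    rw [hS, map_heckeSeries]
    congr 1
  have hSconv : ConvOnDisc (PowerSeries.map V.subtype S) := by
    rw [hSC]; exact convOnDisc_heckeSeries p _ _
  have hSeval : ∀ {z : ℂ}, 0 < z.im →
      seriesEval (PowerSeries.map V.subtype S) (nome (z / p)) = heckeProd p Ec z := by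
    intro z hz
    rw [hSC]; exact seriesEval_heckeSeries p hinf hz
  have hinj : Function.Injective V.subtype := Subtype.val_injective
  obtain ⟨G, hG⟩ : ∃ G : V⟦X⟧, S = expand p hp.out.ne_zero G := by
    refine exists_eq_expand_of_rescale p hinj ?_
    refine seriesEval_injective (hSconv.rescale (norm_nome_two_div p).le) hSconv fun x hx hx0 => ?_
    obtain ⟨w, hw, rfl⟩ := exists_nome_eq hx hx0
    have hz : 0 < (p * w).im := by
      have : (0 : ℝ) < p := by exact_mod_cast hp.out.pos
      simp; positivity
    have e1 : nome w = nome ((p * w) / p) := by rw [mul_div_cancel_left₀ _ hp0]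
    have e2 : nome (2 / p) * nome w = nome ((p * w + 1 + 1) / p) := by
      rw [← nome_add]; congr 1; field_simp; ring
    rw [ConvOnDisc.eval_rescale, e2, hSeval (by simpa using hz), heckeProd_add_one p hPI hp2,
      heckeProd_add_one p hPI hp2, e1, hSeval hz]
  have hGconv : ConvOnDisc (PowerSeries.map V.subtype G) := by
    apply convOnDisc_of_expand hp.out.ne_zero
    rw [← map_expand, ← hG]
    exact hSconv
  have hGeval : ∀ τ : ℍ, heckeProd p Ec τ = seriesEval (PowerSeries.map V.subtype G) (nome τ) := by
    intro τ
    have hzp : 0 < ((τ : ℂ) / p).im := by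
      have := heckePt_im_pos p τ.im_pos 0
      simpa [heckePt] using this
    rw [← hSeval τ.im_pos, hG, map_expand, ConvOnDisc.eval_expand (norm_nome_lt_one hzp) hGconv,
      ← nome_natCast_mul, mul_div_cancel₀ _ hp0]
  obtain ⟨a, ha⟩ := exists_isobaric_coeff (isUnit_sixteen p hp2) G (2 * (p + 1))
  have hmapiso : PowerSeries.map V.subtype (isobaric (2 * (p + 1)) (fun k => C (a k))
      (XSer V) (YSer V)) = isobaric (2 * (p + 1)) (fun k => C (a k : ℂ)) (XSer ℂ) (YSer ℂ) := by
    rw [map_isobaric, map_XSer, map_YSer]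
    simp
  have hiso : ∀ τ : ℍ, heckeProd p Ec τ =
      isobaric (2 * (p + 1)) (fun k => (a k : ℂ)) (thX τ) (thY τ) := by
    refine eq_isobaric_of_levelOne (f := fun τ => heckeProd p Ec τ) hGconv hGeval ?_ ?_ _ ?_
    · intro τ
      rw [coe_T_smul, heckeProd_add_one p hPI hp2]
    · intro τ
      have e : ((ModularGroup.S • τ : ℍ) : ℂ) = -1 / τ := by
        rw [UpperHalfPlane.modular_S_smul]
        change (-(τ : ℂ))⁻¹ = _
        rw [neg_div, one_div, inv_neg]
      rw [e, heckeProd_neg_inv p hPI hp2 τ.im_pos]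
    · intro n hn
      have := ha n hn
      rw [← hmapiso, ← map_sub, coeff_map, this, map_zero]
  have hGiso : G = isobaric (2 * (p + 1)) (fun k => C (a k)) (XSer V) (YSer V) := by
    apply PowerSeries.map_injective _ hinj
    rw [hmapiso]
    refine seriesEval_eq_imp hGconv (convOnDisc_isobaric convOnDisc_XSer convOnDisc_YSer)
      fun τ => ?_
    rw [← hGeval, hiso, seriesEval_isobaric convOnDisc_XSer convOnDisc_YSer
      (norm_nome_lt_one τ.im_pos), seriesEval_XSer τ.im_pos, seriesEval_YSer τ.im_pos]
  refine ⟨ζ, a, hiso, by rw [← hGiso, ← hG], ?_⟩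
  apply expand_injective hp.out.ne_zero
  rw [← heckeSeries_charP p hfrob, ← hζ1, ← map_heckeSeries, ← hS, hG, hGiso, map_expand,
    map_isobaric, map_XSer, map_YSer]
  simp

end HeckeIsobaric

end

section

open Finset

section HasseInvariant

set_option linter.unusedSectionVars false

open Polynomial in
lemma coeff_C_mul_X_add_C_pow' {R : Type*} [CommRing R] (a c : R) (N k : ℕ) (hk : k ≤ N) :
    (((C a * X + C c) ^ N : R[X])).coeff k = a ^ k * c ^ (N - k) * N.choose k := by
  rw [add_pow, finsetSum_coeff, sum_eq_single k]
  · rw [mul_pow, ← C_pow, ← C_pow,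
      show C (a ^ k) * X ^ k * C (c ^ (N - k)) * ((N.choose k : ℕ) : R[X]) =
        C (a ^ k * c ^ (N - k) * N.choose k) * X ^ k by simp; ring]
    rw [coeff_C_mul_X_pow, if_pos rfl]
  · intro i _ hi
    rw [mul_pow, ← C_pow, ← C_pow,
      show C (a ^ i) * X ^ i * C (c ^ (N - i)) * ((N.choose i : ℕ) : R[X]) =
        C (a ^ i * c ^ (N - i) * N.choose i) * X ^ i by simp; ring]
    rw [coeff_C_mul_X_pow, if_neg (Ne.symm hi)]
  · intro h; exact absurd (mem_range.mpr (by omega)) h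

open Polynomial in
/-- The polynomial form of Landen's transformation for truncated hypergeometric sums. -/
lemma sum_choose_centralBinom_landen {R : Type*} [CommRing R] (m : ℕ) (a c : R) :
    ∑ n ∈ range (m + 1), (m.choose n : R) * (-1) ^ n * n.centralBinom * (a * c) ^ n *
      ((a + c) ^ 2) ^ (m - n) =
    ∑ n ∈ range (m + 1), (m.choose n : R) ^ 2 * (c ^ 2) ^ n * (a ^ 2) ^ (m - n) := by
  have hP : (-(C a * X + C c) ^ 2 + C ((a + c) ^ 2) * X : R[X]) =
      (C (-1) * X + C 1) * (C (a ^ 2) * X + C (-c ^ 2)) := by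
    simp only [C_add, C_neg, C_pow, C_1]; ring
  have h := congrArg (fun P : R[X] => (P ^ m).coeff m) hP
  beta_reduce at h
  rw [mul_pow, add_pow, finsetSum_coeff, coeff_mul, Nat.sum_antidiagonal_eq_sum_range_succ_mk] at h
  refine Eq.trans ?_ (h.trans ?_)
  · refine sum_congr rfl fun n hn => ?_
    have hn' : n ≤ m := by have := mem_range.mp hn; omega
    have e : (-(C a * X + C c) ^ 2 : R[X]) ^ n * (C ((a + c) ^ 2) * X) ^ (m - n) * ((m.choose n : ℕ) : R[X]) =
        C ((-1) ^ n * ((a + c) ^ 2) ^ (m - n) * m.choose n) * ((C a * X + C c) ^ (2 * n) *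
          X ^ (m - n)) := by
      rw [neg_pow, mul_pow (C ((a + c) ^ 2)), ← pow_mul]
      simp; ring
    rw [e, coeff_C_mul, coeff_mul_X_pow', if_pos (by omega), show m - (m - n) = n by omega,
      coeff_C_mul_X_add_C_pow' _ _ _ _ (by omega), Nat.centralBinom, mul_pow,
      show 2 * n - n = n by omega]
    ring
  · refine sum_congr rfl fun n hn => ?_
    have hn' : n ≤ m := by have := mem_range.mp hn; omega
    simp only
    rw [coeff_C_mul_X_add_C_pow' _ _ _ _ hn', coeff_C_mul_X_add_C_pow' _ _ _ _ (Nat.sub_le _ _),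
      Nat.choose_symm hn', show m - (m - n) = n by omega, one_pow, neg_pow (c ^ 2)]
    have : ((-1 : R) ^ n) * (-1) ^ n = 1 := by rw [← mul_pow]; simp
    linear_combination (m.choose n : R) ^ 2 * (c ^ 2) ^ n * (a ^ 2) ^ (m - n) * this

variable (p : ℕ) [hp : Fact p.Prime]

lemma four_pow_mul_choose {k : Type*} [Field k] [CharP k p] {m : ℕ} (hm : p = 2 * m + 1) {n : ℕ}
    (hn : n ≤ m) : (4 : k) ^ n * m.choose n = (-1) ^ n * n.centralBinom := by
  have hmk : (2 * m + 1 : k) = 0 := by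
    have := CharP.cast_eq_zero k p
    rw [hm] at this
    exact_mod_cast this
  induction n with
  | zero => simp
  | succ n ih =>
    have ih := ih (by omega)
    have hne : ((n + 1 : ℕ) : k) ≠ 0 := by
      rw [Ne, CharP.cast_eq_zero_iff k p]
      exact fun h => absurd (Nat.le_of_dvd (by omega) h) (by omega)
    apply mul_right_cancel₀ hne
    have h1 : (m.choose (n + 1) : k) * (n + 1 : ℕ) = m.choose n * (m - n) := by
      have := Nat.choose_succ_right_eq m n
      have h2 : ((m - n : ℕ) : k) = m - n := by rw [Nat.cast_sub (by omega)]
      rw [← h2]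
      exact_mod_cast congrArg (Nat.cast (R := k)) this
    have h2 : ((n + 1 : ℕ) : k) * (n + 1).centralBinom = 2 * (2 * n + 1) * n.centralBinom := by
      have := Nat.succ_mul_centralBinom_succ n
      exact_mod_cast congrArg (Nat.cast (R := k)) this
    rw [pow_succ, pow_succ]
    push_cast at h1 h2 ⊢
    linear_combination 4 ^ n * 4 * h1 + (-1) ^ n * h2 + 4 * (m - n : k) * ih
      + 2 * (-1) ^ n * (n.centralBinom : k) * hmk

lemma eq_C_of_eq_expand_two {R : Type*} [CommRing R] {F : PowerSeries R}
    (h : F = PowerSeries.expand 2 two_ne_zero F) : F = PowerSeries.C (PowerSeries.constantCoeff F) := by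
  ext n
  induction n using Nat.strong_induction_on with
  | _ n ih =>
    rcases Nat.eq_zero_or_pos n with rfl | hn
    · simp
    · rw [PowerSeries.coeff_C, if_neg hn.ne']
      rw [h, PowerSeries.coeff_expand]
      split_ifs with h2
      · rw [ih (n / 2) (by omega), PowerSeries.coeff_C, if_neg (by omega)]
      · rfl

/-- The Hasse invariant has `q`-expansion `1`. -/
theorem hasse_isobaric_eq_one (k : Type*) [Field k] [CharP k p] {m : ℕ} (hm : p = 2 * m + 1) :
    isobaric m (fun n => PowerSeries.C ((m.choose n : k) ^ 2)) (XSer k) (YSer k) = 1 := by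
  set a := PowerSeries.expand 2 two_ne_zero (thetaSeries k) ^ 2 with ha
  set c := thetaSeries k ^ 2 - a with hc
  have h1 := theta_sq_add_thetaAlt_sq k
  have h2 := theta_mul_thetaAlt k
  rw [← ha] at h1
  have hY : YSer k = (a + c) ^ 2 := by rw [YSer, hc]; ring
  have h4 : thetaAlt k ^ 2 = a - c := by rw [hc]; linear_combination h1
  have hX : XSer k = 4 * (a * c) := by
    rw [XSer, show thetaSeries k ^ 4 - thetaAlt k ^ 4 = (thetaSeries k ^ 2) ^ 2 -
      (thetaAlt k ^ 2) ^ 2 by ring, h4, show thetaSeries k ^ 2 = a + c by rw [hc]; ring]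
    ring
  have hY2 : PowerSeries.expand 2 two_ne_zero (YSer k) = a ^ 2 := by
    rw [YSer, map_pow, ha]; ring
  have hX2 : PowerSeries.expand 2 two_ne_zero (XSer k) = c ^ 2 := by
    rw [XSer, map_sub, map_pow, map_pow]
    have : PowerSeries.expand 2 two_ne_zero (thetaAlt k) ^ 4 = thetaSeries k ^ 2 * thetaAlt k ^ 2 := by
      rw [show PowerSeries.expand 2 two_ne_zero (thetaAlt k) ^ 4 =
        (PowerSeries.expand 2 two_ne_zero (thetaAlt k) ^ 2) ^ 2 by ring, ← h2]; ring
    rw [this, h4, show PowerSeries.expand 2 two_ne_zero (thetaSeries k) ^ 4 = a ^ 2 by rw [ha]; ring,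
      show thetaSeries k ^ 2 = a + c by rw [hc]; ring]
    ring
  have hfun : isobaric m (fun n => PowerSeries.C ((m.choose n : k) ^ 2)) (XSer k) (YSer k) =
      PowerSeries.expand 2 two_ne_zero
        (isobaric m (fun n => PowerSeries.C ((m.choose n : k) ^ 2)) (XSer k) (YSer k)) := by
    have e : PowerSeries.expand 2 two_ne_zero
        (isobaric m (fun n => PowerSeries.C ((m.choose n : k) ^ 2)) (XSer k) (YSer k)) =
        ∑ n ∈ range (m + 1), (m.choose n : PowerSeries k) ^ 2 * (c ^ 2) ^ n * (a ^ 2) ^ (m - n) := by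
      simp only [isobaric, map_sum, map_mul, map_pow, hX2, hY2]
      simp
    rw [e, ← sum_choose_centralBinom_landen, isobaric]
    refine sum_congr rfl fun n hn => ?_
    have hn' : n ≤ m := by have := mem_range.mp hn; omega
    have h5 := congrArg (PowerSeries.C (R := k)) (four_pow_mul_choose p (k := k) hm hn')
    rw [hX, hY, mul_pow 4]
    simp only [map_mul, map_pow, map_natCast, map_neg, map_one,
      map_ofNat (PowerSeries.C : k →+* PowerSeries k) 4] at h5 ⊢
    linear_combination (m.choose n : PowerSeries k) * (a * c) ^ n * ((a + c) ^ 2) ^ (m - n) * h5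
  rw [eq_C_of_eq_expand_two hfun]
  have : PowerSeries.constantCoeff (isobaric m (fun n => PowerSeries.C ((m.choose n : k) ^ 2))
      (XSer k) (YSer k)) = 1 := by
    obtain ⟨W, hW, -⟩ := exists_XSer_eq k
    rw [map_isobaric, constantCoeff_YSer, hW, isobaric, sum_eq_single 0]
    · simp
    · intro b _ hb; simp [hb]
    · simp
  rw [this, map_one]

end HasseInvariant

end

section

open Finset Polynomial

section ModularPolynomials

set_option linter.unusedSectionVars false

open UpperHalfPlane hiding I

lemma isobaric_coeff_eq_eval₂ {R S : Type*} [CommRing R] [CommRing S] (f : R →+* S) {K : ℕ}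
    {P : R[X]} (hP : P.natDegree ≤ K) {u v l : S} (h : l * v = u) :
    isobaric K (fun k => f (P.coeff k)) u v = v ^ K * P.eval₂ f l := by
  rw [isobaric, eval₂_eq_sum_range' f (Nat.lt_succ_of_le hP), mul_sum]
  refine sum_congr rfl fun k hk => ?_
  have : K = k + (K - k) := by have := mem_range.mp hk; omega
  rw [← h, mul_pow]
  nth_rewrite 2 [this]
  rw [pow_add]; ring

lemma exists_polynomial_coeff_eq {R : Type*} [CommRing R] (K : ℕ) (a : ℕ → R) :
    ∃ P : R[X], P.natDegree ≤ K ∧ ∀ k ≤ K, P.coeff k = a k := by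
  refine ⟨∑ k ∈ range (K + 1), C (a k) * X ^ k, ?_, fun k hk => ?_⟩
  · refine natDegree_sum_le_of_forall_le _ _ fun k hk => ?_
    exact (natDegree_C_mul_X_pow_le _ _).trans (by have := mem_range.mp hk; omega)
  · rw [finsetSum_coeff, sum_eq_single k]
    · rw [coeff_C_mul_X_pow, if_pos rfl]
    · intro j _ hj; rw [coeff_C_mul_X_pow, if_neg (Ne.symm hj)]
    · intro h; exact absurd (mem_range.mpr (by omega)) h

lemma isobaric_congr {R : Type*} [CommRing R] {K : ℕ} {a b : ℕ → R} (h : ∀ k ≤ K, a k = b k)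
    (u v : R) : isobaric K a u v = isobaric K b u v :=
  sum_congr rfl fun k hk => by rw [h k (by have := mem_range.mp hk; omega)]

/-- The `q`-series of the modular function `λ`. -/
lemma exists_lambdaSeries (k : Type*) [Field k] : ∃ L : PowerSeries k, L * YSer k = XSer k := by
  refine ⟨XSer k * (YSer k)⁻¹, ?_⟩
  rw [mul_assoc, PowerSeries.inv_mul_cancel _ (by rw [constantCoeff_YSer]; exact one_ne_zero),
    mul_one]

variable (p : ℕ) [hp : Fact p.Prime] {V : ValuationSubring ℂ}
  [CharP (IsLocalRing.ResidueField V) p]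

theorem exists_hecke_polynomial (hp2 : p ≠ 2) (E Einf : MvPolynomial (Fin 4) V)
    (hPI : PairInvariant fun u v u' v' =>
      MvPolynomial.eval ![u, v, u', v'] (MvPolynomial.map V.subtype E))
    (hinf : ∀ u v u' v', MvPolynomial.eval ![u, v, u', v'] (MvPolynomial.map V.subtype Einf) =
      ((p : ℂ) ^ 2)⁻¹ * MvPolynomial.eval ![u, v, (p : ℂ) ^ 2 * u', (p : ℂ) ^ 2 * v']
        (MvPolynomial.map V.subtype E))
    (hfrob : MvPolynomial.map (frobenius (IsLocalRing.ResidueField V) p)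
      (MvPolynomial.map (IsLocalRing.residue V) E) = MvPolynomial.map (IsLocalRing.residue V) E)
    {R : (IsLocalRing.ResidueField V)[X]} (hR : R.natDegree ≤ 2 * (p + 1))
    (hRE : ∀ L : PowerSeries (IsLocalRing.ResidueField V), L * YSer _ = XSer _ →
      polyAt (MvPolynomial.map (IsLocalRing.residue V) Einf) (XSer _) (YSer _) (XSer _ ^ p)
          (YSer _ ^ p) *
        polyAt (MvPolynomial.map (IsLocalRing.residue V) E) (XSer _ ^ p) (YSer _ ^ p) (XSer _)
          (YSer _) = YSer _ ^ (2 * (p + 1)) * R.eval₂ PowerSeries.C L) :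
    ∃ P : V[X], P.natDegree ≤ 2 * (p + 1) ∧ P.map (IsLocalRing.residue V) = R ∧
      ∀ τ : ℍ, thY τ ≠ 0 → heckeProd p (fun u v u' v' =>
        MvPolynomial.eval ![u, v, u', v'] (MvPolynomial.map V.subtype E)) τ =
        thY τ ^ (2 * (p + 1)) * (P.map V.subtype).eval (thX τ / thY τ) := by
  obtain ⟨ζ, a, h1, -, h3⟩ := exists_hecke_isobaric p hp2 E Einf hPI hinf hfrob
  obtain ⟨P, hPd, hPa⟩ := exists_polynomial_coeff_eq (2 * (p + 1)) a
  refine ⟨P, hPd, ?_, fun τ hτ => ?_⟩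
  · obtain ⟨L, hL⟩ := exists_lambdaSeries (IsLocalRing.ResidueField V)
    rw [hRE L hL, ← isobaric_coeff_eq_eval₂ PowerSeries.C hR hL] at h3
    have h16 : (16 : IsLocalRing.ResidueField V) ≠ 0 := by
      have := (isUnit_sixteen (V := V) p hp2).map (IsLocalRing.residue V)
      rw [map_ofNat] at this
      exact this.ne_zero
    have h4 := isobaric_XSer_YSer_injective h16 h3
    ext k
    rw [coeff_map]
    rcases le_or_gt k (2 * (p + 1)) with hk | hk
    · rw [hPa k hk, h4 k hk]
    · rw [coeff_eq_zero_of_natDegree_lt (hPd.trans_lt hk), map_zero,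
        coeff_eq_zero_of_natDegree_lt (hR.trans_lt hk)]
  · rw [h1, eval_map, ← isobaric_coeff_eq_eval₂ V.subtype hPd (div_mul_cancel₀ _ hτ)]
    exact isobaric_congr (fun k hk => by rw [hPa k hk]; rfl) _ _

/-- The modular polynomial of level `p` for `λ`, restricted to the diagonal. -/
theorem exists_kronecker_polynomial (V : ValuationSubring ℂ) [CharP (IsLocalRing.ResidueField V) p]
    (hp2 : p ≠ 2) :
    ∃ P : V[X], P.natDegree ≤ 2 * (p + 1) ∧
      P.map (IsLocalRing.residue V) = -(X ^ p - X) ^ 2 ∧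
      ∀ τ : ℍ, thY τ ≠ 0 → heckeProd p (fun u v u' v' => u * v' - u' * v) τ =
        thY τ ^ (2 * (p + 1)) * (P.map V.subtype).eval (thX τ / thY τ) := by
  have hp0 : (p : ℂ) ≠ 0 := by exact_mod_cast hp.out.ne_zero
  let E : MvPolynomial (Fin 4) V := MvPolynomial.X 0 * MvPolynomial.X 3 -
    MvPolynomial.X 2 * MvPolynomial.X 1
  have hE : (fun u v u' v' : ℂ => MvPolynomial.eval ![u, v, u', v'] (MvPolynomial.map V.subtype E)) =
      fun u v u' v' => u * v' - u' * v := by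
    funext u v u' v'; simp [E]
  rw [← hE]
  refine exists_hecke_polynomial p hp2 E E ?_ ?_ ?_ ?_ ?_
  · rw [hE]
    refine ⟨fun t u v u' v' => by ring, Or.inr fun u v u' v' => by ring,
      Or.inr fun u v u' v' => by ring⟩
  · intro u v u' v'
    simp [E]
    field_simp
  · simp [E]
  · rw [natDegree_neg]
    have h : ((X : (IsLocalRing.ResidueField V)[X]) ^ p - X).natDegree ≤ p := by
      refine (natDegree_sub_le _ _).trans (max_le (natDegree_X_pow_le p) ?_)
      exact natDegree_X_le.trans hp.out.one_le
    refine natDegree_pow_le.trans ?_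
    omega
  · intro L hL
    simp only [E, polyAt, map_sub, map_mul, MvPolynomial.map_X, MvPolynomial.eval₂_sub,
      MvPolynomial.eval₂_mul, MvPolynomial.eval₂_X, eval₂_neg, eval₂_pow, eval₂_sub, eval₂_X]
    simp only [Matrix.cons_val]
    rw [← hL]
    ring

/-- The truncated hypergeometric polynomial `∑ C(m,n)² y^n`. -/
def hassePoly (k : Type*) [CommRing k] (m : ℕ) : k[X] :=
  ∑ n ∈ range (m + 1), C ((m.choose n : k) ^ 2) * X ^ n

lemma natDegree_hassePoly_le (k : Type*) [CommRing k] (m : ℕ) : (hassePoly k m).natDegree ≤ m := by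
  refine natDegree_sum_le_of_forall_le _ _ fun n hn => ?_
  exact (natDegree_C_mul_X_pow_le _ _).trans (by have := mem_range.mp hn; omega)

lemma coeff_hassePoly (k : Type*) [CommRing k] {m n : ℕ} (hn : n ≤ m) :
    (hassePoly k m).coeff n = (m.choose n : k) ^ 2 := by
  rw [hassePoly, finsetSum_coeff, sum_eq_single n]
  · rw [coeff_C_mul_X_pow, if_pos rfl]
  · intro j _ hj; rw [coeff_C_mul_X_pow, if_neg (Ne.symm hj)]
  · intro h; exact absurd (mem_range.mpr (by omega)) h

/-- The polynomial detecting isogenies of degree `p` with `α² + ᾱ² = 2h`. -/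
theorem exists_trace_polynomial (V : ValuationSubring ℂ) [CharP (IsLocalRing.ResidueField V) p]
    {m : ℕ} (hm : p = 2 * m + 1) (h : ℤ) :
    ∃ P : V[X], P.map (IsLocalRing.residue V) = ((X ^ 2 - X + 1) *
        hassePoly (IsLocalRing.ResidueField V) m ^ 2 -
        C (h : IsLocalRing.ResidueField V) * (2 * X ^ (p + 1) - X - X ^ p + 2)) ^ 2 ∧
      ∀ τ : ℍ, thY τ ≠ 0 → heckeProd p (fun u v u' v' => u' ^ 2 - u' * v' + v' ^ 2 -
          (h : ℂ) * (2 * u * u' - u * v' - v * u' + 2 * v * v') + p ^ 2 * (u ^ 2 - u * v + v ^ 2)) τ =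
        thY τ ^ (2 * (p + 1)) * (P.map V.subtype).eval (thX τ / thY τ) := by
  have hp0 : (p : ℂ) ≠ 0 := by exact_mod_cast hp.out.ne_zero
  have hp2 : p ≠ 2 := by omega
  let x : Fin 4 → MvPolynomial (Fin 4) V := MvPolynomial.X
  let B : MvPolynomial (Fin 4) V := 2 * x 0 * x 2 - x 0 * x 3 - x 1 * x 2 + 2 * x 1 * x 3
  let E : MvPolynomial (Fin 4) V := x 2 ^ 2 - x 2 * x 3 + x 3 ^ 2 - (h : MvPolynomial (Fin 4) V) * B +
    (p : MvPolynomial (Fin 4) V) ^ 2 * (x 0 ^ 2 - x 0 * x 1 + x 1 ^ 2)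
  let Einf : MvPolynomial (Fin 4) V := (p : MvPolynomial (Fin 4) V) ^ 2 *
    (x 2 ^ 2 - x 2 * x 3 + x 3 ^ 2) - (h : MvPolynomial (Fin 4) V) * B +
    (x 0 ^ 2 - x 0 * x 1 + x 1 ^ 2)
  have hE : (fun u v u' v' : ℂ => MvPolynomial.eval ![u, v, u', v'] (MvPolynomial.map V.subtype E)) =
      fun u v u' v' : ℂ => u' ^ 2 - u' * v' + v' ^ 2 -
          (h : ℂ) * (2 * u * u' - u * v' - v * u' + 2 * v * v') + p ^ 2 * (u ^ 2 - u * v + v ^ 2) := by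
    funext u v u' v'; simp [E, B, x]
  rw [← hE]
  obtain ⟨P, -, hP⟩ := exists_hecke_polynomial p hp2 E Einf (R := ((X ^ 2 - X + 1) *
        hassePoly (IsLocalRing.ResidueField V) m ^ 2 -
        C (h : IsLocalRing.ResidueField V) * (2 * X ^ (p + 1) - X - X ^ p + 2)) ^ 2) (by
    rw [hE]
    refine ⟨fun t u v u' v' => by ring, Or.inl fun u v u' v' => by ring,
      Or.inl fun u v u' v' => by ring⟩) (by
    intro u v u' v'
    simp [E, Einf, B, x]
    field_simp) (by simp [E, B, x]) (by
    have h1 : ((X ^ 2 - X + 1) * hassePoly (IsLocalRing.ResidueField V) m ^ 2).natDegree ≤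
        p + 1 := by
      refine natDegree_mul_le.trans ?_
      have a1 : (X ^ 2 - X + 1 : (IsLocalRing.ResidueField V)[X]).natDegree ≤ 2 := by
        compute_degree
      have a2 : (hassePoly (IsLocalRing.ResidueField V) m ^ 2).natDegree ≤ 2 * m :=
        natDegree_pow_le.trans (Nat.mul_le_mul_left 2 (natDegree_hassePoly_le _ m))
      omega
    have h2 : (C (h : IsLocalRing.ResidueField V) *
        (2 * X ^ (p + 1) - X - X ^ p + 2)).natDegree ≤ p + 1 := by
      refine (natDegree_C_mul_le _ _).trans ?_
      refine (natDegree_add_le _ _).trans (max_le ((natDegree_sub_le _ _).trans (max_le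
        ((natDegree_sub_le _ _).trans (max_le ?_ ?_)) ?_)) ?_)
      · rw [← map_ofNat (C : (IsLocalRing.ResidueField V) →+* _) 2]
        exact natDegree_C_mul_X_pow_le _ _
      · exact natDegree_X_le.trans (by omega)
      · exact (natDegree_X_pow_le _).trans (by omega)
      · rw [natDegree_ofNat]; omega
    refine natDegree_pow_le.trans (Nat.mul_le_mul_left 2 ?_)
    exact (natDegree_sub_le _ _).trans (max_le h1 h2)) (by
    intro L hL
    have hH := hasse_isobaric_eq_one p (IsLocalRing.ResidueField V) hm
    have hH2 : YSer (IsLocalRing.ResidueField V) ^ m *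
        (hassePoly (IsLocalRing.ResidueField V) m).eval₂ PowerSeries.C L = 1 := by
      rw [← hH, ← isobaric_coeff_eq_eval₂ PowerSeries.C (natDegree_hassePoly_le _ m) hL]
      exact isobaric_congr (fun k hk => by rw [coeff_hassePoly _ hk]) _ _
    have hpk : (p : PowerSeries (IsLocalRing.ResidueField V)) = 0 := by
      rw [← map_natCast (PowerSeries.C (R := IsLocalRing.ResidueField V)), CharP.cast_eq_zero,
        map_zero]
    have hYp : YSer (IsLocalRing.ResidueField V) ^ (p + 1) =
        (YSer (IsLocalRing.ResidueField V) ^ m) ^ 2 * YSer (IsLocalRing.ResidueField V) ^ 2 := by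
      rw [hm]; ring
    simp only [E, Einf, B, x, polyAt, map_sub, map_add, map_mul, map_pow, map_intCast, map_natCast,
      map_ofNat, MvPolynomial.map_X, ← MvPolynomial.coe_eval₂Hom, MvPolynomial.eval₂Hom_X']
    have hh : eval₂ PowerSeries.C L (h : (IsLocalRing.ResidueField V)[X]) = h :=
      map_intCast (eval₂RingHom (PowerSeries.C (R := IsLocalRing.ResidueField V)) L) h
    simp only [eval₂_pow, eval₂_sub, eval₂_mul, eval₂_add, eval₂_X, eval₂_one, eval₂_ofNat, hh]
    simp only [Matrix.cons_val, hpk]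
    set Y := YSer (IsLocalRing.ResidueField V)
    set H := (hassePoly (IsLocalRing.ResidueField V) m).eval₂ PowerSeries.C L
    have key : Y ^ 2 * (L ^ 2 - L + 1) = Y ^ (p + 1) * ((L ^ 2 - L + 1) * H ^ 2) := by
      rw [hYp]
      linear_combination -(Y ^ 2 * (L ^ 2 - L + 1)) * (Y ^ m * H + 1) * hH2
    have e1 : XSer (IsLocalRing.ResidueField V) ^ 2 - XSer _ * Y + Y ^ 2 = Y ^ 2 * (L ^ 2 - L + 1) := by
      rw [← hL]; ring
    have e2 : ∀ hh : PowerSeries (IsLocalRing.ResidueField V),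
        (Y ^ 2 * (L ^ 2 - L + 1) - hh * (Y ^ (p + 1) * (2 * L ^ (p + 1) - L - L ^ p + 2))) ^ 2 =
        Y ^ (2 * (p + 1)) * ((L ^ 2 - L + 1) * H ^ 2 - hh * (2 * L ^ (p + 1) - L - L ^ p + 2)) ^ 2 := by
      intro hh
      rw [key]; ring
    rw [← e2, ← e1, ← hL]
    ring)
  exact ⟨P, hP⟩

end ModularPolynomials

end

section

open Finset

section FixedPoints

set_option linter.unusedSectionVars false

open UpperHalfPlane hiding I
open ModularGroup Matrix MatrixGroups Polynomial

variable (p : ℕ) [hp : Fact p.Prime]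

/-- An integral matrix `!![a, b; c, d] ≡ 1` modulo `2`, of determinant `p`, fixing `τ`, such that
`c` and `a + d` are prime to `p`. -/
structure FixingMatrix (τ : ℍ) (a b c d : ℤ) : Prop where
  det : a * d - b * c = p
  odd_a : Odd a
  even_b : Even b
  even_c : Even c
  odd_d : Odd d
  fix : (a : ℂ) * τ + b = τ * (c * τ + d)
  c_ne : (c : ZMod p) ≠ 0
  tr_ne : ((a + d : ℤ) : ZMod p) ≠ 0

variable {p} {τ : ℍ} {a b c d : ℤ}

lemma FixingMatrix.adj (h : FixingMatrix p τ a b c d) : FixingMatrix p τ d (-b) (-c) a where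
  det := by linear_combination h.det
  odd_a := h.odd_d
  even_b := h.even_b.neg
  even_c := h.even_c.neg
  odd_d := h.odd_a
  fix := by push_cast; linear_combination -h.fix
  c_ne := by simpa using h.c_ne
  tr_ne := by rw [add_comm]; exact h.tr_ne

lemma intCast_zmod_two_of_odd {n : ℤ} (h : Odd n) : ((n : ℤ) : ZMod 2) = 1 := by
  obtain ⟨r, rfl⟩ := h
  push_cast
  have : (2 : ZMod 2) = 0 := rfl
  rw [this]; ring

lemma intCast_zmod_two_of_even {n : ℤ} (h : Even n) : ((n : ℤ) : ZMod 2) = 0 := by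
  obtain ⟨r, rfl⟩ := h
  push_cast
  exact CharTwo.add_self_eq_zero _

lemma FixingMatrix.exists_heckePt (h : FixingMatrix p τ a b c d) (hp2 : p ≠ 2) {n : ℤ}
    (hn : (2 * n * c : ZMod p) = d) : ∃ β : ℂ, β * (c * τ + d) = p ∧
      thX (heckePt p τ n) = β ^ 2 * thX τ ∧ thY (heckePt p τ n) = β ^ 2 * thY τ := by
  have hp0 : (p : ℂ) ≠ 0 := by exact_mod_cast hp.out.ne_zero
  have hodd : Odd (p : ℤ) := by exact_mod_cast hp.out.odd_of_ne_two hp2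
  obtain ⟨l, hl⟩ : (p : ℤ) ∣ d - 2 * n * c := by
    rw [← ZMod.intCast_zmod_eq_zero_iff_dvd]
    push_cast
    rw [hn, sub_self]
  have hpc : IsCoprime (p : ℤ) c := by
    rw [(Nat.prime_iff_prime_int.mp hp.out).irreducible.coprime_iff_not_dvd]
    intro h1
    exact h.c_ne ((ZMod.intCast_zmod_eq_zero_iff_dvd c p).mpr h1)
  obtain ⟨k, hk⟩ : (p : ℤ) ∣ b - 2 * n * a := by
    refine hpc.dvd_of_dvd_mul_left ?_
    exact ⟨a * l - 1, by linear_combination -h.det + a * hl⟩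
  have hdet : a * l - k * c = 1 := by
    have hpz : (p : ℤ) ≠ 0 := by exact_mod_cast hp.out.ne_zero
    apply mul_left_cancel₀ hpz
    linear_combination h.det - a * hl + c * hk
  have hkeven : Even k := by
    have : Even ((p : ℤ) * k) := by
      rw [← hk]
      exact h.even_b.sub (by rw [mul_assoc]; exact even_two_mul _)
    rcases Int.even_mul.mp this with h1 | h1
    · exact absurd h1 (Int.not_even_iff_odd.mpr hodd)
    · exact h1
  have hlodd : Odd l := by
    have : Odd ((p : ℤ) * l) := by
      rw [← hl]
      exact h.odd_d.sub_even (by rw [mul_assoc]; exact even_two_mul _)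
    exact (Int.odd_mul.mp this).2
  let γ : SL(2, ℤ) := ⟨!![a, k; c, l], by rw [Matrix.det_fin_two_of]; exact hdet⟩
  have hred : redModTwo γ = 1 := by
    ext i j
    fin_cases i <;> fin_cases j
    · exact intCast_zmod_two_of_odd h.odd_a
    · exact intCast_zmod_two_of_even hkeven
    · exact intCast_zmod_two_of_even h.even_c
    · exact intCast_zmod_two_of_odd hlodd
  let w : ℍ := ⟨heckePt p τ n, heckePt_im_pos p τ.im_pos n⟩
  have hw : (w : ℂ) = heckePt p τ n := rfl
  have hkc : (p : ℂ) * k = b - 2 * n * a := by exact_mod_cast hk.symm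
  have hlc : (p : ℂ) * l = d - 2 * n * c := by exact_mod_cast hl.symm
  have haut : autFac γ w = (c * τ + d) / p := by
    rw [hw, autFac, heckePt]
    simp [γ]
    field_simp
    linear_combination hlc
  have hα : (c * τ + d : ℂ) ≠ 0 := by
    intro h0
    have := autFac_ne_zero γ w
    rw [haut, h0, zero_div] at this
    exact this rfl
  have hsm : ((γ • w : ℍ) : ℂ) = τ := by
    rw [coe_smul_eq, haut, hw, heckePt, div_eq_iff (div_ne_zero hα hp0)]
    simp [γ]
    field_simp
    linear_combination hkc + h.fix
  refine ⟨p / (c * τ + d), by field_simp, ?_, ?_⟩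
  · have := thX_smul γ w
    rw [hsm, haut, hred, (repAct_one _ _).1, hw] at this
    rw [this]; field_simp
  · have := thY_smul γ w
    rw [hsm, haut, hred, (repAct_one _ _).2, hw] at this
    rw [this]; field_simp

lemma FixingMatrix.exists_index (h : FixingMatrix p τ a b c d) (hp2 : p ≠ 2) :
    ∃ (j : ZMod p) (β : ℂ), 2 * j * c = d ∧ β * (c * τ + d) = p ∧
      thX (heckePt p τ j.val) = β ^ 2 * thX τ ∧ thY (heckePt p τ j.val) = β ^ 2 * thY τ := by
  have h2 : (2 : ZMod p) ≠ 0 := by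
    intro h
    have : (p : ℕ) ∣ 2 := (ZMod.natCast_eq_zero_iff 2 p).mp (by exact_mod_cast h)
    exact hp2 ((Nat.prime_dvd_prime_iff_eq hp.out Nat.prime_two).mp this)
  have hc := h.c_ne
  have hj : (2 * (d / (2 * c)) * c : ZMod p) = d := by field_simp
  obtain ⟨β, hβ⟩ := h.exists_heckePt hp2 (n := ((d / (2 * c) : ZMod p).val : ℤ)) (by
    simpa using hj)
  exact ⟨_, β, hj, hβ⟩

lemma FixingMatrix.heckeProd_eq_zero (h : FixingMatrix p τ a b c d) (hp2 : p ≠ 2) {t : ℤ}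
    (ht : a + d = 2 * t) : heckeProd p (fun u v u' v' => u' ^ 2 - u' * v' + v' ^ 2 -
      ((2 * t ^ 2 - p : ℤ) : ℂ) * (2 * u * u' - u * v' - v * u' + 2 * v * v') +
        p ^ 2 * (u ^ 2 - u * v + v ^ 2)) τ = 0 := by
  obtain ⟨j, β, -, hβ, hX, hY⟩ := h.exists_index hp2
  rw [heckeProd]
  apply mul_eq_zero_of_right
  refine prod_eq_zero (mem_univ j) ?_
  rw [hX, hY]
  have hdet : (a * d - b * c : ℂ) = p := by exact_mod_cast h.det
  have htr : (a + d : ℂ) = 2 * t := by exact_mod_cast ht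
  have hp0 : (p : ℂ) ≠ 0 := by exact_mod_cast hp.out.ne_zero
  set α : ℂ := c * τ + d with hα
  have hα0 : α ≠ 0 := by rintro h0; rw [h0, mul_zero] at hβ; exact hp0 hβ.symm
  have hsum : α + β = 2 * t := by
    apply mul_left_cancel₀ hα0
    rw [← htr]
    linear_combination hβ - hdet - c * h.fix + (α - (a : ℂ) + c * τ) * hα
  have key : (β ^ 2) ^ 2 - 2 * (2 * t ^ 2 - p : ℂ) * β ^ 2 + p ^ 2 = 0 := by
    rw [← hβ]
    linear_combination β ^ 2 * (α + β + 2 * t) * hsum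
  push_cast
  linear_combination (thX τ ^ 2 - thX τ * thY τ + thY τ ^ 2) * key

lemma differentiableAt_thY {z : ℂ} (hz : 0 < z.im) : DifferentiableAt ℂ thY z :=
  (differentiableAt_jacobiTheta hz).pow 4

lemma differentiableAt_thX {z : ℂ} (hz : 0 < z.im) : DifferentiableAt ℂ thX z := by
  have h : DifferentiableAt ℂ (fun z => jacobiTheta (z + 1)) z :=
    (differentiableAt_jacobiTheta (by simpa using hz)).comp z (differentiableAt_id.add_const 1)
  exact ((differentiableAt_jacobiTheta hz).pow 4).sub (h.pow 4)

/-- The modular function `λ`. -/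
def lam (z : ℂ) : ℂ := thX z / thY z

lemma hasDerivAt_mul_mul_of_zero {f g k : ℂ → ℂ} {z : ℂ} (hf : DifferentiableAt ℂ f z)
    (hg : DifferentiableAt ℂ g z) (hk : DifferentiableAt ℂ k z) (hg0 : g z = 0) (hk0 : k z = 0) :
    HasDerivAt (fun w => f w * (g w * k w)) 0 z := by
  have h1 := hg.hasDerivAt.mul hk.hasDerivAt
  have h2 := hf.hasDerivAt.mul h1
  have e : deriv f z * (g * k) z + f z * (deriv g z * k z + g z * deriv k z) = 0 := by
    simp [hg0, hk0]
  rw [e] at h2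
  exact h2

lemma FixingMatrix.hasDerivAt_heckeProd (h : FixingMatrix p τ a b c d) (hp2 : p ≠ 2) :
    heckeProd p (fun u v u' v' => u * v' - u' * v) τ = 0 ∧
      HasDerivAt (heckeProd p (fun u v u' v' => u * v' - u' * v)) 0 τ := by
  obtain ⟨j, β, hj, -, hX, hY⟩ := h.exists_index hp2
  obtain ⟨j', β', hj', -, hX', hY'⟩ := h.adj.exists_index hp2
  have hne : j ≠ j' := by
    rintro rfl
    apply h.tr_ne
    push_cast at hj' ⊢
    rw [← hj, ← hj']; ring
  let F : ZMod p → ℂ → ℂ := fun j z =>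
    thX z * thY (heckePt p z j.val) - thX (heckePt p z j.val) * thY z
  have hF : F j τ = 0 := by simp only [F]; rw [hX, hY]; ring
  have hF' : F j' τ = 0 := by simp only [F]; rw [hX', hY']; ring
  have hdpt : ∀ n : ℤ, DifferentiableAt ℂ (fun z => heckePt p z n) τ := fun n => by
    unfold heckePt
    exact (differentiableAt_id.add_const _).div_const _
  have hdF : ∀ i, DifferentiableAt ℂ (F i) τ := fun i => by
    have e1 : DifferentiableAt ℂ (fun z => thX (heckePt p z i.val)) τ :=
      DifferentiableAt.comp (τ : ℂ) (differentiableAt_thX (heckePt_im_pos p τ.im_pos _)) (hdpt _)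
    have e2 : DifferentiableAt ℂ (fun z => thY (heckePt p z i.val)) τ :=
      DifferentiableAt.comp (τ : ℂ) (differentiableAt_thY (heckePt_im_pos p τ.im_pos _)) (hdpt _)
    exact ((differentiableAt_thX τ.im_pos).mul e2).sub (e1.mul (differentiableAt_thY τ.im_pos))
  have hpz : 0 < ((p : ℂ) * τ).im := by
    have h1 : (0 : ℝ) < p := by exact_mod_cast hp.out.pos
    have h2 := τ.im_pos
    simp; positivity
  let G : ℂ → ℂ := fun z => ((p : ℂ) ^ 2)⁻¹ * (thX z * ((p : ℂ) ^ 2 * thY (p * z)) -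
    ((p : ℂ) ^ 2 * thX (p * z)) * thY z) * ∏ i ∈ (univ.erase j).erase j', F i z
  have hdG : DifferentiableAt ℂ G τ := by
    have hmul : DifferentiableAt ℂ (fun z : ℂ => (p : ℂ) * z) τ := differentiableAt_id.const_mul _
    have e1 : DifferentiableAt ℂ (fun z => thX (p * z)) τ :=
      DifferentiableAt.comp (τ : ℂ) (differentiableAt_thX hpz) hmul
    have e2 : DifferentiableAt ℂ (fun z => thY (p * z)) τ :=
      DifferentiableAt.comp (τ : ℂ) (differentiableAt_thY hpz) hmul
    have e3 : DifferentiableAt ℂ (fun z => ∏ i ∈ (univ.erase j).erase j', F i z) τ :=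
      DifferentiableAt.fun_finsetProd fun i _ => hdF i
    exact ((((differentiableAt_thX τ.im_pos).mul (e2.const_mul _)).sub
      ((e1.const_mul _).mul (differentiableAt_thY τ.im_pos))).const_mul _).mul e3
  have hfun : heckeProd p (fun u v u' v' => u * v' - u' * v) = fun z => G z * (F j z * F j' z) := by
    funext z
    simp only [heckeProd, G]
    rw [← mul_prod_erase univ (fun i : ZMod p => thX z * thY (heckePt p z i.val) -
      thX (heckePt p z i.val) * thY z) (mem_univ j), ← mul_prod_erase (univ.erase j)
      (fun i : ZMod p => thX z * thY (heckePt p z i.val) -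
      thX (heckePt p z i.val) * thY z) (mem_erase.mpr ⟨hne.symm, mem_univ j'⟩)]
    simp only [F]
    ring
  rw [hfun]
  exact ⟨by simp only [hF, zero_mul, mul_zero], hasDerivAt_mul_mul_of_zero hdG (hdF j) (hdF j') hF hF'⟩

lemma differentiableAt_lam {z : ℂ} (hz : 0 < z.im) (hY : thY z ≠ 0) : DifferentiableAt ℂ lam z :=
  (differentiableAt_thX hz).div (differentiableAt_thY hz) hY

lemma FixingMatrix.isRoot_kronecker (h : FixingMatrix p τ a b c d) (hp2 : p ≠ 2)
    {P : ℂ[X]} (hP : ∀ τ : ℍ, thY τ ≠ 0 → heckeProd p (fun u v u' v' => u * v' - u' * v) τ =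
        thY τ ^ (2 * (p + 1)) * P.eval (thX τ / thY τ)) (hY : thY τ ≠ 0) (hd : deriv lam τ ≠ 0) :
    P.IsRoot (lam τ) ∧ P.derivative.IsRoot (lam τ) := by
  obtain ⟨h0, h1⟩ := h.hasDerivAt_heckeProd hp2
  have hroot : P.eval (lam τ) = 0 := by
    rw [hP τ hY] at h0
    exact (mul_eq_zero.mp h0).resolve_left (pow_ne_zero _ hY)
  refine ⟨hroot, ?_⟩
  have hev : heckeProd p (fun u v u' v' => u * v' - u' * v) =ᶠ[nhds (τ : ℂ)]
      fun z => thY z ^ (2 * (p + 1)) * P.eval (lam z) := by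
    have h2 : ∀ᶠ z in nhds (τ : ℂ), thY z ≠ 0 :=
      (differentiableAt_thY τ.im_pos).continuousAt.eventually_ne hY
    have h3 : ∀ᶠ z in nhds (τ : ℂ), 0 < z.im :=
      Complex.continuous_im.continuousAt.eventually (lt_mem_nhds τ.im_pos)
    filter_upwards [h2, h3] with z hz hzi
    exact hP ⟨z, hzi⟩ hz
  have h4 : HasDerivAt (fun z => thY z ^ (2 * (p + 1)) * P.eval (lam z)) _ (τ : ℂ) :=
    ((differentiableAt_thY τ.im_pos).pow (2 * (p + 1))).hasDerivAt.mul
    (HasDerivAt.comp (τ : ℂ) (P.hasDerivAt (lam τ)) (differentiableAt_lam τ.im_pos hY).hasDerivAt)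
  have h5 := (h1.congr_of_eventuallyEq hev.symm).unique h4
  simp only [hroot, mul_zero, zero_add] at h5
  have h6 := (mul_eq_zero.mp h5.symm).resolve_left (by simpa using pow_ne_zero (2 * (p + 1)) hY)
  exact (mul_eq_zero.mp h6).resolve_right hd

end FixedPoints

end

section

open Finset Polynomial

section Reduction

set_option linter.unusedSectionVars false

open UpperHalfPlane hiding I

lemma X_sub_C_sq_dvd {R : Type*} [CommRing R] {P : R[X]} {r : R} (h0 : P.IsRoot r)
    (h1 : P.derivative.IsRoot r) : (X - C r) ^ 2 ∣ P := by
  obtain ⟨g, rfl⟩ := dvd_iff_isRoot.mpr h0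
  have hg : g.IsRoot r := by
    rw [IsRoot.def] at h1 ⊢
    simpa [derivative_mul] using h1
  rw [pow_two]
  exact mul_dvd_mul_left _ (dvd_iff_isRoot.mpr hg)

lemma isRoot_of_X_sub_C_sq_dvd {R : Type*} [CommRing R] {P : R[X]} {r : R} (h : (X - C r) ^ 2 ∣ P) :
    P.IsRoot r ∧ P.derivative.IsRoot r := by
  obtain ⟨g, rfl⟩ := h
  simp [IsRoot.def, derivative_mul, derivative_pow]

/-- Distinct double roots of a lift of `-(X ^ p - X) ^ 2` have distinct reductions. -/
lemma ne_of_double_roots {R k : Type*} [CommRing R] [IsDomain R] [Field k] (f : R →+* k) (p : ℕ)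
    [Fact p.Prime] [CharP k p] {P : R[X]} (hP : P.map f = -(X ^ p - X) ^ 2) {r s : R}
    (hr : (X - C r) ^ 2 ∣ P) (hs : (X - C s) ^ 2 ∣ P) (hrs : r ≠ s) : f r ≠ f s := by
  intro hf
  obtain ⟨g, rfl⟩ := hr
  obtain ⟨h0, h1⟩ := isRoot_of_X_sub_C_sq_dvd hs
  have hne : s - r ≠ 0 := sub_ne_zero.mpr hrs.symm
  have hg0 : g.IsRoot s := by
    rw [IsRoot.def] at h0 ⊢
    simpa [hne] using h0
  have hg1 : g.derivative.IsRoot s := by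
    rw [IsRoot.def] at h1 hg0 ⊢
    simpa [derivative_mul, derivative_pow, hne, hg0] using h1
  obtain ⟨g2, rfl⟩ := X_sub_C_sq_dvd hg0 hg1
  simp only [Polynomial.map_mul, Polynomial.map_pow, Polynomial.map_sub, map_X, map_C, ← hf] at hP
  set l := f r
  have hlp : (X ^ p - X : k[X]).IsRoot l := by
    have := congrArg (eval l) hP
    rw [IsRoot.def]
    simpa using this.symm
  obtain ⟨w, hw⟩ := dvd_iff_isRoot.mpr hlp
  have hw0 : w.eval l = -1 := by
    have := congrArg (fun Q : k[X] => Q.derivative.eval l) hw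
    simpa [derivative_mul, derivative_X_pow] using this.symm
  rw [hw] at hP
  have hcan : (X - C l) ^ 2 * g2.map f = -w ^ 2 := by
    apply mul_left_cancel₀ (pow_ne_zero 2 (X_sub_C_ne_zero l))
    rw [hP]; ring
  have := congrArg (eval l) hcan
  simp [hw0] at this

lemma reflect_X_pow_sub_X (k : Type*) [CommRing k] {p : ℕ} :
    reflect (2 * (p + 1)) (-(X ^ p - X) ^ 2 : k[X]) = -(X ^ p - X) ^ 2 := by
  have e : (-(X ^ p - X) ^ 2 : k[X]) = -(X ^ (2 * p) - C 2 * X ^ (p + 1) + X ^ 2) := by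
    rw [map_ofNat]; ring
  rw [e, reflect_neg, reflect_add, reflect_sub, reflect_monomial, reflect_C_mul_X_pow,
    reflect_monomial, revAt_le (by omega), revAt_le (by omega), revAt_le (by omega),
    show 2 * (p + 1) - 2 * p = 2 by omega, show 2 * (p + 1) - (p + 1) = p + 1 by omega,
    show 2 * (p + 1) - 2 = 2 * p by omega]
  ring

lemma X_sub_C_inv_sq_dvd_reflect {k : Type*} [Field k] {P : k[X]} {N : ℕ}
    (hN : P.natDegree ≤ N) {r : k} (hr : r ≠ 0) (h : (X - C r) ^ 2 ∣ P) :
    (X - C r⁻¹) ^ 2 ∣ reflect N P := by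
  obtain ⟨g, rfl⟩ := h
  rcases eq_or_ne g 0 with rfl | hg
  · simp
  have hd : ((X - C r) ^ 2).natDegree = 2 := by simp
  have hgd : 2 + g.natDegree ≤ N := by
    rwa [natDegree_mul (pow_ne_zero 2 (X_sub_C_ne_zero r)) hg, hd] at hN
  have hN' : N = 2 + (N - 2) := by omega
  rw [hN', reflect_mul _ _ hd.le (by omega)]
  refine Dvd.dvd.mul_right ?_ _
  have e : reflect 2 ((X - C r) ^ 2) = (1 - C r * X) ^ 2 := by
    rw [pow_two, show (2 : ℕ) = 1 + 1 from rfl, reflect_mul _ _ (natDegree_X_sub_C r).le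
      (natDegree_X_sub_C r).le, reflect_sub, reflect_one_X, reflect_C, pow_one]
    ring
  rw [e]
  refine ⟨C (r ^ 2), ?_⟩
  have h1 : (C r * C r⁻¹ : k[X]) = 1 := by rw [← C_mul, mul_inv_cancel₀ hr, C_1]
  have h2 : (1 - C r * X : k[X]) = -(X - C r⁻¹) * C r := by linear_combination -h1
  rw [h2, C_pow]; ring

variable (p : ℕ) [hp : Fact p.Prime]

lemma exists_zmod_eq_of_pow_eq {k : Type*} [Field k] [CharP k p] {x : k} (hx : x ^ p = x) :
    ∃ l : ZMod p, ZMod.castHom (dvd_refl p) k l = x := by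
  have h1 := (Subfield.mem_bot_iff_pow_eq_self k p).mpr hx
  rw [← ZMod.fieldRange_castHom_eq_bot p] at h1
  exact h1

lemma map_hassePoly {R S : Type*} [CommRing R] [CommRing S] (f : R →+* S) (m : ℕ) :
    (hassePoly R m).map f = hassePoly S m := by
  simp [hassePoly, Polynomial.map_sum]

/-- Reduction modulo `p` of the values of `λ` at points with complex multiplication. -/
theorem exists_reduction {m : ℕ} (hm : p = 2 * m + 1) {ι : Type*} (S : Finset ι) (τ : ι → ℍ)
    (t : ι → ℤ)
    (hfix : ∀ i ∈ S, ∃ a b c d, FixingMatrix p (τ i) a b c d ∧ a + d = 2 * t i)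
    (hY : ∀ i ∈ S, thY (τ i) ≠ 0) (hd : ∀ i ∈ S, deriv lam (τ i) ≠ 0)
    (hinj : Set.InjOn (fun i => lam (τ i)) S) :
    ∃ S' ⊆ S, S.card ≤ S'.card + 1 ∧ ∃ l : ι → ZMod p, Set.InjOn l S' ∧
      ∀ i ∈ S', l i ^ 2 - l i + 1 = 0 ∨ (hassePoly (ZMod p) m).eval (l i) ^ 2 = (2 * t i : ℤ) ^ 2 := by
  have hp2 : p ≠ 2 := by omega
  obtain ⟨V, hV⟩ := exists_valuationSubring_above p
  obtain ⟨P, hPd, hPres, hP⟩ := exists_kronecker_polynomial p V hp2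
  have hdvd : ∀ i ∈ S, (X - C (lam (τ i))) ^ 2 ∣ P.map V.subtype := by
    intro i hi
    obtain ⟨a, b, c, d, h, -⟩ := hfix i hi
    obtain ⟨h1, h2⟩ := h.isRoot_kronecker hp2 hP (hY i hi) (hd i hi)
    exact X_sub_C_sq_dvd h1 h2
  have hsub : Function.Injective V.subtype := Subtype.val_injective
  have descend : ∀ (Q : V[X]) (r : V), (X - C (r : ℂ)) ^ 2 ∣ Q.map V.subtype → (X - C r) ^ 2 ∣ Q := by
    intro Q r h
    obtain ⟨h1, h2⟩ := isRoot_of_X_sub_C_sq_dvd h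
    rw [derivative_map] at h2
    exact X_sub_C_sq_dvd (IsRoot.of_map (f := V.subtype) h1 hsub)
      (IsRoot.of_map (f := V.subtype) h2 hsub)
  have hfilter : (S.filter fun i => lam (τ i) ∉ V).card ≤ 1 := by
    rw [card_le_one]
    intro i hi j hj
    rw [mem_filter] at hi hj
    by_contra hij
    have hne : ∀ k, lam (τ k) ∉ V → lam (τ k) ≠ 0 := fun k hk h0 => hk (h0 ▸ V.zero_mem)
    have hmem : ∀ k, lam (τ k) ∉ V → ∃ r : V, (r : ℂ) = (lam (τ k))⁻¹ ∧ IsLocalRing.residue V r = 0 := by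
      intro k hk
      have h1 : (lam (τ k))⁻¹ ∈ V.nonunits := V.inv_mem_nonunits_iff.mpr (Or.inr hk)
      rw [ValuationSubring.mem_nonunits_iff_exists_mem_maximalIdeal] at h1
      obtain ⟨h2, h3⟩ := h1
      exact ⟨⟨_, h2⟩, rfl, (IsLocalRing.residue_eq_zero_iff _).mpr h3⟩
    obtain ⟨r, hr, hr0⟩ := hmem i hi.2
    obtain ⟨s, hs, hs0⟩ := hmem j hj.2
    have hPd' : (P.map V.subtype).natDegree ≤ 2 * (p + 1) := natDegree_map_le.trans hPd
    have h1 := X_sub_C_inv_sq_dvd_reflect hPd' (hne i hi.2) (hdvd i hi.1)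
    have h2 := X_sub_C_inv_sq_dvd_reflect hPd' (hne j hj.2) (hdvd j hj.1)
    rw [reflect_map, ← hr] at h1
    rw [reflect_map, ← hs] at h2
    refine ne_of_double_roots (IsLocalRing.residue V) p (P := reflect (2 * (p + 1)) P) ?_
      (descend _ r h1) (descend _ s h2) ?_ (hr0.trans hs0.symm)
    · rw [← reflect_map, hPres, reflect_X_pow_sub_X]
    · intro hrs
      rw [hrs, hs] at hr
      exact hij (hinj hi.1 hj.1 (inv_injective hr).symm)
  refine ⟨S.filter fun i => lam (τ i) ∈ V, filter_subset _ _, ?_, ?_⟩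
  · have := card_filter_add_card_filter_not (s := S) (fun i => lam (τ i) ∈ V)
    omega
  have hl : ∀ i, ∃ l : ZMod p, i ∈ S.filter (fun i => lam (τ i) ∈ V) → ∃ r : V,
      (r : ℂ) = lam (τ i) ∧ ZMod.castHom (dvd_refl p) (IsLocalRing.ResidueField V) l =
        IsLocalRing.residue V r := by
    intro i
    by_cases hi : i ∈ S.filter (fun i => lam (τ i) ∈ V)
    · rw [mem_filter] at hi
      have hroot := (isRoot_of_X_sub_C_sq_dvd (descend P ⟨_, hi.2⟩ (hdvd i hi.1))).1
      have h1 := hroot.map (f := IsLocalRing.residue V)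
      rw [hPres, IsRoot.def] at h1
      simp only [eval_neg, eval_pow, eval_sub, eval_X, neg_eq_zero] at h1
      have h2 := sub_eq_zero.mp ((pow_eq_zero_iff two_ne_zero).mp h1)
      obtain ⟨l, hl⟩ := exists_zmod_eq_of_pow_eq p h2
      exact ⟨l, fun _ => ⟨⟨_, hi.2⟩, rfl, hl⟩⟩
    · exact ⟨0, fun h => absurd h hi⟩
  choose l hl using hl
  refine ⟨l, ?_, ?_⟩
  · intro i hi j hj hij
    obtain ⟨r, hr, hlr⟩ := hl i hi
    obtain ⟨s, hs, hls⟩ := hl j hj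
    have hiS := (mem_filter.mp hi).1
    have hjS := (mem_filter.mp hj).1
    by_contra hne
    have h1 := hdvd i hiS
    have h2 := hdvd j hjS
    rw [← hr] at h1
    rw [← hs] at h2
    refine ne_of_double_roots (IsLocalRing.residue V) p hPres (descend _ r h1) (descend _ s h2) ?_ ?_
    · intro hrs
      rw [hrs, hs] at hr
      exact hne (hinj hiS hjS hr.symm)
    · rw [← hlr, ← hls, hij]
  · intro i hi
    obtain ⟨r, hr, hlr⟩ := hl i hi
    have hiS := (mem_filter.mp hi).1
    obtain ⟨a, b, c, d, h, ht⟩ := hfix i hiS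
    obtain ⟨Q, hQres, hQ⟩ := exists_trace_polynomial p V hm (2 * t i ^ 2 - p)
    have h0 := h.heckeProd_eq_zero hp2 ht
    rw [hQ _ (hY i hiS)] at h0
    have h1 : (Q.map V.subtype).IsRoot (V.subtype r) := by
      rw [IsRoot.def]
      have h2 := (mul_eq_zero.mp h0).resolve_left (pow_ne_zero _ (hY i hiS))
      rw [← h2]
      congr 1
    have h2 := (IsRoot.of_map h1 hsub).map (f := IsLocalRing.residue V)
    rw [hQres, ← hlr] at h2
    have hmap : ((X ^ 2 - X + 1) * hassePoly (IsLocalRing.ResidueField V) m ^ 2 -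
        C ((2 * t i ^ 2 - p : ℤ) : IsLocalRing.ResidueField V) *
          (2 * X ^ (p + 1) - X - X ^ p + 2)) ^ 2 =
        (((X ^ 2 - X + 1) * hassePoly (ZMod p) m ^ 2 - C ((2 * t i ^ 2 - p : ℤ) : ZMod p) *
          (2 * X ^ (p + 1) - X - X ^ p + 2)) ^ 2).map
            (ZMod.castHom (dvd_refl p) (IsLocalRing.ResidueField V)) := by
      simp only [Polynomial.map_pow, Polynomial.map_sub, Polynomial.map_mul, Polynomial.map_add,
        map_X, Polynomial.map_one, Polynomial.map_ofNat, map_hassePoly, map_intCast,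
        Polynomial.map_intCast]
    rw [hmap] at h2
    have h3 := IsRoot.of_map h2 (ZMod.castHom (dvd_refl p) (IsLocalRing.ResidueField V)).injective
    rw [IsRoot.def, eval_pow] at h3
    have h4 := (pow_eq_zero_iff two_ne_zero).mp h3
    simp only [eval_sub, eval_mul, eval_add, eval_pow, eval_X, eval_one, eval_ofNat, eval_C] at h4
    rw [pow_succ (l i) p, ZMod.pow_card] at h4
    have hpz : (p : ZMod p) = 0 := ZMod.natCast_self p
    push_cast at h4 ⊢
    have h5 : (l i ^ 2 - l i + 1) * ((hassePoly (ZMod p) m).eval (l i) ^ 2 - (2 * t i) ^ 2) = 0 := by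
      linear_combination h4 - 2 * (l i ^ 2 - l i + 1) * hpz
    rcases mul_eq_zero.mp h5 with h6 | h6
    · exact Or.inl h6
    · exact Or.inr (sub_eq_zero.mp h6)

end Reduction

end

section

open Finset Polynomial

section LegendreFamily

set_option linter.unusedSectionVars false

variable (p : ℕ) [hp : Fact p.Prime]

lemma sum_pow_of_pos {K : Type*} [Field K] [Fintype K] {i : ℕ} (hi : i ≠ 0) :
    ∑ x : K, x ^ i = if Fintype.card K - 1 ∣ i then -1 else 0 := by
  rw [← FiniteField.sum_pow_units K i]
  let φ : Kˣ ↪ K := ⟨fun x => x, Units.val_injective⟩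
  have h : univ.map φ = univ \ {0} := by
    ext x
    simpa only [mem_map, mem_univ, Function.Embedding.coeFn_mk, true_and, mem_sdiff,
      mem_singleton, φ] using! isUnit_iff_ne_zero
  calc ∑ x : K, x ^ i = ∑ x ∈ univ \ {(0 : K)}, x ^ i := by
        rw [← sum_sdiff ({0} : Finset K).subset_univ, sum_singleton, zero_pow hi, add_zero]
    _ = ∑ x : Kˣ, (x ^ i : K) := by simp [φ, ← h, univ.sum_map φ]

/-- The trace of Frobenius, up to sign, of the Legendre curve. -/
def legendreSum (l : ZMod p) : ℤ := ∑ z : ZMod p, quadraticChar (ZMod p) (z * (z - 1) * (z - l))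

lemma ringChar_zmod_ne_two {m : ℕ} (hm : p = 2 * m + 1) : ringChar (ZMod p) ≠ 2 := by
  rw [ZMod.ringChar_zmod_n]; omega

lemma coeff_legendre (m : ℕ) (l : ZMod p) :
    (((X - C 1) * (X - C l)) ^ m : (ZMod p)[X]).coeff m =
      (-1) ^ m * (hassePoly (ZMod p) m).eval l := by
  have e : (((X - C 1) * (X - C l)) ^ m : (ZMod p)[X]) =
      (C 1 * X + C (-1)) ^ m * (C 1 * X + C (-l)) ^ m := by
    rw [mul_pow]; simp [sub_eq_add_neg]
  rw [e, coeff_mul, Nat.sum_antidiagonal_eq_sum_range_succ_mk, hassePoly, eval_finsetSum, mul_sum]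
  refine sum_congr rfl fun n hn => ?_
  have hn' : n ≤ m := by have := mem_range.mp hn; omega
  rw [coeff_C_mul_X_add_C_pow' _ _ _ _ hn', coeff_C_mul_X_add_C_pow' _ _ _ _ (Nat.sub_le _ _)]
  simp only [eval_mul, eval_C, eval_pow, eval_X]
  rw [Nat.choose_symm hn', Nat.sub_sub_self hn', neg_pow l]
  have h : ((-1 : ZMod p)) ^ (m - n) * (-1) ^ n = (-1) ^ m := by
    rw [← pow_add, Nat.sub_add_cancel hn']
  rw [← h]; ring

lemma legendreSum_cast {m : ℕ} (hm : p = 2 * m + 1) (l : ZMod p) :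
    (legendreSum p l : ZMod p) = -((-1) ^ m * (hassePoly (ZMod p) m).eval l) := by
  have hm0 : m ≠ 0 := by rintro rfl; exact hp.out.one_lt.ne' (by omega)
  have hcard : Fintype.card (ZMod p) / 2 = m := by rw [ZMod.card]; omega
  rw [legendreSum, Int.cast_sum]
  simp_rw [quadraticChar_eq_pow_of_char_ne_two' (ringChar_zmod_ne_two p hm), hcard]
  set g : (ZMod p)[X] := ((X - C 1) * (X - C l)) ^ m with hg
  have hgd : g.natDegree < 2 * m + 1 := by
    refine Nat.lt_succ_of_le (natDegree_pow_le.trans ?_)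
    rw [mul_comm]
    refine Nat.mul_le_mul_right m ?_
    exact natDegree_mul_le.trans (by rw [natDegree_X_sub_C, natDegree_X_sub_C])
  have h1 : ∀ z : ZMod p, (z * (z - 1) * (z - l)) ^ m =
      ∑ k ∈ range (2 * m + 1), g.coeff k * z ^ (m + k) := by
    intro z
    have : g.eval z = ((z - 1) * (z - l)) ^ m := by simp [hg]
    rw [mul_assoc, mul_pow, ← this, eval_eq_sum_range' hgd, mul_sum]
    exact sum_congr rfl fun k _ => by rw [pow_add]; ring
  simp_rw [h1]
  rw [sum_comm]
  simp_rw [← mul_sum]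
  rw [sum_eq_single m]
  · rw [sum_pow_of_pos (by omega), if_pos (by rw [ZMod.card]; exact ⟨1, by omega⟩), hg,
      coeff_legendre]
    ring
  · intro k hk hkm
    have hk' := mem_range.mp hk
    rw [sum_pow_of_pos (by omega), if_neg, mul_zero]
    rw [ZMod.card, hm, Nat.add_sub_cancel]
    rintro ⟨c, hc⟩
    rcases Nat.lt_or_ge c 2 with h | h
    · interval_cases c <;> omega
    · have : 2 * m * 2 ≤ 2 * m * c := Nat.mul_le_mul_left _ h
      omega
  · intro h; exact absurd (mem_range.mpr (by omega)) h

lemma even_legendreSum {m : ℕ} (hm : p = 2 * m + 1) {l : ZMod p} (h0 : l ≠ 0) (h1 : l ≠ 1) :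
    Even (legendreSum p l) := by
  have hE : ∀ s : Finset (ZMod p), (∀ z ∈ s, z * (z - 1) * (z - l) ≠ 0) →
      ((∑ z ∈ s, quadraticChar (ZMod p) (z * (z - 1) * (z - l)) : ℤ) : ZMod 2) = s.card := by
    intro s hs
    rw [Int.cast_sum, card_eq_sum_ones, Nat.cast_sum]
    refine sum_congr rfl fun z hz => ?_
    rcases quadraticChar_dichotomy (hs z hz) with h | h <;> rw [h] <;> rfl
  have hsub : ({0, 1, l} : Finset (ZMod p)) ⊆ univ := subset_univ _
  have hc3 : ({0, 1, l} : Finset (ZMod p)).card = 3 := by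
    rw [card_eq_three]
    exact ⟨0, 1, l, zero_ne_one, h0.symm, h1.symm, rfl⟩
  have hsum : legendreSum p l = ∑ z ∈ univ \ ({0, 1, l} : Finset (ZMod p)),
      quadraticChar (ZMod p) (z * (z - 1) * (z - l)) := by
    rw [legendreSum, ← sum_sdiff hsub]
    have : ∑ z ∈ ({0, 1, l} : Finset (ZMod p)), quadraticChar (ZMod p) (z * (z - 1) * (z - l)) = 0 := by
      refine sum_eq_zero fun z hz => ?_
      simp only [mem_insert, mem_singleton] at hz
      rcases hz with rfl | rfl | rfl <;> simp
    rw [this, add_zero]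
  rw [even_iff_two_dvd, show (2 : ℤ) = ((2 : ℕ) : ℤ) from rfl]
  refine (ZMod.intCast_zmod_eq_zero_iff_dvd _ 2).mp ?_
  have h2 := hE (univ \ {0, 1, l}) (fun z hz => by
    simp only [mem_sdiff, mem_univ, mem_insert, mem_singleton, true_and, not_or] at hz
    exact mul_ne_zero (mul_ne_zero hz.1 (sub_ne_zero.mpr hz.2.1)) (sub_ne_zero.mpr hz.2.2))
  rw [hsum]
  refine (by exact_mod_cast h2 : _ = _).trans ?_
  rw [card_sdiff_of_subset hsub, hc3, card_univ, ZMod.card, hm]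
  rw [show 2 * m + 1 - 3 = 2 * (m - 1) by omega]
  push_cast
  have : (2 : ZMod 2) = 0 := rfl
  rw [this, zero_mul]

lemma abs_legendreSum_le (l : ZMod p) : |legendreSum p l| ≤ p := by
  rw [legendreSum]
  refine (abs_sum_le_sum_abs _ _).trans ?_
  calc ∑ z : ZMod p, |quadraticChar (ZMod p) (z * (z - 1) * (z - l))| ≤ ∑ z : ZMod p, 1 := by
        refine sum_le_sum fun z _ => ?_
        rcases eq_or_ne (z * (z - 1) * (z - l)) 0 with h | h
        · rw [h]; simp
        · rcases quadraticChar_dichotomy h with h | h <;> rw [h] <;> simp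
    _ = p := by simp [ZMod.card]

lemma legendreSum_sq_eq {m : ℕ} (hm : p = 2 * m + 1) {l : ZMod p} (h0 : l ≠ 0) (h1 : l ≠ 1) {t : ℤ}
    (ht : |2 * t| < p) (h : (hassePoly (ZMod p) m).eval l ^ 2 = (2 * t : ℤ) ^ 2) :
    legendreSum p l ^ 2 = (2 * t) ^ 2 := by
  have h2 : ((legendreSum p l - 2 * t : ℤ) : ZMod p) * ((legendreSum p l + 2 * t : ℤ) : ZMod p) = 0 := by
    push_cast at h ⊢
    rw [legendreSum_cast p hm]
    have : ((-1 : ZMod p) ^ m) ^ 2 = 1 := by rw [← pow_mul, mul_comm, pow_mul]; simp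
    linear_combination ((-1 : ZMod p) ^ m) ^ 2 * h + (2 * t : ZMod p) ^ 2 * this
  have heven := even_legendreSum p hm h0 h1
  have habs := abs_le.mp (abs_legendreSum_le p l)
  have ht' := abs_lt.mp ht
  have key : ∀ u : ℤ, Even u → |u| < 2 * p → (u : ZMod p) = 0 → u = 0 := by
    intro u hu hlt hz
    obtain ⟨k, rfl⟩ := (ZMod.intCast_zmod_eq_zero_iff_dvd u p).mp hz
    have hpz : (0 : ℤ) < p := by exact_mod_cast hp.out.pos
    rw [abs_mul, abs_of_pos hpz, mul_comm] at hlt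
    have hk : |k| < 2 := lt_of_mul_lt_mul_right hlt hpz.le
    rcases Int.even_mul.mp hu with h3 | h3
    · exfalso
      rw [hm] at h3
      exact (Int.not_even_iff_odd.mpr ⟨(m : ℤ), by push_cast; ring⟩) h3
    · obtain ⟨r, rfl⟩ := h3
      have := abs_lt.mp hk
      have : r = 0 := by omega
      rw [this]; ring
  rcases mul_eq_zero.mp h2 with h3 | h3
  · have := key _ (heven.sub (even_two_mul t)) (abs_lt.mpr ⟨by linarith, by linarith⟩) h3
    rw [sub_eq_zero.mp this]
  · have := key _ (heven.add (even_two_mul t)) (abs_lt.mpr ⟨by linarith, by linarith⟩) h3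
    rw [eq_neg_of_add_eq_zero_left this]; ring

lemma clausenTrace_eq_sum (hp2 : p ≠ 2) (lam : ZMod p) :
    clausenTrace p lam = -∑ x : ZMod p, quadraticChar (ZMod p) ((x - 1) * (x ^ 2 + lam)) := by
  have hF : ringChar (ZMod p) ≠ 2 := by rwa [ZMod.ringChar_zmod_n]
  have hcard : (((Finset.univ : Finset (ZMod p × ZMod p)).filter
      (fun xy => xy.2 ^ 2 = (xy.1 - 1) * (xy.1 ^ 2 + lam))).card : ℤ) =
      ∑ x : ZMod p, (quadraticChar (ZMod p) ((x - 1) * (x ^ 2 + lam)) + 1) := by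
    rw [card_filter, Nat.cast_sum, ← univ_product_univ, sum_product]
    refine sum_congr rfl fun x _ => ?_
    rw [← quadraticChar_card_sqrts hF, ← Nat.cast_sum, ← card_filter]
    congr 2
    ext y; simp
  rw [clausenTrace, hcard, sum_add_distrib]
  simp [ZMod.card]
  ring

lemma clausenTrace_sq (hp2 : p ≠ 2) {l : ZMod p} (hl : 2 * l - 1 ≠ 0) :
    clausenTrace p (-(4 * l * (l - 1) + 1)⁻¹) ^ 2 = legendreSum p l ^ 2 := by
  have h2 : (2 : ZMod p) ≠ 0 := by
    intro h
    have : (p : ℕ) ∣ 2 := (ZMod.natCast_eq_zero_iff 2 p).mp (by exact_mod_cast h)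
    exact hp2 ((Nat.prime_dvd_prime_iff_eq hp.out Nat.prime_two).mp this)
  rw [clausenTrace_eq_sum p hp2, neg_sq]
  have hsq : (4 * l * (l - 1) + 1 : ZMod p) = (2 * l - 1) ^ 2 := by ring
  have e : Function.Bijective fun z : ZMod p => (2 * z - 1) / (2 * l - 1) := by
    rw [← Finite.injective_iff_bijective]
    intro z w h
    simp only at h
    rw [div_left_inj' hl] at h
    exact mul_left_cancel₀ h2 (by linear_combination h)
  rw [← e.sum_comp (fun x => quadraticChar (ZMod p) ((x - 1) * (x ^ 2 + -(4 * l * (l - 1) + 1)⁻¹)))]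
  have h3 : ∀ z : ZMod p, quadraticChar (ZMod p) (((2 * z - 1) / (2 * l - 1) - 1) *
      (((2 * z - 1) / (2 * l - 1)) ^ 2 + -(4 * l * (l - 1) + 1)⁻¹)) =
      quadraticChar (ZMod p) (2 * (2 * l - 1)) * quadraticChar (ZMod p) (z * (z - 1) * (z - l)) := by
    intro z
    have h4 : ((2 * z - 1) / (2 * l - 1) - 1) * (((2 * z - 1) / (2 * l - 1)) ^ 2 +
        -(4 * l * (l - 1) + 1)⁻¹) = (2 / (2 * l - 1) ^ 2) ^ 2 * ((2 * (2 * l - 1)) *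
          (z * (z - 1) * (z - l))) := by
      rw [hsq]
      field_simp
      ring
    rw [h4, map_mul, map_mul, quadraticChar_sq_one' (div_ne_zero h2 (pow_ne_zero 2 hl)), one_mul]
  simp_rw [h3]
  rw [← mul_sum, mul_pow, quadraticChar_sq_one (mul_ne_zero h2 hl), one_mul, legendreSum]

lemma ALam_eq (hp2 : p ≠ 2) {l : ZMod p} (hl : 2 * l - 1 ≠ 0) :
    ALam p (4 * l * (l - 1)) = (legendreSum p l : ℝ) ^ 2 / p - 1 := by
  have hp0 : (p : ℝ) ≠ 0 := by exact_mod_cast hp.out.ne_zero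
  have hsq : (4 * l * (l - 1) + 1 : ZMod p) = (2 * l - 1) ^ 2 := by ring
  have h1 : legendreChar p (4 * l * (l - 1) + 1) = 1 := by
    rw [legendreChar, hsq, if_neg (pow_ne_zero 2 hl), if_pos (IsSquare.sq _)]
  have h2 : (clausenTrace p (-(4 * l * (l - 1) + 1)⁻¹) : ℝ) ^ 2 = (legendreSum p l : ℝ) ^ 2 := by
    exact_mod_cast congrArg (Int.cast (R := ℝ)) (clausenTrace_sq p hp2 hl)
  rw [ALam, h1, h2]
  field_simp

lemma card_le_two_mul_card_ALam (hp2 : p ≠ 2) {x : ℝ} (L : Finset (ZMod p))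
    (hL : ∀ l ∈ L, l ≠ 0 ∧ l ≠ 1 ∧ 2 * l - 1 ≠ 0 ∧ (legendreSum p l : ℝ) ^ 2 ≤ x * p) :
    L.card ≤ 2 * Nat.card {lam : ZMod p //
      lam ≠ 0 ∧ lam ≠ -1 ∧ ALam p lam ∈ Set.Icc (-1) (-1 + x)} := by
  have h2 : (2 : ZMod p) ≠ 0 := by
    intro h
    have : (p : ℕ) ∣ 2 := (ZMod.natCast_eq_zero_iff 2 p).mp (by exact_mod_cast h)
    exact hp2 ((Nat.prime_dvd_prime_iff_eq hp.out Nat.prime_two).mp this)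
  have h4 : (4 : ZMod p) ≠ 0 := by
    rw [show (4 : ZMod p) = 2 * 2 by norm_num]; exact mul_ne_zero h2 h2
  have hp0 : (0 : ℝ) < p := by exact_mod_cast hp.out.pos
  set T : Finset (ZMod p) := univ.filter fun lam =>
    lam ≠ 0 ∧ lam ≠ -1 ∧ ALam p lam ∈ Set.Icc (-1) (-1 + x) with hT
  have hcard : Nat.card {lam : ZMod p // lam ≠ 0 ∧ lam ≠ -1 ∧
      ALam p lam ∈ Set.Icc (-1) (-1 + x)} = T.card := by
    rw [Nat.card_eq_fintype_card, Fintype.card_subtype]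
  rw [hcard]
  refine card_le_mul_card_image_of_maps_to (f := fun l => 4 * l * (l - 1)) ?_ 2 ?_
  · intro l hl
    obtain ⟨a0, a1, a2, a3⟩ := hL l hl
    rw [mem_filter]
    refine ⟨mem_univ _, mul_ne_zero (mul_ne_zero h4 a0) (sub_ne_zero.mpr a1), ?_, ?_⟩
    · intro h
      have : (2 * l - 1) ^ 2 = 0 := by linear_combination h
      exact a2 ((pow_eq_zero_iff two_ne_zero).mp this)
    · rw [ALam_eq p hp2 a2]
      constructor
      · have : (0 : ℝ) ≤ (legendreSum p l : ℝ) ^ 2 / p := by positivity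
        linarith
      · have : (legendreSum p l : ℝ) ^ 2 / p ≤ x := by rwa [div_le_iff₀ hp0]
        linarith
  · intro lam _
    by_contra! hcon
    obtain ⟨a, ha, b, hb, c, hc, hab, hac, hbc⟩ := two_lt_card.mp hcon
    simp only [mem_filter] at ha hb hc
    have e1 : (a - b) * (a + b - 1) = 0 := by
      apply mul_left_cancel₀ h4
      linear_combination ha.2 - hb.2
    have e2 : (a - c) * (a + c - 1) = 0 := by
      apply mul_left_cancel₀ h4
      linear_combination ha.2 - hc.2
    have e1' := (mul_eq_zero.mp e1).resolve_left (sub_ne_zero.mpr hab)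
    have e2' := (mul_eq_zero.mp e2).resolve_left (sub_ne_zero.mpr hac)
    exact hbc (by linear_combination e1' - e2')

end LegendreFamily

end

section

open Finset

section LambdaAnalysis

set_option linter.unusedSectionVars false

open UpperHalfPlane hiding I

/-- The function `q ↦ ∑ q^{n²}` on the unit disc. -/
def thFun (q : ℂ) : ℂ := seriesEval (thetaSeries ℂ) q

lemma norm_thFun_sub_le {q : ℂ} (hq : ‖q‖ ≤ 1 / 3) : ‖thFun q - 1 - 2 * q‖ ≤ 3 * ‖q‖ ^ 4 := by
  have hq1 : ‖q‖ < 1 := by linarith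
  have h1 := convOnDisc_thetaSeries.hasSum hq1
  have h2 := (hasSum_nat_add_iff' 4).mpr h1
  have h3 : thFun q - 1 - 2 * q = seriesEval (thetaSeries ℂ) q - ∑ i ∈ range 4,
      PowerSeries.coeff i (thetaSeries ℂ) * q ^ i := by
    have hns : ¬ IsSquare (2 : ℕ) := by rintro ⟨r, hr⟩; have : r < 2 := by nlinarith
                                        interval_cases r <;> omega
    have hns' : ¬ IsSquare (3 : ℕ) := by rintro ⟨r, hr⟩; have : r < 2 := by nlinarith
                                         interval_cases r <;> omega
    simp [sum_range_succ, thetaSeries, thFun, hns, hns', PowerSeries.coeff_mk]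
    ring
  rw [h3]
  have h4 : HasSum (fun n : ℕ => 2 * ‖q‖ ^ 4 * ‖q‖ ^ n) (2 * ‖q‖ ^ 4 * (1 - ‖q‖)⁻¹) :=
    (hasSum_geometric_of_lt_one (norm_nonneg q) hq1).mul_left _
  refine (h2.norm_le_of_bounded h4 fun n => ?_).trans ?_
  · rw [norm_mul, norm_pow, pow_add]
    have : ‖PowerSeries.coeff (n + 4) (thetaSeries ℂ)‖ ≤ 2 := by
      simp only [thetaSeries, PowerSeries.coeff_mk]
      split_ifs <;> simp
    calc ‖PowerSeries.coeff (n + 4) (thetaSeries ℂ)‖ * (‖q‖ ^ n * ‖q‖ ^ 4) ≤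
        2 * (‖q‖ ^ n * ‖q‖ ^ 4) := by gcongr
      _ = _ := by ring
  · have h5 : (1 - ‖q‖)⁻¹ ≤ 3 / 2 := by
      rw [inv_le_comm₀ (by linarith) (by norm_num)]; norm_num; linarith
    calc 2 * ‖q‖ ^ 4 * (1 - ‖q‖)⁻¹ ≤ 2 * ‖q‖ ^ 4 * (3 / 2) := by gcongr
      _ = _ := by ring

lemma differentiableAt_thFun {q : ℂ} (hq : ‖q‖ < 1) : DifferentiableAt ℂ thFun q :=
  differentiableAt_seriesEval convOnDisc_thetaSeries hq

lemma pow_four_le {r : ℝ} (h0 : 0 ≤ r) (hr : r ≤ 1 / 3) : r ^ 4 ≤ 1 / 81 :=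
  (pow_le_pow_left₀ h0 hr 4).trans (by norm_num)

/-- Half the sum `θ(q) + θ(-q)`. -/
def thEven (q : ℂ) : ℂ := (thFun q + thFun (-q)) / 2

/-- A quarter of the difference `θ(q) - θ(-q)`. -/
def thOdd (q : ℂ) : ℂ := (thFun q - thFun (-q)) / 4

/-- The uniformizer `ε(q) = q + O(q⁴)` with `θ(-q)/θ(q) = (1 - 2ε)/(1 + 2ε)`. -/
def thEps (q : ℂ) : ℂ := thOdd q / thEven q

lemma norm_thEven_sub_le {q : ℂ} (hq : ‖q‖ ≤ 1 / 3) : ‖thEven q - 1‖ ≤ 3 * ‖q‖ ^ 4 := by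
  have h1 := norm_thFun_sub_le hq
  have h2 := norm_thFun_sub_le (q := -q) (by rwa [norm_neg])
  rw [norm_neg] at h2
  have e : thEven q - 1 = ((thFun q - 1 - 2 * q) + (thFun (-q) - 1 - 2 * (-q))) / 2 := by
    rw [thEven]; ring
  rw [e, norm_div, Complex.norm_ofNat]
  have := norm_add_le (thFun q - 1 - 2 * q) (thFun (-q) - 1 - 2 * (-q))
  linarith

lemma norm_thOdd_sub_le {q : ℂ} (hq : ‖q‖ ≤ 1 / 3) : ‖thOdd q - q‖ ≤ 3 / 2 * ‖q‖ ^ 4 := by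
  have h1 := norm_thFun_sub_le hq
  have h2 := norm_thFun_sub_le (q := -q) (by rwa [norm_neg])
  rw [norm_neg] at h2
  have e : thOdd q - q = ((thFun q - 1 - 2 * q) - (thFun (-q) - 1 - 2 * (-q))) / 4 := by
    rw [thOdd]; ring
  rw [e, norm_div, Complex.norm_ofNat]
  have := norm_sub_le (thFun q - 1 - 2 * q) (thFun (-q) - 1 - 2 * (-q))
  linarith

lemma thEven_norm_ge {q : ℂ} (hq : ‖q‖ ≤ 1 / 3) : 26 / 27 ≤ ‖thEven q‖ := by
  have h1 := norm_thEven_sub_le hq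
  have h2 := pow_four_le (norm_nonneg q) hq
  have h3 := norm_sub_norm_le (1 : ℂ) (1 - thEven q)
  rw [norm_sub_rev 1 (thEven q), sub_sub_cancel, norm_one] at h3
  linarith

lemma thEven_ne_zero {q : ℂ} (hq : ‖q‖ ≤ 1 / 3) : thEven q ≠ 0 := by
  have := thEven_norm_ge hq
  exact norm_pos_iff.mp (by linarith)

lemma norm_thEps_sub_le {q : ℂ} (hq : ‖q‖ ≤ 1 / 3) : ‖thEps q - q‖ ≤ 13 / 5 * ‖q‖ ^ 4 := by
  have hZ := thEven_norm_ge hq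
  have e : thEps q - q = ((thOdd q - q) - q * (thEven q - 1)) / thEven q := by
    rw [thEps]
    have := thEven_ne_zero hq
    field_simp
    ring
  rw [e, norm_div, div_le_iff₀ (by linarith)]
  have h1 := norm_thOdd_sub_le hq
  have h2 := norm_thEven_sub_le hq
  have h3 := norm_sub_le (thOdd q - q) (q * (thEven q - 1))
  rw [norm_mul] at h3
  have h4 : ‖q‖ * ‖thEven q - 1‖ ≤ 1 / 3 * (3 * ‖q‖ ^ 4) := by gcongr
  have h5 : 0 ≤ ‖q‖ ^ 4 := by positivity
  nlinarith

lemma differentiableAt_thEps {q : ℂ} (hq : ‖q‖ ≤ 1 / 3) : DifferentiableAt ℂ thEps q := by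
  have hq1 : ‖q‖ < 1 := by linarith
  have h1 := differentiableAt_thFun hq1
  have h2 : DifferentiableAt ℂ (fun q => thFun (-q)) q :=
    DifferentiableAt.comp q (differentiableAt_thFun (by rwa [norm_neg])) differentiableAt_id.neg
  exact ((h1.sub h2).div_const 4).div ((h1.add h2).div_const 2) (thEven_ne_zero hq)

lemma norm_deriv_thEps_sub_le {q : ℂ} (hq : ‖q‖ ≤ 1 / 24) :
    ‖deriv (fun q => thEps q - q) q‖ ≤ 1 / 9 := by
  have hball : ∀ z ∈ Metric.closedBall q (7 / 24), ‖z‖ ≤ 1 / 3 := by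
    intro z hz
    rw [mem_closedBall_iff_norm] at hz
    have := norm_add_le (z - q) q
    rw [sub_add_cancel] at this
    linarith
  have hd : DiffContOnCl ℂ (fun q => thEps q - q) (Metric.ball q (7 / 24)) := by
    refine DifferentiableOn.diffContOnCl ?_
    rw [closure_ball _ (by norm_num)]
    intro z hz
    exact ((differentiableAt_thEps (hball z hz)).sub differentiableAt_id).differentiableWithinAt
  have := Complex.norm_deriv_le_of_forall_mem_sphere_norm_le (by norm_num) hd
    (C := 13 / 5 * (1 / 81)) fun z hz => by
      have h1 := hball z (Metric.sphere_subset_closedBall hz)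
      exact (norm_thEps_sub_le h1).trans (by gcongr; exact pow_four_le (norm_nonneg z) h1)
  exact this.trans (by norm_num)

lemma deriv_thEps_ne_zero {q : ℂ} (hq : ‖q‖ ≤ 1 / 24) : deriv thEps q ≠ 0 := by
  have h1 := norm_deriv_thEps_sub_le hq
  have h2 : deriv (fun q => thEps q - q) q = deriv thEps q - 1 := by
    have := (differentiableAt_thEps (q := q) (by linarith)).hasDerivAt.sub (hasDerivAt_id q)
    exact this.deriv
  intro h0
  rw [h2, h0, zero_sub, norm_neg, norm_one] at h1
  norm_num at h1

lemma thEps_injOn {q r : ℂ} (hq : ‖q‖ ≤ 1 / 24) (hr : ‖r‖ ≤ 1 / 24) (h : thEps q = thEps r) :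
    q = r := by
  have h1 := (convex_closedBall (0 : ℂ) (1 / 24)).norm_image_sub_le_of_norm_deriv_le
    (𝕜 := ℂ) (f := fun q => thEps q - q) (C := 1 / 9) (x := r) (y := q) (fun z hz => by
      rw [mem_closedBall_zero_iff] at hz
      exact (differentiableAt_thEps (by linarith)).sub differentiableAt_id) (fun z hz => by
      rw [mem_closedBall_zero_iff] at hz
      exact norm_deriv_thEps_sub_le hz) (by simpa using hr) (by simpa using hq)
  simp only [h] at h1
  rw [show thEps r - q - (thEps r - r) = -(q - r) by ring, norm_neg] at h1
  have h2 := norm_nonneg (q - r)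
  exact sub_eq_zero.mp (norm_eq_zero.mp (by linarith))

lemma norm_thEps_le_two_div {q : ℂ} (hq : ‖q‖ ≤ 1 / 24) : ‖thEps q‖ ≤ 2 / 47 := by
  have h1 := norm_thEps_sub_le (q := q) (by linarith)
  have h2 : ‖q‖ ^ 4 ≤ (1 / 24) ^ 4 := pow_le_pow_left₀ (norm_nonneg q) hq 4
  have h3 := norm_add_le (thEps q - q) q
  rw [sub_add_cancel] at h3
  norm_num at h2
  linarith

lemma norm_thEps_le {q : ℂ} (hq : ‖q‖ ≤ 1 / 24) : ‖thEps q‖ ≤ 1 / 23 :=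
  (norm_thEps_le_two_div hq).trans (by norm_num)

lemma one_add_two_mul_norm_ge {e : ℂ} (he : ‖e‖ ≤ 1 / 23) : 21 / 23 ≤ ‖1 + 2 * e‖ := by
  have h := norm_sub_norm_le (1 : ℂ) (-(2 * e))
  rw [sub_neg_eq_add, norm_one, norm_neg, norm_mul, Complex.norm_ofNat] at h
  linarith

/-- The function `w = (1 - 2ε)/(1 + 2ε)`. -/
def wFun (e : ℂ) : ℂ := (1 - 2 * e) / (1 + 2 * e)

lemma norm_wFun_sub_one_le {e : ℂ} (he : ‖e‖ ≤ 1 / 23) : ‖wFun e - 1‖ ≤ 1 / 5 := by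
  have h1 := one_add_two_mul_norm_ge he
  have h0 : (1 + 2 * e) ≠ 0 := norm_pos_iff.mp (by linarith)
  have e1 : wFun e - 1 = -(4 * e) / (1 + 2 * e) := by rw [wFun]; field_simp; ring
  rw [e1, norm_div, norm_neg, norm_mul, Complex.norm_ofNat, div_le_iff₀ (by linarith)]
  linarith

lemma wFun_injOn {e f : ℂ} (he : ‖e‖ ≤ 1 / 23) (hf : ‖f‖ ≤ 1 / 23) (h : wFun e ^ 4 = wFun f ^ 4) :
    e = f := by
  have h1 := norm_wFun_sub_one_le he
  have h2 := norm_wFun_sub_one_le hf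
  have hd1 : (1 + 2 * e) ≠ 0 := norm_pos_iff.mp (by linarith [one_add_two_mul_norm_ge he])
  have hd2 : (1 + 2 * f) ≠ 0 := norm_pos_iff.mp (by linarith [one_add_two_mul_norm_ge hf])
  have key : ∀ a b : ℂ, ‖a - 1‖ ≤ 9 / 20 → ‖b - 1‖ ≤ 9 / 20 → a + b ≠ 0 := by
    intro a b ha hb h0
    have h3 := norm_add_le (a - 1) (b - 1)
    rw [show a - 1 + (b - 1) = -2 by linear_combination h0, norm_neg, Complex.norm_ofNat] at h3
    linarith
  have hsq : ∀ a : ℂ, ‖a - 1‖ ≤ 1 / 5 → ‖a ^ 2 - 1‖ ≤ 9 / 20 := by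
    intro a ha
    have h3 := norm_add_le (a - 1) 2
    rw [show a - 1 + 2 = a + 1 by ring, Complex.norm_ofNat] at h3
    rw [show a ^ 2 - 1 = (a - 1) * (a + 1) by ring, norm_mul]
    have := norm_nonneg (a - 1)
    nlinarith
  have h3 : (wFun e - wFun f) * (wFun e + wFun f) * (wFun e ^ 2 + wFun f ^ 2) = 0 := by
    linear_combination h
  have h4 := (mul_eq_zero.mp h3).resolve_right (key _ _ (hsq _ h1) (hsq _ h2))
  have h5 := sub_eq_zero.mp ((mul_eq_zero.mp h4).resolve_right
    (key _ _ (h1.trans (by norm_num)) (h2.trans (by norm_num))))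
  rw [wFun, wFun, div_eq_div_iff hd1 hd2] at h5
  linear_combination -h5 / 4

lemma norm_nome_le {z : ℂ} (hz : 1.02 ≤ z.im) : ‖nome z‖ ≤ 1 / 24 := by
  have h1 : ‖nome z‖ = Real.exp (-(Real.pi * z.im)) := by
    rw [nome, Complex.norm_exp]; simp
  have h2 : (3.2 : ℝ) ≤ Real.pi * z.im := by nlinarith [Real.pi_gt_d2]
  have h3 : (24 : ℝ) ≤ Real.exp 3.2 := by
    have h4 : Real.exp 3.2 ^ 5 = Real.exp 1 ^ 16 := by
      rw [← Real.exp_nat_mul, ← Real.exp_nat_mul]; norm_num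
    have h5 : (24 : ℝ) ^ 5 ≤ Real.exp 3.2 ^ 5 := by
      rw [h4]
      calc (24 : ℝ) ^ 5 ≤ 2.71 ^ 16 := by norm_num
        _ ≤ Real.exp 1 ^ 16 := by
          gcongr
          exact (by norm_num : (2.71 : ℝ) ≤ 2.7182818283).trans Real.exp_one_gt_d9.le
    exact le_of_pow_le_pow_left₀ (by norm_num) (Real.exp_pos _).le h5
  rw [h1, Real.exp_neg, one_div]
  exact inv_anti₀ (by norm_num) (h3.trans (Real.exp_le_exp.mpr h2))

lemma jacobiTheta_eq_eps {z : ℂ} (hz : 0 < z.im) (hq : ‖nome z‖ ≤ 1 / 3) :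
    jacobiTheta z = thEven (nome z) * (1 + 2 * thEps (nome z)) ∧
    jacobiTheta (z + 1) = thEven (nome z) * (1 - 2 * thEps (nome z)) := by
  have h0 := thEven_ne_zero hq
  rw [jacobiTheta_eq_seriesEval hz, jacobiTheta_add_one_eq_seriesEval hz, thEps]
  have e1 : thEven (nome z) * (1 + 2 * (thOdd (nome z) / thEven (nome z))) =
      thEven (nome z) + 2 * thOdd (nome z) := by field_simp
  have e2 : thEven (nome z) * (1 - 2 * (thOdd (nome z) / thEven (nome z))) =
      thEven (nome z) - 2 * thOdd (nome z) := by field_simp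
  rw [e1, e2, thEven, thOdd, thFun, thFun]
  constructor <;> ring

lemma one_add_two_thEps_ne_zero {q : ℂ} (hq : ‖q‖ ≤ 1 / 24) : 1 + 2 * thEps q ≠ 0 :=
  norm_pos_iff.mp (by linarith [one_add_two_mul_norm_ge (norm_thEps_le hq)])

lemma thY_ne_zero {z : ℂ} (hz : 1.02 ≤ z.im) : thY z ≠ 0 := by
  have hq := norm_nome_le hz
  rw [thY, (jacobiTheta_eq_eps (by norm_num at hz; linarith) (by linarith)).1]
  exact pow_ne_zero 4 (mul_ne_zero (thEven_ne_zero (by linarith)) (one_add_two_thEps_ne_zero hq))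

lemma lam_eq_wFun {z : ℂ} (hz : 0 < z.im) (hq : ‖nome z‖ ≤ 1 / 24) :
    lam z = 1 - wFun (thEps (nome z)) ^ 4 := by
  obtain ⟨h1, h2⟩ := jacobiTheta_eq_eps hz (by linarith)
  have h3 := one_add_two_thEps_ne_zero hq
  have h4 := thEven_ne_zero (q := nome z) (by linarith)
  rw [lam, thX, thY, h1, h2, wFun]
  field_simp

lemma nome_eq_of_lam_eq {z w : ℂ} (hz : 1.02 ≤ z.im) (hw : 1.02 ≤ w.im) (h : lam z = lam w) :
    nome z = nome w := by
  have hq := norm_nome_le hz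
  have hr := norm_nome_le hw
  rw [lam_eq_wFun (by norm_num at hz; linarith) hq, lam_eq_wFun (by norm_num at hw; linarith) hr,
    sub_right_inj] at h
  exact thEps_injOn hq hr (wFun_injOn (norm_thEps_le hq) (norm_thEps_le hr) h)

lemma norm_lam_lt_one {z : ℂ} (hz : 1.02 ≤ z.im) : ‖lam z‖ < 1 := by
  have hq := norm_nome_le hz
  have he := norm_thEps_le_two_div hq
  have h0 := one_add_two_thEps_ne_zero hq
  have hge : 43 / 47 ≤ ‖1 + 2 * thEps (nome z)‖ := by
    have h := norm_sub_norm_le (1 : ℂ) (-(2 * thEps (nome z)))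
    rw [sub_neg_eq_add, norm_one, norm_neg, norm_mul, Complex.norm_ofNat] at h
    linarith
  rw [lam_eq_wFun (by norm_num at hz; linarith) hq]
  set e := thEps (nome z)
  have e1 : 1 - wFun e ^ 4 = (16 * e + 64 * e ^ 3) / (1 + 2 * e) ^ 4 := by
    rw [wFun]; field_simp; ring
  rw [e1, norm_div, norm_pow, div_lt_one (by positivity)]
  have h1 : ‖16 * e + 64 * e ^ 3‖ ≤ 16 * ‖e‖ + 64 * ‖e‖ ^ 3 := by
    refine (norm_add_le _ _).trans ?_
    rw [norm_mul, norm_mul, norm_pow, Complex.norm_ofNat, Complex.norm_ofNat]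
  have h2 : ‖e‖ ^ 3 ≤ (2 / 47) ^ 3 := pow_le_pow_left₀ (norm_nonneg e) he 3
  have h3 : ‖e‖ * 16 ≤ 32 / 47 := by linarith
  have h4 : (43 / 47 : ℝ) ^ 4 ≤ ‖1 + 2 * e‖ ^ 4 := pow_le_pow_left₀ (by norm_num) hge 4
  norm_num at h2 h4
  linarith

lemma deriv_lam_ne_zero {z : ℂ} (hz : 1.02 < z.im) : deriv lam z ≠ 0 := by
  have hq := norm_nome_le hz.le
  have he := norm_thEps_le hq
  have h0 := one_add_two_thEps_ne_zero hq
  have hz0 : 0 < z.im := by norm_num at hz; linarith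
  have hev : lam =ᶠ[nhds z] fun z => 1 - wFun (thEps (nome z)) ^ 4 := by
    have h3 : ∀ᶠ z in nhds z, 1.02 < z.im :=
      Complex.continuous_im.continuousAt.eventually (lt_mem_nhds hz)
    filter_upwards [h3] with w hw
    exact lam_eq_wFun (by norm_num at hw; linarith) (norm_nome_le hw.le)
  have hnome : HasDerivAt nome (nome z * (Real.pi * Complex.I)) z := by
    have h1 : HasDerivAt (fun z : ℂ => Real.pi * Complex.I * z) (Real.pi * Complex.I) z := by
      simpa using (hasDerivAt_id z).const_mul (Real.pi * Complex.I : ℂ)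
    exact h1.cexp
  have heps := (differentiableAt_thEps (q := nome z) (by linarith)).hasDerivAt.comp z hnome
  set e := thEps (nome z) with hedef
  have hw : HasDerivAt wFun (-4 / (1 + 2 * e) ^ 2) e := by
    have h1 : HasDerivAt (fun e : ℂ => 1 - 2 * e) (-2) e := by
      simpa using ((hasDerivAt_id e).const_mul (2 : ℂ)).const_sub 1
    have h2 : HasDerivAt (fun e : ℂ => 1 + 2 * e) 2 e := by
      simpa using ((hasDerivAt_id e).const_mul (2 : ℂ)).const_add 1
    have h3 := h1.div h2 h0
    have h4 : (-2 * (1 + 2 * e) - (1 - 2 * e) * 2) / (1 + 2 * e) ^ 2 = -4 / (1 + 2 * e) ^ 2 := by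
      ring
    rw [h4] at h3
    exact h3
  have hcomp := HasDerivAt.comp z hw heps
  have hpow := (hcomp.pow 4).const_sub 1
  have hlam := hpow.congr_of_eventuallyEq hev
  rw [hlam.deriv, neg_ne_zero]
  have hw0 : wFun e ≠ 0 := by
    have h1 := norm_wFun_sub_one_le he
    intro h2
    rw [h2, zero_sub, norm_neg, norm_one] at h1
    norm_num at h1
  refine mul_ne_zero (mul_ne_zero (by norm_num) (pow_ne_zero _ hw0)) (mul_ne_zero ?_ (mul_ne_zero
    (deriv_thEps_ne_zero hq) (mul_ne_zero (nome_ne_zero z) ?_)))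
  · exact div_ne_zero (by norm_num) (pow_ne_zero 2 h0)
  · exact mul_ne_zero (by exact_mod_cast Real.pi_ne_zero) Complex.I_ne_zero

end LambdaAnalysis

end

section

open Finset

section SingularModuli

set_option linter.unusedSectionVars false

open UpperHalfPlane hiding I
open ModularGroup Matrix MatrixGroups

lemma thEps_zero : thEps 0 = 0 := by simp [thEps, thOdd]

lemma lam_ne_zero {z : ℂ} (hz : 1.02 ≤ z.im) : lam z ≠ 0 := by
  have hq := norm_nome_le hz
  rw [lam_eq_wFun (by norm_num at hz; linarith) hq]
  intro h
  have h1 : wFun (thEps (nome z)) ^ 4 = wFun 0 ^ 4 := by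
    rw [← sub_eq_zero.mp h]; simp [wFun]
  have h2 := wFun_injOn (norm_thEps_le hq) (by simp) h1
  rw [← thEps_zero] at h2
  exact nome_ne_zero z (thEps_injOn hq (by simp) h2)

lemma lam_add_one (z : ℂ) : lam (z + 1) = -thX z / (thY z - thX z) := by
  rw [lam, thX_add_one, thY_add_one]

lemma norm_lam_lt_norm_one_sub {z : ℂ} (hz : 1.02 ≤ z.im) : ‖lam z‖ < ‖1 - lam z‖ := by
  have hY := thY_ne_zero hz
  have hz1 : 1.02 ≤ (z + 1).im := by simpa using hz
  have hY1 := thY_ne_zero hz1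
  rw [thY_add_one] at hY1
  have h1 := norm_lam_lt_one hz1
  have e : lam (z + 1) = -(lam z / (1 - lam z)) := by
    rw [lam_add_one, lam]
    field_simp
  have hne : 1 - lam z ≠ 0 := by
    rw [lam]
    intro h
    apply hY1
    field_simp at h
    linear_combination h
  rw [e, norm_neg, norm_div, div_lt_one (norm_pos_iff.mpr hne)] at h1
  exact h1

lemma deriv_lam_smul_ne_zero (γ : SL(2, ℤ)) {F : ℂ → ℂ} {τ : ℍ} {d : ℂ} (hd : d ≠ 0)
    (hF : HasDerivAt F d (lam τ))
    (hev : ∀ᶠ z in nhds (τ : ℂ), ∀ hz : 0 < z.im, lam ((γ • (⟨z, hz⟩ : ℍ) : ℍ) : ℂ) = F (lam z))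
    (hY : thY τ ≠ 0) (hYγ : thY ((γ • τ : ℍ) : ℂ) ≠ 0) (hl : deriv lam τ ≠ 0) :
    deriv lam ((γ • τ : ℍ) : ℂ) ≠ 0 := by
  intro h0
  let g : ℂ → ℂ := fun z => ((γ 0 0 : ℂ) * z + γ 0 1) / autFac γ z
  have hg : DifferentiableAt ℂ g τ := by
    refine DifferentiableAt.div ?_ ?_ (autFac_ne_zero γ τ)
    · exact (differentiableAt_id.const_mul _).add_const _
    · unfold autFac
      exact (differentiableAt_id.const_mul _).add_const _
  have hgτ : g τ = ((γ • τ : ℍ) : ℂ) := (coe_smul_eq γ τ).symm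
  have h1 : HasDerivAt lam 0 (g τ) := by
    rw [hgτ, ← h0]
    exact (differentiableAt_lam (γ • τ).im_pos hYγ).hasDerivAt
  have h2 := HasDerivAt.comp (τ : ℂ) h1 hg.hasDerivAt
  have h3 := HasDerivAt.comp (τ : ℂ) hF (differentiableAt_lam τ.im_pos hY).hasDerivAt
  have hev' : (lam ∘ g) =ᶠ[nhds (τ : ℂ)] (F ∘ lam) := by
    have h4 : ∀ᶠ z in nhds (τ : ℂ), 0 < z.im :=
      Complex.continuous_im.continuousAt.eventually (lt_mem_nhds τ.im_pos)
    filter_upwards [hev, h4] with z hz hzi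
    rw [Function.comp, Function.comp, ← hz hzi, coe_smul_eq]
  have h5 := (h3.congr_of_eventuallyEq hev').unique h2
  rw [zero_mul] at h5
  exact mul_ne_zero hd hl h5

/-- The matrix `!![1, 0; 1, 1]`. -/
def lowerT : SL(2, ℤ) := ⟨!![1, 0; 1, 1], by rw [Matrix.det_fin_two_of]; norm_num⟩

lemma repAct_lowerT {R : Type*} [CommRing R] (u v : R) :
    repAct (redModTwo lowerT) 0 u v = v ∧ repAct (redModTwo lowerT) 1 u v = u := by
  have h : thetaRep (redModTwo lowerT).1 = !![0, 1; 1, 0] := by decide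
  simp only [repAct, h]
  simp

lemma lam_S_smul {τ : ℍ} (hY : thY τ ≠ 0) : lam ((S • τ : ℍ) : ℂ) = 1 - lam τ := by
  have := autFac_ne_zero S τ
  rw [lam, lam, thX_smul, thY_smul, (repAct_S _ _).1, (repAct_S _ _).2]
  field_simp
  ring

lemma lam_lowerT_smul {τ : ℍ} : lam ((lowerT • τ : ℍ) : ℂ) = (lam τ)⁻¹ := by
  have := autFac_ne_zero lowerT τ
  rw [lam, lam, thX_smul, thY_smul, (repAct_lowerT _ _).1, (repAct_lowerT _ _).2, inv_div,
    mul_div_mul_left _ _ (pow_ne_zero 2 this)]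

variable (p : ℕ) [hp : Fact p.Prime]

/-- The parameters `(b, A, B)` of a point of complex multiplication with `Im τ > 1.02`. -/
structure CMTriple (s : ℤ × ℤ × ℤ) : Prop where
  b_pos : 0 < s.1
  A_pos : 0 < s.2.1
  B_nonneg : 0 ≤ s.2.2
  B_lt : s.2.2 < 4 * s.2.1
  b_le : 4 * s.1 ^ 2 ≤ p
  A_lt : 41616 * s.2.1 ^ 2 < 10000 * (p - s.1 ^ 2)
  dvd : 4 * s.2.1 ∣ s.2.2 ^ 2 - s.1 ^ 2 + p

/-- The point `(-B + i√(p - b²))/(2A)`. -/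
def cmPoint (s : ℤ × ℤ × ℤ) : ℂ :=
  (-s.2.2 + (Real.sqrt (p - s.1 ^ 2) : ℝ) * Complex.I) / (2 * s.2.1)

variable {p} {s : ℤ × ℤ × ℤ}

lemma cmPoint_im (s : ℤ × ℤ × ℤ) : (cmPoint p s).im = Real.sqrt (p - s.1 ^ 2) / (2 * s.2.1) := by
  rw [cmPoint, show (2 * s.2.1 : ℂ) = ((2 * s.2.1 : ℝ) : ℂ) by push_cast; ring,
    Complex.div_ofReal_im]
  simp

lemma cmPoint_re (s : ℤ × ℤ × ℤ) : (cmPoint p s).re = -s.2.2 / (2 * s.2.1) := by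
  rw [cmPoint, show (2 * s.2.1 : ℂ) = ((2 * s.2.1 : ℝ) : ℂ) by push_cast; ring,
    Complex.div_ofReal_re]
  simp

lemma CMTriple.im_gt (h : CMTriple p s) : 1.02 < (cmPoint p s).im := by
  have hA : (0 : ℝ) < s.2.1 := by exact_mod_cast h.A_pos
  rw [cmPoint_im, lt_div_iff₀ (by positivity)]
  apply Real.lt_sqrt_of_sq_lt
  have : (41616 * s.2.1 ^ 2 : ℝ) < 10000 * (p - s.1 ^ 2) := by exact_mod_cast h.A_lt
  norm_num
  linarith

/-- The point of the upper half plane attached to a triple. -/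
def CMTriple.point (h : CMTriple p s) : ℍ := ⟨cmPoint p s, by
  have := h.im_gt; norm_num at this; linarith⟩

lemma CMTriple.coe_point (h : CMTriple p s) : (h.point : ℂ) = cmPoint p s := rfl

lemma CMTriple.pos (h : CMTriple p s) : (0 : ℝ) < p - s.1 ^ 2 := by
  have h1 : (41616 * s.2.1 ^ 2 : ℝ) < 10000 * (p - s.1 ^ 2) := by exact_mod_cast h.A_lt
  have h2 : (0 : ℝ) ≤ s.2.1 ^ 2 := by positivity
  linarith

lemma CMTriple.quadratic (h : CMTriple p s) {C : ℤ} (hC : s.2.2 ^ 2 - s.1 ^ 2 + p = 4 * s.2.1 * C) :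
    (s.2.1 : ℂ) * cmPoint p s ^ 2 + s.2.2 * cmPoint p s + C = 0 := by
  have hA : (s.2.1 : ℂ) ≠ 0 := by exact_mod_cast h.A_pos.ne'
  have hsq : ((Real.sqrt (p - s.1 ^ 2) : ℝ) : ℂ) ^ 2 = p - s.1 ^ 2 := by
    rw [← Complex.ofReal_pow, Real.sq_sqrt h.pos.le]; push_cast; ring
  have hCc : (s.2.2 ^ 2 - s.1 ^ 2 + p : ℂ) = 4 * s.2.1 * C := by exact_mod_cast hC
  rw [cmPoint]
  field_simp
  linear_combination hsq * (Complex.I ^ 2) + (p - s.1 ^ 2 : ℂ) * Complex.I_sq - hCc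

lemma zmod_ne_zero_of_lt {n : ℤ} (h0 : 0 < n) (h1 : n < p) : (n : ZMod p) ≠ 0 := by
  rw [Ne, ZMod.intCast_zmod_eq_zero_iff_dvd]
  exact fun h => absurd (Int.le_of_dvd h0 h) (by linarith)

lemma CMTriple.odd (h : CMTriple p s) (hp2 : p ≠ 2) : Odd (s.1 - s.2.2) := by
  have hodd : Odd (p : ℤ) := by exact_mod_cast hp.out.odd_of_ne_two hp2
  obtain ⟨C, hC⟩ := h.dvd
  have h1 : Odd ((s.1 - s.2.2) * (s.1 + s.2.2)) := by
    have : (s.1 - s.2.2) * (s.1 + s.2.2) = p - 2 * (2 * s.2.1 * C) := by linear_combination -hC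
    rw [this]
    exact hodd.sub_even (even_two_mul _)
  exact (Int.odd_mul.mp h1).1

lemma CMTriple.odd' (h : CMTriple p s) (hp2 : p ≠ 2) : Odd (s.1 + s.2.2) := by
  have := (h.odd hp2).add_even (even_two_mul s.2.2)
  rwa [show s.1 - s.2.2 + 2 * s.2.2 = s.1 + s.2.2 by ring] at this

lemma not_dvd_four_mul (hp2 : p ≠ 2) (n : ℤ) : (p : ℤ) ≠ 4 * n := by
  have hodd : Odd (p : ℤ) := by exact_mod_cast hp.out.odd_of_ne_two hp2
  obtain ⟨r, hr⟩ := hodd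
  omega

lemma two_zmod_ne_zero (hp2 : p ≠ 2) : (2 : ZMod p) ≠ 0 := by
  intro h
  have : (p : ℕ) ∣ 2 := (ZMod.natCast_eq_zero_iff 2 p).mp (by exact_mod_cast h)
  exact hp2 ((Nat.prime_dvd_prime_iff_eq hp.out Nat.prime_two).mp this)

lemma CMTriple.two_b_lt (h : CMTriple p s) (hp2 : p ≠ 2) : 2 * s.1 < p := by
  have h1 := h.b_le
  have h2 := h.b_pos
  have h3 : (2 : ℤ) < p := by
    have := hp.out.two_le; omega
  nlinarith

lemma CMTriple.two_A_lt (h : CMTriple p s) : 2 * s.2.1 < p := by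
  have h1 := h.A_lt
  have h2 := h.A_pos
  have h3 := h.b_pos
  nlinarith

lemma CMTriple.fixingMatrix (h : CMTriple p s) (hp2 : p ≠ 2) {C : ℤ}
    (hC : s.2.2 ^ 2 - s.1 ^ 2 + p = 4 * s.2.1 * C) :
    FixingMatrix p h.point (s.1 - s.2.2) (-2 * C) (2 * s.2.1) (s.1 + s.2.2) where
  det := by linear_combination -hC
  odd_a := h.odd hp2
  even_b := ⟨-C, by ring⟩
  even_c := even_two_mul _
  odd_d := h.odd' hp2
  fix := by
    rw [h.coe_point]
    push_cast
    linear_combination -2 * h.quadratic hC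
  c_ne := zmod_ne_zero_of_lt (by have := h.A_pos; omega) h.two_A_lt
  tr_ne := by
    rw [show s.1 - s.2.2 + (s.1 + s.2.2) = 2 * s.1 by ring]
    exact zmod_ne_zero_of_lt (by have := h.b_pos; omega) (h.two_b_lt hp2)

lemma CMTriple.fixingMatrix_S (h : CMTriple p s) (hp2 : p ≠ 2) {C : ℤ}
    (hC : s.2.2 ^ 2 - s.1 ^ 2 + p = 4 * s.2.1 * C) :
    FixingMatrix p (S • h.point) (s.1 + s.2.2) (-2 * s.2.1) (2 * C) (s.1 - s.2.2) where
  det := by linear_combination -hC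
  odd_a := h.odd' hp2
  even_b := ⟨-s.2.1, by ring⟩
  even_c := even_two_mul _
  odd_d := h.odd hp2
  fix := by
    have hz : (h.point : ℂ) ≠ 0 := h.point.ne_zero
    rw [coe_smul_eq]
    simp [autFac, ModularGroup.S]
    rw [h.coe_point] at hz ⊢
    field_simp
    linear_combination -2 * h.quadratic hC
  c_ne := by
    push_cast
    refine mul_ne_zero (two_zmod_ne_zero hp2) ?_
    rw [Ne, ZMod.intCast_zmod_eq_zero_iff_dvd]
    rintro ⟨C', rfl⟩
    have hp5 : (3 : ℤ) ≤ p := by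
      have := hp.out.two_le; omega
    have h1 := h.A_lt
    have h2 := h.A_pos
    have h3 := h.B_nonneg
    have h4 := h.B_lt
    have h5 := h.b_pos
    have h6 := h.b_le
    have hB2 : s.2.2 ^ 2 ≤ (4 * s.2.1 - 1) ^ 2 := by nlinarith
    have hlt : 4 * s.2.1 * C' * p < 5 * p := by nlinarith
    have hpos : 0 < 4 * s.2.1 * C' * p := by nlinarith
    have hC1 : 4 * (s.2.1 * C') < 5 := by nlinarith
    have hC2 : 0 < s.2.1 * C' := by nlinarith
    have hC3 : s.2.1 * C' = 1 := by omega
    have hA1 : s.2.1 = 1 := Int.eq_one_of_mul_eq_one_right h2.le hC3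
    rw [hA1] at hC3 hC hB2 h1
    have hp4 : 3 < (p : ℤ) := by nlinarith
    have : C' = 1 := by linarith
    rw [this] at hC
    nlinarith
  tr_ne := by
    rw [show s.1 + s.2.2 + (s.1 - s.2.2) = 2 * s.1 by ring]
    exact zmod_ne_zero_of_lt (by have := h.b_pos; omega) (h.two_b_lt hp2)

lemma CMTriple.fixingMatrix_lowerT (h : CMTriple p s) (hp2 : p ≠ 2) {C : ℤ}
    (hC : s.2.2 ^ 2 - s.1 ^ 2 + p = 4 * s.2.1 * C) :
    FixingMatrix p (lowerT • h.point) (s.1 - s.2.2 + 2 * C) (-2 * C)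
      (2 * (s.2.1 - s.2.2 + C)) (s.1 + s.2.2 - 2 * C) where
  det := by linear_combination -hC
  odd_a := (h.odd hp2).add_even (even_two_mul C)
  even_b := ⟨-C, by ring⟩
  even_c := even_two_mul _
  odd_d := (h.odd' hp2).sub_even (even_two_mul C)
  fix := by
    have hz := autFac_ne_zero lowerT h.point
    rw [coe_smul_eq]
    simp [autFac, lowerT] at hz ⊢
    rw [h.coe_point] at hz ⊢
    field_simp
    linear_combination -2 * h.quadratic hC
  c_ne := by
    push_cast
    refine mul_ne_zero (two_zmod_ne_zero hp2) ?_
    intro h0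
    have h1 := h.A_lt
    have h2 := h.A_pos
    have h3 := h.B_nonneg
    have h4 := h.B_lt
    have h5 := h.b_pos
    have h6 := h.b_le
    have h7 : (p : ℤ) ∣ (2 * s.2.1 - s.2.2) ^ 2 - s.1 ^ 2 := by
      rw [← ZMod.intCast_zmod_eq_zero_iff_dvd]
      have h8 : (s.2.2 ^ 2 - s.1 ^ 2 + p : ZMod p) = 4 * s.2.1 * C := by
        exact_mod_cast congrArg (Int.cast (R := ZMod p)) hC
      rw [ZMod.natCast_self] at h8
      push_cast
      linear_combination 4 * (s.2.1 : ZMod p) * h0 + h8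
    have hsq : (2 * s.2.1 - s.2.2) ^ 2 ≤ (2 * s.2.1) ^ 2 := by
      apply sq_le_sq'
      · linarith
      · linarith
    have h9 : (2 * s.2.1 - s.2.2) ^ 2 - s.1 ^ 2 = 0 := by
      refine Int.eq_zero_of_abs_lt_dvd h7 (abs_lt.mpr ⟨?_, ?_⟩)
      · nlinarith
      · nlinarith
    exact not_dvd_four_mul hp2 (s.2.1 * (s.2.1 - s.2.2 + C)) (by linear_combination hC - h9)
  tr_ne := by
    rw [show s.1 - s.2.2 + 2 * C + (s.1 + s.2.2 - 2 * C) = 2 * s.1 by ring]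
    exact zmod_ne_zero_of_lt (by have := h.b_pos; omega) (h.two_b_lt hp2)

end SingularModuli

end

section

open Finset

section CountingBound

set_option linter.unusedSectionVars false

open UpperHalfPlane hiding I
open ModularGroup Matrix MatrixGroups

variable {p : ℕ} [hp : Fact p.Prime] {s : ℤ × ℤ × ℤ}

/-- The transformations `z`, `1 - z`, `1/z` of `λ`. -/
def lamImage (k : Fin 3) (z : ℂ) : ℂ := ![z, 1 - z, z⁻¹] k

lemma CMTriple.exists_image (h : CMTriple p s) (hp2 : p ≠ 2) (k : Fin 3) : ∃ τ : ℍ,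
    (∃ a b c d, FixingMatrix p τ a b c d ∧ a + d = 2 * s.1) ∧ thY τ ≠ 0 ∧ deriv lam τ ≠ 0 ∧
      lam τ = lamImage k (lam (cmPoint p s)) := by
  obtain ⟨C, hC⟩ := h.dvd
  have him : 1.02 < (h.point : ℂ).im := h.im_gt
  have hY : thY h.point ≠ 0 := thY_ne_zero him.le
  have hl : lam h.point ≠ 0 := lam_ne_zero him.le
  have hd : deriv lam h.point ≠ 0 := deriv_lam_ne_zero him
  have hX : thX h.point ≠ 0 := by
    intro h0
    rw [lam, h0, zero_div] at hl
    exact hl rfl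
  have hevY : ∀ᶠ z in nhds (h.point : ℂ), thY z ≠ 0 :=
    (differentiableAt_thY h.point.im_pos).continuousAt.eventually_ne hY
  fin_cases k
  · exact ⟨h.point, ⟨_, _, _, _, h.fixingMatrix hp2 hC, by ring⟩, hY, hd, rfl⟩
  · have hYS : thY ((S • h.point : ℍ) : ℂ) ≠ 0 := by
      rw [thY_smul, (repAct_S _ _).2]
      exact mul_ne_zero (pow_ne_zero 2 (autFac_ne_zero _ _)) (neg_ne_zero.mpr hY)
    refine ⟨S • h.point, ⟨_, _, _, _, h.fixingMatrix_S hp2 hC, by ring⟩, hYS, ?_, lam_S_smul hY⟩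
    refine deriv_lam_smul_ne_zero S (F := fun z => 1 - z) (d := -1) (by norm_num) ?_ ?_ hY hYS hd
    · simpa using (hasDerivAt_id (lam h.point)).const_sub 1
    · filter_upwards [hevY] with z hz hzi
      exact lam_S_smul (τ := ⟨z, hzi⟩) hz
  · have hYS : thY ((lowerT • h.point : ℍ) : ℂ) ≠ 0 := by
      rw [thY_smul, (repAct_lowerT _ _).2]
      exact mul_ne_zero (pow_ne_zero 2 (autFac_ne_zero _ _)) hX
    refine ⟨lowerT • h.point, ⟨_, _, _, _, h.fixingMatrix_lowerT hp2 hC, by ring⟩, hYS, ?_,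
      lam_lowerT_smul⟩
    refine deriv_lam_smul_ne_zero lowerT (F := fun z => z⁻¹) (d := -(lam h.point ^ 2)⁻¹)
      (neg_ne_zero.mpr (inv_ne_zero (pow_ne_zero 2 hl))) (hasDerivAt_inv hl) ?_ hY hYS hd
    exact Filter.Eventually.of_forall fun z hzi => lam_lowerT_smul (τ := ⟨z, hzi⟩)

lemma nome_eq_iff {z w : ℂ} (h : nome z = nome w) : ∃ n : ℤ, z = w + 2 * n := by
  rw [nome, nome, Complex.exp_eq_exp_iff_exists_int] at h
  obtain ⟨n, hn⟩ := h
  refine ⟨n, ?_⟩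
  have hpi : (Real.pi * Complex.I : ℂ) ≠ 0 :=
    mul_ne_zero (by exact_mod_cast Real.pi_ne_zero) Complex.I_ne_zero
  apply mul_left_cancel₀ hpi
  linear_combination hn

lemma CMTriple.eq_of_lam_eq {s t : ℤ × ℤ × ℤ} (hs : CMTriple p s) (ht : CMTriple p t)
    (h : lam (cmPoint p s) = lam (cmPoint p t)) : s = t := by
  obtain ⟨n, hn⟩ := nome_eq_iff (nome_eq_of_lam_eq hs.im_gt.le ht.im_gt.le h)
  obtain ⟨b, A, B⟩ := s
  obtain ⟨b', A', B'⟩ := t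
  have hA0 := hs.A_pos
  have hA0' := ht.A_pos
  have hb0 := hs.b_pos
  have hb0' := ht.b_pos
  have hA : (0 : ℝ) < A := by exact_mod_cast hs.A_pos
  have hA' : (0 : ℝ) < A' := by exact_mod_cast ht.A_pos
  have him := congrArg Complex.im hn
  have hre := congrArg Complex.re hn
  have e1 : (2 * (n : ℂ)).im = 0 := by simp
  have e2 : (2 * (n : ℂ)).re = 2 * n := by simp
  rw [Complex.add_im, cmPoint_im, cmPoint_im, e1, add_zero] at him
  rw [Complex.add_re, cmPoint_re, cmPoint_re, e2] at hre
  simp only at him hre hA0 hA0' hb0 hb0'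
  have hsq : (A' : ℝ) ^ 2 * (p - b ^ 2) = A ^ 2 * (p - b' ^ 2) := by
    rw [div_eq_div_iff (by positivity) (by positivity)] at him
    have h1 := Real.sq_sqrt hs.pos.le
    have h2 := Real.sq_sqrt ht.pos.le
    simp only at h1 h2
    have h3 := congrArg (· ^ 2) him
    simp only [mul_pow] at h3
    rw [h1, h2] at h3
    linear_combination h3 / 4
  have hsqz : A' ^ 2 * ((p : ℤ) - b ^ 2) = A ^ 2 * (p - b' ^ 2) := by exact_mod_cast hsq
  have hA2 := hs.A_lt
  have hA2' := ht.A_lt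
  have hb2 := hs.b_le
  have hb2' := ht.b_le
  simp only at hA2 hA2' hb2 hb2'
  have hb : A' * b = A * b' := by
    have hdvd : (p : ℤ) ∣ (A' * b - A * b') * (A' * b + A * b') :=
      ⟨A' ^ 2 - A ^ 2, by linear_combination -hsqz⟩
    have hm1 : 4 * (A' * b) < p := by nlinarith [sq_nonneg (A' - b)]
    have hm2 : 4 * (A * b') < p := by nlinarith [sq_nonneg (A - b')]
    have hq1 : 0 < A' * b := mul_pos hA0' hb0
    have hq2 : 0 < A * b' := mul_pos hA0 hb0'
    rcases (Nat.prime_iff_prime_int.mp hp.out).dvd_or_dvd hdvd with h1 | h1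
    · have := Int.eq_zero_of_abs_lt_dvd h1 (abs_lt.mpr ⟨by linarith, by linarith⟩)
      linarith
    · exact absurd (Int.le_of_dvd (by linarith) h1) (by linarith)
  have hAA : A = A' := by
    have hpz : (p : ℤ) ≠ 0 := by exact_mod_cast hp.out.ne_zero
    have h1 : (p : ℤ) * ((A - A') * (A + A')) = 0 := by
      linear_combination -hsqz - (A' * b + A * b') * hb
    have h2 := (mul_eq_zero.mp h1).resolve_left hpz
    have h3 := (mul_eq_zero.mp h2).resolve_right (by linarith)
    linarith
  subst hAA
  have hbb : b = b' := mul_left_cancel₀ hA0.ne' hb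
  subst hbb
  have hBB : B = B' - 4 * A * n := by
    have : (B : ℝ) = B' - 4 * A * n := by
      field_simp at hre
      linarith
    exact_mod_cast this
  have k1 := hs.B_nonneg
  have k2 := hs.B_lt
  have k3 := ht.B_nonneg
  have k4 := ht.B_lt
  simp only at k1 k2 k3 k4
  have hn0 : n = 0 := by
    by_contra hn0
    rcases lt_or_gt_of_ne hn0 with hneg | hpos
    · nlinarith
    · nlinarith
  rw [hn0] at hBB
  rw [hBB]; simp

lemma lamImage_injective {z w : ℂ} {i j : Fin 3} (hz : ‖z‖ < 1) (hw : ‖w‖ < 1)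
    (hz0 : z ≠ 0) (hw0 : w ≠ 0) (hz1 : ‖z‖ < ‖1 - z‖) (hw1 : ‖w‖ < ‖1 - w‖)
    (h : lamImage i z = lamImage j w) : i = j ∧ z = w := by
  have key01 : ∀ z w : ℂ, ‖z‖ < ‖1 - z‖ → ‖w‖ < ‖1 - w‖ → z ≠ 1 - w := by
    rintro _ w h1 h2 rfl
    rw [sub_sub_cancel] at h1
    exact absurd h1 (not_lt.mpr h2.le)
  have key02 : ∀ z w : ℂ, ‖z‖ < 1 → ‖w‖ < 1 → w ≠ 0 → z ≠ w⁻¹ := by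
    rintro _ w h1 h2 h3 rfl
    rw [norm_inv] at h1
    have := one_lt_inv_iff₀.mpr ⟨norm_pos_iff.mpr h3, h2⟩
    linarith
  have key12 : ∀ z w : ℂ, ‖z‖ < 1 → w ≠ 0 → ‖w‖ < ‖1 - w‖ → 1 - z ≠ w⁻¹ := by
    intro z w h1 h2 h3 h4
    have hz : z = -(1 - w) / w := by
      field_simp
      have h5 : (1 - z) * w = 1 := by rw [h4]; field_simp
      linear_combination -h5
    rw [hz, norm_div, norm_neg, div_lt_one (norm_pos_iff.mpr h2)] at h1
    linarith
  fin_cases i <;> fin_cases j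
  · exact ⟨rfl, h⟩
  · exact absurd h (key01 z w hz1 hw1)
  · exact absurd h (key02 z w hz hw hw0)
  · exact absurd h.symm (key01 w z hw1 hz1)
  · exact ⟨rfl, sub_right_injective h⟩
  · exact absurd h (key12 z w hz hw0 hw1)
  · exact absurd h.symm (key02 w z hw hz hz0)
  · exact absurd h.symm (key12 w z hw hz0 hz1)
  · exact ⟨rfl, inv_injective h⟩

/-- The points of complex multiplication give a lower bound for the number of `λ` with `A_λ` close
to `-1`. -/
theorem three_mul_card_le (hp2 : p ≠ 2) {x : ℝ} (T : Finset (ℤ × ℤ × ℤ))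
    (hT : ∀ s ∈ T, CMTriple p s ∧ 4 * (s.1 : ℝ) ^ 2 ≤ x * p) :
    3 * T.card ≤ 2 * Nat.card {lam : ZMod p //
      lam ≠ 0 ∧ lam ≠ -1 ∧ ALam p lam ∈ Set.Icc (-1) (-1 + x)} + 6 := by
  obtain ⟨m, hm⟩ := hp.out.odd_of_ne_two hp2
  have hex : ∀ i : (ℤ × ℤ × ℤ) × Fin 3, ∃ τ : ℍ, i.1 ∈ T →
      (∃ a b c d, FixingMatrix p τ a b c d ∧ a + d = 2 * i.1.1) ∧ thY τ ≠ 0 ∧ deriv lam τ ≠ 0 ∧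
        lam τ = lamImage i.2 (lam (cmPoint p i.1)) := by
    intro i
    by_cases hi : i.1 ∈ T
    · obtain ⟨τ, hτ⟩ := (hT _ hi).1.exists_image hp2 i.2
      exact ⟨τ, fun _ => hτ⟩
    · exact ⟨UpperHalfPlane.I, fun h => absurd h hi⟩
  choose τ hτ using hex
  have hmem : ∀ i ∈ T ×ˢ (univ : Finset (Fin 3)), i.1 ∈ T := fun i hi => (mem_product.mp hi).1
  obtain ⟨S', hS', hcard, l, hinj, hl⟩ := exists_reduction p hm (T ×ˢ (univ : Finset (Fin 3))) τ
    (fun i => i.1.1) (fun i hi => (hτ i (hmem i hi)).1) (fun i hi => (hτ i (hmem i hi)).2.1)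
    (fun i hi => (hτ i (hmem i hi)).2.2.1) (by
      intro i hi j hj hij
      have hi' := hmem i hi
      have hj' := hmem j hj
      simp only at hij
      rw [(hτ i hi').2.2.2, (hτ j hj').2.2.2] at hij
      have hci := (hT _ hi').1
      have hcj := (hT _ hj').1
      obtain ⟨h1, h2⟩ := lamImage_injective (norm_lam_lt_one hci.im_gt.le)
        (norm_lam_lt_one hcj.im_gt.le) (lam_ne_zero hci.im_gt.le) (lam_ne_zero hcj.im_gt.le)
        (norm_lam_lt_norm_one_sub hci.im_gt.le) (norm_lam_lt_norm_one_sub hcj.im_gt.le) hij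
      exact Prod.ext (hci.eq_of_lam_eq hcj h2) h1)
  rw [card_product, card_univ, Fintype.card_fin] at hcard
  set L := S'.image l with hL
  have hLcard : L.card = S'.card := card_image_of_injOn hinj
  set D : Finset (ZMod p) := {0, 1, 2⁻¹} ∪ univ.filter fun l => l ^ 2 - l + 1 = 0 with hD
  have hDcard : D.card ≤ 5 := by
    refine (card_union_le _ _).trans ?_
    have h1 : ({0, 1, 2⁻¹} : Finset (ZMod p)).card ≤ 3 := card_le_three
    have h2 : (univ.filter fun l : ZMod p => l ^ 2 - l + 1 = 0).card ≤ 2 := by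
      by_contra! hcon
      obtain ⟨a, ha, b, hb, c, hc, hab, hac, hbc⟩ := two_lt_card.mp hcon
      simp only [mem_filter] at ha hb hc
      have e1 : (a - b) * (a + b - 1) = 0 := by linear_combination ha.2 - hb.2
      have e2 : (a - c) * (a + c - 1) = 0 := by linear_combination ha.2 - hc.2
      have e1' := (mul_eq_zero.mp e1).resolve_left (sub_ne_zero.mpr hab)
      have e2' := (mul_eq_zero.mp e2).resolve_left (sub_ne_zero.mpr hac)
      exact hbc (by linear_combination e1' - e2')
    omega
  have hfin := card_le_two_mul_card_ALam p hp2 (x := x) (L \ D) (by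
    intro u hu
    rw [mem_sdiff, hL, mem_image] at hu
    obtain ⟨⟨i, hi, rfl⟩, huD⟩ := hu
    have hiT := hmem i (hS' hi)
    simp only [hD, mem_union, mem_insert, mem_singleton, mem_filter, mem_univ, true_and,
      not_or] at huD
    obtain ⟨⟨h0, h1, h2⟩, h3⟩ := huD
    refine ⟨h0, h1, ?_, ?_⟩
    · intro h4
      apply h2
      have h5 := two_zmod_ne_zero hp2
      field_simp
      linear_combination h4
    · have h4 := (hl i hi).resolve_left h3
      have h5 := legendreSum_sq_eq p hm h0 h1 (by
        rw [abs_of_pos (by have := (hT _ hiT).1.b_pos; linarith)]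
        exact (hT _ hiT).1.two_b_lt hp2) h4
      have h6 : (legendreSum p (l i) : ℝ) ^ 2 = 4 * (i.1.1 : ℝ) ^ 2 := by
        have : (legendreSum p (l i) : ℝ) ^ 2 = (2 * (i.1.1 : ℝ)) ^ 2 := by exact_mod_cast h5
        rw [this]; ring
      rw [h6]
      exact (hT _ hiT).2)
  have h7 := le_card_sdiff D L
  omega

end CountingBound

end

section

open Finset

section FiniteFourier

variable {G ι κ : Type*} [AddCommGroup G] [Fintype G]

lemma sum_norm_sq_charSum (I : Finset ι) (c : ι → G) (hc : Set.InjOn c I) (α : ι → ℂ) :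
    ∑ ψ : AddChar G ℂ, ‖∑ i ∈ I, α i * ψ (c i)‖ ^ 2
      = Fintype.card G * ∑ i ∈ I, ‖α i‖ ^ 2 := by
  have h : ((∑ ψ : AddChar G ℂ, ‖∑ i ∈ I, α i * ψ (c i)‖ ^ 2 : ℝ) : ℂ)
      = ((Fintype.card G * ∑ i ∈ I, ‖α i‖ ^ 2 : ℝ) : ℂ) := by
    push_cast
    have h1 : ∀ ψ : AddChar G ℂ, ((‖∑ i ∈ I, α i * ψ (c i)‖ : ℂ)) ^ 2
        = ∑ i ∈ I, ∑ j ∈ I, α i * (starRingEnd ℂ) (α j) * ψ (c i - c j) := by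
      intro ψ
      rw [← Complex.mul_conj', map_sum, sum_mul_sum]
      refine sum_congr rfl fun i _ => sum_congr rfl fun j _ => ?_
      rw [map_mul, ← AddChar.map_neg_eq_conj, sub_eq_add_neg, AddChar.map_add_eq_mul]
      ring
    simp_rw [h1]
    rw [sum_comm, mul_sum]
    refine sum_congr rfl fun i hi => ?_
    rw [sum_comm, sum_eq_single i]
    · rw [← mul_sum, AddChar.sum_apply_eq_ite]
      simp only [sub_self, if_true]
      rw [Complex.mul_conj', mul_comm]
    · intro j hj hji
      rw [← mul_sum, AddChar.sum_apply_eq_ite, if_neg, mul_zero]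
      exact fun h => hji (hc hj hi (sub_eq_zero.mp h).symm)
    · exact fun h => absurd hi h
  exact_mod_cast h

/-- A bilinear form with kernel `f (x + y)` is bounded by the largest Fourier coefficient of `f`. -/
lemma norm_bilinear_le {f : G → ℂ} {B : ℝ} (hB : ∀ ψ : AddChar G ℂ, ‖∑ x, f x * ψ x‖ ≤ B)
    {I : Finset ι} {J : Finset κ} {c : ι → G} {c' : κ → G} (hc : Set.InjOn c I)
    (hc' : Set.InjOn c' J) (α : ι → ℂ) (β : κ → ℂ) :
    ‖∑ i ∈ I, ∑ j ∈ J, α i * β j * f (c i + c' j)‖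
      ≤ B * (√(∑ i ∈ I, ‖α i‖ ^ 2) * √(∑ j ∈ J, ‖β j‖ ^ 2)) := by
  have hG : (0 : ℝ) < Fintype.card G := by exact_mod_cast Fintype.card_pos
  obtain ⟨fh, hfh⟩ : ∃ fh : AddChar G ℂ → ℂ, ∀ ψ, ∑ x, f x * ψ x = fh ψ := ⟨_, fun _ => rfl⟩
  have hinv : ∀ z : G, (Fintype.card G : ℂ) * f z = ∑ ψ : AddChar G ℂ, fh ψ * ψ (-z) := by
    intro z
    simp_rw [← hfh, sum_mul]
    rw [sum_comm, sum_eq_single z]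
    · have : ∀ ψ : AddChar G ℂ, f z * ψ z * ψ (-z) = f z := fun ψ => by
        rw [mul_assoc, ← AddChar.map_add_eq_mul, add_neg_cancel, AddChar.map_zero_eq_one, mul_one]
      simp_rw [this]
      rw [sum_const, card_univ, AddChar.card_eq, nsmul_eq_mul]
    · intro x _ hx
      have : ∀ ψ : AddChar G ℂ, f x * ψ x * ψ (-z) = f x * ψ (x - z) := fun ψ => by
        rw [mul_assoc, ← AddChar.map_add_eq_mul, sub_eq_add_neg]
      simp_rw [this]
      rw [← mul_sum, AddChar.sum_apply_eq_ite, if_neg (sub_ne_zero.mpr hx), mul_zero]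
    · simp
  have hsum : (Fintype.card G : ℂ) * ∑ i ∈ I, ∑ j ∈ J, α i * β j * f (c i + c' j)
      = ∑ ψ : AddChar G ℂ, fh ψ *
        ((∑ i ∈ I, α i * ψ (-c i)) * ∑ j ∈ J, β j * ψ (-c' j)) := by
    simp_rw [sum_mul_sum, mul_sum]
    rw [sum_comm (s := univ)]
    refine sum_congr rfl fun i _ => ?_
    rw [sum_comm (s := univ)]
    refine sum_congr rfl fun j _ => ?_
    rw [show (Fintype.card G : ℂ) * (α i * β j * f (c i + c' j))
      = α i * β j * ((Fintype.card G : ℂ) * f (c i + c' j)) by ring, hinv, mul_sum]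
    refine sum_congr rfl fun ψ _ => ?_
    rw [neg_add, AddChar.map_add_eq_mul]
    ring
  have hcs := Real.sum_mul_le_sqrt_mul_sqrt univ
    (fun ψ : AddChar G ℂ => ‖∑ i ∈ I, α i * ψ (-c i)‖) (fun ψ => ‖∑ j ∈ J, β j * ψ (-c' j)‖)
  rw [sum_norm_sq_charSum I (fun i => -c i) (fun i hi j hj h => hc hi hj (neg_injective h)),
    sum_norm_sq_charSum J (fun i => -c' i) (fun i hi j hj h => hc' hi hj (neg_injective h)),
    Real.sqrt_mul hG.le, Real.sqrt_mul hG.le, mul_mul_mul_comm, Real.mul_self_sqrt hG.le] at hcs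
  have hB0 : 0 ≤ B := (norm_nonneg _).trans (hB 1)
  refine le_of_mul_le_mul_left ?_ hG
  calc (Fintype.card G : ℝ) * ‖∑ i ∈ I, ∑ j ∈ J, α i * β j * f (c i + c' j)‖
      = ‖(Fintype.card G : ℂ) * ∑ i ∈ I, ∑ j ∈ J, α i * β j * f (c i + c' j)‖ := by
        rw [norm_mul, Complex.norm_natCast]
    _ ≤ ∑ ψ : AddChar G ℂ, B *
        (‖∑ i ∈ I, α i * ψ (-c i)‖ * ‖∑ j ∈ J, β j * ψ (-c' j)‖) := by
        rw [hsum]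
        refine (norm_sum_le _ _).trans (sum_le_sum fun ψ _ => ?_)
        rw [norm_mul, norm_mul]
        exact mul_le_mul_of_nonneg_right (hfh ψ ▸ hB ψ) (by positivity)
    _ ≤ _ := by
        rw [← mul_sum, mul_left_comm]
        exact mul_le_mul_of_nonneg_left hcs hB0

end FiniteFourier

section PeriodicSpectrum

/-- `F` has period `Q`, sum `M` over a period, and Fourier coefficients bounded by `B`. -/
def PerSpec (Q : ℕ) [NeZero Q] (F : ℤ → ℂ) (M : ℂ) (B : ℝ) : Prop :=
  ∃ f : ZMod Q → ℂ, (∀ x : ℤ, F x = f x) ∧ ∑ x, f x = M ∧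
    ∀ ψ : AddChar (ZMod Q) ℂ, ‖∑ x, f x * ψ x‖ ≤ B

lemma PerSpec.mul {Q R : ℕ} [NeZero Q] [NeZero R] [NeZero (Q * R)] (h : Q.Coprime R)
    {F F' : ℤ → ℂ} {M M' : ℂ} {B B' : ℝ} (hF : PerSpec Q F M B) (hF' : PerSpec R F' M' B') :
    PerSpec (Q * R) (fun x => F x * F' x) (M * M') (B * B') := by
  obtain ⟨f, hf, hM, hB⟩ := hF
  obtain ⟨g, hg, hM', hB'⟩ := hF'
  set e := ZMod.chineseRemainder h with he
  refine ⟨fun z => f (e z).1 * g (e z).2, fun x => ?_, ?_, fun ψ => ?_⟩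
  · simp only [map_intCast, Prod.fst_intCast, Prod.snd_intCast, hf, hg]
  · refine (Equiv.sum_comp e.toEquiv (fun z : ZMod Q × ZMod R => f z.1 * g z.2)).trans ?_
    rw [← hM, ← hM', sum_mul_sum, ← univ_product_univ, sum_product]
  · have h1 : ∑ z, f (e z).1 * g (e z).2 * ψ z
        = ∑ z : ZMod Q × ZMod R, f z.1 * g z.2 * ψ (e.symm z) := by
      rw [← Equiv.sum_comp e.toEquiv (fun z : ZMod Q × ZMod R => f z.1 * g z.2 * ψ (e.symm z))]
      refine sum_congr rfl fun z _ => ?_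
      simp
    have h2 : ∑ z, f (e z).1 * g (e z).2 * ψ z
        = (∑ x, f x * (ψ.compAddMonoidHom
            ((e.symm : ZMod Q × ZMod R →+ ZMod (Q * R)).comp (AddMonoidHom.inl _ _))) x) *
          ∑ y, g y * (ψ.compAddMonoidHom
            ((e.symm : ZMod Q × ZMod R →+ ZMod (Q * R)).comp (AddMonoidHom.inr _ _))) y := by
      rw [h1, sum_mul_sum, ← univ_product_univ, sum_product]
      refine sum_congr rfl fun x _ => sum_congr rfl fun y _ => ?_
      have : ((x, y) : ZMod Q × ZMod R) = (x, 0) + (0, y) := by simp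
      rw [this, map_add, AddChar.map_add_eq_mul]
      simp only [AddChar.compAddMonoidHom_apply, AddMonoidHom.comp_apply, AddMonoidHom.inl_apply,
        AddMonoidHom.inr_apply]
      simp only [AddMonoidHom.coe_coe, Prod.mk_add_mk, add_zero, zero_add]
      ring
    rw [h2, norm_mul]
    exact mul_le_mul (hB _) (hB' _) (norm_nonneg _) ((norm_nonneg _).trans (hB 1))

lemma PerSpec.bound_nonneg {Q : ℕ} [NeZero Q] {F : ℤ → ℂ} {M : ℂ} {B : ℝ} (hF : PerSpec Q F M B) :
    0 ≤ B := by
  obtain ⟨f, -, -, hB⟩ := hF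
  exact (norm_nonneg _).trans (hB 1)

lemma sum_range_eq_sum_zmod {Q : ℕ} [NeZero Q] {M : Type*} [AddCommMonoid M] (f : ZMod Q → M) :
    ∑ n ∈ range Q, f n = ∑ x, f x := by
  refine sum_nbij' (fun n => (n : ZMod Q)) ZMod.val ?_ ?_ ?_ ?_ ?_
  · simp
  · intro x _; exact mem_range.mpr (ZMod.val_lt x)
  · intro n hn; exact ZMod.val_cast_of_lt (mem_range.mp hn)
  · intro x _; simp
  · simp

lemma PerSpec.sum_range {Q : ℕ} [NeZero Q] {F : ℤ → ℂ} {M : ℂ} {B : ℝ} (hF : PerSpec Q F M B) :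
    ∑ n ∈ range Q, F n = M := by
  obtain ⟨f, hf, hM, -⟩ := hF
  rw [← hM, ← sum_range_eq_sum_zmod]
  exact sum_congr rfl fun n _ => by rw [hf]; simp

lemma PerSpec.of_nonneg {Q : ℕ} [NeZero Q] {F : ℤ → ℕ} {M : ℕ}
    (hF : ∀ x y : ℤ, (Q : ℤ) ∣ x - y → F x = F y) (hM : ∑ n ∈ range Q, F n = M) :
    PerSpec Q (fun x => F x) M M := by
  have hs : ∑ x : ZMod Q, F (x.val : ℤ) = M := by
    rw [← hM, ← sum_range_eq_sum_zmod (fun x : ZMod Q => F (x.val : ℤ))]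
    refine sum_congr rfl fun n hn => ?_
    rw [ZMod.val_cast_of_lt (mem_range.mp hn)]
  refine ⟨fun x => F (x.val : ℤ), fun x => ?_, ?_, fun ψ => ?_⟩
  · refine congrArg _ (hF _ _ ?_)
    rw [← ZMod.intCast_zmod_eq_zero_iff_dvd]
    simp
  · beta_reduce; exact_mod_cast hs
  · refine (norm_sum_le _ _).trans (le_of_eq ?_)
    rw [← hs, Nat.cast_sum]
    refine sum_congr rfl fun x _ => ?_
    rw [norm_mul, ψ.norm_apply, mul_one, Complex.norm_natCast]

lemma sum_range_mod_period {Q : ℕ} [NeZero Q] {f : ZMod Q → ℂ} (hf : ∑ x, f x = 0) (a : ZMod Q)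
    (n : ℕ) : ∑ k ∈ range n, f (a + k) = ∑ k ∈ range (n % Q), f (a + k) := by
  conv_lhs => rw [← Nat.div_add_mod n Q]
  induction n / Q with
  | zero => simp
  | succ m ih =>
    rw [← ih, show Q * (m + 1) + n % Q = Q + (Q * m + n % Q) by ring, sum_range_add]
    have h1 : ∑ k ∈ range Q, f (a + k) = 0 := by
      rw [sum_range_eq_sum_zmod (fun x => f (a + x)), ← hf]
      exact Equiv.sum_comp (Equiv.addLeft a) f
    rw [h1, zero_add]
    refine sum_congr rfl fun k _ => ?_
    simp

lemma injOn_natCast_zmod {Q n : ℕ} (hn : n ≤ Q) (a : ZMod Q) :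
    Set.InjOn (fun k : ℕ => a + (k : ZMod Q)) (range n) := by
  intro i hi j hj h
  have hi := mem_range.mp hi
  have hj := mem_range.mp hj
  have h1 := (ZMod.natCast_eq_natCast_iff' i j Q).mp (add_left_cancel h)
  rwa [Nat.mod_eq_of_lt (by omega), Nat.mod_eq_of_lt (by omega)] at h1

lemma norm_sum_sum_le_of_sum_eq_zero {Q : ℕ} [NeZero Q] {f : ZMod Q → ℂ} {B : ℝ}
    (hf : ∑ x, f x = 0) (hB : ∀ ψ : AddChar (ZMod Q) ℂ, ‖∑ x, f x * ψ x‖ ≤ B) (a : ZMod Q)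
    (n n' : ℕ) : ‖∑ k ∈ range n, ∑ l ∈ range n', f (a + k + l)‖ ≤ B * (√n * √n') := by
  have hB0 : 0 ≤ B := (norm_nonneg _).trans (hB 1)
  have h1 : ∑ k ∈ range n, ∑ l ∈ range n', f (a + k + l)
      = ∑ k ∈ range (n % Q), ∑ l ∈ range (n' % Q), f (a + k + l) := by
    simp_rw [sum_range_mod_period hf _ n']
    rw [sum_comm, sum_comm (s := range (n % Q))]
    refine sum_congr rfl fun l _ => ?_
    simp_rw [add_right_comm a _ (l : ZMod Q)]
    exact sum_range_mod_period hf _ n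
  have hQ : 0 < Q := Nat.pos_of_ne_zero (NeZero.ne Q)
  have h2 := norm_bilinear_le hB (injOn_natCast_zmod (Nat.mod_lt n hQ).le a)
    (injOn_natCast_zmod (Nat.mod_lt n' hQ).le (0 : ZMod Q)) (fun _ => 1) (fun _ => 1)
  simp only [one_mul, zero_add, norm_one, one_pow, sum_const, card_range, nsmul_eq_mul,
    mul_one] at h2
  rw [h1]
  refine h2.trans (mul_le_mul_of_nonneg_left ?_ hB0)
  gcongr
  · exact Nat.mod_le _ _
  · exact Nat.mod_le _ _

lemma PerSpec.norm_sum_sum_sub_le {Q : ℕ} [NeZero Q] {F : ℤ → ℂ} {M : ℂ} {B : ℝ}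
    (hF : PerSpec Q F M B) (a : ℤ) (n n' : ℕ) :
    ‖∑ k ∈ range n, ∑ l ∈ range n', F (a + k + l) - M / Q * (n * n')‖ ≤ B * (√n * √n') := by
  have hB0 := hF.bound_nonneg
  obtain ⟨f, hf, hM, hB⟩ := hF
  have hQ : (Q : ℂ) ≠ 0 := by exact_mod_cast NeZero.ne Q
  have h0 : ∑ x, (f x - M / Q) = 0 := by
    rw [sum_sub_distrib, hM, sum_const, card_univ, ZMod.card, nsmul_eq_mul, mul_div_cancel₀ _ hQ,
      sub_self]
  have h1 : ∀ ψ : AddChar (ZMod Q) ℂ, ‖∑ x, (f x - M / Q) * ψ x‖ ≤ B := by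
    intro ψ
    rcases eq_or_ne ψ 1 with rfl | hψ
    · simp only [AddChar.one_apply, mul_one, h0, norm_zero, hB0]
    · have h2 : ∑ x, ψ x = 0 := AddChar.sum_eq_zero_of_ne_one hψ
      simp_rw [sub_mul]
      rw [sum_sub_distrib, ← mul_sum, h2, mul_zero, sub_zero]
      exact hB ψ
  have h2 := norm_sum_sum_le_of_sum_eq_zero h0 h1 (a : ZMod Q) n n'
  simp only [sum_sub_distrib, sum_const, card_range, nsmul_eq_mul] at h2
  convert h2 using 3
  · refine sum_congr rfl fun k _ => sum_congr rfl fun l _ => ?_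
    rw [hf]; push_cast; rfl
  · ring

/-- Here the Fourier coefficients of only one of two factors of coprime periods are used. -/
lemma PerSpec.norm_sum_sum_mul_le {Q m : ℕ} [NeZero Q] (hm : 0 < m) (hQm : m.Coprime Q)
    {g F : ℤ → ℂ} {M : ℂ} {B : ℝ} (hF : PerSpec Q F M B) (hg : ∀ x, ‖g x‖ ≤ 1)
    (hper : ∀ x y : ℤ, (m : ℤ) ∣ x - y → g x = g y) (a : ℤ) {n n' : ℕ} (hn : n ≤ m * Q)
    (hn' : n' ≤ Q) :
    ‖∑ k ∈ range n, ∑ l ∈ range n', g (a + k + l) * F (a + k + l)‖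
      ≤ B * √m * (√n * √n') := by
  have hB0 := hF.bound_nonneg
  obtain ⟨f, hf, hM, hB⟩ := hF
  have hfib : ∀ k ∈ range n, k % m ∈ range m := fun k _ => mem_range.mpr (Nat.mod_lt _ hm)
  have h1 : ∀ r ∈ range m, ‖∑ k ∈ range n with k % m = r, ∑ l ∈ range n',
      g (a + k + l) * F (a + k + l)‖ ≤ B * (√(#{k ∈ range n | k % m = r} : ℝ) * √n') := by
    intro r _
    have hinj : Set.InjOn (fun k : ℕ => (a : ZMod Q) + (k : ZMod Q))
        ({k ∈ range n | k % m = r} : Finset ℕ) := by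
      intro i hi j hj h
      obtain ⟨hi1, hi2⟩ := mem_filter.mp hi
      obtain ⟨hj1, hj2⟩ := mem_filter.mp hj
      have hi1 := mem_range.mp hi1
      have hj1 := mem_range.mp hj1
      have h3 : i ≡ j [MOD Q] := (ZMod.natCast_eq_natCast_iff i j Q).mp (add_left_cancel h)
      have h4 : i ≡ j [MOD m] := hi2.trans hj2.symm
      have h5 := (Nat.modEq_and_modEq_iff_modEq_mul hQm).mp ⟨h4, h3⟩
      exact Nat.ModEq.eq_of_lt_of_lt h5 (by omega) (by omega)
    have h2 := norm_bilinear_le hB hinj (injOn_natCast_zmod hn' (0 : ZMod Q)) (fun _ => 1)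
      (fun l => g (a + r + l))
    simp only [one_mul, zero_add, norm_one, one_pow, sum_const, nsmul_eq_mul, mul_one] at h2
    have h3 : ∑ k ∈ range n with k % m = r, ∑ l ∈ range n', g (a + k + l) * F (a + k + l)
        = ∑ k ∈ range n with k % m = r, ∑ l ∈ range n',
          g (a + r + l) * f ((a : ZMod Q) + k + l) := by
      refine sum_congr rfl fun k hk => sum_congr rfl fun l _ => ?_
      rw [hf]
      congr 1
      · refine hper _ _ ?_
        have := (mem_filter.mp hk).2
        rw [show (a + k + l : ℤ) - (a + r + l) = k - r by ring, ← this]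
        push_cast
        exact Int.dvd_self_sub_emod
      · push_cast; rfl
    rw [h3]
    refine h2.trans (mul_le_mul_of_nonneg_left ?_ hB0)
    refine mul_le_mul_of_nonneg_left (Real.sqrt_le_sqrt ?_) (Real.sqrt_nonneg _)
    calc ∑ l ∈ range n', ‖g (a + r + l)‖ ^ 2 ≤ ∑ l ∈ range n', (1 : ℝ) :=
          sum_le_sum fun l _ => pow_le_one₀ (norm_nonneg _) (hg _)
      _ = n' := by simp
  have hcs := Real.sum_mul_le_sqrt_mul_sqrt (range m)
    (fun r => √(#{k ∈ range n | k % m = r} : ℝ)) (fun _ => 1)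
  simp only [mul_one, Real.sq_sqrt (Nat.cast_nonneg _), one_pow, sum_const, card_range,
    nsmul_eq_mul] at hcs
  have hcard : ∑ r ∈ range m, (#{k ∈ range n | k % m = r} : ℝ) = n := by
    have := card_eq_sum_card_fiberwise (f := fun k => k % m) (s := range n) (t := range m)
      (fun k hk => hfib k hk)
    rw [card_range] at this
    exact_mod_cast this.symm
  rw [hcard] at hcs
  rw [← sum_fiberwise_of_maps_to hfib]
  calc _ ≤ ∑ r ∈ range m, B * (√(#{k ∈ range n | k % m = r} : ℝ) * √n') :=
        (norm_sum_le _ _).trans (sum_le_sum h1)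
    _ = B * √n' * ∑ r ∈ range m, √(#{k ∈ range n | k % m = r} : ℝ) := by
        rw [mul_sum]; exact sum_congr rfl fun r _ => by ring
    _ ≤ B * √n' * (√n * √m) := mul_le_mul_of_nonneg_left hcs (by positivity)
    _ = _ := by ring

end PeriodicSpectrum

end

section

open Finset

section LocalCounts

lemma sum_divisors_mul_of_coprime {M : Type*} [AddCommMonoid M] {m n : ℕ} (h : m.Coprime n)
    (f : ℕ → M) :
    ∑ d ∈ (m * n).divisors, f d = ∑ a ∈ m.divisors, ∑ b ∈ n.divisors, f (a * b) := by
  rw [Nat.divisors_mul, mul_def, sum_image h.mul_injOn_divisors, sum_product]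

lemma mul_dvd_iff_of_isCoprime {a b c : ℤ} (h : IsCoprime a b) : a * b ∣ c ↔ a ∣ c ∧ b ∣ c :=
  ⟨fun h' => ⟨dvd_of_mul_right_dvd h', dvd_of_mul_left_dvd h'⟩, fun h' => h.mul_dvd h'.1 h'.2⟩

lemma sum_quadraticChar_mul_addChar {ℓ p : ℕ} [Fact ℓ.Prime] (hℓ : ℓ ≠ 2)
    (hp : (p : ZMod ℓ) ≠ 0) (ψ : AddChar (ZMod ℓ) ℂ) :
    ∃ ψ' : AddChar (ZMod ℓ) ℂ, (ψ' = 1 ↔ ψ = 1) ∧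
      ∑ x : ZMod ℓ, (quadraticChar (ZMod ℓ) (x ^ 2 - p) : ℂ) * ψ x
        = klooSum ψ' (p : ZMod ℓ) - ∑ y, ψ' y := by
  have hF : ringChar (ZMod ℓ) ≠ 2 := by rwa [ZMod.ringChar_zmod_n]
  have h2 : (2 : ZMod ℓ) ≠ 0 := Ring.two_ne_zero hF
  let ψ' : AddChar (ZMod ℓ) ℂ := ψ.compAddMonoidHom (AddMonoidHom.mulLeft (2 : ZMod ℓ)⁻¹)
  have hψ' : ∀ y, ψ' y = ψ (2⁻¹ * y) := fun y => rfl
  refine ⟨ψ', ⟨fun h => ?_, fun h => ?_⟩, ?_⟩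
  · ext x
    have := congrArg (fun g : AddChar (ZMod ℓ) ℂ => g (2 * x)) h
    simpa [hψ', inv_mul_cancel_left₀ h2] using this
  · ext x
    simp [hψ', h]
  · have hk : klooSum ψ' (p : ZMod ℓ)
        = ∑ y, (1 + quadraticChar (ZMod ℓ) (y ^ 2 - 4 * p) : ℂ) * ψ' y := by
      rw [klooSum]
      convert sum_erase_add_div hF hp (fun y => ψ' y)
    rw [hk, ← sum_sub_distrib,
      ← Equiv.sum_comp (Equiv.mulLeft₀ (2 : ZMod ℓ) h2) (fun y =>
        (1 + quadraticChar (ZMod ℓ) (y ^ 2 - 4 * p) : ℂ) * ψ' y - ψ' y)]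
    refine sum_congr rfl fun x _ => ?_
    simp only [Equiv.mulLeft₀_apply, hψ', inv_mul_cancel_left₀ h2]
    have : (2 * x) ^ 2 - 4 * (p : ZMod ℓ) = 2 ^ 2 * (x ^ 2 - p) := by ring
    rw [this, map_mul, quadraticChar_sq_one' h2]
    push_cast
    ring

lemma perSpec_jacobiSym_prime {ℓ p : ℕ} [Fact ℓ.Prime] (hℓ : ℓ ≠ 2) (hp : (p : ZMod ℓ) ≠ 0) :
    PerSpec ℓ (fun x => (jacobiSym (x ^ 2 - p) ℓ : ℂ)) (-1) (2 * √ℓ) := by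
  have hF : ringChar (ZMod ℓ) ≠ 2 := by rwa [ZMod.ringChar_zmod_n]
  have hℓ1 : (1 : ℝ) ≤ ℓ := by exact_mod_cast (Fact.out : ℓ.Prime).one_lt.le
  have hone : ∑ x : ZMod ℓ, (quadraticChar (ZMod ℓ) (x ^ 2 - p) : ℂ) = -1 := by
    obtain ⟨ψ', h1, h2⟩ := sum_quadraticChar_mul_addChar hℓ hp 1
    have h3 := h1.mpr rfl
    subst h3
    simp only [AddChar.one_apply, mul_one, klooSum, sum_const, card_univ, ZMod.card,
      nsmul_eq_mul, card_erase_of_mem (mem_univ _)] at h2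
    rw [h2, Nat.cast_sub (Fact.out : ℓ.Prime).one_lt.le]
    push_cast; ring
  refine ⟨fun x => (quadraticChar (ZMod ℓ) (x ^ 2 - p) : ℂ), fun x => ?_, hone, fun ψ => ?_⟩
  · beta_reduce
    rw [← jacobiSym.legendreSym.to_jacobiSym, legendreSym]
    push_cast; rfl
  · rcases eq_or_ne ψ 1 with rfl | hψ
    · simp only [AddChar.one_apply, mul_one, hone, norm_neg, norm_one]
      have : 1 ≤ √(ℓ : ℝ) := Real.one_le_sqrt.mpr hℓ1
      linarith
    · obtain ⟨ψ', h1, h2⟩ := sum_quadraticChar_mul_addChar hℓ hp ψ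
      have h3 : ψ' ≠ 1 := fun h => hψ (h1.mp h)
      rw [h2, AddChar.sum_eq_zero_of_ne_one h3, sub_zero]
      have := norm_klooSum_le hF hp h3
      rwa [ZMod.card] at this

lemma perSpec_jacobiSym {p : ℕ} (d : ℕ) [hd0 : NeZero d] (hd : Odd d) (hsq : Squarefree d)
    (hp : d.Coprime p) :
    PerSpec d (fun x => (jacobiSym (x ^ 2 - p) d : ℂ)) (ArithmeticFunction.moebius d)
      (#d.divisors * √d) := by
  revert hd0
  induction d using induction_on_primes with
  | zero => intro h; exact absurd rfl h.out
  | one =>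
    intro _
    have h := PerSpec.of_nonneg (Q := 1) (F := fun _ => 1) (M := 1) (fun _ _ _ => rfl) (by simp)
    simpa using h
  | prime_mul ℓ a hℓ ih =>
    intro _
    have ha : a ≠ 0 := fun h => NeZero.ne (ℓ * a) (by rw [h, mul_zero])
    have : NeZero a := ⟨ha⟩
    have : NeZero ℓ := ⟨hℓ.ne_zero⟩
    have : Fact ℓ.Prime := ⟨hℓ⟩
    have hc : ℓ.Coprime a := Nat.coprime_of_squarefree_mul hsq
    have h1 := ih (Nat.odd_mul.mp hd).2 (hsq.of_mul_right) (Nat.Coprime.coprime_mul_left hp)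
    have h2 : (p : ZMod ℓ) ≠ 0 := by
      rw [Ne, ZMod.natCast_eq_zero_iff]
      exact fun h => hℓ.one_lt.ne' (Nat.Coprime.eq_one_of_dvd (Nat.Coprime.coprime_mul_right hp) h)
    have h3 := (perSpec_jacobiSym_prime (p := p)
      (fun h => by subst h; exact absurd (Nat.odd_mul.mp hd).1 (by decide)) h2).mul hc h1
    convert h3 using 1
    · funext x
      rw [jacobiSym.mul_right]
      push_cast; rfl
    · rw [ArithmeticFunction.isMultiplicative_moebius.map_mul_of_coprime hc,
        ArithmeticFunction.moebius_apply_prime hℓ]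
      push_cast; rfl
    · rw [hc.card_divisors_mul, hℓ.divisors, card_pair hℓ.one_lt.ne]
      push_cast
      rw [Real.sqrt_mul (Nat.cast_nonneg _)]
      ring

/-- The number of `B mod 2^(e+1)` with `B² ≡ b² - p mod 2^(e+2)`. -/
def twoCount (p e : ℕ) (b : ℤ) : ℕ :=
  #((range (2 ^ (e + 1))).filter fun B : ℕ => (2 : ℤ) ^ (e + 2) ∣ (B : ℤ) ^ 2 - b ^ 2 + p)

lemma two_pow_dvd_sq_sub_sq {e : ℕ} {x y : ℤ} (h : ((2 ^ (e + 1) : ℕ) : ℤ) ∣ x - y) :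
    (2 : ℤ) ^ (e + 2) ∣ x ^ 2 - y ^ 2 := by
  push_cast at h
  have h1 : (2 : ℤ) ∣ x + y := by
    have : (2 : ℤ) ∣ x - y := (dvd_pow_self 2 (by omega)).trans h
    omega
  rw [show x ^ 2 - y ^ 2 = (x - y) * (x + y) by ring, pow_succ]
  exact mul_dvd_mul h h1

lemma twoCount_congr {p e : ℕ} {x y : ℤ} (h : ((2 ^ (e + 1) : ℕ) : ℤ) ∣ x - y) :
    twoCount p e x = twoCount p e y := by
  refine congrArg card (filter_congr fun B _ => ?_)
  rw [show (B : ℤ) ^ 2 - x ^ 2 + p = (B ^ 2 - y ^ 2 + p) - (x ^ 2 - y ^ 2) by ring]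
  exact dvd_sub_left (two_pow_dvd_sq_sub_sq h)

lemma twoCount_mod (p e : ℕ) (b : ℤ) : twoCount p e b = twoCount (p % 2 ^ (e + 2)) e b := by
  refine congrArg card (filter_congr fun B _ => ?_)
  conv_lhs => rw [← Nat.mod_add_div p (2 ^ (e + 2))]
  push_cast
  rw [← add_assoc]
  exact dvd_add_left (dvd_mul_right _ _)

lemma sum_twoCount {p e : ℕ} (hp : Odd p) (he : e ≤ 3) :
    ∑ b ∈ range (2 ^ (e + 1)), twoCount p e b = 2 ^ e := by
  simp_rw [twoCount_mod p e]
  have h1 : p % 2 ^ (e + 2) < 2 ^ (e + 2) := Nat.mod_lt _ (by positivity)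
  have h2 : (p % 2 ^ (e + 2)) % 2 = 1 := by
    rw [Nat.mod_mod_of_dvd _ (dvd_pow_self 2 (by omega))]
    exact Nat.odd_iff.mp hp
  generalize p % 2 ^ (e + 2) = r at h1 h2
  revert r
  interval_cases e <;> decide +kernel

lemma perSpec_twoCount {p e : ℕ} (hp : Odd p) (he : e ≤ 3) :
    PerSpec (2 ^ (e + 1)) (fun x => (twoCount p e x : ℂ)) (2 ^ e) (2 ^ e) := by
  have := PerSpec.of_nonneg (Q := 2 ^ (e + 1)) (F := fun x => twoCount p e x) (M := 2 ^ e)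
    (fun x y h => twoCount_congr h) (sum_twoCount hp he)
  simpa using this

lemma twoCount_le {p e : ℕ} (hp : Odd p) (he : e ≤ 3) (b : ℤ) : twoCount p e b ≤ 2 ^ e := by
  have hpos : (0 : ℤ) < (2 ^ (e + 1) : ℕ) := by positivity
  have h0 := Int.emod_nonneg b hpos.ne'
  have h1 := Int.emod_lt_of_pos b hpos
  rw [← sum_twoCount hp he, twoCount_congr (p := p) (x := b)
    (y := ((b % ((2 ^ (e + 1) : ℕ) : ℤ)).toNat : ℤ))
    (by rw [Int.toNat_of_nonneg h0]; exact Int.dvd_self_sub_emod)]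
  exact single_le_sum (f := fun n : ℕ => twoCount p e n) (fun _ _ => Nat.zero_le _)
    (mem_range.mpr (by omega))

/-- Number of `B mod 2A` with `B² ≡ b² - p mod 4A`. -/
def formCount (p A : ℕ) (b : ℤ) : ℕ :=
  #((range (2 * A)).filter fun B : ℕ => (4 * A : ℤ) ∣ (B : ℤ) ^ 2 - b ^ 2 + p)

lemma perSpec_dvd_sq_prime {ℓ : ℕ} [Fact ℓ.Prime] (hℓ : ℓ ≠ 2) (c : ℤ) :
    PerSpec ℓ (fun x => if (ℓ : ℤ) ∣ x ^ 2 - c then 1 else 0) (1 + jacobiSym c ℓ)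
      (1 + jacobiSym c ℓ : ℤ) := by
  have hiff : ∀ x : ℤ, (ℓ : ℤ) ∣ x ^ 2 - c ↔ ((x : ZMod ℓ)) ^ 2 = c := by
    intro x
    rw [← ZMod.intCast_zmod_eq_zero_iff_dvd, Int.cast_sub, sub_eq_zero, Int.cast_pow]
  have hs : ∑ x : ZMod ℓ, (if x ^ 2 = (c : ZMod ℓ) then (1 : ℤ) else 0) = 1 + jacobiSym c ℓ := by
    rw [← jacobiSym.legendreSym.to_jacobiSym, add_comm, ← legendreSym.card_sqrts ℓ hℓ c, sum_boole]
    congr 2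
    ext x; simp
  refine ⟨fun x => if x ^ 2 = (c : ZMod ℓ) then 1 else 0, fun x => by simp only [hiff], ?_,
    fun ψ => ?_⟩
  · have := congrArg (Int.cast : ℤ → ℂ) hs
    push_cast at this
    exact this
  · rw [← hs, Int.cast_sum]
    refine (norm_sum_le _ _).trans (sum_le_sum fun x _ => ?_)
    rw [norm_mul, ψ.norm_apply, mul_one]
    by_cases h : x ^ 2 = (c : ZMod ℓ) <;> simp [h]

lemma perSpec_dvd_sq (d : ℕ) [hd0 : NeZero d] (hd : Odd d) (hsq : Squarefree d) (c : ℤ) :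
    PerSpec d (fun x => if (d : ℤ) ∣ x ^ 2 - c then 1 else 0) (∑ k ∈ d.divisors, jacobiSym c k : ℤ)
      (∑ k ∈ d.divisors, jacobiSym c k : ℤ) := by
  revert hd0
  induction d using induction_on_primes with
  | zero => intro h; exact absurd rfl h.out
  | one =>
    intro _
    have h := PerSpec.of_nonneg (Q := 1) (F := fun _ => 1) (M := 1) (fun _ _ _ => rfl) (by simp)
    simpa using h
  | prime_mul ℓ a hℓ ih =>
    intro _
    have ha : a ≠ 0 := fun h => NeZero.ne (ℓ * a) (by rw [h, mul_zero])
    have : NeZero a := ⟨ha⟩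
    have : NeZero ℓ := ⟨hℓ.ne_zero⟩
    have : Fact ℓ.Prime := ⟨hℓ⟩
    have hc : ℓ.Coprime a := Nat.coprime_of_squarefree_mul hsq
    have h1 := ih (Nat.odd_mul.mp hd).2 (hsq.of_mul_right)
    have h3 := (perSpec_dvd_sq_prime (fun h => by subst h; exact absurd (Nat.odd_mul.mp hd).1 (by decide)) c).mul hc h1
    have hsum : ∑ k ∈ (ℓ * a).divisors, jacobiSym c k
        = (1 + jacobiSym c ℓ) * ∑ k ∈ a.divisors, jacobiSym c k := by
      rw [sum_divisors_mul_of_coprime hc, hℓ.divisors, sum_pair hℓ.one_lt.ne, add_mul, one_mul,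
        mul_sum]
      congr 1
      · simp
      · refine sum_congr rfl fun k hk => ?_
        exact jacobiSym.mul_right' c hℓ.ne_zero (Nat.pos_of_mem_divisors hk).ne'
    convert h3 using 1
    · funext x
      have := mul_dvd_iff_of_isCoprime (c := x ^ 2 - c) (Nat.isCoprime_iff_coprime.mpr hc)
      rw [Nat.cast_mul, if_congr this rfl rfl, ite_and]
      split_ifs <;> simp
    · rw [hsum]; push_cast; rfl
    · rw [hsum]; push_cast; rfl

lemma formCount_eq {p e A : ℕ} (hA : Odd A) (hsq : Squarefree A) (b : ℤ) :
    (formCount p (2 ^ e * A) b : ℤ)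
      = twoCount p e b * ∑ d ∈ A.divisors, jacobiSym (b ^ 2 - p) d := by
  have : NeZero A := ⟨hsq.ne_zero⟩
  have hc : (2 ^ (e + 1)).Coprime A := Nat.Coprime.pow_left _ (Nat.coprime_two_left.mpr hA)
  have h1 := PerSpec.of_nonneg (Q := 2 ^ (e + 1)) (M := twoCount p e b)
    (F := fun x : ℤ => if (2 : ℤ) ^ (e + 2) ∣ x ^ 2 - b ^ 2 + p then 1 else 0)
    (fun x y h => by
      refine if_congr ?_ rfl rfl
      rw [show x ^ 2 - b ^ 2 + p = (y ^ 2 - b ^ 2 + p) + (x ^ 2 - y ^ 2) by ring]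
      exact dvd_add_left (two_pow_dvd_sq_sub_sq h))
    (by rw [sum_boole]; rfl)
  have h2 := (h1.mul hc (perSpec_dvd_sq A hA hsq (b ^ 2 - p))).sum_range
  have h3 : ∀ n : ℕ, (((if (2 : ℤ) ^ (e + 2) ∣ (n : ℤ) ^ 2 - b ^ 2 + p then 1 else 0 : ℕ) : ℂ) *
      if (A : ℤ) ∣ (n : ℤ) ^ 2 - (b ^ 2 - p) then 1 else 0)
      = if (4 * (2 ^ e * A : ℕ) : ℤ) ∣ (n : ℤ) ^ 2 - b ^ 2 + p then 1 else 0 := by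
    intro n
    have hc' : IsCoprime ((2 : ℤ) ^ (e + 2)) A := by
      have : (2 ^ (e + 2)).Coprime A := Nat.Coprime.pow_left _ (Nat.coprime_two_left.mpr hA)
      exact_mod_cast Nat.isCoprime_iff_coprime.mpr this
    rw [show (4 * (2 ^ e * A : ℕ) : ℤ) = 2 ^ (e + 2) * A by push_cast; ring,
      show (n : ℤ) ^ 2 - (b ^ 2 - p) = n ^ 2 - b ^ 2 + p by ring,
      if_congr (mul_dvd_iff_of_isCoprime (c := (n : ℤ) ^ 2 - b ^ 2 + p) hc') rfl rfl, ite_and]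
    split_ifs <;> simp
  simp_rw [h3] at h2
  rw [sum_boole] at h2
  have h4 : 2 * (2 ^ e * A) = 2 ^ (e + 1) * A := by ring
  rw [formCount, h4]
  exact_mod_cast h2

end LocalCounts

end

section

open Finset

section CountingForms

/-- The sum over `k < n`, `l < n'` of `twoCount p e b * (b² - p | d)` with `b = a + k + l`. -/
def chiSum (p e d : ℕ) (a : ℤ) (n n' : ℕ) : ℤ :=
  ∑ k ∈ range n, ∑ l ∈ range n',
    (twoCount p e (a + k + l) : ℤ) * jacobiSym ((a + k + l) ^ 2 - p) d

lemma abs_chiSum_sub_le {p e d : ℕ} (hp : Odd p) (he : e ≤ 3) (hd : Odd d) (hsq : Squarefree d)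
    (hdp : d.Coprime p) (a : ℤ) (n n' : ℕ) :
    |(chiSum p e d a n n' : ℝ) - ArithmeticFunction.moebius d / d * (n * n') / 2|
      ≤ 2 ^ e * (#d.divisors * √d) * (√n * √n') := by
  have : NeZero d := ⟨hsq.ne_zero⟩
  have hc : (2 ^ (e + 1)).Coprime d := Nat.Coprime.pow_left _ (Nat.coprime_two_left.mpr hd)
  have h := ((perSpec_twoCount hp he).mul hc (perSpec_jacobiSym d hd hsq hdp)).norm_sum_sum_sub_le
    a n n'
  rw [← Real.norm_eq_abs, ← Complex.norm_real]
  convert h using 2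
  rw [chiSum]
  push_cast
  have hd0 : (d : ℂ) ≠ 0 := by exact_mod_cast NeZero.ne d
  congr 1
  rw [pow_succ]
  field_simp

lemma abs_chiSum_le {p e m r : ℕ} (hp : Odd p) (he : e ≤ 3) (hd : Odd (m * r))
    (hsq : Squarefree (m * r)) (hdp : (m * r).Coprime p) (a : ℤ) {n n' : ℕ}
    (hn : n ≤ 2 ^ (e + 1) * (m * r)) (hn' : n' ≤ 2 ^ (e + 1) * r) :
    |(chiSum p e (m * r) a n n' : ℝ)|
      ≤ 2 ^ e * (#r.divisors * √(m * r)) * (√n * √n') := by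
  have hm0 : m ≠ 0 := fun h => hsq.ne_zero (by simp [h])
  have hr0 : r ≠ 0 := fun h => hsq.ne_zero (by simp [h])
  have : NeZero r := ⟨hr0⟩
  have hr := (Nat.odd_mul.mp hd).2
  have hc : ∀ j, Odd j → (2 ^ (e + 1)).Coprime j :=
    fun j hj => Nat.Coprime.pow_left _ (Nat.coprime_two_left.mpr hj)
  have hmr : m.Coprime r := Nat.coprime_of_squarefree_mul hsq
  have h := ((perSpec_twoCount hp he).mul (hc r hr) (perSpec_jacobiSym r hr hsq.of_mul_right
    (Nat.Coprime.coprime_mul_left hdp))).norm_sum_sum_mul_le (Nat.pos_of_ne_zero hm0)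
    (Nat.Coprime.mul_right (hc m (Nat.odd_mul.mp hd).1).symm hmr)
    (g := fun x => (jacobiSym (x ^ 2 - p) m : ℂ)) (fun x => by
      rcases jacobiSym.trichotomy (x ^ 2 - p) m with h | h | h <;> simp [h])
    (fun x y hxy => by
      have h1 : (m : ℤ) ∣ (x ^ 2 - p) - (y ^ 2 - p) := by
        rw [show (x ^ 2 - (p : ℤ)) - (y ^ 2 - p) = (x - y) * (x + y) by ring]
        exact hxy.mul_right _
      exact congrArg _ (jacobiSym.mod_left' (Int.emod_eq_emod_iff_emod_sub_eq_zero.mpr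
          (Int.emod_eq_zero_of_dvd h1))))
    a (hn.trans (le_of_eq (by ring))) hn'
  rw [← Real.norm_eq_abs, ← Complex.norm_real]
  calc _ = _ := ?_
    _ ≤ _ := h
    _ = _ := ?_
  · rw [chiSum]
    push_cast
    refine congrArg _ (sum_congr rfl fun k _ => sum_congr rfl fun l _ => ?_)
    rw [jacobiSym.mul_right' _ hm0 hr0]
    push_cast; ring
  · rw [Real.sqrt_mul (Nat.cast_nonneg _)]; ring

lemma sum_chiSum_le {p e A : ℕ} (hA : Odd A) (hsq : Squarefree A) (s t : ℕ) :
    ∑ d ∈ A.divisors, chiSum p e d (-(s + t : ℕ)) (2 * s + 1) (2 * t + 1)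
      ≤ (2 * t + 1) * (∑ b ∈ (Icc (-(s + t : ℕ) : ℤ) (s + t : ℕ)).erase 0,
          (formCount p (2 ^ e * A) b : ℤ) + formCount p (2 ^ e * A) 0) := by
  have h1 : ∑ d ∈ A.divisors, chiSum p e d (-(s + t : ℕ)) (2 * s + 1) (2 * t + 1)
      = ∑ l ∈ range (2 * t + 1), ∑ k ∈ range (2 * s + 1),
        (formCount p (2 ^ e * A) (-(s + t : ℕ) + k + l) : ℤ) := by
    simp only [chiSum]
    rw [sum_comm, sum_comm (s := range (2 * t + 1))]
    refine sum_congr rfl fun k _ => ?_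
    rw [sum_comm]
    refine sum_congr rfl fun l _ => ?_
    rw [formCount_eq hA hsq, mul_sum]
  have h2 : ∀ l ∈ range (2 * t + 1), ∑ k ∈ range (2 * s + 1),
      (formCount p (2 ^ e * A) (-(s + t : ℕ) + k + l) : ℤ)
      ≤ ∑ b ∈ (Icc (-(s + t : ℕ) : ℤ) (s + t : ℕ)).erase 0,
          (formCount p (2 ^ e * A) b : ℤ) + formCount p (2 ^ e * A) 0 := by
    intro l hl
    rw [sum_erase_add _ _ (by simp; omega), ← sum_image (s := range (2 * s + 1))
      (g := fun k : ℕ => (-(s + t : ℕ) + k + l : ℤ))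
      (f := fun b => (formCount p (2 ^ e * A) b : ℤ)) (fun i _ j _ h => by simpa using h)]
    refine sum_le_sum_of_subset_of_nonneg (fun b hb => ?_) (fun _ _ _ => Nat.cast_nonneg _)
    obtain ⟨k, hk, rfl⟩ := mem_image.mp hb
    have := mem_range.mp hk
    have := mem_range.mp hl
    rw [mem_Icc]
    push_cast
    constructor <;> omega
  rw [h1]
  refine (sum_le_sum h2).trans (le_of_eq ?_)
  rw [sum_const, card_range, nsmul_eq_mul]
  push_cast; rfl

lemma formCount_zero_le {p e A : ℕ} (hp : Odd p) (he : e ≤ 3) (hA : Odd A) (hsq : Squarefree A) :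
    (formCount p (2 ^ e * A) 0 : ℤ) ≤ 2 ^ e * #A.divisors := by
  rw [formCount_eq hA hsq]
  have h1 : ∑ d ∈ A.divisors, jacobiSym (0 ^ 2 - (p : ℤ)) d ≤ #A.divisors := by
    refine (sum_le_sum (g := fun _ => (1 : ℤ)) fun d _ => ?_).trans (by simp)
    rcases jacobiSym.trichotomy (0 ^ 2 - (p : ℤ)) d with h | h | h <;> rw [h] <;> norm_num
  have h2 : (twoCount p e 0 : ℤ) ≤ 2 ^ e := by exact_mod_cast twoCount_le hp he 0
  calc _ ≤ (twoCount p e 0 : ℤ) * #A.divisors := mul_le_mul_of_nonneg_left h1 (by positivity)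
    _ ≤ _ := mul_le_mul_of_nonneg_right h2 (by positivity)

variable {p : ℕ} [Fact p.Prime]

lemma three_mul_sum_formCount_le (hp2 : p ≠ 2) {x : ℝ} {H : ℕ} (hH : 4 * H ^ 2 ≤ p)
    (hx : 4 * (H : ℝ) ^ 2 ≤ x * p) (S : Finset ℕ)
    (hS : ∀ A ∈ S, 0 < A ∧ 41616 * (A : ℤ) ^ 2 < 10000 * (p - H ^ 2)) :
    3 * ∑ A ∈ S, ∑ b ∈ (Icc (-H : ℤ) H).erase 0, formCount p A b
      ≤ 2 * Nat.card {lam : ZMod p // lam ≠ 0 ∧ lam ≠ -1 ∧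
        ALam p lam ∈ Set.Icc (-1) (-1 + x)} + 6 := by
  let U : Finset (Σ _ : ℕ, Σ _ : ℤ, ℕ) := S.sigma fun A => ((Icc (-H : ℤ) H).erase 0).sigma fun b =>
    (range (2 * A)).filter fun B : ℕ => (4 * A : ℤ) ∣ (B : ℤ) ^ 2 - b ^ 2 + p
  have hU : #U = ∑ A ∈ S, ∑ b ∈ (Icc (-H : ℤ) H).erase 0, formCount p A b := by
    rw [card_sigma]
    exact sum_congr rfl fun A _ => card_sigma _ _
  let φ : (Σ _ : ℕ, Σ _ : ℤ, ℕ) → ℤ × ℤ × ℤ := fun u =>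
    if 0 < u.2.1 then (u.2.1, u.1, u.2.2) else (-u.2.1, u.1, u.2.2 + 2 * u.1)
  have hmem : ∀ u ∈ U, u.1 ∈ S ∧ u.2.1 ≠ 0 ∧ -(H : ℤ) ≤ u.2.1 ∧ u.2.1 ≤ H ∧ u.2.2 < 2 * u.1 ∧
      (4 * u.1 : ℤ) ∣ (u.2.2 : ℤ) ^ 2 - u.2.1 ^ 2 + p := by
    rintro ⟨A, b, B⟩ hu
    simp only [U, mem_sigma, mem_erase, mem_Icc, mem_filter, mem_range] at hu
    obtain ⟨h1, ⟨h2, h3, h4⟩, h5, h6⟩ := hu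
    exact ⟨h1, h2, h3, h4, h5, h6⟩
  have hinj : Set.InjOn φ U := by
    intro u hu v hv h
    obtain ⟨-, hu2, -, -, hu5, -⟩ := hmem u hu
    obtain ⟨-, hv2, -, -, hv5, -⟩ := hmem v hv
    obtain ⟨A, b, B⟩ := u
    obtain ⟨A', b', B'⟩ := v
    simp only [φ] at h hu2 hv2 hu5 hv5
    split_ifs at h with h1 h2 h2 <;> simp only [Prod.mk.injEq] at h <;> obtain ⟨h3, h4, h5⟩ := h
    · obtain rfl : A = A' := by omega
      obtain rfl : B = B' := by omega
      rw [h3]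
    · omega
    · omega
    · obtain rfl : A = A' := by omega
      obtain rfl : B = B' := by omega
      obtain rfl : b = b' := by omega
      rfl
  rw [← hU, ← card_image_of_injOn hinj]
  refine three_mul_card_le hp2 _ fun s hs => ?_
  obtain ⟨u, hu, rfl⟩ := mem_image.mp hs
  obtain ⟨h1, h2, h3, h4, h5, h6⟩ := hmem u hu
  obtain ⟨A, b, B⟩ := u
  simp only at h1 h2 h3 h4 h5 h6
  obtain ⟨hA0, hA⟩ := hS A h1
  have hbH : b ^ 2 ≤ (H : ℤ) ^ 2 := sq_le_sq' h3 h4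
  have hHp : 4 * (H : ℤ) ^ 2 ≤ p := by exact_mod_cast hH
  have hbx : 4 * (b : ℝ) ^ 2 ≤ x * p := by
    have : (b : ℝ) ^ 2 ≤ (H : ℝ) ^ 2 := by exact_mod_cast hbH
    linarith
  by_cases hb : 0 < b
  · simp only [φ, hb, if_true]
    refine ⟨⟨hb, by simpa using hA0, by simp, by simp only; omega, ?_, ?_, h6⟩, hbx⟩
    · simp only; linarith
    · simp only; linarith
  · simp only [φ, hb, if_false]
    refine ⟨⟨by simp only; omega, by simpa using hA0, by simp only; positivity,
      by simp only; omega, ?_, ?_, ?_⟩, by push_cast; rwa [neg_sq]⟩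
    · simp only [neg_sq]; linarith
    · simp only [neg_sq]; linarith
    · simp only [neg_sq]
      rw [show ((B : ℤ) + 2 * A) ^ 2 - b ^ 2 + p
        = ((B : ℤ) ^ 2 - b ^ 2 + p) + 4 * A * (B + A) by ring]
      exact dvd_add h6 (dvd_mul_right _ _)

/-- The lower bound for the count in terms of bounds `E e d` for the deviation of the character
sums from their means. -/
lemma sum_main_sub_error_le (hp2 : p ≠ 2) {x : ℝ} {s t : ℕ} (hH : 4 * (s + t) ^ 2 ≤ p)
    (hx : 4 * ((s + t : ℕ) : ℝ) ^ 2 ≤ x * p) (𝒜 : ℕ → Finset ℕ)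
    (h𝒜 : ∀ e < 4, ∀ A ∈ 𝒜 e, Odd A ∧ Squarefree A ∧
      41616 * ((2 ^ e * A : ℕ) : ℤ) ^ 2 < 10000 * (p - (s + t : ℕ) ^ 2)) (E : ℕ → ℕ → ℝ)
    (hE : ∀ e < 4, ∀ A ∈ 𝒜 e, ∀ d ∈ A.divisors,
      |(chiSum p e d (-(s + t : ℕ)) (2 * s + 1) (2 * t + 1) : ℝ)
        - ArithmeticFunction.moebius d / d * ((2 * s + 1) * (2 * t + 1)) / 2|
        ≤ (2 * t + 1) * E e d) :
    3 * ∑ e ∈ range 4, ∑ A ∈ 𝒜 e,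
      ((2 * s + 1) / 2 * ∑ d ∈ A.divisors, (ArithmeticFunction.moebius d / d : ℝ)
        - ∑ d ∈ A.divisors, E e d - 2 ^ e * #A.divisors)
      ≤ 2 * (Nat.card {lam : ZMod p // lam ≠ 0 ∧ lam ≠ -1 ∧
        ALam p lam ∈ Set.Icc (-1) (-1 + x)} : ℝ) + 6 := by
  have hp : Odd p := (Fact.out : p.Prime).odd_of_ne_two hp2
  let S : Finset ℕ := ((range 4).sigma 𝒜).image fun u : Σ _ : ℕ, ℕ => 2 ^ u.1 * u.2
  have hinj : Set.InjOn (fun u : Σ _ : ℕ, ℕ => 2 ^ u.1 * u.2)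
      ((range 4).sigma 𝒜 : Finset (Σ _ : ℕ, ℕ)) := by
    rintro ⟨e, A⟩ hu ⟨e', A'⟩ hv h
    simp only [mem_coe, mem_sigma, mem_range] at hu hv h
    have hA := (h𝒜 e hu.1 A hu.2).1
    have hA' := (h𝒜 e' hv.1 A' hv.2).1
    have hee : e = e' := by
      have h1 := congrArg (padicValNat 2) h
      have h3 : ∀ (f C : ℕ), Odd C → padicValNat 2 (2 ^ f * C) = f := fun f C hC => by
        rw [padicValNat.mul (by positivity) (by rintro rfl; simp at hC), padicValNat.prime_pow,
          padicValNat.eq_zero_of_not_dvd (fun h => by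
            rw [Nat.odd_iff] at hC; omega), add_zero]
      rwa [h3 _ _ hA, h3 _ _ hA'] at h1
    subst hee
    rw [Nat.eq_of_mul_eq_mul_left (by positivity) h]
  have h1 := three_mul_sum_formCount_le hp2 hH hx S (fun A hA => by
    obtain ⟨⟨e, A'⟩, hu, rfl⟩ := mem_image.mp hA
    simp only [mem_sigma, mem_range] at hu
    obtain ⟨h1, h2, h3⟩ := h𝒜 e hu.1 A' hu.2
    exact ⟨Nat.mul_pos (by positivity) h1.pos, h3⟩)
  rw [sum_image hinj, sum_sigma] at h1
  have h2 : ∑ e ∈ range 4, ∑ A ∈ 𝒜 e,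
      ((2 * s + 1) / 2 * ∑ d ∈ A.divisors, (ArithmeticFunction.moebius d / d : ℝ)
        - ∑ d ∈ A.divisors, E e d - 2 ^ e * #A.divisors)
      ≤ ((∑ e ∈ range 4, ∑ A ∈ 𝒜 e, ∑ b ∈ (Icc (-(s + t : ℕ) : ℤ) (s + t : ℕ)).erase 0,
        formCount p (2 ^ e * A) b : ℕ) : ℝ) := by
    rw [Nat.cast_sum]
    refine sum_le_sum fun e he => ?_
    rw [Nat.cast_sum]
    refine sum_le_sum fun A hA => ?_
    have he := mem_range.mp he
    obtain ⟨hA1, hA2, -⟩ := h𝒜 e he A hA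
    have h3 := sum_chiSum_le (p := p) (e := e) hA1 hA2 s t
    have h4 := formCount_zero_le hp (by omega : e ≤ 3) hA1 hA2
    have h5 : ∑ d ∈ A.divisors, (ArithmeticFunction.moebius d / d * ((2 * s + 1) * (2 * t + 1)) / 2
        - (2 * t + 1) * E e d)
        ≤ ∑ d ∈ A.divisors, (chiSum p e d (-(s + t : ℕ)) (2 * s + 1) (2 * t + 1) : ℝ) :=
      sum_le_sum fun d hd => by
        have := (abs_le.mp (hE e he A hA d hd)).1
        linarith
    have h6 : ∑ d ∈ A.divisors, (ArithmeticFunction.moebius d / d * ((2 * s + 1) * (2 * t + 1)) / 2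
        - (2 * t + 1) * E e d : ℝ)
        = (2 * t + 1) * ((2 * s + 1) / 2 * ∑ d ∈ A.divisors, (ArithmeticFunction.moebius d / d : ℝ)
          - ∑ d ∈ A.divisors, E e d) := by
      rw [mul_sub, mul_sum, mul_sum, mul_sum, ← sum_sub_distrib]
      exact sum_congr rfl fun d _ => by ring
    have h7 : (∑ d ∈ A.divisors, (chiSum p e d (-(s + t : ℕ)) (2 * s + 1) (2 * t + 1) : ℝ))
        ≤ (2 * t + 1) * (∑ b ∈ (Icc (-(s + t : ℕ) : ℤ) (s + t : ℕ)).erase 0,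
          (formCount p (2 ^ e * A) b : ℝ) + formCount p (2 ^ e * A) 0) := by
      exact_mod_cast h3
    have h8 : (formCount p (2 ^ e * A) 0 : ℝ) ≤ 2 ^ e * #A.divisors := by exact_mod_cast h4
    have h9 := le_of_mul_le_mul_left (h6 ▸ h5.trans h7) (by positivity : (0 : ℝ) < 2 * t + 1)
    push_cast at h9 ⊢
    linarith
  have h3 : (3 * (∑ e ∈ range 4, ∑ A ∈ 𝒜 e, ∑ b ∈ (Icc (-(s + t : ℕ) : ℤ) (s + t : ℕ)).erase 0,
      formCount p (2 ^ e * A) b : ℕ) : ℝ) ≤ 2 * (Nat.card {lam : ZMod p // lam ≠ 0 ∧ lam ≠ -1 ∧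
        ALam p lam ∈ Set.Icc (-1) (-1 + x)} : ℝ) + 6 := by
    exact_mod_cast h1
  linarith

end CountingForms

end

section

open Finset

section OddMultiples

/-- Odd natural numbers up to `N`. -/
def odds (N : ℕ) : Finset ℕ := (Icc 1 N).filter fun n => Odd n

lemma mem_odds {N n : ℕ} : n ∈ odds N ↔ n ≤ N ∧ Odd n := by
  rw [odds, mem_filter, mem_Icc]
  exact ⟨fun h => ⟨h.1.2, h.2⟩, fun h => ⟨⟨h.2.pos, h.1⟩, h.2⟩⟩

lemma sum_odds {M : Type*} [AddCommMonoid M] (N : ℕ) (f : ℕ → M) :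
    ∑ n ∈ odds N, f n = ∑ i ∈ range ((N + 1) / 2), f (2 * i + 1) := by
  refine sum_nbij' (fun n => n / 2) (fun i => 2 * i + 1) ?_ ?_ ?_ ?_ ?_
  · intro n hn
    obtain ⟨h1, h2⟩ := mem_odds.mp hn
    rw [Nat.odd_iff] at h2
    rw [mem_range]; omega
  · intro i hi
    rw [mem_range] at hi
    exact mem_odds.mpr ⟨by omega, ⟨i, rfl⟩⟩
  · intro n hn
    have h2 := (mem_odds.mp hn).2
    rw [Nat.odd_iff] at h2
    omega
  · intro i _; omega
  · intro n hn
    have h2 := (mem_odds.mp hn).2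
    rw [Nat.odd_iff] at h2
    congr 1; omega

lemma sum_odds_dvd {M : Type*} [AddCommMonoid M] (N : ℕ) {c : ℕ} (hc : Odd c) (f : ℕ → M) :
    ∑ n ∈ odds N with c ∣ n, f n = ∑ l ∈ odds (N / c), f (c * l) := by
  symm
  refine sum_nbij' (fun l => c * l) (fun n => n / c) ?_ ?_ ?_ ?_ ?_
  · intro l hl
    obtain ⟨h1, h2⟩ := mem_odds.mp hl
    exact mem_filter.mpr ⟨mem_odds.mpr ⟨(Nat.mul_le_mul_left c h1).trans (Nat.mul_div_le N c),
      hc.mul h2⟩, dvd_mul_right _ _⟩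
  · intro n hn
    obtain ⟨h1, l, rfl⟩ := mem_filter.mp hn
    obtain ⟨h2, h3⟩ := mem_odds.mp h1
    rw [Nat.mul_div_cancel_left _ hc.pos]
    exact mem_odds.mpr ⟨(Nat.le_div_iff_mul_le hc.pos).mpr (by rwa [mul_comm]),
      (Nat.odd_mul.mp h3).2⟩
  · intro l _
    exact Nat.mul_div_cancel_left _ hc.pos
  · intro n hn
    exact Nat.mul_div_cancel' (mem_filter.mp hn).2
  · intro l _; rfl

lemma card_odds (N : ℕ) : #(odds N) = (N + 1) / 2 := by
  have := sum_odds N (fun _ => 1)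
  simpa using this

lemma card_odds_dvd (N : ℕ) {c : ℕ} (hc : Odd c) :
    #((odds N).filter fun n => c ∣ n) = (N / c + 1) / 2 := by
  have := sum_odds_dvd N hc (fun _ => 1)
  rw [sum_const, sum_const, card_odds] at this
  simpa using this

lemma abs_card_odds_dvd_sub_le (N : ℕ) {c : ℕ} (hc : Odd c) :
    |(#((odds N).filter fun n => c ∣ n) : ℝ) - N / c / 2| ≤ 1 / 2 := by
  rw [card_odds_dvd N hc]
  have hc0 : (0 : ℝ) < c := by exact_mod_cast hc.pos
  have h1 : ((N / c : ℕ) : ℝ) ≤ N / c := Nat.cast_div_le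
  have h2 : (N : ℝ) / c < (N / c : ℕ) + 1 := by
    rw [div_lt_iff₀ hc0]
    rw [mul_comm]
    exact_mod_cast Nat.lt_mul_div_succ N hc.pos
  generalize N / c = q at *
  rcases Nat.even_or_odd' q with ⟨k, rfl | rfl⟩
  · rw [show (2 * k + 1) / 2 = k by omega]
    push_cast at h1 h2
    rw [abs_le]; constructor <;> linarith
  · rw [show (2 * k + 1 + 1) / 2 = k + 1 by omega]
    push_cast at h1 h2 ⊢
    rw [abs_le]; constructor <;> linarith

lemma card_odds_dvd_le (N : ℕ) {c : ℕ} (hc : Odd c) :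
    (#((odds N).filter fun n => c ∣ n) : ℝ) ≤ N / c := by
  rw [card_odds_dvd N hc]
  refine le_trans ?_ (Nat.cast_div_le (m := N) (n := c))
  generalize N / c = q
  exact_mod_cast (by omega : (q + 1) / 2 ≤ q)

/-- The contribution of the prime `3` to `φ(n)/n` on squarefree numbers. -/
def threeWeight (n : ℕ) : ℝ :=
  1 - (if 3 ∣ n then 1 / 3 else 0) - (if 9 ∣ n then 2 / 3 else 0)

lemma threeWeight_nonneg (n : ℕ) : 0 ≤ threeWeight n := by
  unfold threeWeight
  split_ifs <;> norm_num

lemma sum_threeWeight (N : ℕ) {c : ℕ} (hc : c.Coprime 3) :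
    ∑ n ∈ odds N with c ∣ n, threeWeight n
      = #((odds N).filter fun n => c ∣ n) - #((odds N).filter fun n => c * 3 ∣ n) / 3
        - 2 / 3 * #((odds N).filter fun n => c * 9 ∣ n) := by
  have key : ∀ m : ℕ, c.Coprime m → ∀ a : ℝ, ∑ n ∈ odds N with c ∣ n, (if m ∣ n then a else 0)
      = a * #((odds N).filter fun n => c * m ∣ n) := by
    intro m hm a
    rw [← sum_filter, filter_filter, sum_const, nsmul_eq_mul, mul_comm]
    congr 3
    refine filter_congr fun n _ => ?_
    exact ⟨fun h => hm.mul_dvd_of_dvd_of_dvd h.1 h.2,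
      fun h => ⟨dvd_of_mul_right_dvd h, dvd_of_mul_left_dvd h⟩⟩
  simp only [threeWeight, sum_sub_distrib]
  rw [key 3 hc, key 9 (by rw [show 9 = 3 ^ 2 by norm_num]; exact hc.pow_right 2)]
  simp only [sum_const, nsmul_eq_mul, mul_one]
  ring

lemma abs_sum_threeWeight_sub_le (N : ℕ) {c : ℕ} (hc : Odd c) (hc3 : c.Coprime 3) :
    |∑ n ∈ odds N with c ∣ n, threeWeight n - 11 / 27 * (N / c)| ≤ 1 := by
  rw [sum_threeWeight N hc3]
  have h1 := abs_card_odds_dvd_sub_le N hc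
  have h2 := abs_card_odds_dvd_sub_le N (hc.mul (by decide : Odd 3))
  have h3 := abs_card_odds_dvd_sub_le N (hc.mul (by decide : Odd 9))
  have e2 : (N : ℝ) / (c * 3 : ℕ) = N / c / 3 := by push_cast; rw [div_div]
  have e3 : (N : ℝ) / (c * 9 : ℕ) = N / c / 9 := by push_cast; rw [div_div]
  rw [e2] at h2
  rw [e3] at h3
  rw [abs_le] at *
  constructor <;> linarith [h1.1, h1.2, h2.1, h2.2, h3.1, h3.2]

/-- Numbers `5 ≤ c ≤ N` prime to `6`. -/
def sixUnits (N : ℕ) : Finset ℕ := (Icc 5 N).filter fun c => c % 6 = 1 ∨ c % 6 = 5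

lemma sixUnits_odd {N c : ℕ} (hc : c ∈ sixUnits N) : Odd c ∧ c.Coprime 3 ∧ 5 ≤ c ∧ c ≤ N := by
  rw [sixUnits, mem_filter, mem_Icc] at hc
  refine ⟨Nat.odd_iff.mpr (by omega), ?_, hc.1.1, hc.1.2⟩
  rw [Nat.coprime_comm, Nat.Prime.coprime_iff_not_dvd Nat.prime_three]
  omega

lemma prime_mem_sixUnits {N ℓ : ℕ} (hℓ : ℓ.Prime) (h2 : ℓ ≠ 2) (h3 : ℓ ≠ 3) (hN : ℓ ≤ N) :
    ℓ ∈ sixUnits N := by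
  have h5 := hℓ.two_le
  have e2 := (Nat.Prime.coprime_iff_not_dvd Nat.prime_two).mp
    ((Nat.coprime_primes Nat.prime_two hℓ).mpr h2.symm)
  have e3 := (Nat.Prime.coprime_iff_not_dvd Nat.prime_three).mp
    ((Nat.coprime_primes Nat.prime_three hℓ).mpr h3.symm)
  rw [sixUnits, mem_filter, mem_Icc]
  omega

lemma sum_sixUnits_inv_sq (N : ℕ) : ∑ c ∈ sixUnits N, 1 / (c : ℝ) ^ 2 ≤ 0.09745 := by
  have key : ∀ K : ℕ, 1 ≤ K → ∑ c ∈ range (6 * K + 2),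
      (if 5 ≤ c ∧ (c % 6 = 1 ∨ c % 6 = 5) then 1 / (c : ℝ) ^ 2 else 0)
      ≤ (0.09745 - 1 / 18 / ((K : ℝ) + 1 / 2) : ℝ) := by
    intro K hK
    induction K, hK using Nat.le_induction with
    | base =>
      rw [sum_range_succ, sum_range_succ, sum_range_succ, sum_range_succ, sum_range_succ,
        sum_range_succ, sum_range_succ, sum_range_succ]
      norm_num
    | succ K hK ih =>
      rw [show 6 * (K + 1) + 2 = 6 * K + 2 + 1 + 1 + 1 + 1 + 1 + 1 by ring]
      rw [sum_range_succ, sum_range_succ, sum_range_succ, sum_range_succ, sum_range_succ,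
        sum_range_succ]
      rw [if_neg (by omega), if_neg (by omega), if_neg (by omega), if_pos (by omega),
        if_neg (by omega), if_pos (by omega)]
      have hK' : (1 : ℝ) ≤ K := by exact_mod_cast hK
      have : 1 / (6 * (K : ℝ) + 5) ^ 2 + 1 / (6 * (K : ℝ) + 7) ^ 2
          ≤ 1 / 18 / (K + 1 / 2) - 1 / 18 / (K + 1 + 1 / 2) := by
        rw [div_add_div _ _ (by positivity) (by positivity),
          div_sub_div _ _ (by positivity) (by positivity), div_le_div_iff₀ (by positivity)
            (by positivity)]
        nlinarith [pow_pos (by linarith : (0 : ℝ) < K) 2, pow_pos (by linarith : (0 : ℝ) < K) 3]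
      push_cast at ih ⊢
      linarith
  calc ∑ c ∈ sixUnits N, 1 / (c : ℝ) ^ 2
      ≤ ∑ c ∈ range (6 * (N + 1) + 2),
        (if 5 ≤ c ∧ (c % 6 = 1 ∨ c % 6 = 5) then 1 / (c : ℝ) ^ 2 else 0) := by
        rw [← sum_filter]
        refine sum_le_sum_of_subset_of_nonneg (fun c hc => ?_) (fun _ _ _ => by positivity)
        rw [sixUnits, mem_filter, mem_Icc] at hc
        rw [mem_filter, mem_range]
        omega
    _ ≤ _ := (key (N + 1) (by omega)).trans (sub_le_self _ (by positivity))

lemma one_sub_sum_le_prod {ι : Type*} (s : Finset ι) (f : ι → ℝ) (h0 : ∀ i ∈ s, 0 ≤ f i)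
    (h1 : ∀ i ∈ s, f i ≤ 1) : 1 - ∑ i ∈ s, f i ≤ ∏ i ∈ s, (1 - f i) := by
  induction s using Finset.induction_on with
  | empty => simp
  | insert a s ha ih =>
    rw [sum_insert ha, prod_insert ha]
    have h2 := ih (fun i hi => h0 i (mem_insert_of_mem hi)) fun i hi => h1 i (mem_insert_of_mem hi)
    have h3 := h0 a (mem_insert_self a s)
    have h4 := h1 a (mem_insert_self a s)
    have h5 : 0 ≤ ∑ i ∈ s, f i := sum_nonneg fun i hi => h0 i (mem_insert_of_mem hi)
    nlinarith [mul_le_mul_of_nonneg_left h2 (sub_nonneg.mpr h4), mul_nonneg h3 h5]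

lemma sum_moebius_div_eq_prod {n : ℕ} (hn : Squarefree n) :
    ∑ d ∈ n.divisors, (ArithmeticFunction.moebius d / d : ℝ)
      = ∏ ℓ ∈ n.primeFactors, (1 - 1 / (ℓ : ℝ)) := by
  have := ArithmeticFunction.IsMultiplicative.prodPrimeFactors_one_sub_of_squarefree
    (⟨fun n => (n : ℝ)⁻¹, by simp⟩ : ArithmeticFunction ℝ)
    ⟨by simp, fun {m n} _ => by simp [mul_comm]⟩ hn
  simp only [ArithmeticFunction.coe_mk] at this
  simp only [div_eq_mul_inv, one_mul, this]

/-- Odd squarefree natural numbers up to `N`. -/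
def oddSqfree (N : ℕ) : Finset ℕ := (odds N).filter Squarefree

lemma threeWeight_mul_le {n N : ℕ} (hn : n ∈ oddSqfree N) :
    threeWeight n * (1 - ∑ c ∈ sixUnits N, (if c ∣ n then 1 / (c : ℝ) else 0))
      ≤ ∑ d ∈ n.divisors, (ArithmeticFunction.moebius d / d : ℝ) := by
  obtain ⟨h1, hsq⟩ := mem_filter.mp hn
  obtain ⟨hnN, hodd⟩ := mem_odds.mp h1
  rw [sum_moebius_div_eq_prod hsq]
  have h9 : ¬ 9 ∣ n := fun h => by
    have := hsq 3 (by simpa using h)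
    simp at this
  have hprod : ∏ ℓ ∈ n.primeFactors, (1 - 1 / (ℓ : ℝ))
      = threeWeight n * ∏ ℓ ∈ n.primeFactors.erase 3, (1 - 1 / (ℓ : ℝ)) := by
    unfold threeWeight
    rw [if_neg h9]
    by_cases h3 : 3 ∣ n
    · rw [← mul_prod_erase _ _ (Nat.mem_primeFactors.mpr ⟨Nat.prime_three, h3, hsq.ne_zero⟩),
        if_pos h3]
      norm_num
    · rw [if_neg h3, erase_eq_of_notMem (fun h => h3 (Nat.dvd_of_mem_primeFactors h))]
      ring
  rw [hprod]
  refine mul_le_mul_of_nonneg_left ?_ (threeWeight_nonneg n)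
  refine le_trans ?_ (one_sub_sum_le_prod _ _ (fun i _ => by positivity) fun i hi => ?_)
  · refine sub_le_sub_left ?_ 1
    rw [← sum_filter]
    refine sum_le_sum_of_subset_of_nonneg (fun ℓ hℓ => ?_) (fun _ _ _ => by positivity)
    obtain ⟨h3, h4⟩ := mem_erase.mp hℓ
    have h5 := Nat.prime_of_mem_primeFactors h4
    have h6 := Nat.dvd_of_mem_primeFactors h4
    refine mem_filter.mpr ⟨prime_mem_sixUnits h5 ?_ h3
      ((Nat.le_of_dvd hodd.pos h6).trans hnN), h6⟩
    rintro rfl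
    rw [Nat.odd_iff] at hodd
    omega
  · have := (Nat.prime_of_mem_primeFactors (mem_of_mem_erase hi)).one_lt
    rw [div_le_one (by positivity)]
    exact_mod_cast this.le

lemma sum_moebius_div_ge (N : ℕ) :
    0.328 * N - 3 * √N ≤
      ∑ A ∈ oddSqfree N, ∑ d ∈ A.divisors, (ArithmeticFunction.moebius d / d : ℝ) := by
  rcases Nat.eq_zero_or_pos N with rfl | hN
  · simp [oddSqfree, odds]
  let w : ℕ → ℝ := fun n => threeWeight n *
    (1 - ∑ c ∈ sixUnits N, (if c ∣ n then 1 / (c : ℝ) else 0)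
      - ∑ c ∈ sixUnits N, (if c ^ 2 ∣ n then 1 else 0))
  have h1 : ∑ n ∈ odds N, w n ≤
      ∑ A ∈ oddSqfree N, ∑ d ∈ A.divisors, (ArithmeticFunction.moebius d / d : ℝ) := by
    rw [← sum_filter_add_sum_filter_not (odds N) Squarefree w]
    have hneg : ∑ n ∈ odds N with ¬ Squarefree n, w n ≤ 0 := by
      refine sum_nonpos fun n hn => ?_
      obtain ⟨hn1, hn2⟩ := mem_filter.mp hn
      obtain ⟨hnN, hodd⟩ := mem_odds.mp hn1
      rw [Nat.squarefree_iff_prime_squarefree] at hn2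
      push Not at hn2
      obtain ⟨ℓ, hℓ, hd⟩ := hn2
      have hle : ℓ ≤ n := Nat.le_of_dvd hodd.pos (dvd_of_mul_left_dvd hd)
      by_cases h3 : ℓ = 3
      · subst h3
        have h9 : 9 ∣ n := hd
        have : threeWeight n = 0 := by
          rw [threeWeight, if_pos (by omega), if_pos h9]; norm_num
        simp only [w, this, zero_mul, le_refl]
      · have hmem := prime_mem_sixUnits hℓ (by
          rintro rfl; rw [Nat.odd_iff] at hodd; omega) h3 (hle.trans hnN)
        refine mul_nonpos_of_nonneg_of_nonpos (threeWeight_nonneg n) ?_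
        have ha : 0 ≤ ∑ c ∈ sixUnits N, (if c ∣ n then 1 / (c : ℝ) else 0) :=
          sum_nonneg fun c _ => by positivity
        have hb : (1 : ℝ) ≤ ∑ c ∈ sixUnits N, (if c ^ 2 ∣ n then 1 else 0) := by
          refine le_trans (le_of_eq ?_) (single_le_sum (f := fun c : ℕ =>
            (if c ^ 2 ∣ n then (1 : ℝ) else 0)) (fun c _ => by positivity) hmem)
          rw [if_pos (by rwa [sq])]
        linarith
    have hpos : ∑ n ∈ odds N with Squarefree n, w n ≤
        ∑ A ∈ oddSqfree N, ∑ d ∈ A.divisors, (ArithmeticFunction.moebius d / d : ℝ) := by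
      refine sum_le_sum fun n hn => le_trans ?_ (threeWeight_mul_le hn)
      refine mul_le_mul_of_nonneg_left ?_ (threeWeight_nonneg n)
      exact sub_le_self _ (sum_nonneg fun c _ => by positivity)
    linarith
  have h2 : ∑ n ∈ odds N, w n = ∑ n ∈ odds N, threeWeight n
      - ∑ c ∈ sixUnits N, 1 / (c : ℝ) * ∑ n ∈ odds N with c ∣ n, threeWeight n
      - ∑ c ∈ sixUnits N, ∑ n ∈ odds N with c ^ 2 ∣ n, threeWeight n := by
    simp only [w, mul_sub, mul_one, sum_sub_distrib, mul_sum, sum_filter]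
    congr 1
    · congr 1
      rw [sum_comm]
      refine sum_congr rfl fun c _ => sum_congr rfl fun n _ => ?_
      split_ifs <;> ring
    · rw [sum_comm]
      refine sum_congr rfl fun c _ => sum_congr rfl fun n _ => ?_
      split_ifs <;> ring
  have hN1 : (1 : ℝ) ≤ N := by exact_mod_cast hN
  have h3 : 11 / 27 * (N : ℝ) - 1 ≤ ∑ n ∈ odds N, threeWeight n := by
    have := (abs_le.mp (abs_sum_threeWeight_sub_le N odd_one (by norm_num))).1
    simp only [one_dvd, filter_true, Nat.cast_one, div_one] at this
    linarith
  have h4 : ∑ c ∈ sixUnits N, 1 / (c : ℝ) * ∑ n ∈ odds N with c ∣ n, threeWeight n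
      ≤ 11 / 27 * N * ∑ c ∈ sixUnits N, 1 / (c : ℝ) ^ 2 + (1 + Real.log N) := by
    have : ∑ c ∈ sixUnits N, 1 / (c : ℝ) ≤ 1 + Real.log N := by
      refine le_trans ?_ (harmonic_le_one_add_log N)
      rw [harmonic_eq_sum_Icc]
      push_cast
      simp only [one_div]
      refine sum_le_sum_of_subset_of_nonneg (fun c hc => ?_) (fun _ _ _ => by positivity)
      have := sixUnits_odd hc
      exact mem_Icc.mpr ⟨by omega, this.2.2.2⟩
    refine le_trans ?_ (add_le_add_right this _)
    rw [mul_sum, ← sum_add_distrib]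
    refine sum_le_sum fun c hc => ?_
    obtain ⟨ho, h3, h5, -⟩ := sixUnits_odd hc
    have hb := (abs_le.mp (abs_sum_threeWeight_sub_le N ho h3)).2
    have hc0 : (0 : ℝ) < c := by exact_mod_cast ho.pos
    calc _ ≤ 1 / (c : ℝ) * (11 / 27 * (N / c) + 1) :=
          mul_le_mul_of_nonneg_left (by linarith) (by positivity)
      _ = _ := by field_simp
  have h5 : ∑ c ∈ sixUnits N, ∑ n ∈ odds N with c ^ 2 ∣ n, threeWeight n
      ≤ 11 / 27 * N * ∑ c ∈ sixUnits N, 1 / (c : ℝ) ^ 2 + √N := by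
    have hz : ∀ c ∈ sixUnits N, ∑ n ∈ odds N with c ^ 2 ∣ n, threeWeight n
        ≤ 11 / 27 * N * (1 / (c : ℝ) ^ 2) + if c ≤ Nat.sqrt N then 1 else 0 := by
      intro c hc
      obtain ⟨ho, h3, h5, -⟩ := sixUnits_odd hc
      split_ifs with h
      · have hb := (abs_le.mp (abs_sum_threeWeight_sub_le N (ho.pow (n := 2)) (h3.pow_left 2))).2
        push_cast at hb
        rw [mul_assoc, mul_one_div]
        linarith
      · rw [sum_eq_zero]
        · positivity
        · intro n hn
          obtain ⟨hn1, hn2⟩ := mem_filter.mp hn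
          obtain ⟨hnN, hodd⟩ := mem_odds.mp hn1
          exact absurd (Nat.le_sqrt'.mpr ((Nat.le_of_dvd hodd.pos hn2).trans hnN)) h
    refine (sum_le_sum hz).trans ?_
    rw [sum_add_distrib, ← mul_sum, ← sum_filter, sum_const, nsmul_eq_mul, mul_one]
    refine add_le_add_right ?_ _
    calc (#((sixUnits N).filter fun c => c ≤ Nat.sqrt N) : ℝ) ≤ #(Icc 1 (Nat.sqrt N)) := by
          refine Nat.cast_le.mpr (card_le_card fun c hc => ?_)
          obtain ⟨h6, h7⟩ := mem_filter.mp hc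
          exact mem_Icc.mpr ⟨(sixUnits_odd h6).1.pos, h7⟩
      _ = (Nat.sqrt N : ℝ) := by simp
      _ ≤ √N := Real.nat_sqrt_le_real_sqrt
  have h6 := sum_sixUnits_inv_sq N
  have h7 : 1 + Real.log N ≤ 2 * √N - 1 := by
    have h8 := Real.log_le_sub_one_of_pos (Real.sqrt_pos.mpr (by linarith : (0 : ℝ) < N))
    rw [Real.log_sqrt (by positivity)] at h8
    linarith
  have h8 : 11 / 27 * (N : ℝ) * ∑ c ∈ sixUnits N, 1 / (c : ℝ) ^ 2 ≤ 11 / 27 * N * 0.09745 :=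
    mul_le_mul_of_nonneg_left h6 (by positivity)
  linarith

end OddMultiples

end

section

open Finset

section DivisorSums

lemma sum_odds_inv_sqrt_le (L : ℕ) : ∑ l ∈ odds L, 1 / √(l : ℝ) ≤ √L := by
  have key : ∀ m : ℕ, ∑ i ∈ range (m + 1), 1 / √((2 * i + 1 : ℕ) : ℝ) ≤ √((2 * m + 1 : ℕ) : ℝ) := by
    intro m
    induction m with
    | zero => simp
    | succ m ih =>
      rw [sum_range_succ]
      have hu : 0 < √((2 * (m + 1) + 1 : ℕ) : ℝ) := Real.sqrt_pos.mpr (by positivity)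
      have hu2 := Real.sq_sqrt (Nat.cast_nonneg (α := ℝ) (2 * (m + 1) + 1))
      have hv2 := Real.sq_sqrt (Nat.cast_nonneg (α := ℝ) (2 * m + 1))
      have hv := Real.sqrt_nonneg ((2 * m + 1 : ℕ) : ℝ)
      set u := √((2 * (m + 1) + 1 : ℕ) : ℝ)
      set v := √((2 * m + 1 : ℕ) : ℝ)
      have huv : u ^ 2 = v ^ 2 + 2 := by rw [hu2, hv2]; push_cast; ring
      have : 1 / u ≤ u - v := by
        rw [div_le_iff₀ hu]
        nlinarith [sq_nonneg (u - v)]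
      linarith
  rw [sum_odds L (fun l => 1 / √(l : ℝ))]
  rcases Nat.eq_zero_or_pos L with rfl | hL
  · simp
  · obtain ⟨m, hm⟩ : ∃ m, (L + 1) / 2 = m + 1 := ⟨(L + 1) / 2 - 1, by omega⟩
    rw [hm]
    refine (key m).trans (Real.sqrt_le_sqrt ?_)
    exact_mod_cast (by omega : 2 * m + 1 ≤ L)

lemma sum_odds_sqrt_le (L : ℕ) : ∑ l ∈ odds L, √(l : ℝ) ≤ (L * √L + 2 * √L) / 3 := by
  have key : ∀ m : ℕ, ∑ i ∈ range (m + 1), √((2 * i + 1 : ℕ) : ℝ)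
      ≤ (((2 * m + 1 : ℕ) : ℝ) * √((2 * m + 1 : ℕ) : ℝ) + 2 * √((2 * m + 1 : ℕ) : ℝ)) / 3 := by
    intro m
    induction m with
    | zero => norm_num
    | succ m ih =>
      rw [sum_range_succ]
      have hu2 := Real.sq_sqrt (Nat.cast_nonneg (α := ℝ) (2 * (m + 1) + 1))
      have hv2 := Real.sq_sqrt (Nat.cast_nonneg (α := ℝ) (2 * m + 1))
      have hu := Real.sqrt_nonneg ((2 * (m + 1) + 1 : ℕ) : ℝ)
      have hv := Real.sqrt_nonneg ((2 * m + 1 : ℕ) : ℝ)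
      rw [← hv2] at ih
      rw [← hu2]
      rw [Real.sqrt_sq hv] at ih
      rw [Real.sqrt_sq hu]
      set u := √((2 * (m + 1) + 1 : ℕ) : ℝ)
      set v := √((2 * m + 1 : ℕ) : ℝ)
      have huv : v ^ 2 = u ^ 2 - 2 := by rw [hu2, hv2]; push_cast; ring
      have h1 : 0 ≤ u * (u ^ 2 - 1 - u * v) := mul_nonneg hu (by nlinarith [sq_nonneg (u - v)])
      have h2 : v ^ 2 * v = (u ^ 2 - 2) * v := by rw [huv]
      rw [h2] at ih
      nlinarith
  rw [sum_odds L (fun l => √(l : ℝ))]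
  rcases Nat.eq_zero_or_pos L with rfl | hL
  · simp
  · obtain ⟨m, hm⟩ : ∃ m, (L + 1) / 2 = m + 1 := ⟨(L + 1) / 2 - 1, by omega⟩
    rw [hm]
    refine (key m).trans ?_
    have : ((2 * m + 1 : ℕ) : ℝ) ≤ L := by exact_mod_cast (by omega : 2 * m + 1 ≤ L)
    gcongr

lemma sum_odds_inv_le {L : ℕ} (hL : 0 < L) : ∑ l ∈ odds L, 1 / (l : ℝ) ≤ 1 + Real.log L / 2 := by
  have key : ∀ m : ℕ, ∑ i ∈ range (m + 1), 1 / ((2 * i + 1 : ℕ) : ℝ)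
      ≤ 1 + Real.log ((2 * m + 1 : ℕ) : ℝ) / 2 := by
    intro m
    induction m with
    | zero => simp
    | succ m ih =>
      rw [sum_range_succ]
      have h1 : (0 : ℝ) < ((2 * (m + 1) + 1 : ℕ) : ℝ) := by positivity
      have h2 : (0 : ℝ) < ((2 * m + 1 : ℕ) : ℝ) := by positivity
      have h3 := Real.one_sub_inv_le_log_of_pos (div_pos h1 h2)
      rw [Real.log_div h1.ne' h2.ne', inv_div] at h3
      have h4 : 1 - ((2 * m + 1 : ℕ) : ℝ) / ((2 * (m + 1) + 1 : ℕ) : ℝ)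
          = 2 * (1 / ((2 * (m + 1) + 1 : ℕ) : ℝ)) := by
        rw [eq_comm, ← sub_eq_zero]
        field_simp
        push_cast; ring
      rw [h4] at h3
      linarith
  rw [sum_odds L (fun l => 1 / (l : ℝ))]
  obtain ⟨m, hm⟩ : ∃ m, (L + 1) / 2 = m + 1 := ⟨(L + 1) / 2 - 1, by omega⟩
  rw [hm]
  refine (key m).trans ?_
  have : ((2 * m + 1 : ℕ) : ℝ) ≤ L := by exact_mod_cast (by omega : 2 * m + 1 ≤ L)
  have := Real.log_le_log (by positivity) this
  linarith

variable (K : ℕ → Prop)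

/-- The number of divisors of `d` with the property `K`. -/
def divCount (d : ℕ) : ℕ := #(d.divisors.filter K)

/-- The sum of reciprocals of the odd `k ≤ X` with the property `K`. -/
def invSum (X : ℕ) : ℝ := ∑ k ∈ (odds X).filter K, 1 / (k : ℝ)

lemma invSum_nonneg (X : ℕ) : 0 ≤ invSum K X := sum_nonneg fun _ _ => by positivity

lemma sum_divCount_mul (X : ℕ) (h : ℕ → ℝ) :
    ∑ d ∈ odds X, (divCount K d : ℝ) * h d
      = ∑ k ∈ (odds X).filter K, ∑ l ∈ odds (X / k), h (k * l) := by
  have h1 : ∑ d ∈ odds X, (divCount K d : ℝ) * h d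
      = ∑ k ∈ (odds X).filter K, ∑ d ∈ odds X with k ∣ d, h d := by
    have h2 : ∀ d, (divCount K d : ℝ) * h d = ∑ k ∈ d.divisors.filter K, h d := fun d => by
      rw [sum_const, nsmul_eq_mul, divCount]
    simp_rw [h2]
    refine sum_comm' fun d k => ?_
    simp only [mem_filter, Nat.mem_divisors, mem_odds]
    constructor
    · rintro ⟨⟨h3, h4⟩, ⟨h5, h6⟩, h7⟩
      exact ⟨⟨⟨h3, h4⟩, h5⟩, ⟨(Nat.le_of_dvd h4.pos h5).trans h3, h4.of_dvd_nat h5⟩, h7⟩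
    · rintro ⟨⟨⟨h3, h4⟩, h5⟩, ⟨h6, h7⟩, h8⟩
      exact ⟨⟨h3, h4⟩, ⟨h5, h4.pos.ne'⟩, h8⟩
  rw [h1]
  exact sum_congr rfl fun k hk => sum_odds_dvd X (mem_odds.mp (mem_filter.mp hk).1).2 h

lemma sum_divCount_div_sqrt_le (X : ℕ) :
    ∑ d ∈ odds X, (divCount K d : ℝ) * (1 / √(d : ℝ)) ≤ √X * invSum K X := by
  rw [sum_divCount_mul K X (fun d => 1 / √(d : ℝ)), invSum, mul_sum]
  refine sum_le_sum fun k hk => ?_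
  have hk0 : (0 : ℝ) < k := by exact_mod_cast (mem_odds.mp (mem_filter.mp hk).1).2.pos
  have h1 : ∑ l ∈ odds (X / k), 1 / √((k * l : ℕ) : ℝ)
      = 1 / √(k : ℝ) * ∑ l ∈ odds (X / k), 1 / √(l : ℝ) := by
    rw [mul_sum]
    refine sum_congr rfl fun l _ => ?_
    rw [Nat.cast_mul, Real.sqrt_mul hk0.le, one_div_mul_one_div]
  rw [h1]
  have h2 : √((X / k : ℕ) : ℝ) ≤ √X / √k := by
    rw [← Real.sqrt_div (Nat.cast_nonneg _)]
    exact Real.sqrt_le_sqrt Nat.cast_div_le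
  calc _ ≤ 1 / √(k : ℝ) * (√X / √k) :=
        mul_le_mul_of_nonneg_left ((sum_odds_inv_sqrt_le _).trans h2) (by positivity)
    _ = √X * (1 / (√k * √k)) := by ring
    _ = _ := by rw [Real.mul_self_sqrt hk0.le]

lemma sum_divCount_mul_sqrt_le (X : ℕ) :
    ∑ d ∈ odds X, (divCount K d : ℝ) * √(d : ℝ) ≤ √X * (X * invSum K X + (X + 1)) / 3 := by
  rw [sum_divCount_mul K X (fun d => √(d : ℝ))]
  have hterm : ∀ k ∈ (odds X).filter K, ∑ l ∈ odds (X / k), √((k * l : ℕ) : ℝ)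
      ≤ √X * (X * (1 / k) + 2) / 3 := by
    intro k hk
    have hk0 : (0 : ℝ) < k := by exact_mod_cast (mem_odds.mp (mem_filter.mp hk).1).2.pos
    have h1 : ∑ l ∈ odds (X / k), √((k * l : ℕ) : ℝ) = √(k : ℝ) * ∑ l ∈ odds (X / k), √(l : ℝ) := by
      rw [mul_sum]
      refine sum_congr rfl fun l _ => ?_
      rw [Nat.cast_mul, Real.sqrt_mul hk0.le]
    have h2 : √((X / k : ℕ) : ℝ) ≤ √X / √k := by
      rw [← Real.sqrt_div (Nat.cast_nonneg _)]
      exact Real.sqrt_le_sqrt Nat.cast_div_le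
    have h3 : ((X / k : ℕ) : ℝ) ≤ X / k := Nat.cast_div_le
    have hs := Real.sqrt_pos.mpr hk0
    rw [h1]
    calc _ ≤ √(k : ℝ) * ((X / k * (√X / √k) + 2 * (√X / √k)) / 3) := by
          refine mul_le_mul_of_nonneg_left ((sum_odds_sqrt_le _).trans ?_) hs.le
          gcongr
      _ = _ := by field_simp
  refine (sum_le_sum hterm).trans ?_
  rw [← sum_div, ← mul_sum, sum_add_distrib, ← mul_sum, sum_const, nsmul_eq_mul]
  have hc : (#((odds X).filter K) : ℝ) * 2 ≤ X + 1 := by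
    have h1 : #((odds X).filter K) ≤ (X + 1) / 2 := card_odds X ▸ card_filter_le _ _
    exact_mod_cast (by omega : #((odds X).filter K) * 2 ≤ X + 1)
  rw [invSum]
  gcongr

lemma sum_oddSqfree_divisors_le (N : ℕ) {h : ℕ → ℝ} (h0 : ∀ d, 0 ≤ h d) :
    ∑ A ∈ oddSqfree N, ∑ d ∈ A.divisors, h d
      ≤ ∑ d ∈ odds N, (#((odds N).filter fun n => d ∣ n) : ℝ) * h d := by
  calc _ ≤ ∑ A ∈ odds N, ∑ d ∈ A.divisors, h d :=
        sum_le_sum_of_subset_of_nonneg (filter_subset _ _) fun _ _ _ => sum_nonneg fun d _ => h0 d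
    _ = ∑ d ∈ odds N, ∑ A ∈ odds N with d ∣ A, h d := by
        refine sum_comm' fun A d => ?_
        simp only [mem_filter, Nat.mem_divisors, mem_odds]
        constructor
        · rintro ⟨⟨h3, h4⟩, h5, h6⟩
          exact ⟨⟨⟨h3, h4⟩, h5⟩, (Nat.le_of_dvd h4.pos h5).trans h3, h4.of_dvd_nat h5⟩
        · rintro ⟨⟨⟨h3, h4⟩, h5⟩, h6, h7⟩
          exact ⟨⟨h3, h4⟩, h5, h4.pos.ne'⟩
    _ = _ := sum_congr rfl fun d _ => by rw [sum_const, nsmul_eq_mul]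

lemma sum_sum_sqrt_mul_divCount_le (N : ℕ) :
    ∑ A ∈ oddSqfree N, ∑ d ∈ A.divisors, √(d : ℝ) * divCount K d
      ≤ 2 / 3 * (N * √N) * (invSum K N + 1 / 2) := by
  refine (sum_oddSqfree_divisors_le N fun d => by positivity).trans ?_
  have h1 : ∀ d ∈ odds N, (#((odds N).filter fun n => d ∣ n) : ℝ) * (√(d : ℝ) * divCount K d)
      ≤ N / 2 * (divCount K d * (1 / √(d : ℝ))) + 1 / 2 * (divCount K d * √(d : ℝ)) := by
    intro d hd
    have hodd := (mem_odds.mp hd).2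
    have hd0 : (0 : ℝ) < d := by exact_mod_cast hodd.pos
    have h2 := (abs_le.mp (abs_card_odds_dvd_sub_le N hodd)).2
    have hs := Real.sqrt_pos.mpr hd0
    calc _ ≤ (N / d / 2 + 1 / 2) * (√(d : ℝ) * divCount K d) :=
          mul_le_mul_of_nonneg_right (by linarith) (by positivity)
      _ = (N / (√d * √d) / 2 + 1 / 2) * (√(d : ℝ) * divCount K d) := by
          rw [Real.mul_self_sqrt hd0.le]
      _ = _ := by field_simp
  refine (sum_le_sum h1).trans ?_
  rw [sum_add_distrib, ← mul_sum, ← mul_sum]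
  have h2 := mul_le_mul_of_nonneg_left (sum_divCount_div_sqrt_le K N)
    (by positivity : (0 : ℝ) ≤ N / 2)
  have h3 := sum_divCount_mul_sqrt_le K N
  have h4 : √(N : ℝ) ≤ N * √N := by
    rcases Nat.eq_zero_or_pos N with rfl | hN
    · simp
    · have : (1 : ℝ) ≤ N := by exact_mod_cast hN
      nlinarith [Real.sqrt_nonneg (N : ℝ)]
  nlinarith

lemma invSum_true_le {X : ℕ} (hX : 0 < X) : invSum (fun _ => True) X ≤ 1 + Real.log X / 2 := by
  rw [invSum, filter_true]
  exact sum_odds_inv_le hX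

lemma divCount_true (d : ℕ) : divCount (fun _ => True) d = #d.divisors := by
  rw [divCount, filter_true]

lemma sum_sum_sqrt_mul_card_divisors_le (N : ℕ) {D : ℕ} (hD : 0 < D) :
    ∑ A ∈ oddSqfree N, ∑ d ∈ A.divisors, (if d ≤ D then √(d : ℝ) * #d.divisors else 0)
      ≤ N * √D * (1 + Real.log D / 2) := by
  refine (sum_oddSqfree_divisors_le N fun d => by split_ifs <;> positivity).trans ?_
  have h1 : ∀ d ∈ odds N,
      (#((odds N).filter fun n => d ∣ n) : ℝ) * (if d ≤ D then √(d : ℝ) * #d.divisors else 0)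
      ≤ if d ≤ D then N * (divCount (fun _ => True) d * (1 / √(d : ℝ))) else 0 := by
    intro d hd
    have hodd := (mem_odds.mp hd).2
    have hd0 : (0 : ℝ) < d := by exact_mod_cast hodd.pos
    have hs := Real.sqrt_pos.mpr hd0
    split_ifs
    · rw [divCount_true]
      calc _ ≤ (N / d : ℝ) * (√(d : ℝ) * #d.divisors) :=
            mul_le_mul_of_nonneg_right (card_odds_dvd_le N hodd) (by positivity)
        _ = (N / (√d * √d)) * (√(d : ℝ) * #d.divisors) := by rw [Real.mul_self_sqrt hd0.le]
        _ = _ := by field_simp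
    · simp
  refine (sum_le_sum h1).trans ?_
  rw [← sum_filter]
  calc _ ≤ ∑ d ∈ odds D, (N : ℝ) * (divCount (fun _ => True) d * (1 / √(d : ℝ))) := by
        refine sum_le_sum_of_subset_of_nonneg (fun d hd => ?_) (fun _ _ _ => by positivity)
        obtain ⟨h2, h3⟩ := mem_filter.mp hd
        exact mem_odds.mpr ⟨h3, (mem_odds.mp h2).2⟩
    _ ≤ _ := by
        rw [← mul_sum, mul_assoc]
        refine mul_le_mul_of_nonneg_left ((sum_divCount_div_sqrt_le _ D).trans ?_) (by positivity)
        exact mul_le_mul_of_nonneg_left (invSum_true_le hD) (by positivity)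

lemma sum_card_divisors_le {N : ℕ} (hN : 0 < N) :
    ∑ A ∈ oddSqfree N, (#A.divisors : ℝ) ≤ N * (1 + Real.log N / 2) := by
  have h := sum_oddSqfree_divisors_le N (h := fun _ => (1 : ℝ)) fun _ => zero_le_one
  simp only [sum_const, nsmul_eq_mul, mul_one] at h
  refine h.trans ?_
  calc _ ≤ ∑ d ∈ odds N, (N : ℝ) * (1 / d) := sum_le_sum fun d hd => by
        rw [mul_one_div]; exact card_odds_dvd_le N (mem_odds.mp hd).2
    _ ≤ _ := by
        rw [← mul_sum]
        exact mul_le_mul_of_nonneg_left (sum_odds_inv_le hN) (by positivity)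

end DivisorSums

end

section

open Finset

section RoughNumbers

/-- All prime factors of `k` exceed `y`. -/
def IsRough (y k : ℕ) : Prop := ∀ ℓ, ℓ.Prime → ℓ ∣ k → y < ℓ

/-- The product of the primes `ℓ ≤ y` dividing `n`. -/
def smoothPart (y n : ℕ) : ℕ := ∏ ℓ ∈ n.primeFactors with ℓ ≤ y, ℓ

/-- The product of the primes `ℓ > y` dividing `n`. -/
def roughPart (y n : ℕ) : ℕ := ∏ ℓ ∈ n.primeFactors with ¬ ℓ ≤ y, ℓ

lemma smoothPart_mul_roughPart {y n : ℕ} (hn : Squarefree n) :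
    smoothPart y n * roughPart y n = n := by
  rw [smoothPart, roughPart, prod_filter_mul_prod_filter_not]
  exact Nat.prod_primeFactors_of_squarefree hn

lemma isRough_roughPart (y n : ℕ) : IsRough y (roughPart y n) := by
  intro ℓ hℓ hd
  obtain ⟨q, hq, hlq⟩ := (hℓ.prime.dvd_finsetProd_iff _).mp hd
  obtain ⟨h1, h2⟩ := mem_filter.mp hq
  rw [(Nat.prime_dvd_prime_iff_eq hℓ (Nat.prime_of_mem_primeFactors h1)).mp hlq]
  omega

lemma card_divisors_roughPart_le {y d : ℕ} (hd : Squarefree d) :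
    #(roughPart y d).divisors ≤ divCount (IsRough y) d := by
  refine card_le_card fun k hk => ?_
  have hk1 := Nat.dvd_of_mem_divisors hk
  refine mem_filter.mpr ⟨Nat.mem_divisors.mpr ⟨hk1.trans ⟨smoothPart y d, ?_⟩, hd.ne_zero⟩,
    fun ℓ hℓ h => isRough_roughPart y d ℓ hℓ (h.trans hk1)⟩
  rw [mul_comm, smoothPart_mul_roughPart hd]

lemma smoothPart_pos (y n : ℕ) : 0 < smoothPart y n :=
  prod_pos fun _ hℓ => (Nat.prime_of_mem_primeFactors (mem_filter.mp hℓ).1).pos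

lemma smoothPart_le_of_dvd {y d n : ℕ} (h : d ∣ n) (hn : n ≠ 0) :
    smoothPart y d ≤ smoothPart y n :=
  prod_le_prod_of_subset_of_one_le' (filter_subset_filter _ (Nat.primeFactors_mono h hn))
    fun _ hℓ _ => (Nat.prime_of_mem_primeFactors (mem_filter.mp hℓ).1).one_lt.le

lemma invSum_isRough_le (y N : ℕ) :
    Real.log (y + 1) * invSum (IsRough y) N ≤ 1 + Real.log (N * y) := by
  have hinj : Set.InjOn (fun u : ℕ × ℕ => u.1 * u.2)
      (Icc 1 y ×ˢ (odds N).filter (IsRough y) : Finset (ℕ × ℕ)) := by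
    have hcop : ∀ g k, g ∈ Icc 1 y → IsRough y k → g.Coprime k := by
      intro g k hg hk
      refine Nat.coprime_of_dvd fun ℓ hℓ h1 h2 => ?_
      have h3 := hk ℓ hℓ h2
      have h4 := Nat.le_of_dvd (mem_Icc.mp hg).1 h1
      have := (mem_Icc.mp hg).2
      omega
    rintro ⟨g, k⟩ h1 ⟨g', k'⟩ h2 h
    simp only [mem_coe, mem_product, mem_filter] at h1 h2 h
    have e1 : g ∣ g' := (hcop g k' h1.1 h2.2.2).dvd_of_dvd_mul_right (h ▸ dvd_mul_right g k)
    have e2 : g' ∣ g := (hcop g' k h2.1 h1.2.2).dvd_of_dvd_mul_right (h ▸ dvd_mul_right g' k')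
    obtain rfl := Nat.dvd_antisymm e1 e2
    rw [Nat.eq_of_mul_eq_mul_left (mem_Icc.mp h1.1).1 h]
  have h1 : (∑ g ∈ Icc 1 y, 1 / (g : ℝ)) * invSum (IsRough y) N
      ≤ ∑ n ∈ Icc 1 (N * y), 1 / (n : ℝ) := by
    rw [invSum, sum_mul_sum, ← sum_product']
    have h2 : ∀ u : ℕ × ℕ, 1 / (u.1 : ℝ) * (1 / (u.2 : ℝ)) = 1 / ((u.1 * u.2 : ℕ) : ℝ) := fun u => by
      rw [one_div_mul_one_div, Nat.cast_mul]
    simp_rw [h2]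
    rw [← sum_image (f := fun n : ℕ => 1 / (n : ℝ)) hinj]
    refine sum_le_sum_of_subset_of_nonneg (fun n hn => ?_) (fun _ _ _ => by positivity)
    obtain ⟨⟨g, k⟩, hu, rfl⟩ := mem_image.mp hn
    simp only [mem_product, mem_filter, mem_Icc, mem_odds] at hu ⊢
    exact ⟨Nat.mul_pos hu.1.1 hu.2.1.2.pos, by
      rw [mul_comm N]; exact Nat.mul_le_mul hu.1.2 hu.2.1.1⟩
  have h2 : Real.log (y + 1) ≤ ∑ g ∈ Icc 1 y, 1 / (g : ℝ) := by
    have := log_add_one_le_harmonic y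
    rw [harmonic_eq_sum_Icc] at this
    push_cast at this
    simpa only [one_div] using this
  have h3 : ∑ n ∈ Icc 1 (N * y), 1 / (n : ℝ) ≤ 1 + Real.log (N * y) := by
    have := harmonic_le_one_add_log (N * y)
    rw [harmonic_eq_sum_Icc] at this
    push_cast at this
    simpa only [one_div] using this
  exact (mul_le_mul_of_nonneg_right h2 (invSum_nonneg _ _)).trans (h1.trans h3)

/-- The odd primes up to `y`. -/
def oddPrimes (y : ℕ) : Finset ℕ := (Ioc 2 y).filter Nat.Prime

lemma sum_log_div_primes_le {n : ℕ} (hn : 0 < n) :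
    ∑ ℓ ∈ (Ioc 0 n).filter Nat.Prime, Real.log ℓ / ℓ ≤ Real.log n + Real.log 4 := by
  have hn0 : (0 : ℝ) < n := by exact_mod_cast hn
  have h1 : ∑ ℓ ∈ (Ioc 0 n).filter Nat.Prime, ((n / ℓ : ℕ) : ℝ) * Real.log ℓ ≤ n * Real.log n := by
    calc _ = ∑ ℓ ∈ (Ioc 0 n).filter Nat.Prime, ∑ m ∈ Ioc 0 n with ℓ ∣ m, Real.log ℓ := by
          refine sum_congr rfl fun ℓ _ => ?_
          rw [sum_const, nsmul_eq_mul, Nat.Ioc_filter_dvd_card_eq_div]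
      _ = ∑ m ∈ Ioc 0 n, ∑ ℓ ∈ m.primeFactors, Real.log ℓ := by
          refine sum_comm' fun ℓ m => ?_
          simp only [mem_filter, mem_Ioc, Nat.mem_primeFactors]
          constructor
          · rintro ⟨⟨⟨h2, h3⟩, h4⟩, ⟨h5, h6⟩, h7⟩
            exact ⟨⟨h4, h7, by omega⟩, h5, h6⟩
          · rintro ⟨⟨h4, h7, h8⟩, h5, h6⟩
            exact ⟨⟨⟨h4.pos, (Nat.le_of_dvd h5 h7).trans h6⟩, h4⟩, ⟨h5, h6⟩, h7⟩
      _ ≤ ∑ m ∈ Ioc 0 n, Real.log n := by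
          refine sum_le_sum fun m hm => ?_
          obtain ⟨h2, h3⟩ := mem_Ioc.mp hm
          rw [← Real.log_prod fun ℓ hℓ => by
            exact_mod_cast (Nat.prime_of_mem_primeFactors hℓ).ne_zero, ← Nat.cast_prod]
          refine Real.log_le_log ?_ ?_
          · exact_mod_cast prod_pos fun ℓ hℓ => (Nat.prime_of_mem_primeFactors hℓ).pos
          · exact_mod_cast (Nat.le_of_dvd h2 (Nat.prod_primeFactors_dvd m)).trans h3
      _ = _ := by simp
  have h2 : ∑ ℓ ∈ (Ioc 0 n).filter Nat.Prime, Real.log ℓ ≤ Real.log 4 * n := by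
    have := Chebyshev.theta_le_log4_mul_x (x := n) hn0.le
    rw [Chebyshev.theta, Nat.floor_natCast] at this
    exact this
  have h3 : n * ∑ ℓ ∈ (Ioc 0 n).filter Nat.Prime, Real.log ℓ / ℓ
      ≤ ∑ ℓ ∈ (Ioc 0 n).filter Nat.Prime, ((n / ℓ : ℕ) : ℝ) * Real.log ℓ
        + ∑ ℓ ∈ (Ioc 0 n).filter Nat.Prime, Real.log ℓ := by
    rw [mul_sum, ← sum_add_distrib]
    refine sum_le_sum fun ℓ hℓ => ?_
    have hp := (mem_filter.mp hℓ).2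
    have hℓ0 : (0 : ℝ) < ℓ := by exact_mod_cast hp.pos
    have h4 : (n : ℝ) / ℓ ≤ (n / ℓ : ℕ) + 1 := by
      rw [div_le_iff₀ hℓ0, mul_comm]
      exact_mod_cast (Nat.lt_mul_div_succ n hp.pos).le
    have h5 : 0 ≤ Real.log ℓ := Real.log_nonneg (by exact_mod_cast hp.one_lt.le)
    calc _ = (n / ℓ : ℝ) * Real.log ℓ := by ring
      _ ≤ ((n / ℓ : ℕ) + 1) * Real.log ℓ := mul_le_mul_of_nonneg_right h4 h5
      _ = _ := by ring
  refine le_of_mul_le_mul_left ?_ hn0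
  calc _ ≤ _ := h3
    _ ≤ n * Real.log n + Real.log 4 * n := add_le_add h1 h2
    _ = _ := by ring

lemma sum_log_div_oddPrimes_le {y : ℕ} (hy : 2 ≤ y) :
    ∑ ℓ ∈ oddPrimes y, Real.log ℓ / ℓ ≤ Real.log y + 3 / 2 * Real.log 2 := by
  have h1 := sum_log_div_primes_le (n := y) (by omega)
  have h2 : (Ioc 0 y).filter Nat.Prime = insert 2 (oddPrimes y) := by
    ext ℓ
    simp only [oddPrimes, mem_filter, mem_Ioc, mem_insert]
    constructor
    · rintro ⟨⟨h3, h4⟩, h5⟩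
      have := h5.two_le
      rcases eq_or_ne ℓ 2 with h | h
      · exact Or.inl h
      · exact Or.inr ⟨⟨by omega, h4⟩, h5⟩
    · rintro (rfl | ⟨⟨h3, h4⟩, h5⟩)
      · exact ⟨⟨by omega, hy⟩, Nat.prime_two⟩
      · exact ⟨⟨by omega, h4⟩, h5⟩
  rw [h2, sum_insert (by simp [oddPrimes]), show (4 : ℝ) = 2 ^ 2 by norm_num, Real.log_pow] at h1
  push_cast at h1
  linarith

lemma log_smoothPart {y n : ℕ} (hn : Odd n) :
    Real.log (smoothPart y n) = ∑ ℓ ∈ oddPrimes y, (if ℓ ∣ n then Real.log ℓ else 0) := by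
  rw [smoothPart, Nat.cast_prod, Real.log_prod fun ℓ hℓ => by
    exact_mod_cast (Nat.prime_of_mem_primeFactors (mem_filter.mp hℓ).1).ne_zero, ← sum_filter]
  refine sum_congr ?_ fun _ _ => rfl
  ext ℓ
  simp only [oddPrimes, mem_filter, mem_Ioc, Nat.mem_primeFactors]
  constructor
  · rintro ⟨⟨h1, h2, h3⟩, h4⟩
    have : ℓ ≠ 2 := by
      rintro rfl
      rw [Nat.odd_iff] at hn
      omega
    exact ⟨⟨⟨by have := h1.two_le; omega, h4⟩, h1⟩, h2⟩
  · rintro ⟨⟨⟨h3, h4⟩, h1⟩, h2⟩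
    exact ⟨⟨h1, h2, hn.pos.ne'⟩, h4⟩

lemma sum_log_smoothPart_sq_le {y N : ℕ} (hy : 0 < y) :
    ∑ A ∈ odds N, Real.log (smoothPart y A) ^ 2
      ≤ N / 2 * ((∑ ℓ ∈ oddPrimes y, Real.log ℓ / ℓ) ^ 2
        + Real.log y * ∑ ℓ ∈ oddPrimes y, Real.log ℓ / ℓ) + y ^ 4 / 2 := by
  have hodd : ∀ ℓ ∈ oddPrimes y, Odd ℓ ∧ ℓ.Prime ∧ ℓ ≤ y := fun ℓ hℓ => by
    obtain ⟨h1, h2⟩ := mem_filter.mp hℓ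
    rw [mem_Ioc] at h1
    exact ⟨h2.odd_of_ne_two (by omega), h2, h1.2⟩
  have hlog : ∀ ℓ ∈ oddPrimes y, 0 ≤ Real.log ℓ := fun ℓ hℓ =>
    Real.log_nonneg (by exact_mod_cast (hodd ℓ hℓ).2.1.one_lt.le)
  have h1 : ∑ A ∈ odds N, Real.log (smoothPart y A) ^ 2
      = ∑ ℓ ∈ oddPrimes y, ∑ q ∈ oddPrimes y, Real.log ℓ * Real.log q *
        #((odds N).filter fun n => ℓ ∣ n ∧ q ∣ n) := by
    calc _ = ∑ A ∈ odds N, ∑ ℓ ∈ oddPrimes y, ∑ q ∈ oddPrimes y,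
          (if ℓ ∣ A ∧ q ∣ A then Real.log ℓ * Real.log q else 0) := by
          refine sum_congr rfl fun A hA => ?_
          rw [log_smoothPart (mem_odds.mp hA).2, sq, sum_mul_sum]
          refine sum_congr rfl fun ℓ _ => sum_congr rfl fun q _ => ?_
          by_cases h2 : ℓ ∣ A <;> by_cases h3 : q ∣ A <;> simp [h2, h3]
      _ = _ := by
          rw [sum_comm]
          refine sum_congr rfl fun ℓ _ => ?_
          rw [sum_comm]
          refine sum_congr rfl fun q _ => ?_
          rw [← sum_filter, sum_const, nsmul_eq_mul, mul_comm]
  have h2 : ∀ ℓ ∈ oddPrimes y, ∀ q ∈ oddPrimes y,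
      (#((odds N).filter fun n => ℓ ∣ n ∧ q ∣ n) : ℝ)
        ≤ N / 2 * (1 / ℓ * (1 / q)) + (if ℓ = q then N / 2 * (1 / (ℓ : ℝ)) else 0) + 1 / 2 := by
    intro ℓ hℓ q hq
    obtain ⟨o1, p1, -⟩ := hodd ℓ hℓ
    obtain ⟨o2, p2, -⟩ := hodd q hq
    split_ifs with h
    · subst h
      simp only [and_self]
      have h3 := (abs_le.mp (abs_card_odds_dvd_sub_le N o1)).2
      have h4 : (0 : ℝ) ≤ N / 2 * (1 / ℓ * (1 / ℓ)) := by positivity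
      have h5 : (N : ℝ) / ℓ / 2 = N / 2 * (1 / ℓ) := by ring
      linarith
    · have hc : ℓ.Coprime q := (Nat.coprime_primes p1 p2).mpr h
      have e : ((odds N).filter fun n => ℓ ∣ n ∧ q ∣ n) = (odds N).filter fun n => ℓ * q ∣ n :=
        filter_congr fun n _ => ⟨fun h => hc.mul_dvd_of_dvd_of_dvd h.1 h.2,
          fun h => ⟨dvd_of_mul_right_dvd h, dvd_of_mul_left_dvd h⟩⟩
      rw [e]
      have h3 := (abs_le.mp (abs_card_odds_dvd_sub_le N (o1.mul o2))).2
      have h5 : (N : ℝ) / (ℓ * q : ℕ) / 2 = N / 2 * (1 / ℓ * (1 / q)) := by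
        push_cast
        rw [one_div_mul_one_div]; ring
      linarith
  rw [h1]
  calc _ ≤ ∑ ℓ ∈ oddPrimes y, ∑ q ∈ oddPrimes y, Real.log ℓ * Real.log q *
        (N / 2 * (1 / ℓ * (1 / q)) + (if ℓ = q then N / 2 * (1 / (ℓ : ℝ)) else 0) + 1 / 2) :=
        sum_le_sum fun ℓ hℓ => sum_le_sum fun q hq =>
          mul_le_mul_of_nonneg_left (h2 ℓ hℓ q hq) (mul_nonneg (hlog ℓ hℓ) (hlog q hq))
    _ = N / 2 * ((∑ ℓ ∈ oddPrimes y, Real.log ℓ / ℓ) ^ 2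
          + ∑ ℓ ∈ oddPrimes y, Real.log ℓ * (Real.log ℓ / ℓ))
          + (∑ ℓ ∈ oddPrimes y, Real.log ℓ) ^ 2 / 2 := by
        rw [sq, sq, sum_mul_sum, sum_mul_sum, mul_add, mul_sum, mul_sum, sum_div,
          ← sum_add_distrib, ← sum_add_distrib]
        refine sum_congr rfl fun ℓ hℓ => ?_
        have h3 : N / 2 * (Real.log ℓ * (Real.log ℓ / ℓ)) = ∑ q ∈ oddPrimes y,
            Real.log ℓ * Real.log q * (if ℓ = q then N / 2 * (1 / (ℓ : ℝ)) else 0) := by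
          simp only [mul_ite, mul_zero, sum_ite_eq, hℓ, if_true]
          ring
        rw [h3, mul_sum, sum_div, ← sum_add_distrib, ← sum_add_distrib]
        exact sum_congr rfl fun q _ => by ring
    _ ≤ _ := by
        have hl : ∀ ℓ ∈ oddPrimes y, Real.log ℓ ≤ Real.log y := fun ℓ hℓ =>
          Real.log_le_log (by exact_mod_cast (hodd ℓ hℓ).2.1.pos)
            (by exact_mod_cast (hodd ℓ hℓ).2.2)
        have h3 : ∑ ℓ ∈ oddPrimes y, Real.log ℓ * (Real.log ℓ / ℓ)
            ≤ Real.log y * ∑ ℓ ∈ oddPrimes y, Real.log ℓ / ℓ := by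
          rw [mul_sum]
          exact sum_le_sum fun ℓ hℓ => mul_le_mul_of_nonneg_right (hl ℓ hℓ)
            (div_nonneg (hlog ℓ hℓ) (by positivity))
        have h4 : ∑ ℓ ∈ oddPrimes y, Real.log ℓ ≤ (y : ℝ) ^ 2 := by
          have hy1 : (0 : ℝ) < y := by exact_mod_cast hy
          calc _ ≤ ∑ ℓ ∈ oddPrimes y, (y : ℝ) := sum_le_sum fun ℓ hℓ => (hl ℓ hℓ).trans
                (by have := Real.log_le_sub_one_of_pos hy1; linarith)
            _ = #(oddPrimes y) * (y : ℝ) := by rw [sum_const, nsmul_eq_mul]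
            _ ≤ y * y := by
                refine mul_le_mul_of_nonneg_right ?_ hy1.le
                have : #(oddPrimes y) ≤ y := by
                  refine (card_filter_le _ _).trans ?_
                  rw [Nat.card_Ioc]; omega
                exact_mod_cast this
            _ = _ := by ring
        have h5 : (∑ ℓ ∈ oddPrimes y, Real.log ℓ) ^ 2 ≤ ((y : ℝ) ^ 2) ^ 2 :=
          pow_le_pow_left₀ (sum_nonneg hlog) h4 2
        have h6 : ((y : ℝ) ^ 2) ^ 2 = y ^ 4 := by ring
        have h7 : (0 : ℝ) ≤ N / 2 := by positivity
        rw [h6] at h5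
        have h8 := mul_le_mul_of_nonneg_left h3 h7
        linarith

lemma card_smoothPart_gt_le {y N : ℕ} (hy : 2 ≤ y) {M : ℝ} (hM : 1 ≤ M) :
    Real.log M ^ 2 * #((oddSqfree N).filter fun A => ¬ (smoothPart y A : ℝ) ≤ M)
      ≤ N / 2 * ((Real.log y + 3 / 2 * Real.log 2) * (2 * Real.log y + 3 / 2 * Real.log 2))
        + y ^ 4 / 2 := by
  have h1 : Real.log M ^ 2 * #((oddSqfree N).filter fun A => ¬ (smoothPart y A : ℝ) ≤ M)
      ≤ ∑ A ∈ odds N, Real.log (smoothPart y A) ^ 2 := by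
    calc _ = ∑ A ∈ (oddSqfree N).filter fun A => ¬ (smoothPart y A : ℝ) ≤ M, Real.log M ^ 2 := by
          rw [sum_const, nsmul_eq_mul, mul_comm]
      _ ≤ ∑ A ∈ (oddSqfree N).filter fun A => ¬ (smoothPart y A : ℝ) ≤ M,
          Real.log (smoothPart y A) ^ 2 := by
          refine sum_le_sum fun A hA => pow_le_pow_left₀ (Real.log_nonneg hM) ?_ 2
          exact Real.log_le_log (by linarith) (not_le.mp (mem_filter.mp hA).2).le
      _ ≤ _ := sum_le_sum_of_subset_of_nonneg
          ((filter_subset _ _).trans (filter_subset _ _)) fun _ _ _ => sq_nonneg _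
  refine h1.trans ((sum_log_smoothPart_sq_le (by omega)).trans ?_)
  have hS := sum_log_div_oddPrimes_le hy
  have hS0 : 0 ≤ ∑ ℓ ∈ oddPrimes y, Real.log ℓ / ℓ := sum_nonneg fun ℓ hℓ =>
    div_nonneg (Real.log_nonneg (by exact_mod_cast (mem_filter.mp hℓ).2.one_lt.le)) (by positivity)
  have hy0 : 0 ≤ Real.log y := Real.log_nonneg (by exact_mod_cast (by omega : 1 ≤ y))
  set S := ∑ ℓ ∈ oddPrimes y, Real.log ℓ / ℓ
  have h2 : S ^ 2 + Real.log y * S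
      ≤ (Real.log y + 3 / 2 * Real.log 2) * (2 * Real.log y + 3 / 2 * Real.log 2) := by
    rw [show S ^ 2 + Real.log y * S = S * (Real.log y + S) by ring]
    exact mul_le_mul hS (by linarith) (by linarith) (by linarith)
  have := mul_le_mul_of_nonneg_left h2 (by positivity : (0 : ℝ) ≤ N / 2)
  linarith

end RoughNumbers

end

section

open Finset

section Combination

lemma sum_moebius_div_le_one {A : ℕ} (hA : Squarefree A) :
    ∑ d ∈ A.divisors, (ArithmeticFunction.moebius d / d : ℝ) ≤ 1 := by
  rw [sum_moebius_div_eq_prod hA]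
  refine prod_le_one (fun ℓ hℓ => ?_) fun ℓ _ => sub_le_self _ (by positivity)
  have h1 : (1 : ℝ) ≤ ℓ := by exact_mod_cast (Nat.prime_of_mem_primeFactors hℓ).one_lt.le
  rw [sub_nonneg, div_le_one (by linarith)]
  exact h1

lemma mem_oddSqfree {N A : ℕ} : A ∈ oddSqfree N ↔ (A ≤ N ∧ Odd A) ∧ Squarefree A := by
  rw [oddSqfree, mem_filter, mem_odds]

lemma sqrt_mul_sqrt_eq {a b : ℝ} (hb : 0 < b) : √a * √b = b * (√a / √b) := by
  have h := Real.mul_self_sqrt hb.le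
  have h' := Real.sqrt_pos.mpr hb
  field_simp
  rw [sq, h]

lemma abs_chiSum_sub_le_mul {p e d : ℕ} (hp : Odd p) (he : e ≤ 3) (hd : Odd d)
    (hsq : Squarefree d) (hdp : d.Coprime p) (a : ℤ) {n n' : ℕ} (hn' : 0 < n') :
    |(chiSum p e d a n n' : ℝ) - ArithmeticFunction.moebius d / d * (n * n') / 2|
      ≤ n' * (2 ^ e * (√n / √n') * (√d * #d.divisors)) := by
  refine (abs_chiSum_sub_le hp he hd hsq hdp a n n').trans (le_of_eq ?_)
  rw [sqrt_mul_sqrt_eq (by exact_mod_cast hn' : (0 : ℝ) < n')]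
  ring

lemma plain_lower_bound {N : ℕ} (hN : 0 < N) (e : ℕ) {n ν : ℝ} (hn : 0 ≤ n) (hν : 0 ≤ ν) :
    n / 2 * (0.328 * N - 3 * √N) - 2 ^ e * ν * (2 / 3 * (N * √N) * (3 / 2 + Real.log N / 2))
        - 2 ^ e * (N * (1 + Real.log N / 2))
      ≤ ∑ A ∈ oddSqfree N, (n / 2 * ∑ d ∈ A.divisors, (ArithmeticFunction.moebius d / d : ℝ)
        - ∑ d ∈ A.divisors, 2 ^ e * ν * (√d * #d.divisors) - 2 ^ e * #A.divisors) := by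
  simp only [sum_sub_distrib, ← mul_sum]
  have h1 := mul_le_mul_of_nonneg_left (sum_moebius_div_ge N) (by positivity : 0 ≤ n / 2)
  have h2 := mul_le_mul_of_nonneg_left (sum_card_divisors_le hN)
    (by positivity : (0 : ℝ) ≤ 2 ^ e)
  have h3 := sum_sum_sqrt_mul_divCount_le (fun _ => True) N
  simp only [divCount_true] at h3
  have h4 : 2 / 3 * (N * √N) * (invSum (fun _ => True) N + 1 / 2)
      ≤ 2 / 3 * (N * √N) * (3 / 2 + Real.log N / 2) :=
    mul_le_mul_of_nonneg_left (by linarith [invSum_true_le hN]) (by positivity)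
  have h5 := mul_le_mul_of_nonneg_left (h3.trans h4) (by positivity : (0 : ℝ) ≤ 2 ^ e * ν)
  linarith

lemma rough_lower_bound {N D : ℕ} (hN : 0 < N) (hD : 0 < D) (e y : ℕ) (M : ℝ) {n ν η : ℝ}
    (hn : 0 ≤ n) (hν : 0 ≤ ν) (hη : 0 ≤ η) :
    n / 2 * (0.328 * N - 3 * √N - #((oddSqfree N).filter fun A => ¬ (smoothPart y A : ℝ) ≤ M))
        - 2 ^ e * ν * (2 / 3 * (N * √N) * (invSum (IsRough y) N + 1 / 2)
          + N * √D * (1 + Real.log D / 2))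
        - η * (N * (1 + Real.log N / 2)) - 2 ^ e * (N * (1 + Real.log N / 2))
      ≤ ∑ A ∈ oddSqfree N with (smoothPart y A : ℝ) ≤ M,
        (n / 2 * ∑ d ∈ A.divisors, (ArithmeticFunction.moebius d / d : ℝ)
        - ∑ d ∈ A.divisors, (2 ^ e * ν * (√d * divCount (IsRough y) d
          + if d ≤ D then √d * #d.divisors else 0) + η) - 2 ^ e * #A.divisors) := by
  simp only [sum_sub_distrib, ← mul_sum]
  have h1 : 0.328 * N - 3 * √N - #((oddSqfree N).filter fun A => ¬ (smoothPart y A : ℝ) ≤ M)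
      ≤ ∑ A ∈ oddSqfree N with (smoothPart y A : ℝ) ≤ M,
        ∑ d ∈ A.divisors, (ArithmeticFunction.moebius d / d : ℝ) := by
    have h2 := sum_filter_add_sum_filter_not (oddSqfree N) (fun A => (smoothPart y A : ℝ) ≤ M)
      (fun A => ∑ d ∈ A.divisors, (ArithmeticFunction.moebius d / d : ℝ))
    have h3 : ∑ A ∈ oddSqfree N with ¬ (smoothPart y A : ℝ) ≤ M,
        ∑ d ∈ A.divisors, (ArithmeticFunction.moebius d / d : ℝ)
        ≤ #((oddSqfree N).filter fun A => ¬ (smoothPart y A : ℝ) ≤ M) := by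
      refine (sum_le_sum (g := fun _ => (1 : ℝ)) fun A hA => ?_).trans (by simp)
      exact sum_moebius_div_le_one (mem_oddSqfree.mp (mem_filter.mp hA).1).2
    have h4 := sum_moebius_div_ge N
    linarith
  have hdiv : ∑ A ∈ oddSqfree N with (smoothPart y A : ℝ) ≤ M, (#A.divisors : ℝ)
      ≤ N * (1 + Real.log N / 2) :=
    (sum_le_sum_of_subset_of_nonneg (filter_subset _ _) fun _ _ _ => by positivity).trans
      (sum_card_divisors_le hN)
  have hE : ∑ A ∈ oddSqfree N with (smoothPart y A : ℝ) ≤ M,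
      ∑ d ∈ A.divisors, (2 ^ e * ν * (√d * divCount (IsRough y) d
          + if d ≤ D then √d * #d.divisors else 0) + η)
      ≤ 2 ^ e * ν * (2 / 3 * (N * √N) * (invSum (IsRough y) N + 1 / 2)
          + N * √D * (1 + Real.log D / 2)) + η * (N * (1 + Real.log N / 2)) := by
    have h5 := sum_sum_sqrt_mul_divCount_le (IsRough y) N
    have h6 := sum_sum_sqrt_mul_card_divisors_le N hD
    have h7 : ∑ A ∈ oddSqfree N with (smoothPart y A : ℝ) ≤ M,
        ∑ d ∈ A.divisors, (√d * divCount (IsRough y) d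
          + if d ≤ D then √d * #d.divisors else 0)
        ≤ 2 / 3 * (N * √N) * (invSum (IsRough y) N + 1 / 2) + N * √D * (1 + Real.log D / 2) := by
      refine (sum_le_sum_of_subset_of_nonneg (filter_subset _ _) fun _ _ _ =>
        sum_nonneg fun d _ => ?_).trans ?_
      · split_ifs <;> positivity
      · simp only [sum_add_distrib]
        exact add_le_add h5 h6
    simp only [sum_add_distrib (f := fun d : ℕ => 2 ^ e * ν * (√(d : ℝ) * divCount (IsRough y) d
          + if d ≤ D then √(d : ℝ) * #d.divisors else 0)), ← mul_sum, sum_const, nsmul_eq_mul]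
    rw [sum_add_distrib, ← mul_sum, ← sum_mul, mul_comm _ η]
    exact add_le_add (mul_le_mul_of_nonneg_left h7 (by positivity))
      (mul_le_mul_of_nonneg_left hdiv hη)
  have h8 := mul_le_mul_of_nonneg_left h1 (by positivity : 0 ≤ n / 2)
  have h9 := mul_le_mul_of_nonneg_left hdiv (by positivity : (0 : ℝ) ≤ 2 ^ e)
  linarith

lemma abs_chiSum_sub_le_rough {p e A d D y : ℕ} (hp : Odd p) (he : e ≤ 3) (hA : Odd A)
    (hsq : Squarefree A) (hd : d ∣ A) (hdp : d.Coprime p) (hD : 0 < D) {M : ℝ}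
    (hM : (smoothPart y A : ℝ) ≤ M) (a : ℤ) {n n' : ℕ} (hn0 : 0 < n') (hn : n ≤ 2 * (D + 1))
    (hn' : n' * M ≤ 2 * (D + 1)) :
    |(chiSum p e d a n n' : ℝ) - ArithmeticFunction.moebius d / d * (n * n') / 2|
      ≤ n' * (2 ^ e * (√n / √n') * (√d * divCount (IsRough y) d
          + if d ≤ D then √d * #d.divisors else 0) + n / (2 * D)) := by
  have hdo := hA.of_dvd_nat hd
  have hds := hsq.squarefree_of_dvd hd
  have hν : 0 ≤ √(n : ℝ) / √n' := by positivity
  by_cases h : d ≤ D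
  · rw [if_pos h]
    refine (abs_chiSum_sub_le_mul hp he hdo hds hdp a hn0).trans
      (mul_le_mul_of_nonneg_left ?_ (Nat.cast_nonneg _))
    have h1 : 0 ≤ 2 ^ e * (√(n : ℝ) / √n') * (√d * divCount (IsRough y) d) := by positivity
    have h2 : (0 : ℝ) ≤ n / (2 * D) := by positivity
    rw [mul_add]
    linarith
  · rw [if_neg h, add_zero]
    have hmr := smoothPart_mul_roughPart (y := y) hds
    set m := smoothPart y d
    set r := roughPart y d
    have hDd : D + 1 ≤ d := by omega
    have hmM : (m : ℝ) ≤ M :=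
      (Nat.cast_le.mpr (smoothPart_le_of_dvd hd hsq.ne_zero)).trans hM
    have hm0 : (0 : ℝ) < m := by exact_mod_cast smoothPart_pos y d
    have hpow : 2 ≤ 2 ^ (e + 1) := by rw [pow_succ]; have := Nat.one_le_two_pow (n := e); omega
    have hnr : n' ≤ 2 * r := by
      have h1 : (n' : ℝ) * m ≤ 2 * r * m := by
        have h2 : ((D + 1 : ℕ) : ℝ) ≤ (m * r : ℕ) := by rw [hmr]; exact_mod_cast hDd
        push_cast at h2
        have h3 : (n' : ℝ) * m ≤ n' * M := mul_le_mul_of_nonneg_left hmM (Nat.cast_nonneg _)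
        nlinarith
      exact_mod_cast le_of_mul_le_mul_right h1 hm0
    have h1 : |(chiSum p e d a n n' : ℝ)|
        ≤ n' * (2 ^ e * (√n / √n') * (√d * divCount (IsRough y) d)) := by
      have h2 := abs_chiSum_le (m := m) (r := r) hp he (hmr.symm ▸ hdo) (hmr.symm ▸ hds)
        (hmr.symm ▸ hdp) a (n := n) (n' := n')
        (by rw [hmr]; nlinarith) (hnr.trans (Nat.mul_le_mul_right r hpow))
      rw [← Nat.cast_mul, hmr] at h2
      refine h2.trans ?_
      rw [sqrt_mul_sqrt_eq (by exact_mod_cast hn0 : (0 : ℝ) < n')]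
      have h3 : (#r.divisors : ℝ) ≤ divCount (IsRough y) d := by
        exact_mod_cast card_divisors_roughPart_le hds
      calc _ = n' * (2 ^ e * (√n / √n') * (√d * #r.divisors)) := by ring
        _ ≤ _ := by gcongr
    have h2 : |(ArithmeticFunction.moebius d / d * (n * n') / 2 : ℝ)| ≤ n' * (n / (2 * D)) := by
      have h3 : |(ArithmeticFunction.moebius d : ℝ)| ≤ 1 := by
        exact_mod_cast ArithmeticFunction.abs_moebius_le_one (n := d)
      have hD0 : (0 : ℝ) < D := by exact_mod_cast hD
      have hdD : (D : ℝ) ≤ d := by exact_mod_cast (by omega : D ≤ d)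
      rw [abs_div, abs_mul, abs_div, Nat.abs_cast, abs_of_pos (two_pos : (0 : ℝ) < 2),
        abs_of_nonneg (by positivity : (0 : ℝ) ≤ n * n')]
      calc _ ≤ 1 / (D : ℝ) * (n * n') / 2 := by gcongr
        _ = _ := by field_simp
    rw [mul_add]
    exact (abs_sub _ _).trans (add_le_add h1 h2)

end Combination

end

section

open Finset

section Frame

/-- The normalisation of the parameters: `R = p^(1/4)`, `W = √(x p)`, `P = √(p - W²/4)`, with `b`
running over `|b| ≤ s + t` and the leading coefficients bounded by `0.49 P`. -/
structure CountData (p : ℕ) (R W P : ℝ) (s t : ℕ) : Prop where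
  R_ge : 1297 ≤ R
  R_pow : R ^ 4 = p
  W_ge : 348 * R ≤ W
  W_le : W ≤ R ^ 2
  P_nonneg : 0 ≤ P
  P_sq : P ^ 2 = R ^ 4 - W ^ 2 / 4
  s_eq : s = ⌊0.4 * W⌋₊
  t_eq : t = ⌊0.1 * W⌋₊

variable {p : ℕ} {R W P : ℝ} {s t : ℕ}

namespace CountData

lemma W_large (h : CountData p R W P s t) : 451000 ≤ W := by linarith [h.R_ge, h.W_ge]

lemma P_le (h : CountData p R W P s t) : P ≤ R ^ 2 := by
  have hR := h.R_ge
  refine le_of_sq_le_sq ?_ (by positivity)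
  rw [h.P_sq]
  nlinarith [sq_nonneg W]

lemma le_P (h : CountData p R W P s t) : 0.866 * R ^ 2 ≤ P := by
  have hW := h.W_large
  refine le_of_sq_le_sq ?_ h.P_nonneg
  rw [h.P_sq]
  have : W ^ 2 ≤ (R ^ 2) ^ 2 := pow_le_pow_left₀ (by linarith) h.W_le 2
  nlinarith [sq_nonneg (R ^ 2)]

lemma s_bounds (h : CountData p R W P s t) : 0.4 * W - 1 ≤ s ∧ (s : ℝ) ≤ 0.4 * W := by
  have hW := h.W_large
  rw [h.s_eq]
  exact ⟨by linarith [Nat.lt_floor_add_one (0.4 * W)], Nat.floor_le (by linarith)⟩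

lemma t_bounds (h : CountData p R W P s t) : 0.1 * W - 1 ≤ t ∧ (t : ℝ) ≤ 0.1 * W := by
  have hW := h.W_large
  rw [h.t_eq]
  exact ⟨by linarith [Nat.lt_floor_add_one (0.1 * W)], Nat.floor_le (by linarith)⟩

lemma sqrt_div_le (h : CountData p R W P s t) :
    √((2 * s + 1 : ℕ) : ℝ) / √((2 * t + 1 : ℕ) : ℝ) ≤ 2.0001 := by
  have hs := h.s_bounds
  have ht := h.t_bounds
  have hW := h.W_large
  rw [div_le_iff₀ (Real.sqrt_pos.mpr (by positivity))]
  rw [show (2.0001 : ℝ) = √(2.0001 ^ 2) by rw [Real.sqrt_sq (by norm_num)],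
    ← Real.sqrt_mul (by positivity)]
  refine Real.sqrt_le_sqrt ?_
  push_cast
  linarith

lemma Y_ge (h : CountData p R W P s t) : 713000 ≤ 0.49 * P := by
  have h1 := h.le_P
  have h2 : 1297 ^ 2 ≤ R ^ 2 := pow_le_pow_left₀ (by norm_num) h.R_ge 2
  linarith

lemma sqrt_Y_le (h : CountData p R W P s t) : √(0.49 * P) ≤ 0.7 * R := by
  have hR := h.R_ge
  rw [Real.sqrt_le_left (by linarith)]
  nlinarith [h.P_le]

lemma Y_mul_sqrt_le (h : CountData p R W P s t) : 0.49 * P * √(0.49 * P) ≤ 0.343 * R ^ 3 := by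
  have hR := h.R_ge
  have := mul_le_mul (mul_le_mul_of_nonneg_left h.P_le (by norm_num : (0 : ℝ) ≤ 0.49)) h.sqrt_Y_le
    (Real.sqrt_nonneg _) (by positivity)
  nlinarith

lemma frame (h : CountData p R W P s t) [Fact p.Prime] {x : ℝ} (hx : x * p = W ^ 2) (𝒜 : ℕ → Finset ℕ)
    (h𝒜 : ∀ e < 4, 𝒜 e ⊆ oddSqfree ⌊0.49 * P / 2 ^ e⌋₊) (E : ℕ → ℕ → ℝ)
    (hE : Odd p → ∀ e < 4, ∀ A ∈ 𝒜 e, ∀ d, d ∣ A → d.Coprime p →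
      |(chiSum p e d (-(s + t : ℕ)) (2 * s + 1) (2 * t + 1) : ℝ)
        - ArithmeticFunction.moebius d / d * (((2 * s + 1 : ℕ) : ℝ) * ((2 * t + 1 : ℕ) : ℝ)) / 2|
        ≤ ((2 * t + 1 : ℕ) : ℝ) * E e d) :
    3 * ∑ e ∈ range 4, ∑ A ∈ 𝒜 e,
      (((2 * s + 1 : ℕ) : ℝ) / 2 * ∑ d ∈ A.divisors, (ArithmeticFunction.moebius d / d : ℝ)
        - ∑ d ∈ A.divisors, E e d - 2 ^ e * #A.divisors)
      ≤ 2 * (Nat.card {lam : ZMod p // lam ≠ 0 ∧ lam ≠ -1 ∧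
        ALam p lam ∈ Set.Icc (-1) (-1 + x)} : ℝ) + 6 := by
  have hs := h.s_bounds
  have ht := h.t_bounds
  have hW := h.W_large
  have hR := h.R_ge
  have hpp : p.Prime := Fact.out
  have hR4 : (1297 : ℝ) ^ 4 ≤ R ^ 4 := pow_le_pow_left₀ (by norm_num) hR 4
  have hp2 : p ≠ 2 := by
    rintro rfl
    rw [h.R_pow] at hR4
    norm_num at hR4
  have hst : 2 * ((s + t : ℕ) : ℝ) ≤ W := by push_cast; linarith
  have hst2 : 4 * ((s + t : ℕ) : ℝ) ^ 2 ≤ W ^ 2 := by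
    have := pow_le_pow_left₀ (by positivity) hst 2
    linarith
  have hWp : W ^ 2 ≤ p := by
    rw [← h.R_pow]
    have := pow_le_pow_left₀ (by linarith) h.W_le 2
    linarith
  have hA : ∀ e < 4, ∀ A ∈ 𝒜 e, ((2 ^ e * A : ℕ) : ℝ) ≤ 0.49 * P := by
    intro e he A hA
    have h1 := (mem_oddSqfree.mp (h𝒜 e he hA)).1.1
    have h2 : (A : ℝ) ≤ 0.49 * P / 2 ^ e :=
      (Nat.cast_le.mpr h1).trans (Nat.floor_le (by have := h.P_nonneg; positivity))
    rw [le_div_iff₀ (by positivity)] at h2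
    push_cast
    linarith
  have h4 : 4 * (s + t) ^ 2 ≤ p := by
    have := hst2.trans hWp
    exact_mod_cast this
  have key := sum_main_sub_error_le hp2 h4 (hst2.trans_eq hx.symm) 𝒜 (fun e he A hAm => ?_) E
    (fun e he A hAm d hd => ?_)
  · push_cast at key ⊢
    exact key
  · obtain ⟨⟨h1, h2⟩, h3⟩ := mem_oddSqfree.mp (h𝒜 e he hAm)
    refine ⟨h2, h3, ?_⟩
    have h5 := pow_le_pow_left₀ (Nat.cast_nonneg _) (hA e he A hAm) 2
    have h6 : (41616 : ℝ) * ((2 ^ e * A : ℕ) : ℝ) ^ 2 < 10000 * (p - ((s + t : ℕ) : ℝ) ^ 2) := by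
      have h7 : (713000 / 0.49) ^ 2 ≤ P ^ 2 :=
        pow_le_pow_left₀ (by norm_num) (by linarith [h.Y_ge]) 2
      have h8 := h.P_sq
      rw [h.R_pow] at h8
      nlinarith
    exact_mod_cast h6
  · have hd1 := Nat.dvd_of_mem_divisors hd
    have hd0 := Nat.pos_of_mem_divisors hd
    obtain ⟨⟨-, h2⟩, -⟩ := mem_oddSqfree.mp (h𝒜 e he hAm)
    have hdp : d.Coprime p := by
      refine (Nat.coprime_of_lt_prime hd0.ne' ?_ hpp).symm
      have h5 : d ≤ 2 ^ e * A := (Nat.le_of_dvd h2.pos hd1).trans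
        (Nat.le_mul_of_pos_left _ (by positivity))
      have h6 : (d : ℝ) < p := by
        have h7 : (d : ℝ) ≤ 0.49 * P := (Nat.cast_le.mpr h5).trans (hA e he A hAm)
        have h8 := h.P_le
        rw [← h.R_pow]
        nlinarith [sq_nonneg R]
      exact_mod_cast h6
    have := hE (hpp.odd_of_ne_two hp2) e he A hAm d hd1 hdp
    push_cast at this ⊢
    exact this

end CountData

lemma floor_div_two_pow_bounds {Y : ℝ} (hY : 8 ≤ Y) {e : ℕ} (he : e < 4) :
    0 < ⌊Y / 2 ^ e⌋₊ ∧ (⌊Y / 2 ^ e⌋₊ : ℝ) ≤ Y / 2 ^ e ∧ Y / 2 ^ e - 1 ≤ (⌊Y / 2 ^ e⌋₊ : ℝ) ∧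
      Real.log (⌊Y / 2 ^ e⌋₊ : ℝ) ≤ Real.log Y ∧
      √(⌊Y / 2 ^ e⌋₊ : ℝ) ≤ √Y * (1 / √(2 ^ e)) := by
  have h1 : 1 ≤ Y / 2 ^ e := by
    rw [le_div_iff₀ (by positivity), one_mul]
    calc (2 : ℝ) ^ e ≤ 2 ^ 3 := pow_le_pow_right₀ (by norm_num) (by omega)
      _ ≤ Y := by linarith
  have h0 : 0 < ⌊Y / 2 ^ e⌋₊ := Nat.floor_pos.mpr h1
  have h2 : (⌊Y / 2 ^ e⌋₊ : ℝ) ≤ Y / 2 ^ e := Nat.floor_le (by linarith)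
  refine ⟨h0, h2, by linarith [Nat.lt_floor_add_one (Y / 2 ^ e)], ?_, ?_⟩
  · refine Real.log_le_log (by exact_mod_cast h0) (h2.trans ?_)
    exact div_le_self (by linarith) (one_le_pow₀ (by norm_num))
  · rw [mul_one_div, ← Real.sqrt_div (by linarith)]
    exact Real.sqrt_le_sqrt h2

lemma sum_inv_sqrt_two_pow_le : ∑ e ∈ range 4, 1 / √((2 : ℝ) ^ e) ≤ 2.5608 := by
  have h2 : (1.41421 : ℝ) ≤ √2 := Real.le_sqrt_of_sq_le (by norm_num)
  have h4 : √((2 : ℝ) ^ 2) = 2 := Real.sqrt_sq (by norm_num)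
  have h8 : √((2 : ℝ) ^ 3) = 2 * √2 := by
    rw [pow_succ, Real.sqrt_mul (by norm_num), h4]
  have h5 : 1 / √2 ≤ 1 / 1.41421 := one_div_le_one_div_of_le (by norm_num) h2
  have h6 : 1 / (2 * √2) = 1 / √2 / 2 := by rw [mul_comm, ← div_div]
  simp only [sum_range_succ, sum_range_zero, pow_zero, pow_one, Real.sqrt_one, h4, h8, h6]
  norm_num at h5 ⊢
  linarith

end Frame

end

section

open Finset

section Numerics

variable {p : ℕ} {R W P : ℝ} {s t : ℕ}

lemma sum_range_four_linear (a b k : ℝ) (c : ℕ → ℝ) :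
    ∑ e ∈ range 4, (a * (1 / 2 ^ e) - b * c e - k)
      = a * 1.875 - b * ∑ e ∈ range 4, c e - 4 * k := by
  simp only [sum_range_succ, sum_range_zero]
  ring

lemma plain_numerics {n ν Y u L C K : ℝ} (hR : 1297 ≤ R) (hW : 451000 ≤ W) (hP0 : 0 ≤ P)
    (hP : P ≤ R ^ 2) (hP' : 0.866 * R ^ 2 ≤ P) (hYdef : Y = 0.49 * P) (hu844 : 844 ≤ u)
    (hu2 : u ^ 2 = Y) (hYu : Y * u ≤ 0.343 * R ^ 3) (hlog : 0 ≤ L) (hν0 : 0 ≤ ν)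
    (hν : ν ≤ 2.0001) (hn : 0.79999 * W ≤ n) (hC : C ≤ 2.5608)
    (hL : 1.76 * (3 / 2 + L / 2) * R ≤ 0.016 * W + 55.4 * R)
    (hsum : 3 * (n * 0.164 * Y * 1.875
      - (3 / 2 * n * u + 2 / 3 * ν * (Y * u) * (3 / 2 + L / 2)) * C
      - 4 * (n * 0.164 + Y * (1 + L / 2))) ≤ 2 * K + 6) :
    0.15916 * (W * P) - 55.42 * R ^ 3 < K := by
  have hn0 : 0 ≤ n := by linarith
  have hY0 : 0 ≤ Y := by rw [← hu2]; positivity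
  have hu0 : 0 ≤ u := by linarith
  have hC2 : (3 / 2 * n * u + 2 / 3 * ν * (Y * u) * (3 / 2 + L / 2)) * C
      ≤ 3 / 2 * n * u * 2.5608
        + 2 / 3 * 2.0001 * (0.343 * R ^ 3) * (3 / 2 + L / 2) * 2.5608 := by
    calc _ ≤ (3 / 2 * n * u + 2 / 3 * ν * (Y * u) * (3 / 2 + L / 2)) * 2.5608 := by gcongr
      _ ≤ (3 / 2 * n * u + 2 / 3 * 2.0001 * (0.343 * R ^ 3) * (3 / 2 + L / 2)) * 2.5608 := by
          gcongr
      _ = _ := by ring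
  have hmain : 0.605 * (n * Y) ≤ n * (0.328 * 1.875 * Y - 3 * 2.5608 * u - 4 * 0.328) := by
    have : 0.605 * Y ≤ 0.328 * 1.875 * Y - 3 * 2.5608 * u - 4 * 0.328 := by nlinarith
    calc _ = n * (0.605 * Y) := by ring
      _ ≤ _ := mul_le_mul_of_nonneg_left this hn0
  have hnY : 0.79999 * W * Y ≤ n * Y := mul_le_mul_of_nonneg_right hn (by linarith)
  have hWY : 0.79999 * W * Y = 0.79999 * 0.49 * (W * P) := by rw [hYdef]; ring
  have hYR : Y * (1 + L / 2) ≤ 0.000378 * R ^ 3 * (3 / 2 + L / 2) := by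
    have h1 : Y ≤ 0.000378 * R ^ 3 := by
      have : R ^ 2 * 1297 ≤ R ^ 2 * R := mul_le_mul_of_nonneg_left hR (by positivity)
      rw [hYdef]
      nlinarith
    calc _ ≤ Y * (3 / 2 + L / 2) := by gcongr; norm_num
      _ ≤ _ := by gcongr
  have hL2 : 1.76 * (R ^ 3 * (3 / 2 + L / 2)) ≤ 0.016 * (W * R ^ 2) + 55.4 * R ^ 3 := by
    have := mul_le_mul_of_nonneg_right hL (by positivity : 0 ≤ R ^ 2)
    linarith
  have hWP : 0.866 * (W * R ^ 2) ≤ W * P := by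
    have := mul_le_mul_of_nonneg_left hP' (by linarith : 0 ≤ W)
    linarith
  have hR3 : (1297 : ℝ) ^ 3 ≤ R ^ 3 := pow_le_pow_left₀ (by norm_num) hR 3
  have hWP0 : 0 ≤ W * P := mul_nonneg (by linarith) hP0
  have hRL : 0 ≤ R ^ 3 * (3 / 2 + L / 2) := by positivity
  linarith

lemma CountData.card_gt_of_log_le (h : CountData p R W P s t) [Fact p.Prime] {x : ℝ}
    (hx : x * p = W ^ 2)
    (hL : 1.76 * (3 / 2 + Real.log (0.49 * P) / 2) * R ≤ 0.016 * W + 55.4 * R) :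
    0.15916 * (W * P) - 55.42 * R ^ 3 < (Nat.card {lam : ZMod p // lam ≠ 0 ∧ lam ≠ -1 ∧
        ALam p lam ∈ Set.Icc (-1) (-1 + x)} : ℝ) := by
  have hframe := h.frame hx (fun e => oddSqfree ⌊0.49 * P / 2 ^ e⌋₊) (fun _ _ => Subset.rfl)
    (fun e d => 2 ^ e * (√((2 * s + 1 : ℕ) : ℝ) / √((2 * t + 1 : ℕ) : ℝ)) * (√d * #d.divisors))
    (fun hp e he A hA d hd hdp => by
      obtain ⟨⟨-, h2⟩, h3⟩ := mem_oddSqfree.mp hA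
      exact abs_chiSum_sub_le_mul hp (by omega) (h2.of_dvd_nat hd) (h3.squarefree_of_dvd hd) hdp _
        (by omega))
  have hY := h.Y_ge
  have hYu := h.Y_mul_sqrt_le
  have hν := h.sqrt_div_le
  have hR := h.R_ge
  have hP := h.P_le
  have hP' := h.le_P
  have hW := h.W_large
  have hs := h.s_bounds
  have hu844 : 844 ≤ √(0.49 * P) := Real.le_sqrt_of_sq_le (by linarith)
  have hu2 := Real.sq_sqrt (by linarith : 0 ≤ 0.49 * P)
  have hlog : 0 ≤ Real.log (0.49 * P) := Real.log_nonneg (by linarith)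
  have hn0 : (0 : ℝ) ≤ ((2 * s + 1 : ℕ) : ℝ) := by positivity
  have hν0 : 0 ≤ √((2 * s + 1 : ℕ) : ℝ) / √((2 * t + 1 : ℕ) : ℝ) := by positivity
  have hn : 0.79999 * W ≤ ((2 * s + 1 : ℕ) : ℝ) := by push_cast; linarith
  set Y := 0.49 * P with hYdef
  set L := Real.log Y
  set u := √Y
  set n := ((2 * s + 1 : ℕ) : ℝ)
  set ν := √n / √((2 * t + 1 : ℕ) : ℝ)
  have hterm : ∀ e ∈ range 4, n * 0.164 * Y * (1 / 2 ^ e)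
      - (3 / 2 * n * u + 2 / 3 * ν * (Y * u) * (3 / 2 + L / 2)) * (1 / √(2 ^ e))
      - (n * 0.164 + Y * (1 + L / 2))
      ≤ ∑ A ∈ oddSqfree ⌊Y / 2 ^ e⌋₊,
        (n / 2 * ∑ d ∈ A.divisors, (ArithmeticFunction.moebius d / d : ℝ)
        - ∑ d ∈ A.divisors, 2 ^ e * ν * (√d * #d.divisors) - 2 ^ e * #A.divisors) := by
    intro e he
    obtain ⟨f0, f1, f2, f3, f4⟩ := floor_div_two_pow_bounds (by linarith : 8 ≤ Y) (mem_range.mp he)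
    refine le_trans ?_ (plain_lower_bound f0 e hn0 hν0)
    set N := (⌊Y / 2 ^ e⌋₊ : ℝ)
    set c := 1 / √((2 : ℝ) ^ e)
    have hN0 : 0 ≤ N := Nat.cast_nonneg _
    have hlogN : 0 ≤ Real.log N := Real.log_nonneg (Nat.one_le_cast.mpr f0)
    have h2e : (0 : ℝ) < 2 ^ e := by positivity
    have g0 : 2 ^ e * N ≤ Y := by rwa [le_div_iff₀ h2e, mul_comm] at f1
    have g1 : 2 ^ e * ν * (2 / 3 * (N * √N) * (3 / 2 + Real.log N / 2))
        ≤ 2 / 3 * ν * (Y * u) * (3 / 2 + L / 2) * c := by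
      calc _ = 2 / 3 * ν * ((2 ^ e * N) * √N) * (3 / 2 + Real.log N / 2) := by ring
        _ ≤ 2 / 3 * ν * (Y * (u * c)) * (3 / 2 + L / 2) := by gcongr
        _ = _ := by ring
    have g2 : 2 ^ e * (N * (1 + Real.log N / 2)) ≤ Y * (1 + L / 2) := by
      rw [← mul_assoc]
      gcongr
    have g3 : n / 2 * (0.328 * (Y / 2 ^ e - 1) - 3 * (u * c)) ≤ n / 2 * (0.328 * N - 3 * √N) :=
      mul_le_mul_of_nonneg_left (by linarith) (by linarith)
    have g4 : n / 2 * (0.328 * (Y / 2 ^ e - 1) - 3 * (u * c))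
        = n * 0.164 * Y * (1 / 2 ^ e) - 3 / 2 * n * u * c - n * 0.164 := by ring
    linarith
  have hsum := sum_le_sum hterm
  rw [sum_range_four_linear _ _ _ (fun e => 1 / √((2 : ℝ) ^ e))] at hsum
  exact plain_numerics hR hW h.P_nonneg hP hP' hYdef hu844 hu2 hYu hlog hν0 hν hn
    sum_inv_sqrt_two_pow_le hL ((mul_le_mul_of_nonneg_left hsum (by norm_num)).trans hframe)

lemma exp_sub_mul_le (a b : ℝ) : Real.exp a * (1 + (b - a)) ≤ Real.exp b := by
  calc _ ≤ Real.exp a * Real.exp (b - a) :=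
        mul_le_mul_of_nonneg_left (by linarith [Real.add_one_le_exp (b - a)]) (Real.exp_pos a).le
    _ = _ := by rw [← Real.exp_add]; ring_nf

end Numerics

end

section

open Finset

section LargePrimes

variable {p : ℕ} {R W P : ℝ} {s t : ℕ}

lemma floor_exp_bounds {a : ℝ} (ha : 1 ≤ a) : 2 ≤ ⌊Real.exp a⌋₊ ∧
    (⌊Real.exp a⌋₊ : ℝ) ≤ Real.exp a ∧ Real.exp a ≤ ⌊Real.exp a⌋₊ + 1 ∧
    Real.log ⌊Real.exp a⌋₊ ≤ a := by
  have h1 : (2 : ℝ) ≤ Real.exp a := by linarith [Real.add_one_le_exp a]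
  have h2 : 2 ≤ ⌊Real.exp a⌋₊ := Nat.le_floor (by exact_mod_cast h1)
  have h3 := Nat.floor_le (Real.exp_pos a).le
  refine ⟨h2, h3, (Nat.lt_floor_add_one _).le, ?_⟩
  calc _ ≤ Real.log (Real.exp a) := Real.log_le_log (by positivity) h3
    _ = a := Real.log_exp a

lemma exp_eq_exp_div_pow (L : ℝ) (k : ℕ) (hk : k ≠ 0) : Real.exp L = Real.exp (L / k) ^ k := by
  rw [← Real.exp_nat_mul]
  congr 1
  field_simp

lemma six_le_exp {L : ℝ} (hL : 66.2 ≤ L) : 6 ≤ Real.exp (L / 12) := by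
  linarith [Real.add_one_le_exp (L / 12)]

lemma invSum_isRough_floor_exp_le {L : ℝ} (hL : 66.2 ≤ L) {N : ℕ} (hN : 0 < N)
    (hlog : Real.log N ≤ L) : invSum (IsRough ⌊Real.exp (L / 24)⌋₊) N ≤ 25.37 := by
  obtain ⟨h1, h2, h3, h4⟩ := floor_exp_bounds (by linarith : 1 ≤ L / 24)
  have h5 := invSum_isRough_le ⌊Real.exp (L / 24)⌋₊ N
  set y := ⌊Real.exp (L / 24)⌋₊
  have hy0 : (0 : ℝ) < y := by exact_mod_cast (by omega : 0 < y)
  rw [Real.log_mul (by positivity) hy0.ne'] at h5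
  have h6 : L / 24 ≤ Real.log (y + 1) := by
    rw [Real.le_log_iff_exp_le (by positivity)]
    exact h3
  have h7 := mul_le_mul_of_nonneg_right h6 (invSum_nonneg (IsRough y) N)
  nlinarith

lemma card_bad_le {L : ℝ} (hL : 66.2 ≤ L) {N : ℕ} (hN : Real.exp L ≤ 9 * N) :
    (#((oddSqfree N).filter fun A =>
      ¬ (smoothPart ⌊Real.exp (L / 24)⌋₊ A : ℝ) ≤ Real.exp (0.3 * L)) : ℝ) ≤ 0.0318 * N := by
  obtain ⟨h1, h2, h3, h4⟩ := floor_exp_bounds (by linarith : 1 ≤ L / 24)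
  have h5 := card_smoothPart_gt_le (N := N) h1
    (Real.one_le_exp (by linarith : 0 ≤ 0.3 * L))
  rw [Real.log_exp] at h5
  set y := ⌊Real.exp (L / 24)⌋₊
  set bad := (#((oddSqfree N).filter fun A =>
    ¬ (smoothPart y A : ℝ) ≤ Real.exp (0.3 * L)) : ℝ)
  have hy0 : 0 ≤ Real.log y := Real.log_nonneg (by exact_mod_cast (by omega : 1 ≤ y))
  have hl2 := Real.log_two_lt_d9
  have hl2' := Real.log_two_gt_d9
  have h6 : (Real.log y + 3 / 2 * Real.log 2) * (2 * Real.log y + 3 / 2 * Real.log 2)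
      ≤ 0.005706 * L ^ 2 := by
    calc _ ≤ (L / 24 + 1.0398) * (2 * (L / 24) + 1.0398) := by
          apply mul_le_mul <;> first | positivity | linarith
      _ ≤ _ := by nlinarith
  have h7 : (y : ℝ) ^ 4 ≤ 0.001 * N := by
    have h8 : (y : ℝ) ^ 4 ≤ Real.exp (L / 24) ^ 4 := pow_le_pow_left₀ (by positivity) h2 4
    have h9 : Real.exp (L / 24) ^ 4 = Real.exp (L / 12) ^ 2 := by
      rw [← Real.exp_nat_mul, ← Real.exp_nat_mul]
      congr 1; push_cast; ring
    have h10 := exp_eq_exp_div_pow L 12 (by norm_num)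
    push_cast at h10
    have h11 : 6 ^ 10 * Real.exp (L / 12) ^ 2 ≤ Real.exp L := by
      rw [h10, show Real.exp (L / 12) ^ 12 = Real.exp (L / 12) ^ 10 * Real.exp (L / 12) ^ 2 by ring]
      exact mul_le_mul_of_nonneg_right (pow_le_pow_left₀ (by norm_num) (six_le_exp hL) 10)
        (by positivity)
    rw [h9] at h8
    norm_num at h11
    linarith
  have hN0 : (0 : ℝ) ≤ N / 2 := by positivity
  have h8 := mul_le_mul_of_nonneg_left h6 hN0
  have hLsq : 4300 ≤ L ^ 2 := by nlinarith
  have h9 : (0.3 * L) ^ 2 * bad ≤ (0.3 * L) ^ 2 * (0.0318 * N) := by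
    have h10 : 4300 * (N : ℝ) ≤ L ^ 2 * N := mul_le_mul_of_nonneg_right hLsq (by positivity)
    linarith
  exact le_of_mul_le_mul_left h9 (by positivity)

lemma one_add_le_exp_six {L : ℝ} (hL : 66.2 ≤ L) :
    1 + 0.44 * L ≤ 0.7 * Real.exp (0.06 * L) := by
  have h1 := exp_sub_mul_le 4 (0.06 * L)
  have h2 : (54 : ℝ) ≤ Real.exp 4 := by
    have h3 := Real.exp_one_gt_d9
    have h4 : Real.exp 4 = Real.exp 1 ^ 4 := by rw [← Real.exp_nat_mul]; norm_num
    rw [h4]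
    calc (54 : ℝ) ≤ 2.718 ^ 4 := by norm_num
      _ ≤ _ := pow_le_pow_left₀ (by norm_num) (by linarith) 4
  have h3 : 54 * (1 + (0.06 * L - 4)) ≤ Real.exp 4 * (1 + (0.06 * L - 4)) :=
    mul_le_mul_of_nonneg_right h2 (by linarith)
  linarith

lemma linear_le_exp {L : ℝ} (hL : 66.2 ≤ L) : 8.45 * L - 506 ≤ Real.exp (0.08 * L) := by
  have h1 := exp_sub_mul_le 5.6 (0.08 * L)
  have h2 : (200 : ℝ) ≤ Real.exp 5.6 := by
    have h3 := Real.exp_one_gt_d9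
    have h4 : Real.exp 5.6 = Real.exp 1 ^ 5 * Real.exp 0.6 := by
      rw [← Real.exp_nat_mul, ← Real.exp_add]; norm_num
    have h5 : (1.6 : ℝ) ≤ Real.exp 0.6 := by linarith [Real.add_one_le_exp (0.6 : ℝ)]
    rw [h4]
    calc (200 : ℝ) ≤ 2.718 ^ 5 * 1.6 := by norm_num
      _ ≤ _ := mul_le_mul (pow_le_pow_left₀ (by norm_num) (by linarith) 5) h5 (by norm_num)
        (by positivity)
  have h3 : 200 * (1 + (0.08 * L - 5.6)) ≤ Real.exp 5.6 * (1 + (0.08 * L - 5.6)) :=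
    mul_le_mul_of_nonneg_right h2 (by linarith)
  linarith

lemma one_add_half_le {L : ℝ} (hL : 66.2 ≤ L) :
    1 + L / 2 ≤ 0.001 * Real.exp (L / 2) ∧ 1 + L / 2 ≤ 0.001 * Real.exp (0.88 * L) := by
  have h1 := six_le_exp hL
  have h2 : 1 + L / 2 ≤ 6 * Real.exp (L / 12) := by linarith [Real.add_one_le_exp (L / 12)]
  have h3 : Real.exp (L / 2) = Real.exp (L / 12) ^ 6 := by
    rw [← Real.exp_nat_mul]; congr 1; push_cast; ring
  have h4 : 1 + L / 2 ≤ 0.001 * Real.exp (L / 2) := by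
    have h5 : 6 ^ 5 * Real.exp (L / 12) ≤ Real.exp (L / 2) := by
      rw [h3, pow_succ]
      exact mul_le_mul_of_nonneg_right (pow_le_pow_left₀ (by norm_num) h1 5) (by positivity)
    norm_num at h5
    linarith
  refine ⟨h4, h4.trans ?_⟩
  gcongr
  linarith

lemma ten_thousand_le_exp {L : ℝ} (hL : 66.2 ≤ L) : 10000 ≤ Real.exp (L / 2) := by
  have h3 : Real.exp (L / 2) = Real.exp (L / 12) ^ 6 := by
    rw [← Real.exp_nat_mul]; congr 1; push_cast; ring
  rw [h3]
  calc (10000 : ℝ) ≤ 6 ^ 6 := by norm_num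
    _ ≤ _ := pow_le_pow_left₀ (by norm_num) (six_le_exp hL) 6

lemma rough_numerics {n ν Y u L C K η w : ℝ} (hR : 1297 ≤ R) (hW : 451000 ≤ W) (hP0 : 0 ≤ P)
    (hYdef : Y = 0.49 * P) (hu : 10000 ≤ u)
    (hu2 : u ^ 2 = Y) (hYu : Y * u ≤ 0.343 * R ^ 3) (hν0 : 0 ≤ ν)
    (hν : ν ≤ 2.0001) (hn : 0.79999 * W ≤ n) (hC : C ≤ 2.5608)
    (hη : η * (1 + L / 2) ≤ 0.001 * n) (hw : w ≤ 0.7 * u) (hLu : 1 + L / 2 ≤ 0.001 * u)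
    (hsum : 3 * ((n * 0.1481 - η * (1 + L / 2)) * Y * 1.875
      - (3 / 2 * n * u + 2 / 3 * ν * (Y * u) * 25.87) * C
      - 4 * (n * 0.1481 + ν * (Y * w) + Y * (1 + L / 2))) ≤ 2 * K + 6) :
    0.15916 * (W * P) - 55.42 * R ^ 3 < K := by
  have hn0 : 0 ≤ n := by linarith
  have hY0 : 0 ≤ Y := by rw [← hu2]; positivity
  have hu0 : 0 ≤ u := by linarith
  have hC2 : (3 / 2 * n * u + 2 / 3 * ν * (Y * u) * 25.87) * C
      ≤ 3 / 2 * n * u * 2.5608 + 2 / 3 * 2.0001 * (0.343 * R ^ 3) * 25.87 * 2.5608 := by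
    calc _ ≤ (3 / 2 * n * u + 2 / 3 * ν * (Y * u) * 25.87) * 2.5608 := by gcongr
      _ ≤ (3 / 2 * n * u + 2 / 3 * 2.0001 * (0.343 * R ^ 3) * 25.87) * 2.5608 := by gcongr
      _ = _ := by ring
  have hmain : n * (3 * 2.5608 * u + 4 * 0.2962) ≤ n * (0.001 * Y) :=
    mul_le_mul_of_nonneg_left (by nlinarith) hn0
  have hηY := mul_le_mul_of_nonneg_right hη hY0
  have hνw : ν * (Y * w) ≤ 2.0001 * (0.7 * (0.343 * R ^ 3)) := by
    calc ν * (Y * w) ≤ ν * (0.7 * (Y * u)) := by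
          refine mul_le_mul_of_nonneg_left ?_ hν0
          have := mul_le_mul_of_nonneg_left hw hY0
          linarith
      _ ≤ _ := by gcongr
  have hYL : Y * (1 + L / 2) ≤ 0.001 * (0.343 * R ^ 3) := by
    have := mul_le_mul_of_nonneg_left hLu hY0
    linarith
  have hnY : 0.79999 * W * Y ≤ n * Y := mul_le_mul_of_nonneg_right hn hY0
  have hWY : 0.79999 * W * Y = 0.79999 * 0.49 * (W * P) := by rw [hYdef]; ring
  have hR3 : (1297 : ℝ) ^ 3 ≤ R ^ 3 := pow_le_pow_left₀ (by norm_num) hR 3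
  have hWP0 : 0 ≤ W * P := mul_nonneg (by linarith) hP0
  linarith

lemma rough_term_le {Y L n ν η : ℝ} (hL : 66.2 ≤ L) (hY : Y = Real.exp L) (hn0 : 0 ≤ n)
    (hν0 : 0 ≤ ν) (hη : 0 ≤ η) {e : ℕ} (he : e < 4) :
    (n * 0.1481 - η * (1 + L / 2)) * Y * (1 / 2 ^ e)
      - (3 / 2 * n * √Y + 2 / 3 * ν * (Y * √Y) * 25.87) * (1 / √(2 ^ e))
      - (n * 0.1481 + ν * (Y * (Real.exp (0.44 * L) * (1 + 0.44 * L))) + Y * (1 + L / 2))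
      ≤ ∑ A ∈ oddSqfree ⌊Y / 2 ^ e⌋₊ with
          (smoothPart ⌊Real.exp (L / 24)⌋₊ A : ℝ) ≤ Real.exp (0.3 * L),
        (n / 2 * ∑ d ∈ A.divisors, (ArithmeticFunction.moebius d / d : ℝ)
        - ∑ d ∈ A.divisors, (2 ^ e * ν * (√d * divCount (IsRough ⌊Real.exp (L / 24)⌋₊) d
          + if d ≤ ⌊Real.exp (0.88 * L)⌋₊ then √d * #d.divisors else 0) + η)
        - 2 ^ e * #A.divisors) := by
  have hYL : Real.log Y = L := by rw [hY, Real.log_exp]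
  have hYbig : 10000 ≤ Y := by
    rw [hY]
    exact (ten_thousand_le_exp hL).trans (Real.exp_le_exp.mpr (by linarith))
  obtain ⟨f0, f1, f2, f3, f4⟩ := floor_div_two_pow_bounds (by linarith : 8 ≤ Y) he
  obtain ⟨d1, d2, -, d4⟩ := floor_exp_bounds (by linarith : 1 ≤ 0.88 * L)
  rw [hYL] at f3
  refine le_trans ?_ (rough_lower_bound f0 (by omega) e ⌊Real.exp (L / 24)⌋₊
    (Real.exp (0.3 * L)) hn0 hν0 hη)
  have h2e : (0 : ℝ) < 2 ^ e := by positivity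
  have h2e8 : (2 : ℝ) ^ e ≤ 8 := by
    calc (2 : ℝ) ^ e ≤ 2 ^ 3 := pow_le_pow_right₀ (by norm_num) (by omega)
      _ = 8 := by norm_num
  have hY9 : Real.exp L ≤ 9 * (⌊Y / 2 ^ e⌋₊ : ℝ) := by
    have : Y / 8 ≤ Y / 2 ^ e := by gcongr
    rw [← hY]
    linarith
  have hbad := card_bad_le hL hY9
  have hinv := invSum_isRough_floor_exp_le hL f0 f3
  have hlogN : 0 ≤ Real.log (⌊Y / 2 ^ e⌋₊ : ℝ) := Real.log_nonneg (Nat.one_le_cast.mpr f0)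
  have hlogD : 0 ≤ Real.log (⌊Real.exp (0.88 * L)⌋₊ : ℝ) :=
    Real.log_nonneg (by exact_mod_cast (by omega : 1 ≤ ⌊Real.exp (0.88 * L)⌋₊))
  have hsD : √(⌊Real.exp (0.88 * L)⌋₊ : ℝ) ≤ Real.exp (0.44 * L) := by
    rw [Real.sqrt_le_left (Real.exp_pos _).le, ← Real.exp_nat_mul]
    convert d2 using 2
    push_cast; ring
  have hN0 : (0 : ℝ) ≤ ⌊Y / 2 ^ e⌋₊ := Nat.cast_nonneg _
  have hρ0 := invSum_nonneg (IsRough ⌊Real.exp (L / 24)⌋₊) ⌊Y / 2 ^ e⌋₊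
  set N := (⌊Y / 2 ^ e⌋₊ : ℝ)
  set ρ := invSum (IsRough ⌊Real.exp (L / 24)⌋₊) ⌊Y / 2 ^ e⌋₊
  set D := (⌊Real.exp (0.88 * L)⌋₊ : ℝ)
  set bad := (#((oddSqfree ⌊Y / 2 ^ e⌋₊).filter fun A =>
    ¬ (smoothPart ⌊Real.exp (L / 24)⌋₊ A : ℝ) ≤ Real.exp (0.3 * L)) : ℝ)
  set c := 1 / √((2 : ℝ) ^ e)
  have g0 : 2 ^ e * N ≤ Y := by rwa [le_div_iff₀ h2e, mul_comm] at f1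
  have hY0 : 0 ≤ Y := by linarith
  have g1 : 2 ^ e * ν * (2 / 3 * (N * √N) * (ρ + 1 / 2) + N * √D * (1 + Real.log D / 2))
      ≤ 2 / 3 * ν * (Y * √Y) * 25.87 * c
        + ν * (Y * (Real.exp (0.44 * L) * (1 + 0.44 * L))) := by
    have k1 : 2 / 3 * ν * ((2 ^ e * N) * √N) * (ρ + 1 / 2)
        ≤ 2 / 3 * ν * (Y * (√Y * c)) * 25.87 := by
      have : ρ + 1 / 2 ≤ 25.87 := by linarith
      gcongr
    have k2 : ν * ((2 ^ e * N) * (√D * (1 + Real.log D / 2)))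
        ≤ ν * (Y * (Real.exp (0.44 * L) * (1 + 0.44 * L))) := by
      have : 1 + Real.log D / 2 ≤ 1 + 0.44 * L := by linarith
      gcongr
    linarith
  have g2 : 2 ^ e * (N * (1 + Real.log N / 2)) ≤ Y * (1 + L / 2) := by
    rw [← mul_assoc]
    gcongr
  have g5 : η * (N * (1 + Real.log N / 2)) ≤ η * (Y / 2 ^ e * (1 + L / 2)) := by gcongr
  have g3 : n / 2 * (0.2962 * (Y / 2 ^ e - 1) - 3 * (√Y * c)) ≤ n / 2 * (0.328 * N - 3 * √N - bad) :=
    mul_le_mul_of_nonneg_left (by linarith) (by linarith)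
  have g4 : n / 2 * (0.2962 * (Y / 2 ^ e - 1) - 3 * (√Y * c)) - η * (Y / 2 ^ e * (1 + L / 2))
      = (n * 0.1481 - η * (1 + L / 2)) * Y * (1 / 2 ^ e) - 3 / 2 * n * √Y * c - n * 0.1481 := by
    ring
  linarith

lemma CountData.card_gt_of_le_log (h : CountData p R W P s t) [Fact p.Prime] {x : ℝ}
    (hx : x * p = W ^ 2) (hL : 66.2 ≤ Real.log (0.49 * P))
    (hWL : W ≤ (55 * Real.log (0.49 * P) - 3297) * R) :
    0.15916 * (W * P) - 55.42 * R ^ 3 < (Nat.card {lam : ZMod p // lam ≠ 0 ∧ lam ≠ -1 ∧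
        ALam p lam ∈ Set.Icc (-1) (-1 + x)} : ℝ) := by
  have hYge := h.Y_ge
  have hW := h.W_large
  have hR := h.R_ge
  have hs := h.s_bounds
  have ht := h.t_bounds
  have hYexp : 0.49 * P = Real.exp (Real.log (0.49 * P)) := (Real.exp_log (by linarith)).symm
  have huexp : √(0.49 * P) = Real.exp (Real.log (0.49 * P) / 2) := by
    rw [hYexp, ← Real.exp_half, Real.log_exp]
  have hu2 := Real.sq_sqrt (by linarith : 0 ≤ 0.49 * P)
  have hRu : R ≤ 1.5352 * √(0.49 * P) := by
    refine le_of_sq_le_sq ?_ (by positivity)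
    rw [mul_pow, hu2]
    have := h.le_P
    linarith
  set L := Real.log (0.49 * P)
  obtain ⟨d1, d2, d3, -⟩ := floor_exp_bounds (by linarith : 1 ≤ 0.88 * L)
  have hD2 : Real.exp (0.88 * L) ≤ 2 * ⌊Real.exp (0.88 * L)⌋₊ := by
    have : (2 : ℝ) ≤ ⌊Real.exp (0.88 * L)⌋₊ := by exact_mod_cast d1
    linarith
  have hn'le : ((2 * t + 1 : ℕ) : ℝ) ≤ 2 * Real.exp (0.58 * L) := by
    have e1 : Real.exp (0.58 * L) = Real.exp (0.08 * L) * √(0.49 * P) := by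
      rw [huexp, ← Real.exp_add]; congr 1; ring
    have e2 := mul_le_mul_of_nonneg_right (linear_le_exp hL) (Real.sqrt_nonneg (0.49 * P))
    have e3 : (55 * L - 3297) * R ≤ (55 * L - 3297) * (1.5352 * √(0.49 * P)) :=
      mul_le_mul_of_nonneg_left hRu (by linarith)
    have e4 : 0 ≤ L * √(0.49 * P) := mul_nonneg (by linarith) (Real.sqrt_nonneg _)
    have e5 : 66.2 * √(0.49 * P) ≤ L * √(0.49 * P) :=
      mul_le_mul_of_nonneg_right hL (Real.sqrt_nonneg _)
    rw [e1]
    push_cast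
    linarith
  have hnle : ((2 * s + 1 : ℕ) : ℝ) ≤ 2 * Real.exp (0.88 * L) := by
    have e1 : Real.exp (0.88 * L) = Real.exp (0.58 * L) * Real.exp (0.3 * L) := by
      rw [← Real.exp_add]; congr 1; ring
    have e2 : 20 ≤ Real.exp (0.3 * L) := by linarith [Real.add_one_le_exp (0.3 * L)]
    have e3 := mul_le_mul_of_nonneg_left e2 (Real.exp_pos (0.58 * L)).le
    rw [e1]
    push_cast at hn'le ⊢
    linarith
  have hframe := h.frame hx (fun e => (oddSqfree ⌊0.49 * P / 2 ^ e⌋₊).filter fun A =>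
      (smoothPart ⌊Real.exp (L / 24)⌋₊ A : ℝ) ≤ Real.exp (0.3 * L))
    (fun _ _ => filter_subset _ _)
    (fun e d => 2 ^ e * (√((2 * s + 1 : ℕ) : ℝ) / √((2 * t + 1 : ℕ) : ℝ)) *
      (√d * divCount (IsRough ⌊Real.exp (L / 24)⌋₊) d
        + if d ≤ ⌊Real.exp (0.88 * L)⌋₊ then √d * #d.divisors else 0)
        + ((2 * s + 1 : ℕ) : ℝ) / (2 * ⌊Real.exp (0.88 * L)⌋₊))
    (fun hp e he A hA d hd hdp => by
      obtain ⟨hA1, hA2⟩ := mem_filter.mp hA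
      obtain ⟨⟨-, h2⟩, h3⟩ := mem_oddSqfree.mp hA1
      refine abs_chiSum_sub_le_rough hp (by omega) h2 h3 hd hdp (by omega) hA2 _ (by omega) ?_ ?_
      · have : ((2 * s + 1 : ℕ) : ℝ) ≤ ((2 * (⌊Real.exp (0.88 * L)⌋₊ + 1) : ℕ) : ℝ) := by
          push_cast at hnle ⊢
          linarith
        exact_mod_cast this
      · have e1 : Real.exp (0.88 * L) = Real.exp (0.58 * L) * Real.exp (0.3 * L) := by
          rw [← Real.exp_add]; congr 1; ring
        have e2 := mul_le_mul_of_nonneg_right hn'le (Real.exp_pos (0.3 * L)).le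
        linarith)
  have hn0 : (0 : ℝ) ≤ ((2 * s + 1 : ℕ) : ℝ) := by positivity
  have hν0 : 0 ≤ √((2 * s + 1 : ℕ) : ℝ) / √((2 * t + 1 : ℕ) : ℝ) := by positivity
  have hη0 : 0 ≤ ((2 * s + 1 : ℕ) : ℝ) / (2 * ⌊Real.exp (0.88 * L)⌋₊) := by positivity
  have hsum := sum_le_sum fun e he => rough_term_le (n := ((2 * s + 1 : ℕ) : ℝ))
    (ν := √((2 * s + 1 : ℕ) : ℝ) / √((2 * t + 1 : ℕ) : ℝ))
    (η := ((2 * s + 1 : ℕ) : ℝ) / (2 * ⌊Real.exp (0.88 * L)⌋₊)) hL hYexp hn0 hν0 hη0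
    (mem_range (n := 4) (m := e) |>.mp he)
  rw [sum_range_four_linear _ _ _ (fun e => 1 / √((2 : ℝ) ^ e))] at hsum
  obtain ⟨l1, l2⟩ := one_add_half_le hL
  refine rough_numerics hR hW h.P_nonneg rfl (huexp ▸ ten_thousand_le_exp hL) hu2
    h.Y_mul_sqrt_le hν0 h.sqrt_div_le (by push_cast; linarith) sum_inv_sqrt_two_pow_le ?_ ?_
    (huexp ▸ l1) ((mul_le_mul_of_nonneg_left hsum (by norm_num)).trans hframe)
  · rw [div_mul_eq_mul_div, div_le_iff₀ (by linarith [Real.exp_pos (0.88 * L)])]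
    have e1 : 1 + L / 2 ≤ 0.001 * (2 * ⌊Real.exp (0.88 * L)⌋₊) := by linarith
    have := mul_le_mul_of_nonneg_left e1 hn0
    linarith
  · rw [huexp]
    have e1 : Real.exp (L / 2) = Real.exp (0.44 * L) * Real.exp (0.06 * L) := by
      rw [← Real.exp_add]; congr 1; ring
    rw [e1]
    have := mul_le_mul_of_nonneg_left (one_add_le_exp_six hL) (Real.exp_pos (0.44 * L)).le
    linarith

end LargePrimes

end

section

open Finset

section Reduction

variable {p : ℕ} {R W P : ℝ} {s t : ℕ}

lemma CountData.card_gt (h : CountData p R W P s t) [Fact p.Prime] {x : ℝ} (hx : x * p = W ^ 2) :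
    0.15916 * (W * P) - 55.42 * R ^ 3 < (Nat.card {lam : ZMod p // lam ≠ 0 ∧ lam ≠ -1 ∧
        ALam p lam ∈ Set.Icc (-1) (-1 + x)} : ℝ) := by
  by_cases hL : 1.76 * (3 / 2 + Real.log (0.49 * P) / 2) * R ≤ 0.016 * W + 55.4 * R
  · exact h.card_gt_of_log_le hx hL
  · push Not at hL
    have hR : 0 < R := by linarith [h.R_ge]
    refine h.card_gt_of_le_log hx ?_ (by linarith)
    have h1 : 0.016 * (348 * R) + 55.4 * R < 1.76 * (3 / 2 + Real.log (0.49 * P) / 2) * R := by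
      linarith [h.W_ge]
    have h2 : 0.016 * 348 + 55.4 < 1.76 * (3 / 2 + Real.log (0.49 * P) / 2) :=
      lt_of_mul_lt_mul_right (by linarith) hR.le
    linarith

lemma two_mul_sub_sqrt_three_le (v : ℝ) : 2 * (v - √3) ≤ (2 - √3) * (1 + v ^ 2) := by
  have h3 : √3 ^ 2 = (3 : ℝ) := Real.sq_sqrt (by norm_num)
  have h2 : 0 ≤ 2 - √3 := by
    rw [sub_nonneg, Real.sqrt_le_left (by norm_num)]
    norm_num
  have h := mul_nonneg h2 (sq_nonneg (v - (2 + √3)))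
  have e : (2 - √3) * (v - (2 + √3)) ^ 2
      = (2 - √3) * v ^ 2 - 2 * (4 - √3 ^ 2) * v + (4 - √3 ^ 2) * (2 + √3) := by ring
  rw [e, h3] at h
  linarith

lemma mul_delta_lt {T δ : ℝ} (hT : √3 / (4 * Real.pi) < T) :
    4 / (1 + 16 * Real.pi ^ 2 * (T + δ) ^ 2) * δ ≤ 0.04267 := by
  have hpi := Real.pi_gt_d4
  have hpi0 := Real.pi_pos
  set v := 4 * Real.pi * (T + δ) with hv
  have hv2 : 16 * Real.pi ^ 2 * (T + δ) ^ 2 = v ^ 2 := by rw [hv]; ring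
  rw [hv2, div_mul_eq_mul_div, div_le_iff₀ (by positivity)]
  rw [div_lt_iff₀ (by positivity)] at hT
  have h1 : 4 * Real.pi * δ ≤ v - √3 := by rw [hv]; linarith
  have h2 := two_mul_sub_sqrt_three_le v
  have h3 : (1.732 : ℝ) ≤ √3 := Real.le_sqrt_of_sq_le (by norm_num)
  have h4 : (2 - √3) * (1 + v ^ 2) ≤ 0.268 * (1 + v ^ 2) :=
    mul_le_mul_of_nonneg_right (by linarith) (by positivity)
  have h5 : 2 * Real.pi * (4 * δ) ≤ 2 * Real.pi * (0.04267 * (1 + v ^ 2)) := by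
    have h6 : 0.268 * (1 + v ^ 2) ≤ 2 * Real.pi * 0.04267 * (1 + v ^ 2) :=
      mul_le_mul_of_nonneg_right (by linarith) (by positivity)
    linarith
  exact le_of_mul_le_mul_left h5 (by positivity)

end Reduction

end

theorem batman_ear_negative (T δ : ℝ) (hT : Real.sqrt 3 / (4 * Real.pi) < T) (hδ : 0 < δ)
    (x : ℝ) (hx : x = 4 / (1 + 16 * Real.pi ^ 2 * (T + δ) ^ 2))
    (p : ℕ) [Fact p.Prime] (hp : (55.42 / (x * δ)) ^ 4 ≤ (p : ℝ)) :
    T < (1 / x) *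
      ((Nat.card {lam : ZMod p // lam ≠ 0 ∧ lam ≠ -1 ∧ ALam p lam ∈ Set.Icc (-1) (-1 + x)} : ℝ) / p) := by
  have hpi := Real.pi_gt_d4
  have hpi0 := Real.pi_pos
  have hxδ : x * δ ≤ 0.04267 := hx ▸ mul_delta_lt hT
  have hp0 : (0 : ℝ) < p := by exact_mod_cast (Fact.out : p.Prime).pos
  have hx0 : 0 < x := by rw [hx]; positivity
  have hT0 : 0 < T := lt_of_le_of_lt (by positivity) hT
  obtain ⟨R, hR0, hR4⟩ : ∃ R : ℝ, 0 ≤ R ∧ R ^ 4 = p :=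
    ⟨√√(p : ℝ), by positivity, by
      rw [show (4 : ℕ) = 2 * 2 by norm_num, pow_mul, Real.sq_sqrt (by positivity),
        Real.sq_sqrt hp0.le]⟩
  have hRδ : 55.42 ≤ x * δ * R := by
    rw [← hR4] at hp
    have := le_of_pow_le_pow_left₀ (by norm_num) hR0 hp
    rwa [div_le_iff₀ (by positivity), mul_comm] at this
  have hR : 1297 ≤ R := by
    have := mul_le_mul_of_nonneg_right hxδ hR0
    linarith
  obtain ⟨v, hv⟩ : ∃ v, v = 4 * Real.pi * (T + δ) := ⟨_, rfl⟩
  have hv0 : 0 < v := by rw [hv]; positivity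
  have hv2 : 16 * Real.pi ^ 2 * (T + δ) ^ 2 = v ^ 2 := by rw [hv]; ring
  rw [hv2] at hx
  have hv3 : 3 < v ^ 2 := by
    rw [div_lt_iff₀ (by positivity)] at hT
    have h1 : √3 < v := by rw [hv]; nlinarith
    have h2 := pow_lt_pow_left₀ h1 (Real.sqrt_nonneg 3) (by norm_num : 2 ≠ 0)
    rwa [Real.sq_sqrt (by norm_num)] at h2
  obtain ⟨q, hq0, hq2⟩ : ∃ q : ℝ, 0 < q ∧ q ^ 2 = 1 + v ^ 2 :=
    ⟨√(1 + v ^ 2), Real.sqrt_pos.mpr (by positivity), Real.sq_sqrt (by positivity)⟩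
  have hq : 2 ≤ q := le_of_sq_le_sq (by linarith) hq0.le
  have hvq : v ≤ q := le_of_sq_le_sq (by linarith) hq0.le
  have hxq : x = 4 / q ^ 2 := by rw [hx, hq2]
  have hxp : x * p = (2 * R ^ 2 / q) ^ 2 := by
    rw [hxq, ← hR4]; field_simp; ring
  have hprod : 2 * R ^ 2 / q * (R ^ 2 * v / q) = 2 * Real.pi * ((T + δ) * (x * p)) := by
    rw [hxq, ← hR4, div_mul_div_comm, ← sq]
    field_simp
    rw [hv]; ring
  have hδp : 55.42 * R ^ 3 ≤ δ * (x * p) := by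
    have := mul_le_mul_of_nonneg_right hRδ (by positivity : 0 ≤ R ^ 3)
    rw [← hR4]
    linarith
  have hTxp : 0 < T * (x * p) := by positivity
  have hPle : R ^ 2 * v / q ≤ R ^ 2 := by
    rw [div_le_iff₀ hq0]
    exact mul_le_mul_of_nonneg_left hvq (by positivity)
  have hdata : CountData p R (2 * R ^ 2 / q) (R ^ 2 * v / q) ⌊0.4 * (2 * R ^ 2 / q)⌋₊
      ⌊0.1 * (2 * R ^ 2 / q)⌋₊ := by
    refine ⟨hR, hR4, ?_, ?_, by positivity, ?_, rfl, rfl⟩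
    · have h1 : 2 * R ^ 2 / q * (R ^ 2 * v / q) ≤ 2 * R ^ 2 / q * R ^ 2 :=
        mul_le_mul_of_nonneg_left hPle (by positivity)
      have h2 : 2 * Real.pi * (55.42 * R ^ 3) ≤ 2 * R ^ 2 / q * R ^ 2 := by
        refine le_trans ?_ h1
        rw [hprod]
        exact mul_le_mul_of_nonneg_left (by linarith) (by positivity)
      have h3 : 348 * R ^ 3 ≤ 2 * Real.pi * (55.42 * R ^ 3) := by
        have := mul_le_mul_of_nonneg_right (by linarith : 348 ≤ 2 * Real.pi * 55.42)
          (by positivity : 0 ≤ R ^ 3)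
        linarith
      refine le_of_mul_le_mul_right ?_ (by positivity : 0 < R ^ 2)
      linarith
    · rw [div_le_iff₀ hq0]
      nlinarith [sq_nonneg R]
    · rw [div_pow, div_pow, mul_pow, mul_pow, hq2]
      field_simp
      ring
  have hmain := hdata.card_gt hxp
  rw [hprod] at hmain
  have hfin : T * (x * p) < (Nat.card {lam : ZMod p // lam ≠ 0 ∧ lam ≠ -1 ∧
      ALam p lam ∈ Set.Icc (-1) (-1 + x)} : ℝ) := by
    have h1 : (T + δ) * (x * p) ≤ 0.15916 * (2 * Real.pi * ((T + δ) * (x * p))) := by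
      have h2 : 0 ≤ (T + δ) * (x * p) := by positivity
      nlinarith
    linarith
  rw [one_div, inv_mul_eq_div, div_div, lt_div_iff₀ (by positivity), mul_comm (p : ℝ)]
  exact hfin

end
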